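/- Let ∂G be piecewise analytic, with the smallest exterior angle λπ, 0 < λ < 2, at the junction points of its analytic arcs. Suppose ζ ∈ F, where F ⊂ G is compact. Then there is a constant C(G,F) > 0, depending only on G and F, such that for every n ∈ ℕ: max_{z∈F} |φ'(z) − J'_{2n+1}(z)| ≤ C(G,F) · n^{−λ/(2−λ)}. -/

import Mathlib

open Complex MeasureTheory Set Filter Metric
noncomputable section
structure JordanDomain where
  G : Set ℂ
  isOpen : IsOpen G
  nonempty : G.Nonempty
  bounded : Bornology.IsBounded G
  connected : IsConnected G
  simplyConnected : SimplyConnectedSpace ↥G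
  l : ℝ
  l_pos : 0 < l
  γ : ℝ → ℂ
  γ_cont : Continuous γ
  γ_periodic : Function.Periodic γ l
  γ_injOn : InjOn γ (Ico 0 l)
  γ_boundary : γ '' Ico 0 l = frontier G
  γ_unitSpeed : ∀ s t : ℝ, s ≤ t → t ≤ s + l →
    eVariationOn γ (Icc s t) = ENNReal.ofReal (t - s)
def JordanDomain.bnorm (D : JordanDomain) (g : ℝ → ℂ) : ℝ :=
  Real.sqrt ((1 / D.l) * ∫ s in (0:ℝ)..D.l, ‖g s‖ ^ 2)
def JordanDomain.IsONPolys (D : JordanDomain) (p : ℕ → Polynomial ℂ) : Prop :=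
  (∀ k, (p k).natDegree = k) ∧
  (∀ k, ∃ c : ℝ, 0 < c ∧ (p k).leadingCoeff = (c : ℂ)) ∧
  (∀ j k, (1 / (D.l : ℂ)) * (∫ s in (0:ℝ)..D.l,
      (p j).eval (D.γ s) * (starRingEnd ℂ) ((p k).eval (D.γ s))) =
    if j = k then 1 else 0)
def partialSum (p : ℕ → Polynomial ℂ) (ζ : ℂ) (n : ℕ) : ℂ → ℂ := fun z =>
  ∑ k ∈ Finset.range (n + 1), (starRingEnd ℂ) ((p k).eval ζ) * (p k).eval z
def szegoKernel (p : ℕ → Polynomial ℂ) (ζ z : ℂ) : ℂ :=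
  ∑' k : ℕ, (starRingEnd ℂ) ((p k).eval ζ) * (p k).eval z
def Jfun (D : JordanDomain) (p : ℕ → Polynomial ℂ) (ζ : ℂ) (n : ℕ) : ℂ → ℂ := fun z =>
  let S : Polynomial ℂ :=
    (∑ k ∈ Finset.range (n + 1), Polynomial.C ((starRingEnd ℂ) ((p k).eval ζ)) * p k) ^ 2
  (((2 * Real.pi / D.l : ℝ) : ℂ) / (∑ k ∈ Finset.range (n + 1), ((‖(p k).eval ζ‖ : ℂ)) ^ 2)) *
    ∑ i ∈ Finset.range (S.natDegree + 1),
      S.coeff i * ((z ^ (i + 1) - ζ ^ (i + 1)) / ((i : ℂ) + 1))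
def Qfun (D : JordanDomain) (p : ℕ → Polynomial ℂ) (ζ : ℂ) (n : ℕ) : ℂ → ℂ := fun z =>
  ((Real.sqrt ((D.l / (2 * Real.pi)) *
      ∑ k ∈ Finset.range (n + 1), ‖(p k).eval ζ‖ ^ 2) : ℝ) : ℂ)⁻¹ * partialSum p ζ n z
def supNormOn (K : Set ℂ) (f : ℂ → ℂ) : ℝ := ⨆ z : K, ‖f (z : ℂ)‖
def NTLim (G : Set ℂ) (g : ℂ → ℂ) (w v : ℂ) : Prop :=
  ∀ M : ℝ, 1 < M →
    Tendsto g (nhdsWithin w {z | z ∈ G ∧ ‖z - w‖ ≤ M * infDist z (frontier G)}) (nhds v)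
structure ConformalOnto (G : Set ℂ) (φ : ℂ → ℂ) (ζ : ℂ) : Prop where
  differentiable : ∀ z ∈ G, DifferentiableAt ℂ φ z
  bijOn : BijOn φ G (ball (0 : ℂ) 1)
  map_center : φ ζ = 0
  deriv_center_pos : ∃ c : ℝ, 0 < c ∧ deriv φ ζ = (c : ℂ)
def IsSmirnovDomain (G : Set ℂ) : Prop :=
  ∀ ψ : ℂ → ℂ,
    (∀ w ∈ ball (0 : ℂ) 1, DifferentiableAt ℂ ψ w) →
    BijOn ψ (ball (0 : ℂ) 1) G →
    ∃ h : ℝ → ℝ,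
      IntervalIntegrable h volume 0 (2 * Real.pi) ∧
      (∀ᵐ (θ : ℝ) ∂(volume.restrict (Ioc (0 : ℝ) (2 * Real.pi))),
        Tendsto (fun r : ℝ => Real.log ‖deriv ψ ((r : ℂ) * Complex.exp ((θ : ℂ) * Complex.I))‖)
          (nhdsWithin 1 (Iio 1)) (nhds (h θ))) ∧
      (∀ w ∈ ball (0 : ℂ) 1,
        Real.log ‖deriv ψ w‖ =
          (1 / (2 * Real.pi)) * ∫ θ in (0 : ℝ)..(2 * Real.pi),
            ((1 - ‖w‖ ^ 2) / ‖Complex.exp ((θ : ℂ) * Complex.I) - w‖ ^ 2) * h θ)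
def HasCornerAngle (G : Set ℂ) (z₀ : ℂ) (a : ℝ) : Prop :=
  Tendsto (fun r : ℝ =>
      (volume {θ : ℝ | θ ∈ Ico 0 (2 * Real.pi) ∧
        z₀ + (r : ℂ) * Complex.exp ((θ : ℂ) * Complex.I) ∈ G}).toReal)
    (nhdsWithin 0 (Ioi 0)) (nhds a)
structure PiecewiseAnalyticBoundary (D : JordanDomain) where
  m : ℕ
  m_pos : 0 < m
  τ : Fin m → ℂ → ℂ
  U : Fin m → Set ℂ
  U_open : ∀ i, IsOpen (U i)
  seg_sub : ∀ i, (Complex.ofReal '' Icc (0 : ℝ) 1) ⊆ U i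
  analytic : ∀ i, DifferentiableOn ℂ (τ i) (U i)
  inj : ∀ i, InjOn (τ i) (U i)
  cover : (⋃ i, τ i '' (Complex.ofReal '' Icc (0 : ℝ) 1)) = frontier D.G
  junction : ∀ i : Fin m,
    τ i 1 = τ (Fin.mk ((i.val + 1) % m) (Nat.mod_lt _ m_pos)) 0
  extAngle : Fin m → ℝ
  extAngle_mem : ∀ i, extAngle i ∈ Ioo (0 : ℝ) 2
  extAngle_spec : ∀ i, HasCornerAngle D.G (τ i 1) ((2 - extAngle i) * Real.pi)
end
open scoped Topology Real
open Real (norm_of_nonneg exp_pos norm_eq_abs add_one_le_exp volume_Icc pi_pos log_lt_iff_lt_exp lt_log_iff_exp_lt two_pi_pos cos_abs sin_pos_of_pos_of_lt_pi pi_gt_three log_neg sin_lt cos_le_one le_log_iff_exp_le log_pos exp_mul le_sqrt_of_sq_le sqrt_mul sqrt_eq_rpow one_le_exp mul_rpow rpow_le_one one_le_rpow_of_pos_of_le_one_of_nonpos rpow_mul rpow_nonneg tendsto_log_nhdsGT_zero pi_lt_four rpow_le_rpow_of_nonpos rpow_add rpow_def_of_pos)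
open ContinuousOn (intervalIntegrable)
open intervalIntegral (integral_add_adjacent_intervals integral_congr integral_comp_sub_left integral_eq_sub_of_hasDerivAt integral_of_le integral_mono_on)
open Function (Periodic invFunOn invFunOn_eq invFunOn_mem uncurry uncurry_apply_pair)
open Finset (sum_congr sum_sub_distrib mul_sum sum_const card_univ sum_comm sum_neg_distrib single_le_sum)
open Polynomial (eval_pow)
variable {D : JordanDomain} {lam : ℝ} {N : ℕ}
local notation "dG" => JordanDomain.G D
local notation "dl" => JordanDomain.l D
notation "◇" => ?_
notation "bl" => by linarith
notation "bp" => by positivity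
notation "bf" => by fun_prop
notation "bn" => by norm_num
notation "bs" => by simp
notation "O01" => Ioo (0:ℝ) 1
notation "mll" => min_le_left _ _
notation "mlr" => min_le_right _ _
notation "rea" => Real.exp_add
notation "cext" => Complex.ext
notation "rele" => Real.exp_le_exp
notation:max "qq" x:max => x * (1 - x)
notation "hf2" => 1/2
notation "tp" => 2 * π
notation:max "RE" x:max => Complex.re x
notation:max "IM" x:max => Complex.im x
notation:max "tC" x:max => (x : ℂ)
notation:max "tR" x:max => (x : ℝ)
notation "CC" => ℂ → ℂ
notation:max "ivv" a:max => 1/a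
notation:max "opp" a:max => 1 + a/2
notation:max "FR" n:max => Finset.range (n + 1)
notation "rlog" => Real.log
notation "rcos" => Real.cos
notation "rsin" => Real.sin
notation "cj" => starRingEnd ℂ
notation "I01" => Icc (0:ℝ) 1
notation "mh" => (-(1/2:ℝ))
notation:max "Xt" D:max => (closure (JordanDomain.G D))ᶜ
theorem maxP {U : Set ℂ} (hU : IsOpen U) {ψ : CC} (hψ : DifferentiableOn ℂ ψ U) {M : ℝ}
    (hb : ∀ e > 0, ∀ b ∈ frontier U, ∀ᶠ z in 𝓝[U] b, ‖ψ z‖ ≤ M + e)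
    (hi : ∀ e > 0, ∃ R, ∀ z ∈ U, R < ‖z‖ → ‖ψ z‖ ≤ M + e) :
    ∀ z ∈ U, ‖ψ z‖ ≤ M := by
  intro z hz
  refine le_of_forall_pos_le_add fun e he ↦ ◇
  by_contra hc
  push Not at hc
  obtain ⟨R, hR⟩ := hi e he
  set V := {w ∈ U | M + e < ‖ψ w‖}
  have hVU : closure V ⊆ U := by
    intro b hbV
    by_contra hbU
    have h1 : b ∈ frontier U := by
      rw [hU.frontier_eq]
      exact ⟨closure_mono (fun w hw ↦ hw.1) hbV, hbU⟩
    have h2 := hb e he b h1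
    rw [mem_closure_iff_frequently] at hbV
    rw [eventually_nhdsWithin_iff] at h2
    obtain ⟨w, hw1, hw2⟩ := (hbV.and_eventually h2).exists
    exact absurd (hw2 hw1.1) (not_le.2 hw1.2)
  have hVo : IsOpen V := by
    convert! (hψ.continuousOn.norm.isOpen_inter_preimage hU (isOpen_Ioi (a := M + e))) using 1
  have hVb : Bornology.IsBounded V := by
    refine isBounded_closedBall (x := 0) (r := R) |>.subset fun w hw ↦ ◇
    by_contra h
    exact absurd (hR w hw.1 (by simpa using h)) (not_le.2 hw.2)
  have := norm_le_of_forall_mem_frontier_norm_le (C := M + e) hVb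
    ⟨hψ.mono fun w hw ↦ hw.1, hψ.continuousOn.mono hVU⟩ (fun w hw ↦ ◇) (subset_closure ⟨hz, hc⟩)
  · exact absurd this (not_le.2 hc)
  · by_contra h
    have hwU := hVU (frontier_subset_closure hw)
    rw [hVo.frontier_eq] at hw
    exact hw.2 ⟨hwU, not_le.1 h⟩
theorem maxPb {U : Set ℂ} (hU : IsOpen U) (hUb : Bornology.IsBounded U)
    {ψ : CC} (hψ : DifferentiableOn ℂ ψ U) {M : ℝ}
    (hb : ∀ e > 0, ∀ b ∈ frontier U, ∀ᶠ z in 𝓝[U] b, ‖ψ z‖ ≤ M + e) :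
    ∀ z ∈ U, ‖ψ z‖ ≤ M := by
  obtain ⟨R, hR⟩ := hUb.exists_norm_le
  exact maxP hU hψ hb fun e he ↦ ⟨R, fun z hz h ↦ absurd (hR z hz) (not_le.2 h)⟩
theorem schwarzPick {f : CC} {c : ℂ} {R : ℝ} (hR : 0 < R) (hf : DifferentiableOn ℂ f (ball c R))
    (hm : ∀ z ∈ ball c R, ‖f z‖ ≤ 1) : ‖deriv f c‖ ≤ (1 - ‖f c‖ ^ 2) / R := by
  have hcm : c ∈ ball c R := mem_ball_self hR
  rcases (hm c hcm).lt_or_eq with h1 | h1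
  · set a := f c with ha
    have hden : ∀ z ∈ ball c R, 1 - cj a * f z ≠ 0 := by
      intro z hz h
      have h2 : 1 = ‖a‖ * ‖f z‖ := by
        rw [← RCLike.norm_conj a, ← norm_mul, ← (by linear_combination h : 1 = cj a * f z)]
        simp
      nlinarith [hm z hz, norm_nonneg a]
    set g := fun z ↦ (f z - a) / (1 - cj a * f z) with hg
    have hgd : DifferentiableOn ℂ g (ball c R) := by
      refine (hf.sub_const a).div ((differentiableOn_const 1).sub (hf.const_mul _)) hden
    have hgm : ∀ z ∈ ball c R, ‖g z‖ ≤ 1 := by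
      intro z hz
      rw [hg]
      simp only [norm_div]
      rw [div_le_one (norm_pos_iff.2 (hden z hz))]
      have h3 : ‖f z - a‖ ^ 2 ≤ ‖1 - cj a * f z‖ ^ 2 := by
        have e1 : ‖f z‖ ^ 2 ≤ 1 := by nlinarith [hm z hz, norm_nonneg (f z)]
        have e2 : ‖a‖ ^ 2 ≤ 1 := by nlinarith [norm_nonneg a]
        rw [← normSq_eq_norm_sq] at *
        rw [← normSq_eq_norm_sq]
        simp only [normSq_apply] at *
        simp
        nlinarith
      exact le_of_sq_le_sq h3 (norm_nonneg _) |> fun h ↦ h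
    have h4 := norm_deriv_le_div_of_mapsTo_ball hgd
      (fun z hz ↦ by simpa [(by simp [hg, ← ha] : g c = 0)] using hgm z hz) hR
    have hfc :=
      (hf.differentiableAt (ball_mem_nhds c hR)).hasDerivAt
    have h5 : HasDerivAt g (deriv f c / (1 - cj a * a)) c := by
      have := (hfc.sub_const a).div ((hfc.const_mul _).const_sub 1) (hden c hcm)
      convert! this using 1
      have := hden c hcm
      rw [← ha] at this ⊢
      field_simp
      ring
    rw [h5.deriv, norm_div] at h4
    have h6 : 1 - cj a * a = ((1 - ‖a‖ ^ 2 : ℝ) : ℂ) := by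
      rw [← normSq_eq_norm_sq, mul_comm, mul_conj]
      push_cast
      rfl
    have h7 : 0 < 1 - ‖a‖ ^ 2 := by nlinarith [norm_nonneg a]
    rw [h6, norm_real, norm_of_nonneg h7.le, div_le_div_iff₀ h7 hR] at h4
    rw [le_div_iff₀ hR]
    linarith
  · have := eventually_eq_of_isLocalMax_norm
      (by filter_upwards [ball_mem_nhds c hR] with z hz using hf.differentiableAt (isOpen_ball.mem_nhds hz))
      (by filter_upwards [ball_mem_nhds c hR] with z hz; simpa [h1] using hm z hz)
    have : deriv f c = 0 := by
      rw [EventuallyEq.deriv_eq this]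
      simp
    simp [this, h1]
theorem primConvex {s : Set ℂ} (hs : Convex ℝ s) (ho : IsOpen s) {f : CC}
    (hf : DifferentiableOn ℂ f s) : ∃ g : CC, ∀ a ∈ s, HasDerivAt g (f a) a := by
  obtain ⟨g, hg⟩ := hs.exists_forall_hasDerivWithinAt hf
  exact ⟨g, fun a ha ↦ (hg a ha).hasDerivAt (ho.mem_nhds ha)⟩
theorem sqrtConvex {s : Set ℂ} (hs : Convex ℝ s) (ho : IsOpen s) {f : CC}
    (hf : DifferentiableOn ℂ f s) (h0 : ∀ z ∈ s, f z ≠ 0) :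
    ∃ g : CC, DifferentiableOn ℂ g s ∧ ∀ z ∈ s, g z ^ 2 = f z := by
  rcases s.eq_empty_or_nonempty with rfl | ⟨c, hc⟩
  · exact ⟨0, bs, bs⟩
  obtain ⟨g, hg⟩ := primConvex hs ho ((hf.deriv ho).div hf h0)
  have hfd : ∀ z ∈ s, HasDerivAt f _ z := fun z hz ↦
    (hf.differentiableAt (ho.mem_nhds hz)).hasDerivAt
  have key : ∀ z ∈ s, f z * exp (-g z) = f c * exp (-g c) := by
    have hd : ∀ z ∈ s, HasDerivAt (fun z ↦ f z * exp (-g z)) 0 z := by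
      intro z hz
      convert! (hfd z hz).mul ((hg z hz).neg.cexp) using 1
      have := h0 z hz
      simp only [Pi.div_apply]
      field_simp
      ring
    intro z hz
    exact hs.is_const_of_fderivWithin_eq_zero
      (fun z hz ↦ (hd z hz).differentiableAt.differentiableWithinAt)
      (fun z hz ↦ by
        rw [fderivWithin_of_isOpen ho hz]
        rw [((hd z hz).hasFDerivAt.fderiv)]; ext; simp) hz hc
  obtain ⟨b, hb⟩ := IsAlgClosed.exists_pow_nat_eq (f c * exp (-g c)) (n := 2) bn
  refine ⟨fun z ↦ b * exp (g z / 2), fun z hz ↦ ◇, fun z hz ↦ ◇⟩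
  · exact (((hg z hz).div_const 2).cexp.const_mul b).differentiableAt.differentiableWithinAt
  · rw [mul_pow, hb, ← key z hz, ← exp_nat_mul, mul_assoc, ← exp_add]
    push_cast
    rw [show -g z + 2 * (g z / 2) = 0 by ring]
    simp
theorem inj_inverse {U : Set ℂ} (hU : IsOpen U) {f g : CC} (hf : DifferentiableOn ℂ f U)
    (hg : ∀ z ∈ U, g (f z) = z) {z : ℂ} (hz : z ∈ U) :
    deriv f z ≠ 0 ∧ HasDerivAt g (deriv f z)⁻¹ (f z) ∧ 𝓝 (f z) ≤ map f (𝓝 z) := by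
  have han : ∀ w ∈ U, AnalyticAt ℂ f w := fun w hw ↦ hf.analyticAt (hU.mem_nhds hw)
  have hnc : ∀ w ∈ U, ¬ ∀ᶠ y in 𝓝 w, f y = f w := by
    intro w hw h
    have h2 : ∀ᶠ y in 𝓝 w, y = w := by
      filter_upwards [h, hU.mem_nhds hw] with y hy hyU
      rw [← hg y hyU, hy, hg w hw]
    obtain ⟨y, hy1, hy2⟩ := ((h2.filter_mono (nhdsWithin_le_nhds (s := {w}ᶜ))).and self_mem_nhdsWithin).exists
    exact hy2 hy1
  have hopen : ∀ w ∈ U, 𝓝 _ ≤ map f _ := fun w hw ↦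
    ((han w hw).eventually_constant_or_nhds_le_map_nhds).resolve_left (hnc w hw)
  have hcont : ∀ w ∈ U, Tendsto g (𝓝 (f w)) (𝓝 w) := by
    intro w hw
    refine (map_mono (hopen w hw)).trans ◇
    rw [map_map]
    refine (tendsto_id.congr' ◇ : Tendsto _ _ _)
    filter_upwards [hU.mem_nhds hw] with y hy using (hg y hy).symm
  have hfg : ∀ w ∈ U, ∀ᶠ y in 𝓝 (f w), f (g y) = y := by
    intro w hw
    refine (hopen w hw) ◇
    rw [mem_map]
    filter_upwards [hU.mem_nhds hw] with y hy
    simp [hg y hy]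
  have hfd : ∀ w ∈ U, HasDerivAt f _ w := fun w hw ↦
    (hf.differentiableAt (hU.mem_nhds hw)).hasDerivAt
  have hgd : ∀ w ∈ U, deriv f w ≠ 0 → HasDerivAt g (deriv f w)⁻¹ (f w) := by
    intro w hw h0
    refine HasDerivAt.of_local_left_inverse ◇ ◇ h0 (hfg w hw)
    · have := hcont w hw
      unfold ContinuousAt
      rwa [hg w hw]
    · rw [hg w hw]
      exact hfd w hw
  have hne : ∀ᶠ w in 𝓝[≠] z, deriv f w ≠ 0 := by
    rcases (han z hz).deriv.eventually_eq_zero_or_eventually_ne_zero with h | h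
    · exfalso
      obtain ⟨r, hr, hb⟩ := Metric.eventually_nhds_iff_ball.1 (h.and (hU.mem_nhds hz))
      refine hnc z hz ◇
      filter_upwards [ball_mem_nhds z hr] with y hy
      refine (convex_ball z r).is_const_of_fderivWithin_eq_zero
        (fun w hw ↦ (hfd w (hb w hw).2).differentiableAt.differentiableWithinAt)
        (fun w hw ↦ ◇) hy (mem_ball_self hr)
      rw [fderivWithin_of_isOpen isOpen_ball hw, (hfd w (hb w hw).2).hasFDerivAt.fderiv, (hb w hw).1]
      ext
      simp
    · exact h
  have han2 : AnalyticAt ℂ g (f z) := by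
    refine analyticAt_of_differentiable_on_punctured_nhds_of_continuousAt ◇ ◇
    · have h1 : ∀ᶠ w in 𝓝 z, w ≠ z → w ∈ U ∧ deriv f w ≠ 0 := by
        filter_upwards [eventually_nhdsWithin_iff.1 hne, hU.mem_nhds hz] with w h1 h2 h3
        exact ⟨h2, h1 h3⟩
      rw [eventually_nhdsWithin_iff]
      refine hopen z hz ◇
      rw [mem_map]
      filter_upwards [h1] with w hw hne
      have h3 := hw (fun h ↦ hne (by simp [h]))
      exact (hgd w h3.1 h3.2).differentiableAt
    · have := hcont z hz
      unfold ContinuousAt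
      rwa [hg z hz]
  have h0 : deriv f z ≠ 0 := by
    have h1 : HasDerivAt (g ∘ f) 1 z := by
      refine (hasDerivAt_id z).congr_of_eventuallyEq ◇
      filter_upwards [hU.mem_nhds hz] with y hy using hg y hy
    have := (han2.differentiableAt.hasDerivAt.comp z (hfd z hz)).unique h1
    intro h
    rw [h] at this
    simp at this
  exact ⟨h0, hgd z hz h0, hopen z hz⟩
theorem moreraLine {f : CC} {x : ℂ} {r : ℝ} (hc : ContinuousOn f (ball x r))
    (hd : ∀ z ∈ ball x r, IM z ≠ 0 → DifferentiableAt ℂ f z) : DifferentiableOn ℂ f (ball x r) := by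
  have aux : ∀ z w, Rectangle z w ⊆ ball x r → (∀ y ∈ Ioo (min IM z IM w) (max IM z IM w), y ≠ 0) →
      wedgeIntegral z w f = - wedgeIntegral w z f := by
    intro z w hzw hy
    rw [← add_eq_zero_iff_eq_neg, wedgeIntegral_add_wedgeIntegral_eq]
    refine integral_boundary_rect_eq_zero_of_continuousOn_of_differentiableOn f z w (hc.mono hzw) ◇
    intro u hu
    rw [mem_reProdIm] at hu
    refine (hd u (hzw ◇) (hy _ hu.2)).differentiableWithinAt
    exact ⟨⟨hu.1.1.le, hu.1.2.le⟩, ⟨hu.2.1.le, hu.2.2.le⟩⟩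
  have hcons : IsConservativeOn f (ball x r) := by
    intro z w hzw
    by_cases h : ∀ y ∈ Ioo (min IM z IM w) (max IM z IM w), y ≠ 0
    · exact aux z w hzw h
    push Not at h
    obtain ⟨_, h0, rfl⟩ := h
    have hI : 0 ∈ uIcc IM z IM w := ⟨h0.1.le, h0.2.le⟩
    have hsub : ∀ y ∈ uIcc IM z IM w, ∀ y' ∈ uIcc IM z IM w,
        Rectangle (⟨RE z, y⟩) (⟨RE w, y'⟩) ⊆ ball x r := by
      intro y hy y' hy' u hu
      refine hzw ⟨hu.1, uIcc_subset_uIcc hy hy' hu.2⟩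
    have e1 := aux ⟨RE z, IM z⟩ ⟨RE w, 0⟩ (hsub _ left_mem_uIcc _ hI) (by
      rcases le_total IM z IM w with h | h <;> simp [h] at h0 <;>
      intro y hy <;> simp only [mem_Ioo, min_lt_iff, lt_max_iff] at hy <;> rintro rfl
      · rcases hy.2 with h | h <;> linarith
      · rcases hy.1 with h | h <;> linarith)
    have e2 := aux ⟨RE z, 0⟩ ⟨RE w, IM w⟩ (hsub _ hI _ right_mem_uIcc) (by
      rcases le_total IM z IM w with h | h <;> simp [h] at h0 <;>
      intro y hy <;> simp only [mem_Ioo, min_lt_iff, lt_max_iff] at hy <;> rintro rfl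
      · rcases hy.1 with h | h <;> linarith
      · rcases hy.2 with h | h <;> linarith)
    rw [← add_eq_zero_iff_eq_neg, wedgeIntegral_add_wedgeIntegral_eq] at e1 e2 ⊢
    have hv : ∀ a ∈ uIcc RE z RE w, ∀ y ∈ uIcc IM z IM w, ∀ y' ∈ uIcc IM z IM w,
        IntervalIntegrable (fun y ↦ f (a + y * I)) volume y y' := by
      intro a ha y hy y' hy'
      refine intervalIntegrable (hc.comp bf fun u hu ↦ hzw ◇)
      exact ⟨by simpa using ha, by simpa using uIcc_subset_uIcc hy hy' hu⟩
    have s1 := integral_add_adjacent_intervals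
      (hv RE w right_mem_uIcc _ left_mem_uIcc _ hI) (hv RE w right_mem_uIcc _ hI _ right_mem_uIcc)
    have s2 := integral_add_adjacent_intervals
      (hv RE z left_mem_uIcc _ left_mem_uIcc _ hI) (hv RE z left_mem_uIcc _ hI _ right_mem_uIcc)
    rw [← s1, ← s2]
    linear_combination e1 + e2
  exact (hcons.isExactOn_ball hc).differentiableOn isOpen_ball
theorem reflLip {S : Set ℂ} {q : CC} {x : ℝ} {ρ : ℝ} (hρ : 0 < ρ)
    (hS : closedBall tC x ρ ⊆ S)
    (hq : ∀ w ∈ S, 0 < IM w → DifferentiableAt ℂ q w)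
    (hb : ∀ b ∈ S, IM b = 0 → Tendsto (fun w ↦ ‖q w‖) (𝓝[{w | 0 < IM w}] b) (𝓝 1))
    (h2 : ∀ w ∈ closedBall tC x ρ, 0 < IM w → 1/2 ≤ ‖q w‖ ∧ ‖q w‖ ≤ 1)
    {y : ℝ} (hy : 0 < y) (hyρ : y ≤ ρ / 2) :
    ‖deriv q (x + y * I)‖ ≤ 4 / ρ := by
  set A : ℝ := 2 / ρ with hA
  obtain ⟨K, hK⟩ : ∃ K, K = 1/ρ^2 := ⟨_, rfl⟩
  set ψ : CC := fun w ↦ (q w)⁻¹ * exp (-(-I * A * (w - x) + K * (w-x)^2)) with hψ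
  set U : Set ℂ := ball x ρ ∩ {w | 0 < IM w}
  have hUo : IsOpen U := isOpen_ball.inter (isOpen_lt continuous_const continuous_im)
  have hq0 : ∀ w ∈ closedBall tC x ρ, 0 < IM w → q w ≠ 0 := by
    intro w hw hi h
    have := (h2 w hw hi).1
    rw [h] at this
    norm_num at this
  have hre : ∀ w, (-(-I * A * (w - x) + K * (w-x)^2)).re
      = -(A * IM w + K * ((RE w - x)^2 - IM w^2)) := by
    intro w
    simp [pow_two]
  have hψn : ∀ w, ‖ψ w‖ = ‖q w‖⁻¹ * rexp (-(A * IM w + K * ((RE w - x)^2 - IM w^2))) := by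
    intro w
    rw [hψ]
    simp only [norm_mul, norm_inv, norm_exp, hre]
  have hψd : DifferentiableOn ℂ ψ U := by
    intro w hw
    refine DifferentiableAt.differentiableWithinAt ◇
    refine DifferentiableAt.mul ((hq w (hS (ball_subset_closedBall hw.1)) hw.2).inv
      (hq0 w (ball_subset_closedBall hw.1) hw.2)) bf
  have key := maxPb hUo (isBounded_ball.subset inter_subset_left) hψd (by
    intro e he b hbU
    have hbc :=
      (closure_mono inter_subset_left).trans closure_ball_subset_closedBall (frontier_subset_closure hbU)
    have hbi : 0 ≤ IM b := by
      have : closure U ⊆ {w | 0 ≤ IM w} :=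
        closure_minimal (fun w hw ↦ (le_of_lt hw.2 : 0 ≤ IM w)) (isClosed_le continuous_const continuous_im)
      exact this (frontier_subset_closure hbU)
    rcases hbi.lt_or_eq with hp | hp
    · have hbr : (RE b - x)^2 + IM b^2 = ρ^2 := by
        rw [hUo.frontier_eq] at hbU
        have h4 := le_antisymm (by simpa [dist_eq_norm] using hbc) (by simpa [dist_eq_norm] using (fun h ↦ hbU.2 ⟨h, hp⟩))
        rw [← h4, ← normSq_eq_norm_sq, normSq_apply]
        simp
        ring
      have hc : ContinuousAt ψ b := by
        refine ContinuousAt.mul ((hq b (hS hbc) hp).continuousAt.inv₀ (hq0 b hbc hp)) bf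
      have hlt : ‖ψ b‖ < 1 + e := by
        rw [hψn]
        have h5 : A * IM b + K * ((RE b - x)^2 - IM b^2) ≥ 1 := by
          have : IM b ≤ ρ := by nlinarith
          have h6 : A * IM b + K * ((RE b - x)^2 - IM b^2) = 1 + 2 * (IM b * (ρ - IM b)) / ρ^2 := by
            rw [(bl : (RE b - x)^2 = ρ^2 - IM b^2), hA, hK]
            field_simp
            ring
          rw [h6]
          have : 0 ≤ 2 * (IM b * (ρ - IM b)) / ρ^2 := by
            have : 0 ≤ ρ - IM b := bl
            positivity
          linarith
        have h7 : ‖q b‖⁻¹ ≤ 2 := by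
          rw [inv_le_comm₀ (norm_pos_iff.2 (hq0 b hbc hp)) bn]
          linarith [(h2 b hbc hp).1]
        have h8 : rexp (-(A * IM b + K * ((RE b - x)^2 - IM b^2))) ≤ rexp (-1) :=
          Real.exp_le_exp.2 bl
        have h9 : rexp (-1) < 1/2 := by
          have := Real.exp_neg_one_lt_d9
          linarith
        have := mul_le_mul h7 h8 (exp_pos _).le bn
        linarith
      exact nhdsWithin_le_nhds ((hc.norm.eventually_lt_const hlt).mono fun w hw ↦ hw.le)
    · have ht : Tendsto (fun w ↦ ‖ψ w‖) (𝓝[U] b) (𝓝 (1⁻¹ * rexp (-(A * IM b + K * ((RE b - x)^2 - IM b^2))))) := by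
        simp only [hψn]
        refine Tendsto.mul (((hb b (hS hbc) hp.symm).mono_left (nhdsWithin_mono _ inter_subset_right)).inv₀ one_ne_zero) ◇
        exact (bf : Continuous fun w : ℂ ↦ rexp (-(A * IM w + K * ((RE w - x)^2 - IM w^2)))).continuousAt.tendsto.mono_left nhdsWithin_le_nhds
      refine (ht.eventually_lt_const ◇).mono fun w hw ↦ hw.le
      have : rexp (-(A * IM b + K * ((RE b - x)^2 - IM b^2))) ≤ 1 := by
        rw [Real.exp_le_one_iff, ← hp, hK]
        have : 0 ≤ 1/ρ^2 * ((RE b - x)^2) := bp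
        linarith
      simp only [inv_one]; linarith)
  have hwU : (x + y * I : ℂ) ∈ U := by
    constructor
    · simp [ abs_of_pos hy]
      linarith
    · simpa using hy
  have h3 := key _ hwU
  have hqp := norm_pos_iff.2 (hq0 _ (ball_subset_closedBall hwU.1) hwU.2)
  have h4 : 1 - ‖q (x + y * I)‖^2 ≤ 4 / ρ * y := by
    rw [hψn] at h3
    have e1 : -rlog ‖q (x + y * I)‖ ≤ A * y := by
      have :=
        Real.log_nonpos bp h3
      rw [Real.log_mul bp bp, Real.log_exp, Real.log_inv] at this
      simp at this
      have h5 : 0 ≤ K * y^2 := by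
        rw [hK]
        positivity
      linarith
    have e2 := Real.log_le_sub_one_of_pos (show 0 < ‖q _‖^2 by positivity)
    rw [Real.log_pow] at e2
    push_cast at e2
    have : 4 / ρ * y = 2 * (A * y) := by
      rw [hA]
      ring
    linarith
  have hball : ball (x + y * I : ℂ) y ⊆ U := by
    intro w hw
    rw [mem_ball, dist_eq_norm] at hw
    constructor
    · rw [mem_ball, dist_eq_norm]
      calc ‖w - x‖ = ‖(w - (x + y * I)) + y * I‖ := by congr 1; ring
        _ ≤ ‖w - (x + y * I)‖ + ‖(y * I : ℂ)‖ := norm_add_le _ _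
        _ < ρ := by simp [abs_of_pos hy]; linarith
    · have := abs_im_le_norm (w - (x + y * I))
      simp at this
      rw [abs_le] at this
      show 0 < IM w
      linarith
  have h5 := schwarzPick hy (fun w hw ↦ (hq w (hS (ball_subset_closedBall (hball hw).1))
    (hball hw).2).differentiableWithinAt) (fun w hw ↦ (h2 w (ball_subset_closedBall (hball hw).1) (hball hw).2).2)
  exact h5.trans ((div_le_iff₀ hy).2 h4)
theorem hopf {S : Set ℂ} {q : CC} {x : ℝ} {ρ : ℝ} (hρ : 0 < ρ)
    (hS : closedBall tC x (2*ρ) ⊆ S)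
    (hq : ∀ w ∈ S, 0 < IM w → DifferentiableAt ℂ q w)
    (h1 : ∀ w ∈ S, 0 < IM w → ‖q w‖ < 1) :
    ∃ N : ℕ, 0 < N ∧ ∀ y : ℝ, 0 < y → y < ρ/2 → ‖q (x + y * I)‖ ^ N ≤ 1 - y / ρ := by
  set c : ℂ := x + ρ * I with hc
  have hup : ∀ w, w ∈ closedBall c ρ → w ≠ x → 0 < IM w := by
    intro w hw hwx
    rw [mem_closedBall, dist_eq_norm] at hw
    have h2 : (RE w - x)^2 + (IM w - ρ)^2 ≤ ρ^2 := by
      have : ‖w - c‖^2 ≤ ρ^2 := by gcongr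
      rw [← normSq_eq_norm_sq, normSq_apply] at this
      simp [hc] at this
      nlinarith
    by_contra h
    push Not at h
    have h3 : IM w = 0 := by nlinarith
    have h4 : RE w = x := by
      rw [h3] at h2
      nlinarith
    exact hwx (cext (by simpa using h4) (by simpa using h3))
  have hcS : closedBall c ρ ⊆ S := by
    refine subset_trans (closedBall_subset_closedBall' ◇) hS
    simp [hc, abs_of_pos hρ]
    linarith
  have hcd : ∀ w ∈ closedBall c ρ, w ≠ x → DifferentiableAt ℂ q w :=
    fun w hw hx ↦ hq w (hcS hw) (hup w hw hx)
  have hxc : ‖x - c‖ = ρ := by simp [hc, abs_of_pos hρ]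
  have hsx : ∀ w ∈ closedBall c (ρ/2), w ≠ x := by
    rintro w hw rfl
    rw [mem_closedBall, dist_eq_norm, hxc] at hw
    linarith
  have hsub : closedBall c (ρ/2) ⊆ closedBall c ρ := closedBall_subset_closedBall bl
  obtain ⟨m, hm1, hm⟩ : ∃ m < 1, ∀ w ∈ closedBall c _, ‖q w‖ ≤ m := by
    have hcc : ContinuousOn (fun w ↦ ‖q w‖) _ := fun w hw ↦
      (hcd w (hsub hw) (hsx w hw)).continuousAt.norm.continuousWithinAt
    obtain ⟨w, hw, hw2⟩ := (isCompact_closedBall c _).exists_isMaxOn ⟨c, by simp; positivity⟩ hcc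
    exact ⟨‖q w‖, h1 w (hcS (hsub hw)) (hup w (hsub hw) (hsx w hw)), fun z hz ↦ hw2 hz⟩
  obtain ⟨N, hN⟩ := exists_pow_lt_of_lt_one (show tR 0 < 1/2 by norm_num) hm1
  refine ⟨N, Nat.pos_of_ne_zero (by rintro rfl; norm_num at hN), fun y hy hy2 ↦ ◇⟩
  set U : Set ℂ := ball c ρ ∩ {w | ρ/2 < ‖w - c‖}
  have hUo : IsOpen U := isOpen_ball.inter (isOpen_lt continuous_const bf)
  set ψ : CC := fun w ↦ q w ^ N * (ρ / (w - c)) with hψ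
  have hn : ∀ w, ‖ψ w‖ = ‖q w‖^N * (ρ / ‖w - c‖) := by
    intro w
    simp [hψ, abs_of_pos hρ]
  have hUx : ∀ w ∈ U, w ≠ x := by
    rintro w hw rfl
    have := hw.1
    rw [mem_ball, dist_eq_norm, hxc] at this
    linarith
  have key := maxPb hUo (isBounded_ball.subset inter_subset_left) (ψ := ψ) (by
    intro w hw
    have h3 : w - c ≠ 0 := by
      intro h
      have : ρ/2 < ‖w - c‖ := hw.2
      rw [h] at this
      simp at this
      linarith
    exact (DifferentiableAt.mul ((hcd w (ball_subset_closedBall hw.1) (hUx w hw)).pow N) bf).differentiableWithinAt) (by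
    intro e he b hbU
    have hcl := frontier_subset_closure hbU
    have hb1 : ‖b - c‖ ≤ ρ := by
      simpa [dist_eq_norm] using ((closure_mono inter_subset_left).trans closure_ball_subset_closedBall hcl)
    have hb2 : ρ/2 ≤ ‖b - c‖ := by
      have : closure U ⊆ {w | ρ/2 ≤ ‖w - c‖} :=
        closure_minimal (fun w hw ↦ (le_of_lt hw.2 : ρ/2 ≤ ‖w - c‖)) (isClosed_le continuous_const bf)
      exact this hcl
    have hbc : b - c ≠ 0 := by
      intro h
      rw [h] at hb2
      simp at hb2
      linarith
    rcases hb1.lt_or_eq with h3 | h3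
    · have h4 : ‖b - c‖ = ρ/2 := by
        refine le_antisymm ◇ hb2
        by_contra h
        rw [hUo.frontier_eq] at hbU
        exact hbU.2 ⟨by simpa [dist_eq_norm] using h3, not_le.1 h⟩
      have hbm : b ∈ closedBall c (ρ/2) := by simp [dist_eq_norm, h4]
      have hcont : ContinuousAt ψ b := by
        refine ContinuousAt.mul ((hcd b (hsub hbm) (hsx b hbm)).continuousAt.pow N) ◇
        fun_prop
      have : ‖ψ b‖ < 1 + e := by
        rw [hn, h4]
        have := (pow_le_pow_left₀ (norm_nonneg _) (hm b hbm) N).trans hN.le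
        rw [(by field_simp : ρ / (ρ/2) = 2)]
        linarith
      exact nhdsWithin_le_nhds ((hcont.norm.eventually_lt_const this).mono fun w hw ↦ hw.le)
    · have hcont : Tendsto (fun w ↦ ρ / ‖w - c‖) (𝓝[U] b) (𝓝 (ρ/ρ)) := by
        have : ContinuousAt (fun w ↦ ρ / ‖w - c‖) b := by
          refine ContinuousAt.div bf bf (by simpa using hbc)
        rw [← h3] at hρ ⊢
        simpa [h3] using (this.tendsto.mono_left (nhdsWithin_le_nhds (s := U)))
      rw [div_self hρ.ne'] at hcont
      filter_upwards [hcont.eventually_lt_const (show 1 < 1 + e by linarith), self_mem_nhdsWithin] with w hw hwU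
      rw [hn]
      have h7 : ‖q w‖^N ≤ 1 := pow_le_one₀ (norm_nonneg _)
        (h1 w (hcS (ball_subset_closedBall hwU.1)) (hup w (ball_subset_closedBall hwU.1) (hUx w hwU))).le
      have h8 : 0 ≤ ρ / ‖w - c‖ := bp
      nlinarith)
  have hwc : ‖(x + y * I : ℂ) - c‖ = ρ - y := by
    rw [show (x + y * I : ℂ) - c = ((y - ρ : ℝ) : ℂ) * I by simp; ring, norm_mul, norm_real, norm_I, mul_one, norm_eq_abs, abs_sub_comm, abs_of_pos bl]
  have h3 := key _ ⟨by rw [mem_ball, dist_eq_norm, hwc]; linarith, by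
    show ρ/2 < ‖(x + y * I : ℂ) - c‖; rw [hwc]; linarith⟩
  rw [hn, hwc, ← mul_div_assoc, div_le_one bl] at h3
  rwa [show 1 - y/ρ = (ρ - y)/ρ by field_simp, le_div_iff₀ hρ]
theorem upper_ext {S : Set ℂ} (hS : IsOpen S) {q : CC}
    (hq : ∀ w ∈ S, 0 < IM w → DifferentiableAt ℂ q w)
    (h1 : ∀ w ∈ S, 0 < IM w → 0 < ‖q w‖ ∧ ‖q w‖ < 1)
    (hb : ∀ b ∈ S, IM b = 0 → Tendsto (fun w ↦ ‖q w‖) (𝓝[{w | 0 < IM w}] b) (𝓝 1))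
    {b : ℂ} (hbS : b ∈ S) (hb0 : IM b = 0) :
    ∃ y, Tendsto q (𝓝[{w | 0 < IM w}] b) (𝓝 y) := by
  obtain ⟨r, hr, hr2⟩ := Metric.mem_nhdsWithin_iff.1 (((hb b hbS hb0).eventually_const_le (show (1/2:ℝ) < 1 by norm_num)) : {w | hf2 ≤ ‖q w‖} ∈ _)
  obtain ⟨r', hr', hr2'⟩ := Metric.isOpen_iff.1 hS b hbS
  set ρ := min r r' / 4 with hρ
  have hρ0 : 0 < ρ := bp
  have h4 : 4 * ρ = min r r' := by
    rw [hρ]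
    ring
  have hra : 4 * ρ ≤ r := by
    rw [h4]
    exact min_le_left _ _
  have hrb : 4 * ρ ≤ r' := by
    rw [h4]
    exact min_le_right _ _
  set V : Set ℂ := ball b (ρ/2) ∩ {w | 0 < IM w}
  have hder : ∀ w ∈ V, ‖deriv q w‖ ≤ 4/ρ := by
    intro w hw
    have hwb : ‖w - b‖ < ρ/2 := by simpa [dist_eq_norm] using hw.1
    have hre : |RE w - RE b| < ρ/2 := by
      have := abs_re_le_norm (w - b)
      simp at this
      linarith
    have him : |IM w| < ρ/2 := by
      have := abs_im_le_norm (w - b)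
      simp [hb0] at this
      linarith
    have hbr : b = RE b := by apply cext <;> simp [hb0]
    have hsub : closedBall (RE w : ℂ) ρ ⊆ ball b (4*ρ) := by
      intro v hv
      rw [mem_closedBall] at hv
      rw [mem_ball]
      have : dist (RE w : ℂ) b < ρ/2 := by
        rw [hbr, dist_eq_norm, ← ofReal_sub, norm_real]
        exact hre
      linarith [dist_triangle v RE w b]
    have h5 := reflLip hρ0 (hsub.trans ((ball_subset_ball hrb).trans hr2')) hq hb
      (fun v hv hvi ↦ ⟨hr2 ⟨(ball_subset_ball hra) (hsub hv), hvi⟩,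
        (h1 v (hr2' (ball_subset_ball hrb (hsub hv))) hvi).2.le⟩) hw.2
        ((le_abs_self _).trans him.le)
    rwa [re_add_im] at h5
  have hVS : V ⊆ S := fun w hw ↦ hr2' (ball_subset_ball bl hw.1)
  have hlip : ∀ x ∈ V, ∀ y ∈ V, ‖q y - q x‖ ≤ 4/ρ * ‖y - x‖ := fun x hx y hy ↦
    ((convex_ball _ _).inter (convex_halfSpace_im_gt 0)).norm_image_sub_le_of_norm_deriv_le
    (fun w hw ↦ hq w (hVS hw) hw.2) hder hx hy
  have hne : (𝓝[{w : ℂ | 0 < IM w}] b).NeBot := by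
    rw [← mem_closure_iff_nhdsWithin_neBot, closure_setOfPred_lt_im]
    exact hb0.ge
  have huc : UniformContinuousOn q V := by
    refine LipschitzOnWith.uniformContinuousOn (K := ⟨4/ρ, bp⟩) (LipschitzOnWith.of_dist_le_mul ◇)
    intro x hx y hy
    rw [dist_eq_norm, dist_eq_norm]
    exact hlip y hy x hx
  have hVm : V ∈ 𝓝[{w : ℂ | 0 < IM w}] b :=
    inter_mem (nhdsWithin_le_nhds (ball_mem_nhds _ bp)) self_mem_nhdsWithin
  have hcau :=
    Cauchy.map_of_le (cauchy_nhds.mono nhdsWithin_le_nhds) huc (le_principal_iff.2 hVm)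
  exact CompleteSpace.complete hcau
theorem reflect {S : Set ℂ} (hS : IsOpen S) (hsym : ∀ w ∈ S, cj w ∈ S) {q : CC}
    (hq : ∀ w ∈ S, 0 < IM w → DifferentiableAt ℂ q w)
    (h1 : ∀ w ∈ S, 0 < IM w → 0 < ‖q w‖ ∧ ‖q w‖ < 1)
    (hb : ∀ b ∈ S, IM b = 0 → Tendsto (fun w ↦ ‖q w‖) (𝓝[{w | 0 < IM w}] b) (𝓝 1)) :
    ∃ Q : CC, DifferentiableOn ℂ Q S ∧ (∀ w ∈ S, 0 < IM w → Q w = q w) ∧ (∀ w ∈ S, Q w ≠ 0) ∧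
      (∀ w ∈ S, Q (cj w) = (cj (Q w))⁻¹) ∧
      ∀ x : ℝ, tC x ∈ S → ∃ t : ℝ, 0 < t ∧ deriv Q x / Q x = I * t := by
  set P : CC := extendFrom {w | 0 < IM w} q
  have hPq : ∀ w ∈ S, 0 < IM w → P w = q w := fun w hw hi ↦
    extendFrom_eq (subset_closure hi) ((hq w hw hi).continuousAt.tendsto.mono_left nhdsWithin_le_nhds)
  have hPc : ContinuousOn P (S ∩ {w | 0 ≤ IM w}) := by
    refine continuousOn_extendFrom (fun w hw ↦ ◇) (fun w hw ↦ ◇)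
    · rw [closure_setOfPred_lt_im]
      exact hw.2
    · rcases (show 0 ≤ IM w from hw.2).lt_or_eq with h | h
      · exact ⟨q w, (hq w hw.1 h).continuousAt.tendsto.mono_left nhdsWithin_le_nhds⟩
      · exact upper_ext hS hq h1 hb hw.1 h.symm
  have hPr : ∀ w ∈ S, IM w = 0 → ‖P w‖ = 1 := by
    intro w hw hw0
    have hne : (𝓝[{w : ℂ | 0 < IM w}] w).NeBot := by
      rw [← mem_closure_iff_nhdsWithin_neBot, closure_setOfPred_lt_im]
      exact hw0.ge
    have := tendsto_extendFrom (upper_ext hS hq h1 hb hw hw0)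
    exact tendsto_nhds_unique this.norm (hb w hw hw0)
  have hPne : ∀ w ∈ S, 0 ≤ IM w → P w ≠ 0 := by
    intro w hw hi
    rcases hi.lt_or_eq with h | h
    · rw [hPq w hw h]
      exact norm_pos_iff.1 (h1 w hw h).1
    · intro h0
      have := hPr w hw h.symm
      rw [h0] at this
      simp at this
  set Q : CC := fun w ↦ if 0 ≤ IM w then P w else (cj (P (cj w)))⁻¹ with hQ
  have hQu : ∀ w, 0 ≤ IM w → Q w = P w := fun w hw ↦ if_pos hw
  have hinv1 : ∀ z : ℂ, ‖z‖ = 1 → (cj z)⁻¹ = z := by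
    intro z hz
    have h : z ≠ 0 := by
      intro h
      rw [h] at hz
      simp at hz
    rw [inv_eq_iff_eq_inv, Complex.inv_def]
    simp [normSq_eq_norm_sq, hz]
  have hreal : ∀ w : ℂ, IM w = 0 → cj w = w := fun w hw ↦ by
    apply cext <;> simp [hw]
  have hQl : ∀ w ∈ S, IM w ≤ 0 → Q w = (cj (P (cj w)))⁻¹ := by
    intro w hw hi
    rcases hi.lt_or_eq with h | h
    · exact if_neg (not_le.2 h)
    · rw [hQu w h.ge, hreal w h, hinv1 _ (hPr w hw h)]
  have hrefl : ∀ w ∈ S, Q (cj w) = (cj (Q w))⁻¹ := by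
    intro w hw
    rcases le_total 0 IM w with h | h
    · rw [hQl _ (hsym w hw) (by simpa using h), conj_conj, hQu w h]
    · rw [hQu _ (by simpa using h), hQl w hw h]
      simp
  have hQne : ∀ w ∈ S, Q w ≠ 0 := by
    intro w hw
    rcases le_total 0 IM w with h | h
    · rw [hQu w h]
      exact hPne w hw h
    · rw [hQl w hw h]
      simpa using hPne _ (hsym w hw) (by simpa using h)
  have hQc : ContinuousOn Q S := by
    have hu : S = (S ∩ {w | 0 ≤ IM w}) ∪ (S ∩ {w | IM w ≤ 0}) := by
      ext w
      constructor
      · intro h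
        rcases le_total 0 IM w with h' | h'
        · exact Or.inl ⟨h, h'⟩
        · exact Or.inr ⟨h, h'⟩
      · rintro (h | h) <;> exact h.1
    have hA := hPc.congr fun w hw ↦ hQu w hw.2
    have hB : ContinuousOn Q (S ∩ {w | IM w ≤ 0}) := by
      have : ContinuousOn (fun w ↦ (cj (P (cj w)))⁻¹) (S ∩ {w | IM w ≤ 0}) := by
        refine ContinuousOn.inv₀ ◇ ◇
        · refine continuous_conj.comp_continuousOn (hPc.comp continuous_conj.continuousOn ◇)
          intro w hw
          exact ⟨hsym w hw.1, show 0 ≤ (cj w).im by simpa using hw.2⟩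
        · intro w hw
          simpa using hPne _ (hsym w hw.1) (by simpa using hw.2)
      exact this.congr fun w hw ↦ hQl w hw.1 hw.2
    intro w hw
    rw [hu]
    have c1 : ContinuousWithinAt Q (S ∩ {w | 0 ≤ IM w}) w := by
      by_cases h : 0 ≤ IM w
      · exact hA w ⟨hw, h⟩
      · refine continuousWithinAt_of_notMem_closure fun h' ↦ h ◇
        exact (closure_minimal inter_subset_right (isClosed_le continuous_const continuous_im) h' : w ∈ {w : ℂ | 0 ≤ IM w})
    have c2 : ContinuousWithinAt Q (S ∩ {w | IM w ≤ 0}) w := by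
      by_cases h : IM w ≤ 0
      · exact hB w ⟨hw, h⟩
      · refine continuousWithinAt_of_notMem_closure fun h' ↦ h ◇
        exact (closure_minimal inter_subset_right (isClosed_le continuous_im continuous_const) h' : w ∈ {w : ℂ | IM w ≤ 0})
    exact c1.union c2
  have hup : ∀ w ∈ S, 0 < IM w → DifferentiableAt ℂ Q w := by
    intro w hw hi
    refine (hq w hw hi).congr_of_eventuallyEq ◇
    filter_upwards [(isOpen_lt continuous_const continuous_im).mem_nhds hi, hS.mem_nhds hw] with v hv hvS
    rw [hQu v (le_of_lt hv), hPq v hvS hv]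
  have hdn : ∀ w ∈ S, IM w ≠ 0 → DifferentiableAt ℂ Q w := by
    intro w hw hi
    rcases hi.lt_or_gt with h | h
    · have h2 := (hup _ (hsym w hw) (by simpa using h)).conj_conj
      rw [conj_conj] at h2
      refine (h2.inv (by simpa using hQne _ (hsym w hw))).congr_of_eventuallyEq ◇
      filter_upwards [hS.mem_nhds hw] with v hv
      simp [hrefl v hv]
    · exact hup w hw h
  have hQd : DifferentiableOn ℂ Q S := by
    intro w hw
    by_cases h : IM w = 0
    · obtain ⟨r, hr, hr2⟩ := Metric.isOpen_iff.1 hS w hw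
      have hw2 : w = RE w := by apply cext <;> simp [h]
      rw [hw2] at hr2
      refine (((moreraLine (hQc.mono hr2) (fun z hz hz2 ↦ hdn z (hr2 hz) hz2)).differentiableAt (isOpen_ball.mem_nhds ◇))).differentiableWithinAt
      rw [← hw2]
      exact mem_ball_self hr
    · exact (hdn w hw h).differentiableWithinAt
  refine ⟨Q, hQd, fun w hw hi ↦ by rw [hQu w hi.le, hPq w hw hi], hQne, hrefl, fun x hx ↦ ◇⟩
  have hn1 : ‖Q x‖ = 1 := by
    rw [hQu _ bs]
    exact hPr _ hx bs
  have hns : normSq (Q x) = 1 := by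
    rw [normSq_eq_norm_sq, hn1]
    norm_num
  have hline : ∀ v : ℂ, HasDerivAt (fun y : ℝ ↦ normSq (Q (x + y * v))) (2 * (cj (Q x) * (deriv Q x * v)).re) 0 := by
    intro v
    have a1 : HasDerivAt (fun y : ℝ ↦ x + y * v) v 0 := by
      have := ((ofRealCLM.hasDerivAt (x := 0)).mul_const v).const_add tC x
      simpa using this
    have a2 : HasDerivAt (fun y : ℝ ↦ Q (x + y * v)) (deriv Q x * v) 0 := by
      have h0 : HasDerivAt Q (deriv Q x) (x + tC 0 * v) := by simpa using ((hQd.differentiableAt (hS.mem_nhds hx)).hasDerivAt)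
      exact h0.comp_of_eq 0 a1 rfl
    simp only [normSq_eq_norm_sq]
    convert! (a2.norm_sq) using 2
    simp
    ring
  have hd1 : (cj (Q x) * deriv Q x).re = 0 := by
    have h6 : (fun y : ℝ ↦ normSq (Q (x + y * 1))) =ᶠ[𝓝 0] fun _ ↦ 1 := by
      have : ContinuousAt (fun y : ℝ ↦ tC x + y * 1) 0 := bf
      have := this.preimage_mem_nhds (hS.mem_nhds (by simpa using hx))
      filter_upwards [this] with y hy
      have hi : (tC x + y * 1).im = 0 := bs
      rw [hQu _ hi.ge, normSq_eq_norm_sq, hPr _ hy hi]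
      norm_num
    have h7 := (hline 1).unique ((hasDerivAt_const 0 1).congr_of_eventuallyEq h6)
    simp only [mul_one] at h7
    linarith
  set d := cj (Q x) * deriv Q x with hd
  have hdd : deriv Q x / Q x = d := by
    rw [hd, div_eq_mul_inv, Complex.inv_def, hns]
    simp
    ring
  refine ⟨IM d, ◇, ◇⟩
  swap
  · rw [hdd]
    apply cext <;> simp [hd1]
  obtain ⟨r, hr, hr2⟩ := Metric.isOpen_iff.1 hS x hx
  obtain ⟨N, hN, hN2⟩ := hopf (ρ := r/4) bp
    ((closedBall_subset_ball bl).trans hr2) hq (fun w hw hi ↦ (h1 w hw hi).2)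
  have h5 := (hline I).pow N
  have h8 : (2 * (cj (Q x) * (deriv Q x * I)).re) = -2 * IM d := by
    rw [← mul_assoc, ← hd]
    simp
  rw [h8, hasDerivAt_iff_tendsto_slope] at h5
  simp [hns] at h5
  have h9 : ∀ᶠ y in 𝓝[>] 0, slope (fun y : ℝ ↦ normSq (Q (x + y * I)) ^ N) 0 y ≤ -(1/(r/4)) := by
    filter_upwards [(Ioo_mem_nhdsGT bp : Ioo 0 (r/4/2) ∈ 𝓝[>] 0)] with y hy
    rw [slope_def_field, sub_zero, div_le_iff₀ hy.1]
    have h10 := hN2 y hy.1 hy.2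
    have h11 : Q (x + y * I) = q (x + y * I) := by
      rw [hQu _ (by simpa using hy.1.le), hPq _ (hr2 (by simp [abs_of_pos hy.1]; linarith [hy.2])) (by simpa using hy.1)]
    have h13 : 0 ≤ ‖q (x + y * I)‖^N := bp
    have h14 : 0 < 1/(r/4)*y := by
      have := hy.1
      positivity
    simp only [h11, ofReal_zero, zero_mul, add_zero, hns, one_pow, normSq_eq_norm_sq]
    rw [← pow_mul, mul_comm 2 N, pow_mul]
    rw [(by ring : y / (r/4) = 1/(r/4) * y)] at h10
    nlinarith
  have h15 := le_of_tendsto (h5.mono_left (nhdsWithin_mono 0 (s := Ioi 0)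
    (fun y hy ↦ (ne_of_gt hy : y ≠ 0)))) h9
  have : 0 < 1/(r/4) := bp
  by_contra hneg
  push Not at hneg
  nlinarith
theorem invCont {E : Type*} [TopologicalSpace E] [T2Space E] {f : ℝ → E} {g : E → ℝ} {K : Set ℝ} (hK : IsCompact K) (hf : ContinuousOn f K)
    (hg : ∀ x ∈ K, g (f x) = x) : ContinuousOn g (f '' K) := by
  rw [continuousOn_iff_isClosed]
  intro t ht
  refine ⟨f '' _, ((hK.inter_right ht).image_of_continuousOn (hf.mono inter_subset_left)).isClosed, ◇⟩
  ext z
  constructor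
  · rintro ⟨h1, x, hx, rfl⟩
    exact ⟨⟨x, ⟨hx, by rw [← hg x hx]; exact h1⟩, rfl⟩, x, hx, rfl⟩
  · rintro ⟨⟨x, ⟨hx, hxt⟩, rfl⟩, h2⟩
    exact ⟨show g _ ∈ t by rw [hg x hx]; exact hxt, h2⟩
theorem arc_integral {γ : ℝ → ℂ} {ℓ : ℝ → ℝ} {T : CC} {U : Set ℂ} (hU : IsOpen U)
    (hUs : ∀ x ∈ I01, tC x ∈ U) (hT : DifferentiableOn ℂ T U)
    (hγ : Continuous γ) (hl : ContinuousOn ℓ (Icc 0 1)) (hm : StrictMonoOn ℓ (Icc 0 1))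
    (hTl : ∀ x ∈ I01, γ (ℓ x) = T x)
    (hsp : ∀ s t, ℓ 0 ≤ s → s ≤ t → t ≤ ℓ 1 → eVariationOn γ (Icc s t) = ENNReal.ofReal (t - s))
    {u : CC} (hu : Continuous u) :
    ∫ s in (ℓ 0)..(ℓ 1), u (γ s) = ∫ x in 0..1, (‖deriv T x‖ : ℂ) * u (T x) := by
  have hTd : ∀ x ∈ I01, HasDerivAt (fun y : ℝ ↦ T y) _ x := fun x hx ↦
    (hT.differentiableAt (hU.mem_nhds (hUs x hx))).hasDerivAt.comp_ofReal
  have hdc :=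
    ((hT.deriv hU).continuousOn.comp continuous_ofReal.continuousOn hUs).norm
  have hu01 : uIcc tR 0 1 = Icc 0 1 := uIcc_of_le zero_le_one
  have hvar : ∀ x ∈ I01, ∀ y ∈ I01, x ≤ y →
      eVariationOn (fun y : ℝ ↦ T y) (Icc x y) = ENNReal.ofReal (ℓ y - ℓ x) := by
    intro x hx y hy hxy
    have hsub := Icc_subset_Icc hx.1 hy.2
    have e1 : EqOn (fun y : ℝ ↦ T y) (γ ∘ ℓ) _ := fun z hz ↦ (hTl z (hsub hz)).symm
    rw [eVariationOn.congr e1, eVariationOn.comp_eq_of_monotoneOn _ _ (hm.monotoneOn.mono hsub)]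
    have : ℓ '' Icc x y = Icc (ℓ x) (ℓ y) := by
      refine Subset.antisymm ◇ (intermediate_value_Icc hxy (hl.mono hsub))
      rintro _ ⟨z, hz, rfl⟩
      exact ⟨hm.monotoneOn hx (hsub hz) hz.1, hm.monotoneOn (hsub hz) hy hz.2⟩
    rw [this]
    exact hsp _ _ (hm.monotoneOn bs hx hx.1) (hm.monotoneOn hx hy hxy) (hm.monotoneOn hy bs hy.2)
  have hderiv : ∀ x ∈ Ioo (min tR 0 1) (max 0 1), HasDerivWithinAt ℓ (‖deriv T x‖) (Ioi x) x := by
    intro x hx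
    simp only [zero_le_one, min_eq_left, max_eq_right] at hx
    have hx' := Ioo_subset_Icc_self hx
    rw [hasDerivWithinAt_iff_tendsto_slope' bs]
    have hlow :=
      ((hasDerivAt_iff_tendsto_slope.1 (hTd x hx')).mono_left (nhdsWithin_mono _ (fun y hy ↦ ne_of_gt hy))).norm
    have hI := Ioo_mem_nhdsGT hx.2
    rw [tendsto_order]
    constructor
    · intro a ha
      filter_upwards [hlow.eventually_const_lt ha, hI] with y hy hyI
      refine hy.trans_le ◇
      have hyI' : y ∈ I01 := ⟨hx.1.le.trans hyI.1.le, hyI.2.le⟩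
      have hlxy := hm.monotoneOn hx' hyI' hyI.1.le
      have h3 := eVariationOn.edist_le (fun y : ℝ ↦ T y) (right_mem_Icc.2 hyI.1.le) (left_mem_Icc.2 hyI.1.le)
      rw [hvar x hx' y hyI' hyI.1.le, edist_dist, ENNReal.ofReal_le_ofReal_iff bl, dist_eq_norm] at h3
      have hp : 0 < y - x := by linarith [hyI.1]
      rw [slope_def_module, slope_def_field, norm_smul, norm_inv, norm_of_nonneg hp.le, div_eq_inv_mul]
      gcongr
    · intro a ha
      obtain ⟨b, hb1, hb2⟩ := exists_between ha
      obtain ⟨δ, hδ, hδ2⟩ := Metric.mem_nhds_iff.1 ((hdc.continuousAt (Icc_mem_nhds hx.1 hx.2)).eventually_lt_const hb1)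
      filter_upwards [hI, (Ioo_mem_nhdsGT bl : Ioo x (x+δ) ∈ 𝓝[>] x)] with y hyI hy2
      refine lt_of_le_of_lt ◇ hb2
      have hp : 0 < y - x := by linarith [hyI.1]
      have hb0 := (norm_nonneg _).trans hb1.le
      have hLip : LipschitzOnWith ⟨b, hb0⟩ (fun y : ℝ ↦ T y) (Icc x y) := by
        refine (convex_Icc x y).lipschitzOnWith_of_nnnorm_hasDerivWithin_le (f' := fun z : ℝ ↦ deriv T z)
          (fun z hz ↦ (hTd z ⟨hx.1.le.trans hz.1, hz.2.trans hyI.2.le⟩).hasDerivWithinAt) ◇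
        intro z hz
        have : ‖deriv T z‖ < b := hδ2 (by
          rw [mem_ball, Real.dist_eq, abs_of_nonneg (by linarith [hz.1])]; linarith [hz.2, hy2.2])
        exact this.le
      have h4 := hLip.comp_eVariationOn_le (mapsTo_id _)
      rw [Function.comp_id, hvar x hx' y (⟨hx.1.le.trans hyI.1.le, hyI.2.le⟩) hyI.1.le] at h4
      have h5 : eVariationOn (id : ℝ → ℝ) (Icc x y) ≤ ENNReal.ofReal (y - x) := by
        have := (monotone_id.monotoneOn _).eVariationOn_le (left_mem_Icc.2 hyI.1.le) (right_mem_Icc.2 hyI.1.le)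
        simpa using this
      have h6 : ENNReal.ofReal (ℓ y - ℓ x) ≤ ENNReal.ofReal (b * (y - x)) := by
        rw [ENNReal.ofReal_mul hb0]
        refine h4.trans (mul_le_mul' ◇ h5)
        rw [ENNReal.ofReal_eq_coe_nnreal hb0]
        exact le_rfl
      rw [ENNReal.ofReal_le_ofReal_iff bp] at h6
      rwa [slope_def_field, div_le_iff₀ hp]
  have := intervalIntegral.integral_deriv_smul_comp'' (f' := fun x ↦ ‖deriv T x‖)
    (g := fun s ↦ u (γ s)) (by rwa [hu01]) hderiv (by rwa [hu01]) bf
  rw [← this]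
  refine integral_congr fun x hx ↦ ◇
  rw [hu01] at hx
  simp [hTl x hx]
theorem perInj {γ : ℝ → ℂ} {l : ℝ} (hl : 0 < l) (hper : Periodic γ l)
    (hinj : InjOn γ (Ico 0 l)) (c : ℝ) : InjOn γ (Ico c (c + l)) := by
  intro x hx y hy hxy
  have hx' := toIcoMod_mem_Ico hl 0 x
  have hy' := toIcoMod_mem_Ico hl 0 y
  rw [zero_add] at hx' hy'
  have h2 := hinj hx' hy' (by
    rw [toIcoMod, toIcoMod, hper.sub_zsmul_eq, hper.sub_zsmul_eq, hxy])
  have e1 := toIcoMod_add_toIcoDiv_zsmul hl 0 x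
  have e2 := toIcoMod_add_toIcoDiv_zsmul hl 0 y
  rw [h2] at e1
  simp only [zsmul_eq_mul] at e1 e2
  have hk : (toIcoDiv hl 0 x - toIcoDiv hl 0 y : ℤ) = 0 := by
    have h5 : ((toIcoDiv hl 0 x - toIcoDiv hl 0 y : ℤ) : ℝ) * l = x - y := by
      push_cast
      linarith
    have h6 : |((toIcoDiv hl 0 x - toIcoDiv hl 0 y : ℤ) : ℝ)| < 1 := by
      have : |((toIcoDiv hl 0 x - toIcoDiv hl 0 y : ℤ) : ℝ) * l| < l := by
        rw [h5, abs_lt]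
        constructor <;> linarith [hx.1, hx.2, hy.1, hy.2]
      rw [abs_mul, abs_of_pos hl] at this
      by_contra hc
      push Not at hc
      nlinarith
    exact Int.abs_lt_one_iff.1 (by exact_mod_cast h6)
  rw [sub_eq_zero.1 hk] at e1
  linarith
theorem gap_arc {γ : ℝ → ℂ} {l : ℝ} (hl : 0 < l) (hγ : Continuous γ) (hper : Periodic γ l)
    (hinj : InjOn γ (Ico 0 l)) {m : ℕ} {τ : Fin m → ℝ → ℂ} (hτ : ∀ j, ContinuousOn (τ j) (Icc 0 1))
    (hτi : ∀ j, InjOn (τ j) (Icc 0 1)) (hcov : (⋃ j, τ j '' Icc 0 1) = range γ)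
    {a b : ℝ} (hab : a < b) (h0 : ∀ s ∈ Ioo a b, ∀ j, γ s ≠ τ j 0 ∧ γ s ≠ τ j 1) :
    ∃ j, ∀ s ∈ Icc a b, γ s ∈ τ j '' Icc 0 1 := by
  have hcl : ∀ j, IsClosed _ := fun j ↦
    (isCompact_Icc.image_of_continuousOn (hτ j)).isClosed
  have hinj2 := perInj hl hper hinj
  have hopen : ∀ j, IsOpen {s | s ∈ Ioo a b ∧ γ s ∈ τ j '' Icc 0 1} := by
    intro j
    rw [isOpen_iff_mem_nhds]
    rintro s ⟨hs, x, hx, hxs⟩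
    have hx0 : x ∈ Ioo 0 1 := by
      refine ⟨lt_of_le_of_ne hx.1 ◇, lt_of_le_of_ne hx.2 ◇⟩
      · rintro rfl
        exact (h0 s hs j).1 hxs.symm
      · rintro rfl
        exact (h0 s hs j).2 hxs.symm
    set K := Icc (s - l/3) (s + l/3)
    have hKi := (hinj2 _).mono
      (show K ⊆ Ico _ _ from fun t ht ↦ ⟨ht.1, by linarith [ht.2]⟩)
    set g := invFunOn γ K
    have hgK : ∀ t ∈ K, g _ = t := fun t ht ↦ hKi.leftInvOn_invFunOn ht
    have hgc := invCont isCompact_Icc hγ.continuousOn hgK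
    have hcomp : γ s ∉ γ '' Icc (s + l/3) (s + 2*l/3) := by
      rintro ⟨t, ht, hts⟩
      have := hinj2 s (show t ∈ Ico s _ from ⟨by linarith [ht.1], by linarith [ht.2]⟩) (show s ∈ Ico s _ from ⟨le_refl s, bl⟩) hts
      linarith [ht.1]
    have hall : ∀ z ∈ range γ, z ∉ γ '' Icc (s + l/3) (s + 2*l/3) → z ∈ γ '' K := by
      rintro _ ⟨t, rfl⟩ hz
      have ht := toIcoMod_mem_Ico hl (s - l/3) t
      rw [← (by rw [toIcoMod, hper.sub_zsmul_eq] : γ (toIcoMod hl (s - l/3) t) = γ t)] at hz ⊢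
      refine ⟨_, ⟨ht.1, ◇⟩, rfl⟩
      by_contra hc
      push Not at hc
      exact hz ⟨_, ⟨hc.le, by linarith [ht.2]⟩, rfl⟩
    have hev : ∀ᶠ y in 𝓝 x, τ j y ∉ γ '' Icc (s + l/3) (s + 2*l/3) := by
      exact ((hτ j).continuousAt (Icc_mem_nhds hx0.1 hx0.2)).eventually_mem ((isCompact_Icc.image hγ).isClosed.isOpen_compl.mem_nhds (by
        rw [hxs]; exact hcomp))
    obtain ⟨δ, hδ, hδ2⟩ := Metric.eventually_nhds_iff_ball.1
      (hev.and (Ioo_mem_nhds hx0.1 hx0.2 : ∀ᶠ y in 𝓝 x, y ∈ Ioo 0 1))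
    have hJ : ∀ y ∈ Icc (x - δ/2) (x + δ/2), y ∈ I01 ∧ τ j y ∈ γ '' K := by
      intro y hy
      have hyb : y ∈ ball x δ := by
        rw [mem_ball, Real.dist_eq, abs_lt]
        constructor <;> linarith [hy.1, hy.2]
      have h3 := hδ2 y hyb
      refine ⟨Ioo_subset_Icc_self h3.2, hall _ ◇ h3.1⟩
      rw [← hcov]
      exact mem_iUnion.2 ⟨j, y, Ioo_subset_Icc_self h3.2, rfl⟩
    have hFc :=
      hgc.comp ((hτ j).mono fun y hy ↦ (hJ y hy).1) fun y hy ↦ (hJ y hy).2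
    have hγg : ∀ z ∈ γ '' K, γ (g z) = z := fun z hz ↦ invFunOn_eq hz
    have hFi : InjOn (fun y ↦ g (τ j y)) (Icc (x - δ/2) (x + δ/2)) := by
      intro y hy z hz hyz
      have : γ (g (τ j y)) = γ (g (τ j z)) := by rw [show g _ = g _ from hyz]
      rw [hγg _ (hJ y hy).2, hγg _ (hJ z hz).2] at this
      exact hτi j (hJ y hy).1 (hJ z hz).1 this
    have hFx : g (τ j x) = s := by rw [hxs, hgK s (⟨ bl, bl⟩)]
    have hl1 : x - δ/2 ∈ Icc (x - δ/2) (x + δ/2) := ⟨le_refl _, bl⟩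
    have hl2 : x + δ/2 ∈ Icc (x - δ/2) _ := ⟨ bl, le_refl _⟩
    have hl3 : x ∈ Icc (x - δ/2) (x + δ/2) := ⟨ bl, bl⟩
    have hnb : (fun y ↦ g (τ j y)) '' Icc (x - δ/2) (x + δ/2) ∈ 𝓝 s := by
      rcases hFc.strictMonoOn_of_injOn_Icc' bl hFi with hmo | hmo
      · refine mem_of_superset (Icc_mem_nhds ◇ ◇) (intermediate_value_Icc bl hFc)
        · simpa [hFx] using (hmo hl1 hl3 bl)
        · simpa [hFx] using (hmo hl3 hl2 bl)
      · refine mem_of_superset (Icc_mem_nhds ◇ ◇) (intermediate_value_Icc' bl hFc)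
        · simpa [hFx] using (hmo hl3 hl2 bl)
        · simpa [hFx] using (hmo hl1 hl3 bl)
    filter_upwards [hnb, Ioo_mem_nhds hs.1 hs.2] with t ht htI
    obtain ⟨y, hy, rfl⟩ := ht
    exact ⟨htI, y, (hJ y hy).1, by simp only [hγg _ (hJ y hy).2]⟩
  obtain ⟨j, hj⟩ : ∃ j, γ _ ∈ τ j '' Icc 0 1 := by
    have : γ ((a+b)/2) ∈ ⋃ j, τ j '' Icc 0 1 := by
      rw [hcov]
      exact ⟨_, rfl⟩
    exact mem_iUnion.1 this
  refine ⟨j, ◇⟩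
  have hIoo : Ioo a b ⊆ γ ⁻¹' (τ j '' Icc 0 1) := by
    by_contra hne
    obtain ⟨t, ht, htn⟩ := not_subset.1 hne
    have := ((isPreconnected_Ioo (a := a) (b := b))) _ _ᶜ (hopen j) ((hcl j).preimage hγ).isOpen_compl
      (fun s hs ↦ by
        by_cases h : γ s ∈ τ j '' Icc 0 1
        · exact Or.inl ⟨hs, h⟩
        · exact Or.inr h)
      ⟨(a+b)/2, ⟨ bl, bl⟩, ⟨ bl, bl⟩, hj⟩ ⟨t, ht, htn⟩
    obtain ⟨s, _, hs1, hs2⟩ := this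
    exact hs2 hs1.2
  intro s hs
  have := closure_minimal hIoo ((hcl j).preimage hγ)
  rw [closure_Ioo hab.ne] at this
  exact this hs
theorem range_γ (D : JordanDomain) : range D.γ = frontier D.G := by
  rw [← D.γ_boundary]
  refine Subset.antisymm ◇ (image_subset_range _ _)
  rintro _ ⟨s, rfl⟩
  obtain ⟨t, ht, h⟩ := D.γ_periodic.exists_mem_Ico₀ D.l_pos s
  exact ⟨t, ht, h.symm⟩
theorem gap_param (D : JordanDomain) (B : PiecewiseAnalyticBoundary D) {a b : ℝ} (hab : a < b)
    (hbl : b ≤ a + D.l) (h0 : ∀ s ∈ Ioo a b, ∀ j, D.γ s ≠ B.τ j 0 ∧ D.γ s ≠ B.τ j 1) :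
    b < a + D.l ∧ ∃ (T : CC) (U : Set ℂ) (ℓ : ℝ → ℝ), IsOpen U ∧ (∀ x ∈ I01, tC x ∈ U) ∧
      DifferentiableOn ℂ T U ∧ InjOn T U ∧ ContinuousOn ℓ (Icc 0 1) ∧ StrictMonoOn ℓ (Icc 0 1) ∧
      ℓ 0 = a ∧ ℓ 1 = b ∧ ∀ x ∈ I01, D.γ (ℓ x) = T x := by
  have hseg : ∀ j, ∀ x ∈ I01, tC x ∈ B.U j := fun j x hx ↦ B.seg_sub j ⟨x, hx, rfl⟩
  have hτc : ∀ j, ContinuousOn (fun x : ℝ ↦ B.τ j x) _ := fun j ↦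
    (B.analytic j).continuousOn.comp continuous_ofReal.continuousOn (hseg j)
  have hτi : ∀ j, InjOn (fun x : ℝ ↦ B.τ j x) _ := fun j x hx y hy h ↦
    ofReal_injective (B.inj j (hseg j x hx) (hseg j y hy) h)
  obtain ⟨j, hj⟩ := gap_arc D.l_pos D.γ_cont D.γ_periodic D.γ_injOn hτc hτi (by
    rw [(range_γ D), ← B.cover]; simp only [image_image]) hab (by simpa using h0)
  have hinj := perInj D.l_pos D.γ_periodic D.γ_injOn a
  set g := invFunOn (fun x : ℝ ↦ B.τ j x) _
  have hgc := invCont isCompact_Icc (hτc j) (fun x hx ↦ (hτi j).leftInvOn_invFunOn hx)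
  set X : ℝ → ℝ := fun s ↦ g _
  have hXc : ContinuousOn X _ := hgc.comp D.γ_cont.continuousOn hj
  have hXm : ∀ s ∈ Icc a b, X s ∈ I01 := fun s hs ↦ invFunOn_mem (hj s hs)
  have hXτ : ∀ s ∈ Icc a b, B.τ j (X s) = D.γ s := fun s hs ↦ invFunOn_eq (hj s hs)
  have hXinj : ∀ s ∈ Icc a b, ∀ t ∈ Icc a b, X s = X t → s < a + D.l → t < a + D.l → s = t := by
    intro s hs t ht h h1 h2
    exact hinj ⟨hs.1, h1⟩ ⟨ht.1, h2⟩ (by rw [← hXτ s hs, ← hXτ t ht, h])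
  have hbl' : b < a + D.l := by
    refine lt_of_le_of_ne hbl fun hb ↦ ◇
    have hXab : X a = X b := by
      show g _ = g _
      rw [hb, D.γ_periodic]
    set c := (a+b)/2 with hc
    have hac : a < c := bl
    have hcb : c < b := bl
    have haI : a ∈ Icc a b := ⟨le_refl _, hab.le⟩
    have hne : X a ≠ X c := fun h ↦ hac.ne (hXinj a haI c (⟨hac.le, hcb.le⟩) h bl bl)
    have hmem : ∀ p q : ℝ, (p + q)/2 ∈ uIcc p q := by
      intro p q
      rcases le_total p q with h | h
      · rw [uIcc_of_le h]
        constructor <;> linarith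
      · rw [uIcc_of_ge h]
        constructor <;> linarith
    obtain ⟨s, hs, hsv⟩ := intermediate_value_uIcc
      (hXc.mono (by rw [uIcc_of_le hac.le]; exact Icc_subset_Icc_right hcb.le)) (hmem _ _)
    obtain ⟨t, ht, htv⟩ := intermediate_value_uIcc
      (hXc.mono (by rw [uIcc_of_ge hcb.le]; exact Icc_subset_Icc_left hac.le)) (hmem _ _)
    rw [uIcc_of_le hac.le] at hs
    rw [uIcc_of_ge hcb.le] at ht
    have htb : t ≠ b := by
      rintro rfl
      apply hne
      linarith
    have hts := hXinj s ⟨hs.1, by linarith [hs.2]⟩ t ⟨by linarith [ht.1], ht.2⟩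
      (by rw [hsv, htv, hXab]) (by linarith [hs.2]) (by rw [← hb]; exact lt_of_le_of_ne ht.2 htb)
    rw [(le_antisymm (hts ▸ hs.2) ht.1)] at htv
    apply hne
    linarith
  refine ⟨hbl', ◇⟩
  have hXi : InjOn X _ := fun s hs t ht h ↦
    hXinj s hs t ht h (by linarith [hs.2]) (by linarith [ht.2])
  have haI : a ∈ Icc a b := ⟨le_refl _, hab.le⟩
  have hbI : b ∈ Icc a b := ⟨hab.le, le_refl _⟩
  have hd : X b - X a ≠ 0 := fun h ↦ hab.ne (hXi haI hbI bl)
  set Y : ℝ → ℝ := fun s ↦ (X s - X a) / (X b - X a) with hY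
  have hYc : ContinuousOn Y _ := (hXc.sub continuousOn_const).div_const _
  have hYm : StrictMonoOn Y (Icc a b) := by
    rcases hXc.strictMonoOn_of_injOn_Icc' hab.le hXi with h | h
    · intro s hs t ht hst
      have h1 := h haI hbI hab
      have h2 := h hs ht hst
      simp only [hY]
      gcongr
    · intro s hs t ht hst
      have h1 := h haI hbI hab
      have h2 := h hs ht hst
      simp only [hY]
      rw [← neg_div_neg_eq, ← neg_div_neg_eq (X t - X a)]
      have : 0 < -(X b - X a) := bl
      gcongr
  have hYa : Y a = 0 := by simp [hY]
  have hYb : Y b = 1 := by simp [hY, hd]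
  have hYim : Y '' Icc a b = Icc 0 1 := by
    refine Subset.antisymm ◇ (by rw [← hYa, ← hYb]; exact intermediate_value_Icc hab.le hYc)
    rintro _ ⟨s, hs, rfl⟩
    rw [← hYa, ← hYb]
    exact ⟨hYm.monotoneOn haI hs hs.1, hYm.monotoneOn hs hbI hs.2⟩
  set ℓ := invFunOn Y _
  have hℓY : ∀ s ∈ Icc a b, ℓ _ = s := fun s hs ↦ hYm.injOn.leftInvOn_invFunOn hs
  have hYℓ : ∀ x ∈ I01, Y _ = x := fun x hx ↦ invFunOn_eq (by rwa [← hYim] at hx)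
  have hℓm : ∀ x ∈ I01, ℓ x ∈ Icc a b := fun x hx ↦ invFunOn_mem (by rwa [← hYim] at hx)
  refine ⟨fun w ↦ B.τ j (X a + (X b - X a) * w), (fun w ↦ (X a + (X b - X a) * w : ℂ)) ⁻¹' B.U j, ℓ,
    (B.U_open j).preimage bf, ◇, ◇, ◇, ◇, ◇, ◇, ◇, ◇⟩
  · intro x hx
    have h2 := hYℓ x hx
    rw [div_eq_iff hd] at h2
    show (X a + (X b - X a) * x : ℂ) ∈ B.U j
    convert (hseg j _ (hXm _ (hℓm x hx))) using 1
    rw [(bl : X (ℓ x) = X a + (X b - X a) * x)]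
    push_cast
    ring
  · exact (B.analytic j).comp bf (fun w hw ↦ hw)
  · intro w hw w' hw' h
    have := B.inj j hw hw' h
    exact mul_left_cancel₀ (by exact_mod_cast hd) (add_left_cancel this)
  · have := invCont isCompact_Icc hYc hℓY
    rwa [hYim] at this
  · intro x hx y hy hxy
    by_contra hc
    push Not at hc
    have := hYm.monotoneOn (hℓm y hy) (hℓm x hx) hc
    rw [hYℓ x hx, hYℓ y hy] at this
    linarith
  · rw [← hYa]
    exact hℓY a haI
  · rw [← hYb]
    exact hℓY b hbI
  · intro x hx
    have h2 := hYℓ x hx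
    rw [div_eq_iff hd] at h2
    rw [← hXτ _ (hℓm x hx)]
    rw [(bl : X (ℓ x) = X a + (X b - X a) * x)]
    push_cast
    ring_nf
structure Pre (D : JordanDomain) (lam : ℝ) (N : ℕ) where
  T : Fin N → CC
  U : Fin N → Set ℂ
  hU : ∀ i, IsOpen (U i)
  seg : ∀ i, ∀ x ∈ I01, tC x ∈ U i
  diff : ∀ i, DifferentiableOn ℂ (T i) (U i)
  inj : ∀ i, InjOn (T i) (U i)
  σ : Equiv.Perm (Fin N)
  next : ∀ i, T i 1 = T (σ i) 0
  sep : ∀ i j, ∀ x ∈ I01, ∀ y ∈ I01, T i x = T j y →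
    (i = j ∧ x = y) ∨ (x = 1 ∧ y = 0 ∧ j = σ i) ∨ (x = 0 ∧ y = 1 ∧ i = σ j)
  cover : ∀ z, z ∈ frontier D.G ↔ ∃ i, ∃ x ∈ I01, T i tC x = z
  integral : ∀ u : CC, Continuous u → ∫ s in 0..D.l, u (D.γ s) =
    ∑ i, ∫ x in 0..1, (‖deriv (T i) x‖ : ℂ) * u (T i x)
  trans : ∀ P : Fin N → Prop, (∀ i, P i → P (σ i)) → ∀ i j, P i → P j
  la : Fin N → ℝ
  hla : ∀ i, la i ∈ Ioo tR 0 2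
  hlam : ∀ i, lam ≤ la i
  angle : ∀ i, HasCornerAngle D.G (T i 0) ((2 - la i) * π)
theorem exists_pre (D : JordanDomain) (B : PiecewiseAnalyticBoundary D) {lam : ℝ}
    (hmin : ∀ i, lam ≤ B.extAngle i) : ∃ N, Nonempty (Pre D lam (N + 1)) := by
  set Z : Set ℂ := {z | ∃ j, z = B.τ j 0 ∨ z = B.τ j 1}
  have hZf : Z.Finite := by
    have : Z = range (fun j ↦ B.τ j 0) ∪ range (fun j ↦ B.τ j 1) := by
      ext z
      constructor
      · rintro ⟨j, h | h⟩
        · exact Or.inl ⟨j, h.symm⟩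
        · exact Or.inr ⟨j, h.symm⟩
      · rintro (⟨j, h⟩ | ⟨j, h⟩)
        · exact ⟨j, Or.inl h.symm⟩
        · exact ⟨j, Or.inr h.symm⟩
    rw [this]
    exact (finite_range _).union (finite_range _)
  have hZa : ∀ z ∈ Z, ∃ j, z = B.τ j 1 := by
    rintro z ⟨j, h | h⟩
    · rcases Nat.eq_zero_or_pos j.1 with h0 | h0
      · refine ⟨⟨B.m - 1, Nat.sub_lt B.m_pos one_pos⟩, ◇⟩
        rw [h, B.junction]
        congr 2
        apply Fin.ext
        have := B.m_pos
        simp [h0, show B.m - 1 + 1 = B.m by omega]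
      · refine ⟨⟨j.1 - 1, by omega⟩, ◇⟩
        rw [h, B.junction]
        congr 2
        apply Fin.ext
        simp [Nat.sub_add_cancel h0, Nat.mod_eq_of_lt j.2]
    · exact ⟨j, h⟩
  have hSf : (Ico 0 D.l ∩ D.γ ⁻¹' Z).Finite := by
    refine Set.Finite.of_finite_image (hZf.subset ◇) (D.γ_injOn.mono inter_subset_left)
    rintro _ ⟨s, hs, rfl⟩
    exact hs.2
  set S := hSf.toFinset with hS
  have hmemS : ∀ s, s ∈ S ↔ s ∈ Ico 0 D.l ∧ D.γ s ∈ Z := by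
    intro s
    simp [hS]
  have hne : 0 < S.card := by
    rw [Finset.card_pos]
    have h1 : B.τ ⟨0, B.m_pos⟩ 1 ∈ D.γ '' Ico 0 D.l := by
      rw [D.γ_boundary, ← B.cover]
      exact mem_iUnion.2 ⟨_, 1, ⟨1, bs⟩, rfl⟩
    obtain ⟨s, hs, h⟩ := h1
    exact ⟨s, (hmemS s).2 ⟨hs, ⟨_, Or.inr h⟩⟩⟩
  obtain ⟨N, hN⟩ : ∃ N, S.card = N + 1 := ⟨S.card - 1, by omega⟩
  refine ⟨N, ◇⟩
  set e := S.orderEmbOfFin hN with he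
  have hem : ∀ i, e i ∈ Ico 0 D.l ∧ D.γ (e i) ∈ Z := fun i ↦ (hmemS _).1 ((fun i ↦ S.orderEmbOfFin_mem hN i) i)
  have hlp := D.l_pos
  set a : ℕ → ℝ := fun k ↦ if h : k < N + 1 then e ⟨k, h⟩ else e 0 + D.l + (k - (N + 1) : ℝ) with ha
  have ha1 : ∀ k (h : k < N + 1), a k = e ⟨k, h⟩ := fun k h ↦ dif_pos h
  have haN : a (N + 1) = a 0 + D.l := by simp [ha]
  have hmono : StrictMono a := by
    refine strictMono_nat_of_lt_succ fun k ↦ ◇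
    by_cases h : k + 1 < N + 1
    · rw [ha1 k (by omega), ha1 _ h]
      exact e.strictMono bs
    · by_cases h2 : k < N + 1
      · rw [(by omega : k + 1 = N + 1), haN, ha1 k h2, ha1 0 (by omega)]
        linarith [(hem ⟨k, h2⟩).1.2, (hem ⟨0, by omega⟩).1.1]
      · simp only [ha, dif_neg h, dif_neg h2]
        push_cast
        linarith
  have hgap : ∀ k, k < N + 1 → ∀ s ∈ Ioo (a k) (a (k+1)), D.γ s ∉ Z := by
    intro k hk s hs hsZ
    have h0s := lt_of_le_of_lt (hmono.monotone (Nat.zero_le k)) hs.1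
    have hsN : s < a 0 + D.l := by
      rw [← haN]
      exact lt_of_lt_of_le hs.2 (hmono.monotone (by omega))
    have ha0 := (hem ⟨0, by omega⟩).1
    rw [← ha1 0 (by omega)] at ha0
    have key : ∀ t ∈ S, ∃ i : Fin _, e i = t := by
      intro t ht
      have : t ∈ range e := by
        rwa [he, S.range_orderEmbOfFin hN]
      exact this
    by_cases hsl : s < D.l
    · obtain ⟨i, hi⟩ := key s ((hmemS s).2 ⟨⟨by linarith [ha0.1], hsl⟩, hsZ⟩)
      have hai : a i.1 = s := by
        rwa [ha1 _ i.2]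
      rw [← hai] at hs
      have h1 := hmono.lt_iff_lt.1 hs.1
      have h2 := hmono.lt_iff_lt.1 hs.2
      omega
    · push Not at hsl
      obtain ⟨i, hi⟩ := key (s - D.l) ((hmemS _).2 ⟨⟨ bl, by linarith [ha0.2]⟩, by rw [D.γ_periodic.sub_eq]; exact hsZ⟩)
      have hai : a i.1 = s - D.l := by
        rwa [ha1 _ i.2]
      have := hmono.monotone (Nat.zero_le i.1)
      linarith
  have hle : ∀ k, k < N + 1 → a (k+1) ≤ a k + D.l := by
    intro k hk
    have h1 : a (k+1) ≤ a (N+1) := hmono.monotone (by omega)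
    have h2 := hmono.monotone (Nat.zero_le k)
    rw [haN] at h1
    linarith
  have hpar := fun i : Fin _ ↦ (gap_param D B (hmono (Nat.lt_succ_self i.1)) (hle i.1 i.2) (fun s hs j ↦
    ⟨fun h ↦ hgap i.1 i.2 s hs ⟨j, Or.inl h⟩, fun h ↦ hgap i.1 i.2 s hs ⟨j, Or.inr h⟩⟩)).2
  choose T U ℓ hU seg diff inj hℓc hℓm hℓ0 hℓ1 hℓT using hpar
  have hℓI : ∀ i, ∀ x ∈ I01, ℓ i x ∈ Icc (a i.1) (a (i.1+1)) := by
    intro i x hx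
    rw [← hℓ0 i, ← Nat.succ_eq_add_one, ← hℓ1 i]
    exact ⟨(hℓm i).monotoneOn bs hx hx.1, (hℓm i).monotoneOn hx bs hx.2⟩
  have hT0 : ∀ i, T i 0 = D.γ (a i.1) := by
    intro i
    have := hℓT i 0 bs
    rw [hℓ0] at this
    simpa using this.symm
  have hT1 : ∀ i, T i 1 = D.γ (a (i.1+1)) := by
    intro i
    have := hℓT i 1 bs
    rw [hℓ1] at this
    simpa using this.symm
  have hσ : ∀ i : Fin _, i.1 + 1 < N + 1 → (finRotate (N+1) i).1 = i.1 + 1 := by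
    intro i hi
    rw [finRotate_succ_apply, Fin.val_add_one_of_lt]
    rw [Fin.lt_def]
    simp
    omega
  have hσN : ∀ i : Fin _, i.1 + 1 = N + 1 → (finRotate (N+1) i) = 0 := by
    intro i hi
    rw [(Fin.ext (by simp; omega) : i = Fin.last N), finRotate_last]
  have hsepA : ∀ i j : Fin _, ∀ x ∈ I01, ∀ y ∈ I01, ℓ i x = ℓ j y → i < j →
      x = 1 ∧ y = 0 ∧ j = finRotate _ i := by
    intro i j x hx y hy h hij
    have h1 := (hℓI i x hx).2
    have h2 := (hℓI j y hy).1
    have h3 := hmono.monotone hij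
    have h4 : ℓ i x = ℓ i 1 := by
      rw [hℓ1]
      exact le_antisymm h1 (by rw [h]; exact h3.trans h2)
    have h5 : ℓ j y = ℓ j 0 := by
      rw [hℓ0]
      exact le_antisymm (by rw [← h]; exact h1.trans h3) h2
    refine ⟨(hℓm i).injOn hx bs h4, (hℓm j).injOn hy bs h5, Fin.ext ◇⟩
    rw [hσ i (by omega), (hmono.injective (le_antisymm h3 (by rw [← hℓ0 j, ← h5, ← h]; exact h1)) : i.1 + 1 = j.1)]
  have hsepB : ∀ i j : Fin _, ∀ x ∈ I01, ∀ y ∈ I01, ℓ i x = a 0 → ℓ j y = a (N+1) →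
      x = 0 ∧ y = 1 ∧ i = finRotate _ j := by
    intro i j x hx y hy h h'
    have h2 := (hℓI j y hy).2
    have hi : i.1 = 0 := by
      have := hmono.le_iff_le.1 (h ▸ ((hℓI i x hx).1))
      omega
    have hj : j.1 + 1 = N + 1 := by
      have := hmono.le_iff_le.1 (h' ▸ h2)
      omega
    refine ⟨(hℓm i).injOn hx bs (by rw [hℓ0, h, hi]), (hℓm j).injOn hy bs (by rw [hℓ1, h']; exact congrArg a hj.symm), ◇⟩
    rw [hσN j hj]
    exact Fin.ext hi
  have hang : ∀ i : Fin _, ∃ j, T i 0 = B.τ j 1 := fun i ↦ hZa _ (by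
    rw [hT0, ha1 _ i.2]; exact (hem i).2)
  choose J hJ using hang
  refine ⟨{
    T := T, U := U, hU := hU, seg := seg, diff := diff, inj := inj, σ := finRotate _
    next := ◇, sep := ◇, cover := ◇, integral := ◇, trans := ◇, la := fun i ↦ B.extAngle (J i)
    hla := fun i ↦ B.extAngle_mem _, hlam := fun i ↦ hmin _, angle := fun i ↦ ◇ }⟩
  · intro i
    rw [hT0, hT1]
    by_cases h : i.1 + 1 < N + 1
    · rw [hσ i h]
    · have h' : i.1 + 1 = N + 1 := by omega
      rw [hσN i h', h', haN, D.γ_periodic]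
      rfl
  · intro i j x hx y hy h
    rw [← hℓT i x hx, ← hℓT j y hy] at h
    have hr : ∀ i : Fin _, ∀ x ∈ I01, a 0 ≤ ℓ i x ∧ ℓ i x ≤ a (N+1) := fun i x hx ↦
      ⟨(hmono.monotone (Nat.zero_le _)).trans (hℓI i x hx).1, (hℓI i x hx).2.trans (hmono.monotone (by omega))⟩
    have hinj := perInj D.l_pos D.γ_periodic D.γ_injOn (a 0)
    rcases (hr i x hx).2.lt_or_eq with h1 | h1
    · rcases (hr j y hy).2.lt_or_eq with h2 | h2
      · have h3 := hinj ⟨(hr i x hx).1, haN ▸ h1⟩ ⟨(hr j y hy).1, haN ▸ h2⟩ h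
        rcases lt_trichotomy i j with h4 | h4 | h4
        · exact Or.inr (Or.inl (hsepA i j x hx y hy h3 h4))
        · subst h4
          exact Or.inl ⟨rfl, (hℓm i).injOn hx hy h3⟩
        · obtain ⟨p, q, r⟩ := hsepA j i y hy x hx h3.symm h4
          exact Or.inr (Or.inr ⟨q, p, r⟩)
      · rw [h2, haN, D.γ_periodic] at h
        exact Or.inr (Or.inr (hsepB i j x hx y hy (hinj ⟨(hr i x hx).1, haN ▸ h1⟩ ⟨le_refl _, bl⟩ h) h2))
    · rcases (hr j y hy).2.lt_or_eq with h2 | h2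
      · rw [h1, haN, D.γ_periodic] at h
        obtain ⟨p, q, r⟩ := hsepB j i y hy x hx (hinj ⟨(hr j y hy).1, haN ▸ h2⟩ ⟨le_refl _, bl⟩ h.symm) h1
        exact Or.inr (Or.inl ⟨q, p, r⟩)
      · have h3 := h1.trans h2.symm
        rcases lt_trichotomy i j with h4 | h4 | h4
        · exact Or.inr (Or.inl (hsepA i j x hx y hy h3 h4))
        · subst h4
          exact Or.inl ⟨rfl, (hℓm i).injOn hx hy h3⟩
        · obtain ⟨p, q, r⟩ := hsepA j i y hy x hx h3.symm h4
          exact Or.inr (Or.inr ⟨q, p, r⟩)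
  · intro z
    rw [← range_γ]
    constructor
    · rintro ⟨s, rfl⟩
      obtain ⟨t, ht, hst⟩ := D.γ_periodic.exists_mem_Ico D.l_pos s _
      rw [hst]
      have hex : ∃ k, t < a (k+1) := ⟨N, by rw [haN]; exact ht.2⟩
      classical
      have hkN := Nat.find_min' hex (by rw [haN]; exact ht.2)
      have hak : a (Nat.find hex) ≤ t := by
        rcases Nat.eq_zero_or_pos (Nat.find hex) with h | h
        · rw [h]
          exact ht.1
        · have := Nat.find_min hex (m := Nat.find hex - 1) (by omega)
          rw [Nat.sub_add_cancel h] at this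
          exact not_lt.1 this
      set i : Fin (N+1) := ⟨Nat.find hex, by omega⟩ with hi
      have h5 := intermediate_value_Icc zero_le_one (hℓc i)
      rw [hℓ0, hℓ1] at h5
      obtain ⟨x, hx, hxt⟩ := h5 (show t ∈ Icc _ _ from ⟨hak, (Nat.find_spec hex).le⟩)
      exact ⟨i, x, hx, by rw [← hℓT i x hx, hxt]⟩
    · rintro ⟨i, x, hx, rfl⟩
      exact ⟨_, hℓT i x hx⟩
  · intro u hu
    have hper : Periodic (fun s ↦ u (D.γ s)) D.l := fun s ↦ by simp only [D.γ_periodic s]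
    have hcont : Continuous fun s ↦ u _ := hu.comp D.γ_cont
    have h1 := hper.intervalIntegral_add_eq 0 (a 0)
    rw [zero_add, ← haN, ← intervalIntegral.sum_integral_adjacent_intervals
      (fun k _ ↦ hcont.intervalIntegrable _ _), Finset.sum_range] at h1
    rw [h1]
    refine sum_congr rfl fun i _ ↦ ◇
    have h2 := arc_integral (hU i) (seg i) (diff i) D.γ_cont (hℓc i) (hℓm i) (hℓT i) (by
      intro s t _ hst ht1
      rename_i hs0
      refine D.γ_unitSpeed s t hst ◇
      rw [hℓ0] at hs0
      rw [hℓ1] at ht1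
      linarith [hle i.1 i.2]) hu
    rwa [hℓ0, hℓ1] at h2
  · intro P hP i j hi
    have hup : ∀ k (h : k < N + 1), P 0 → P ⟨k, h⟩ := by
      intro k
      induction k with
      | zero => intro h h0; exact h0
      | succ k ih =>
        intro h h0
        convert (hP _ (ih (by omega) h0)) using 1
        exact Fin.ext (by rw [hσ _ h])
    have hdown : ∀ d (i : Fin _), i.1 + d = N → P i → P 0 := by
      intro d
      induction d with
      | zero => intro i hi hPi; rw [← hσN i (by omega)]; exact hP _ hPi
      | succ d ih =>
        intro i hi hPi
        exact ih _ (by rw [hσ i (by omega)]; omega) (hP _ hPi)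
    exact hup j.1 j.2 (hdown (N - i.1) i (by omega) hi)
  · rw [hJ i]
    exact B.extAngle_spec _
theorem endLoc1 {E : CC} {V : Set ℂ} (hV : IsOpen V) (h0 : tC 0 ∈ V) (hE : DifferentiableOn ℂ E V)
    (hd : deriv E 0 ≠ 0) : ∃ C > 0, ∃ δ > 0, ball 0 δ ⊆ V ∧ ∀ w, ‖w‖ < δ → ∃ h : ℂ, ‖h‖ ≤ C * ‖w‖ ∧
      ‖h‖ ≤ 1/2 ∧ E w = E 0 + deriv E 0 * w * exp h := by
  set g : CC := fun w ↦ dslope E 0 w / deriv E 0 with hg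
  have hgd : DifferentiableAt ℂ g 0 :=
    (((differentiableOn_dslope (hV.mem_nhds h0)).2 hE).differentiableAt (hV.mem_nhds h0)).div_const _
  obtain ⟨C, hC⟩ := hgd.isBigO_sub.bound
  obtain ⟨δ1, hδ1, hb1⟩ := Metric.eventually_nhds_iff_ball.1 hC
  obtain ⟨δ2, hδ2, hb2⟩ := Metric.isOpen_iff.1 hV 0 h0
  set C' := |C| + 1 with hC'
  refine ⟨3/2 * C', bp, min (min δ1 δ2) (1/(3*C')), bp, ◇, ◇⟩
  · exact (ball_subset_ball ((mll).trans mlr)).trans hb2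
  intro w hw
  have hw1 := hw.trans_le ((mll).trans mll)
  have hw3 := hw.trans_le mlr
  have h1 := hb1 w (by simpa using hw1)
  rw [(by simp [hg, hd] : g 0 = 1), sub_zero] at h1
  have h2 : ‖g w - 1‖ ≤ C' * ‖w‖ := h1.trans (by gcongr; linarith [le_abs_self C])
  have h3 : C' * ‖w‖ ≤ 1/3 := by
    rw [lt_div_iff₀ bp] at hw3
    nlinarith
  have h4 := Complex.norm_log_one_add_half_le_self (z := g w - 1) bl
  rw [add_sub_cancel] at h4
  refine ⟨log (g w), by nlinarith, by nlinarith, ◇⟩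
  have h5 : g w ≠ 0 := by
    intro h
    rw [h] at h2
    norm_num at h2
    linarith
  rw [exp_log h5]
  have h6 := sub_smul_dslope E 0 w
  simp only [sub_zero, smul_eq_mul] at h6
  simp only [hg]
  field_simp
  rw [h6]
  ring
theorem endLoc2 {E : CC} {V : Set ℂ} (hV : IsOpen V) (hs : ∀ x ∈ I01, tC x ∈ V)
    (hE : DifferentiableOn ℂ E V) (hi : InjOn E V) {v : ℂ} {m : ℝ} (hm : 0 < m) (hd : deriv E 0 = m * v)
    (hv : v ≠ 0) : ∃ A > 0, ∃ r > 0, ∀ x ∈ I01, ∀ s : ℂ, E x = E 0 + v * exp s → rexp RE s < r →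
      ∃ n : ℤ, |IM s - n * tp| ≤ A * rexp RE s := by
  have h0 : 0 ∈ V := by simpa using hs 0 bs
  have hd0 : deriv E 0 ≠ 0 := by
    rw [hd]
    simp [hm.ne', hv]
  obtain ⟨C, hC, δ, hδ, -, hloc⟩ := endLoc1 hV h0 hE hd0
  have hvp := norm_pos_iff.2 hv
  obtain ⟨r1, hr1, hfar⟩ : ∃ r1 > 0, ∀ x ∈ Icc (δ/2) 1, r1 ≤ ‖E x - E 0‖ := by
    rcases (Icc (δ/2) 1).eq_empty_or_nonempty with he | hne
    · exact ⟨1, one_pos, fun x hx ↦ by rw [he] at hx; exact absurd hx (notMem_empty x)⟩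
    have hsub : ∀ x ∈ Icc (δ/2) 1, x ∈ I01 := fun x hx ↦ ⟨by linarith [hx.1], hx.2⟩
    have hc : ContinuousOn (fun x : ℝ ↦ ‖E x - E 0‖) _ :=
      ((hE.continuousOn.comp continuous_ofReal.continuousOn fun x hx ↦ hs x (hsub x hx)).sub continuousOn_const).norm
    obtain ⟨y, hy, hy2⟩ := isCompact_Icc.exists_isMinOn hne hc
    refine ⟨_, norm_pos_iff.2 (sub_ne_zero.2 fun h ↦ ◇), fun x hx ↦ hy2 hx⟩
    have : y = 0 := by exact_mod_cast (hi (hs y (hsub y hy)) h0 h)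
    linarith [hy.1]
  refine ⟨2 * C / m, bp, r1 / ‖v‖, bp, fun x hx s hxs hsr ↦ ◇⟩
  have hxδ : x < δ := by
    by_contra hc
    have h1 := hfar x ⟨ bl, hx.2⟩
    rw [hxs, add_sub_cancel_left, norm_mul, norm_exp] at h1
    rw [lt_div_iff₀ hvp] at hsr
    linarith
  have hx0 : 0 < x := by
    refine lt_of_le_of_ne hx.1 fun h ↦ ◇
    rw [← h] at hxs
    simp [hv] at hxs
  obtain ⟨h, h1, h2, h3⟩ := hloc x (by simpa [abs_of_pos hx0] using hxδ)
  rw [hxs, hd] at h3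
  have h4 : exp s = exp ((rlog (m * x) : ℝ) + h) := by
    have : v * exp s = v * (m * x * exp h) := by
      rw [(add_left_cancel h3)]
      ring
    rw [mul_left_cancel₀ hv this, exp_add, ← ofReal_exp, Real.exp_log bp]
    push_cast
    ring
  obtain ⟨n, hn⟩ := exp_eq_exp_iff_exists_int.1 h4
  have him : IM s - n * tp = IM h := by
    rw [hn]
    simp
  have hre : RE s = rlog (m * x) + RE h := by
    rw [hn]
    simp
  refine ⟨n, ◇⟩
  rw [him, hre, rea, Real.exp_log bp]
  have h5 := (neg_le_abs _).trans ((abs_re_le_norm h).trans h2)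
  have h6 := add_one_le_exp RE h
  have h7 : |IM h| ≤ C * x := by
    refine (abs_im_le_norm h).trans (h1.trans ◇)
    simp [abs_of_pos hx0]
  calc |IM h| ≤ C * x := h7
    _ = 2 * C / m * (m * x * hf2) := by field_simp
    _ ≤ _ := by gcongr; linarith
theorem vol_aux {E : Set ℝ} {p q d : ℝ} (hpq : p ≤ q) (hd : 0 ≤ d) :
    (Ioo (p+d) (q-d) ⊆ E → |(volume (E ∩ Ico p q)).toReal - (q - p)| ≤ 2*d) ∧
    (Disjoint (Ioo (p+d) (q-d)) E → |(volume (E ∩ Ico p q)).toReal| ≤ 2*d) := by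
  have hfin : volume (E ∩ Ico p q) ≠ ⊤ := ne_top_of_le_ne_top bs (measure_mono inter_subset_right)
  constructor
  · intro h
    have h1 : (volume (E ∩ Ico p q)).toReal ≤ q - p := by
      have := ENNReal.toReal_mono bs (measure_mono (μ := volume) (inter_subset_right : E ∩ Ico p q ⊆ Ico p q))
      rwa [Real.volume_Ico, ENNReal.toReal_ofReal bl] at this
    have h2 : q - d - (p + d) ≤ (volume (E ∩ Ico p q)).toReal := by
      have hsub : Ioo (p+d) _ ⊆ E ∩ Ico p q := fun x hx ↦
        ⟨h hx, by linarith [hx.1], by linarith [hx.2]⟩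
      have := ENNReal.toReal_mono hfin (measure_mono hsub)
      rw [Real.volume_Ioo] at this
      exact (ENNReal.ofReal_le_iff_le_toReal ENNReal.ofReal_ne_top).1 le_rfl |>.trans this
    rw [abs_le]
    constructor <;> linarith
  · intro h
    rw [abs_of_nonneg ENNReal.toReal_nonneg]
    have hsub : E ∩ Ico p q ⊆ Icc p (p+d) ∪ Icc (q-d) q := by
      rintro x ⟨hx, hx1, hx2⟩
      by_contra hc
      simp only [mem_union, mem_Icc, not_or, not_and, not_le] at hc
      refine disjoint_left.1 h ⟨hc.1 hx1, ◇⟩ hx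
      by_contra hc2
      push Not at hc2
      linarith [hc.2 hc2]
    have h3 : volume (Icc p (p+d) ∪ Icc (q-d) q) ≤ ENNReal.ofReal (2*d) := by
      refine (measure_union_le _ _).trans ◇
      rw [volume_Icc, volume_Icc, ← ENNReal.ofReal_add bl bl]
      exact ENNReal.ofReal_le_ofReal bl
    exact ENNReal.toReal_le_of_le_ofReal bl ((measure_mono hsub).trans h3)
def Sec (A ρ p q : ℝ) : Set ℂ := {s | RE s < ρ ∧ p + A * rexp RE s < IM s ∧ IM s < q - A * rexp RE s}
theorem Sec_convex {A : ℝ} (hA : 0 ≤ A) (ρ p q : ℝ) : Convex ℝ (Sec A ρ p q) := by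
  have hcv : ConvexOn ℝ univ fun s ↦ A * rexp RE s := by
    simpa using ((convexOn_exp.comp_linearMap Complex.reLm).smul hA)
  have him : ∀ c, ConvexOn ℝ univ fun s ↦ c * IM s := fun c ↦ (c • Complex.imLm).convexOn convex_univ
  have h2 := ((hcv.add (him 1)).convex_lt q)
  have h3 := (convex_halfSpace_re_lt ρ).inter ((((hcv.add (him (-1))).convex_lt (-p))).inter h2)
  convert h3 using 1
  ext s
  simp only [ mem_inter_iff, mem_ofPred_eq, mem_univ, true_and, Pi.add_apply]
  constructor
  · rintro ⟨a, b, c⟩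
    exact ⟨a, bl, bl⟩
  · rintro ⟨a, b, c⟩
    exact ⟨a, bl, bl⟩
theorem side {G : Set ℂ} (hG : IsOpen G) {S : Set ℂ} (hS : IsPreconnected S) {f : CC} (hf : ContinuousOn f S)
    (h : ∀ s ∈ S, f s ∉ frontier G) : (∀ s ∈ S, f s ∈ G) ∨ (∀ s ∈ S, f s ∈ (closure G)ᶜ) := by
  by_contra hc
  push Not at hc
  obtain ⟨⟨a, ha, ha2⟩, b, hb, hb2⟩ := hc
  have hsub : f '' S ⊆ G ∪ (closure G)ᶜ := by
    rintro _ ⟨s, hs, rfl⟩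
    have := h s hs
    rw [hG.frontier_eq] at this
    by_cases hg : f s ∈ G
    · exact Or.inl hg
    · exact Or.inr fun hcl ↦ this ⟨hcl, hg⟩
  obtain ⟨z, _, hz1, hz2⟩ := (hS.image f hf) G _ᶜ hG isClosed_closure.isOpen_compl hsub
    ⟨f b, ⟨b, hb, rfl⟩, by
      rcases hsub ⟨b, hb, rfl⟩ with h | h
      · exact h
      · exact absurd h hb2⟩
    ⟨f a, ⟨a, ha, rfl⟩, by
      rcases hsub ⟨a, ha, rfl⟩ with h | h
      · exact absurd h ha2
      · exact h⟩
  exact hz2 (subset_closure hz1)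
theorem per_vol {P : Set ℝ} {T : ℝ} (hT : 0 < T) (hP : MeasurableSet P) (hper : ∀ x, x + T ∈ P ↔ x ∈ P) (a : ℝ) :
    volume (P ∩ Ico a (a+T)) = volume (P ∩ Ico 0 T) := by
  have hz : ∀ n : ℤ, ∀ x, x + n * T ∈ P ↔ x ∈ P := by
    intro n
    exact fun x ↦ by simpa using ((show Periodic (fun x ↦ x ∈ P) T from fun x ↦ propext (hper x)).int_mul n) x
  have h1 : ∀ c, (P ∩ Ico c _ : Set ℝ) =ᵐ[volume] (P ∩ Ioc c (c+T) : Set ℝ) := fun c ↦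
    (ae_eq_refl P).inter Ico_ae_eq_Ioc
  have h2 := (isAddFundamentalDomain_Ioc hT a volume).measure_set_eq (isAddFundamentalDomain_Ioc hT 0 volume) hP (by
    rintro ⟨g, n, rfl⟩
    ext x
    show (n • T + x ∈ P) ↔ _
    rw [zsmul_eq_mul, add_comm]; exact (hz n x))
  have h3 := measure_congr (h1 0)
  rw [zero_add] at h2 h3
  rw [measure_congr (h1 a), h2, h3]
theorem corner_angle {G : Set ℂ} (hG : IsOpen G) {z v : ℂ} (hv : ‖v‖ = 1) {a κ A ρ : ℝ} (hA : 0 < A)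
    (ha : a ∈ Ioo 0 tp) (hκ : κ ∈ Ico 0 tp) (hang : HasCornerAngle G z a)
    (hL : ∀ s : ℂ, RE s < ρ → z + v * exp s ∈ frontier G → ∃ n : ℤ,
      |IM s - n * tp| ≤ A * rexp RE s ∨ |IM s - κ - n * tp| ≤ A * rexp RE s) :
    ((∀ s ∈ Sec A ρ 0 κ, z + v * exp s ∈ G) ∧ (∀ s ∈ Sec A ρ κ tp, z + v * exp s ∈ (closure G)ᶜ) ∧ a = κ) ∨
    ((∀ s ∈ Sec A ρ 0 κ, z + v * exp s ∈ (closure G)ᶜ) ∧ (∀ s ∈ Sec A ρ κ tp, z + v * exp s ∈ G) ∧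
      a = 2 * π - κ) := by
  have hint : ∀ (n : ℤ) {x : ℝ}, 0 < x + 0 * n → x < 2 * π → ∀ {t e : ℝ}, |x - n * tp| ≤ e →
      e < x → e < 2 * π - x → False := by
    intro n x hx0 hx1 t e h1 h2 h3
    rw [abs_le] at h1
    have h4 : tR n * tp < 1 * tp := by linarith
    have h5 : 0 * tp < tR n * tp := by linarith
    have h7 : tR 0 < n := lt_of_mul_lt_mul_right h5 bp
    have : n < 1 := by exact_mod_cast (lt_of_mul_lt_mul_right h4 bp)
    have : 0 < n := by exact_mod_cast h7
    omega
  have hcont : Continuous fun s ↦ z + v * exp s := bf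
  have hAe : ∀ s, 0 < A * rexp RE s := fun s ↦ bp
  have s1 := side hG (Sec_convex hA.le ρ 0 κ).isPreconnected hcont.continuousOn (by
    intro s hs hf
    obtain ⟨hs1, hs2, hs3⟩ := hs
    have := hAe s
    obtain ⟨n, h | h⟩ := hL s hs1 hf
    · exact hint n bl (by linarith [hκ.2]) (t := 0) h bl (by linarith [hκ.2])
    · refine hint (n+1) (x := IM s - κ + 2 * π) (by linarith [hκ.2]) bl (t := 0) (e := A * rexp RE s) ◇ (by linarith [hκ.2]) bl
      convert h using 2; push_cast; ring)
  have s2 := side hG (Sec_convex hA.le ρ κ tp).isPreconnected hcont.continuousOn (by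
    intro s hs hf
    obtain ⟨hs1, hs2, hs3⟩ := hs
    have := hAe s
    obtain ⟨n, h | h⟩ := hL s hs1 hf
    · exact hint n (by linarith [hκ.1]) bl (t := 0) h (by linarith [hκ.1]) bl
    · exact hint n bl (by linarith [hκ.1]) (t := 0) h bl (by linarith [hκ.1]))
  have hvol : ∀ r, 0 < r → rlog r < ρ → ∀ c1 c2,
      ((c1 = 1 ∧ ∀ s ∈ Sec A ρ 0 κ, z + v * exp s ∈ G) ∨ (c1 = 0 ∧ ∀ s ∈ Sec A ρ 0 κ, z + v * exp s ∈ (closure G)ᶜ)) →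
      ((c2 = 1 ∧ ∀ s ∈ Sec A ρ κ tp, z + v * exp s ∈ G) ∨ (c2 = 0 ∧ ∀ s ∈ Sec A ρ κ tp, z + v * exp s ∈ (closure G)ᶜ)) →
      |(volume {θ : ℝ | θ ∈ Ico 0 tp ∧ z + r * Complex.exp (θ * Complex.I) ∈ G}).toReal
        - (c1 * κ + c2 * (2*π - κ))| ≤ 4 * A * r := by
    intro r hr hrρ c1 c2 h1 h2
    have hd : 0 ≤ A * r := bp
    set E : Set ℝ := {θ | z + v * exp ((rlog r) + θ * I) ∈ G} with hE
    have hEo : IsOpen E := hG.preimage bf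
    have hvs : v = exp ((arg v) * I) := by
      have := norm_mul_exp_arg_mul_I v
      rw [hv] at this
      simpa using this.symm
    have hrot : volume {θ : ℝ | θ ∈ Ico 0 tp ∧ z + r * Complex.exp (θ * Complex.I) ∈ G}
        = volume (E ∩ Ico 0 tp) := by
      set P : Set ℝ := {θ | z + r * exp (θ * I) ∈ G} with hPdef
      have hPo : IsOpen P := hG.preimage bf
      have hper : ∀ x, x + 2*π ∈ P ↔ x ∈ P := by
        intro x
        simp only [hPdef, mem_ofPred_eq]
        push_cast
        rw [add_mul, exp_add, exp_two_pi_mul_I, mul_one]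
      have hEP : E ∩ Ico 0 tp = (fun x ↦ arg v + x) ⁻¹' (P ∩ Ico (arg v) (arg v + 2*π)) := by
        ext x
        simp only [mem_inter_iff, mem_preimage, hE, hPdef, mem_ofPred_eq, mem_Ico, le_add_iff_nonneg_right, add_lt_add_iff_left]
        refine and_congr_left fun _ ↦ ◇
        rw [exp_add, ← ofReal_exp, Real.exp_log hr]
        nth_rewrite 1 [hvs]
        push_cast
        rw [add_mul, exp_add, show exp (arg v * I) * (r * exp (x*I)) = r * (exp (arg v * I) * exp (x*I)) by ring]
      rw [hEP, measure_preimage_add, per_vol bp hPo.measurableSet hper]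
      congr 1
      ext x
      exact and_comm
    have hsplit : (volume (E ∩ Ico 0 tp)).toReal = (volume (E ∩ Ico 0 κ)).toReal + (volume (E ∩ Ico κ tp)).toReal := by
      have hf : ∀ p q, volume (E ∩ Ico p q) ≠ ⊤ := fun p q ↦
        ne_top_of_le_ne_top bs (measure_mono inter_subset_right)
      rw [← ENNReal.toReal_add (hf _ _) (hf _ _), ← measure_union ◇ (hEo.measurableSet.inter measurableSet_Ico),
        ← inter_union_distrib_left, Ico_union_Ico_eq_Ico hκ.1 hκ.2.le]
      exact (Ico_disjoint_Ico_same).mono inter_subset_right inter_subset_right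
    have hmem : ∀ p q, ∀ θ ∈ Ioo (p + A * r) (q - A * r), ((rlog r) + θ * I : ℂ) ∈ Sec A ρ p q := by
      intro p q θ hθ
      refine ⟨by simpa using hrρ, ◇, ◇⟩
      · simp [Real.exp_log hr]
        exact hθ.1
      · simp [Real.exp_log hr]
        linarith [hθ.2]
    have b1 : |(volume (E ∩ Ico 0 κ)).toReal - c1 * κ| ≤ 2 * (A * r) := by
      rcases h1 with ⟨rfl, h⟩ | ⟨rfl, h⟩
      · simpa using ((vol_aux (E := E) hκ.1 hd).1 (fun θ hθ ↦ h _ (hmem _ _ θ hθ)))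
      · simpa using ((vol_aux (E := E) hκ.1 hd).2 (disjoint_left.2 fun θ hθ hθE ↦ h _ (hmem _ _ θ hθ) (subset_closure hθE)))
    have b2 : |(volume (E ∩ Ico κ tp)).toReal - c2 * (2*π - κ)| ≤ 2 * (A * r) := by
      rcases h2 with ⟨rfl, h⟩ | ⟨rfl, h⟩
      · simpa using ((vol_aux (E := E) hκ.2.le hd).1 (fun θ hθ ↦ h _ (hmem _ _ θ hθ)))
      · simpa using ((vol_aux (E := E) hκ.2.le hd).2 (disjoint_left.2 fun θ hθ hθE ↦ h _ (hmem _ _ θ hθ) (subset_closure hθE)))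
    rw [hrot, hsplit]
    rw [abs_le] at b1 b2 ⊢
    constructor <;> linarith [ b1.2]
  have hlim : ∀ c1 c2,
      ((c1 = 1 ∧ ∀ s ∈ Sec A ρ 0 κ, z + v * exp s ∈ G) ∨ (c1 = 0 ∧ ∀ s ∈ Sec A ρ 0 κ, z + v * exp s ∈ (closure G)ᶜ)) →
      ((c2 = 1 ∧ ∀ s ∈ Sec A ρ κ tp, z + v * exp s ∈ G) ∨ (c2 = 0 ∧ ∀ s ∈ Sec A ρ κ tp, z + v * exp s ∈ (closure G)ᶜ)) →
      a = c1 * κ + c2 * (2*π - κ) := by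
    intro c1 c2 h1 h2
    refine tendsto_nhds_unique hang ◇
    rw [tendsto_iff_norm_sub_tendsto_zero]
    have hto : Tendsto (fun r ↦ 4 * A * r) (𝓝[>] 0) (𝓝 0) := by
      simpa using ((bf : Continuous fun r : ℝ ↦ 4 * A * r).tendsto 0).mono_left nhdsWithin_le_nhds
    refine tendsto_of_tendsto_of_tendsto_of_le_of_le' tendsto_const_nhds hto (Eventually.of_forall fun _ ↦ norm_nonneg _) ◇
    filter_upwards [(Ioo_mem_nhdsGT (exp_pos _))] with r hr
    exact hvol r hr.1 ((log_lt_iff_lt_exp hr.1).2 hr.2) c1 c2 h1 h2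
  rcases s1 with s1 | s1 <;> rcases s2 with s2 | s2
  · have := hlim 1 1 (Or.inl ⟨rfl, s1⟩) (Or.inl ⟨rfl, s2⟩)
    linarith [ha.2]
  · have := hlim 1 0 (Or.inl ⟨rfl, s1⟩) (Or.inr ⟨rfl, s2⟩)
    exact Or.inl ⟨s1, s2, bl⟩
  · have := hlim 0 1 (Or.inr ⟨rfl, s1⟩) (Or.inl ⟨rfl, s2⟩)
    exact Or.inr ⟨s1, s2, bl⟩
  · have := hlim 0 0 (Or.inr ⟨rfl, s1⟩) (Or.inr ⟨rfl, s2⟩)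
    linarith [ha.1]
theorem coneLoc {E : CC} {V : Set ℂ} (hV : IsOpen V) (h0 : tC 0 ∈ V) (hE : DifferentiableOn ℂ E V)
    {v : ℂ} {m : ℝ} (hm : 0 < m) (hd : deriv E 0 = m * v) (hv : v ≠ 0) : ∃ C > 0, ∃ δ > 0, ball 0 δ ⊆ V ∧
      ∀ (x y : ℝ), 0 < x → |y| ≤ 1/2 → x < δ → ∃ h : ℂ, ‖h‖ ≤ C * x ∧
        E (x * (1 + y * I)) = E 0 + v * exp (rlog (m * x) + log (1 + y * I) + h) := by
  have hd0 : deriv E 0 ≠ 0 := by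
    rw [hd]
    simp [hm.ne', hv]
  obtain ⟨C, hC, δ, hδ, hsub, hloc⟩ := endLoc1 hV h0 hE hd0
  refine ⟨2 * C, bp, δ / 2, bp, (ball_subset_ball bl).trans hsub, ◇⟩
  intro x y hx hy hxd
  have h1 : ‖(1 + y * I : ℂ)‖ ≤ 2 := by
    refine (norm_add_le _ _).trans ◇
    simp
    linarith
  have hn : ‖(x * (1 + y * I) : ℂ)‖ ≤ x * 2 := by
    rw [norm_mul, norm_real, norm_of_nonneg hx.le]
    gcongr
  obtain ⟨h, h2, -, h3⟩ := hloc _ bl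
  refine ⟨h, h2.trans (by nlinarith), ◇⟩
  have hne : (1 + y * I : ℂ) ≠ 0 := by
    intro h
    have := congrArg re h
    simp at this
  rw [h3, hd, exp_add, exp_add, exp_log hne, ← ofReal_exp, Real.exp_log bp]
  push_cast
  ring
theorem log_im_bound {y : ℝ} (hy : |y| ≤ 1/2) : ‖log (1 + y * I)‖ ≤ 3/2 * |y| := by
  simpa using (Complex.norm_log_one_add_half_le_self (z := y * I) (by simpa using hy))
theorem cone_write {w : ℂ} (hw : 0 < RE w) {ε : ℝ} (h : |IM w| < ε * RE w) :
    w = (RE w : ℂ) * (1 + (IM w / RE w : ℝ) * I) ∧ |IM w / RE w| < ε := by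
  constructor
  · apply cext <;> simp
    field_simp
  · rwa [abs_div, abs_of_pos hw, div_lt_iff₀ hw]
theorem coneSmall {E : CC} {V : Set ℂ} (hV : IsOpen V) (h0 : tC 0 ∈ V) (hE : DifferentiableOn ℂ E V)
    {v : ℂ} {m : ℝ} (hm : 0 < m) (hd : deriv E 0 = m * v) (hv : v ≠ 0) {η : ℝ} (hη : 0 < η) (ρ : ℝ) :
    ∃ ε > 0, ∃ δ > 0, ∀ w : ℂ, 0 < RE w → RE w < δ → |IM w| < ε * RE w → w ∈ V ∧ ∃ s : ℂ, E w = E 0 + v * exp s ∧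
      RE s < ρ ∧ |IM s| < η := by
  obtain ⟨C, hC, δ, hδ, hsub, hloc⟩ := coneLoc hV h0 hE hm hd hv
  refine ⟨min hf2 (η/4), bp, min (min (δ/2) (η/(4*C))) (min (1/C) (rexp (ρ-2)/m)), bp, ◇⟩
  intro w hw hwd hwi
  obtain ⟨h1, h2⟩ := cone_write hw hwi
  have hy1 := h2.le.trans mll
  have hy2 := h2.le.trans mlr
  have ha := hwd.trans_le ((mll).trans mll)
  have hb := hwd.trans_le ((mll).trans mlr)
  have hc := hwd.trans_le ((mlr).trans mll)
  have hd' := hwd.trans_le ((mlr).trans mlr)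
  rw [lt_div_iff₀ bp] at hb hc hd'
  have hlog := log_im_bound hy1
  constructor
  · apply hsub
    rw [mem_ball_zero_iff]
    refine (norm_le_abs_re_add_abs_im w).trans_lt ◇
    rw [abs_of_pos hw]
    have : |IM w| < 1 * RE w := hwi.trans_le (by gcongr; linarith [min_le_left hf2 (η/4)])
    linarith
  · obtain ⟨h, h3, h4⟩ := hloc RE w _ hw hy1 bl
    rw [← h1] at h4
    refine ⟨_, h4, ◇, ◇⟩
    · simp only [add_re, ofReal_re]
      have e1 := (re_le_norm _).trans hlog
      have e2 := (re_le_norm h).trans h3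
      have e3 : rlog (m * RE w) < ρ - 2 := by
        rw [log_lt_iff_lt_exp bp]
        linarith
      linarith
    · simp only [add_im, ofReal_im, zero_add]
      refine (abs_add_le _ _).trans_lt ◇
      have e1 := (abs_im_le_norm _).trans hlog
      have e2 := (abs_im_le_norm h).trans h3
      nlinarith
theorem coneSide {E : CC} {V : Set ℂ} (hV : IsOpen V) (h0 : tC 0 ∈ V) (hE : DifferentiableOn ℂ E V)
    {v : ℂ} {m : ℝ} (hm : 0 < m) (hd : deriv E 0 = m * v) (hv : v ≠ 0) {ε κ A ρ τ : ℝ} (hε : 0 < ε)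
    (hκ : 0 < κ) (hτ : τ = 1 ∨ τ = -1) : ∃ w : ℂ, 0 < RE w ∧ RE w < 1/2 ∧ |IM w| < ε * qq RE w ∧ 0 < τ * IM w ∧
      ∃ s : ℂ, E w = E 0 + v * exp s ∧ RE s < ρ ∧ A * rexp RE s < τ * IM s ∧ τ * IM s < κ - A * rexp RE s := by
  obtain ⟨C, hC, δ, hδ, hsub, hloc⟩ := coneLoc hV h0 hE hm hd hv
  set y : ℝ := min (min hf2 (ε/4)) (κ/4)
  have hy0 : 0 < y := bp
  have hy1 : y ≤ 1/2 := (mll).trans mll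
  have hy2 : y ≤ ε/4 := (mll).trans mlr
  have hy3 : y ≤ κ/4 := min_le_right _ _
  have hτa : |τ| = 1 := by rcases hτ with rfl | rfl <;> simp
  have hτ2 : τ * τ = 1 := by rcases hτ with rfl | rfl <;> simp
  have hya : |τ * y| = y := by rw [abs_mul, hτa, one_mul, abs_of_pos hy0]
  have hl := log_im_bound (by rw [hya]; exact hy1)
  rw [hya] at hl
  set b := τ * (log (1 + (τ * y : ℝ) * I)).im with hb
  have hb0 : 0 < b := by
    rw [hb, log_im]
    rcases hτ with rfl | rfl
    · rw [one_mul]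
      refine lt_of_le_of_ne (arg_nonneg_iff.2 (by simp [hy0.le])) fun h ↦ ◇
      have := (arg_eq_zero_iff.1 h.symm).2
      simp at this
      linarith
    · rw [neg_one_mul, neg_pos]
      exact arg_neg_iff.2 (by simp [hy0])
  have hb1 : b ≤ κ/2 := by
    have : |b| ≤ 3/2*y := by
      rw [hb, abs_mul, hτa, one_mul]
      exact (abs_im_le_norm _).trans hl
    linarith [le_abs_self b]
  have hev : ∀ᶠ x : ℝ in 𝓝[>] 0, x < δ ∧ x < 1/2 ∧ m * x < rexp (ρ - 2) ∧ C * x < 1 ∧ C * x + |A| * (m * x * rexp 2) < b/2 ∧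
      C * x + |A| * (m * x * rexp 2) < κ/2 := by
    have key : ∀ (f : ℝ → ℝ) c, Continuous f → f 0 < c → ∀ᶠ x : ℝ in 𝓝[>] 0, f x < c := fun f c hf h ↦
      nhdsWithin_le_nhds (hf.continuousAt.eventually_lt continuousAt_const h)
    exact (key (fun x ↦ x) δ bf hδ).and ((key (fun x ↦ x) _ bf bn).and
      ((key (fun x ↦ m*x) _ bf (by simp [exp_pos])).and ((key (fun x ↦ C*x) _ bf bs).and
      ((key (fun x ↦ C * x + |A| * (m * x * rexp 2)) _ bf (by simp [hb0])).and (key (fun x ↦ C * x + |A| * (m * x * rexp 2)) _ bf (by simp [hκ]))))))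
  obtain ⟨x, ⟨h1, h2, h3, h4, h5, h6⟩, hx⟩ := (hev.and self_mem_nhdsWithin).exists
  replace hx : 0 < x := hx
  obtain ⟨h, h7, h8⟩ := hloc x _ hx (by rw [hya]; exact hy1) h1
  refine ⟨_, ◇, ◇, ◇, ◇, _, h8, ◇, ◇⟩
  · simpa using hx
  · simpa using h2
  · simp only [mul_re, ofReal_re, add_re, one_re, I_re, mul_zero, I_im, ofReal_im, mul_one, sub_self, add_zero,
      mul_im, add_im, one_im, zero_add]
    rw [abs_mul, hya, abs_of_pos hx]
    have : y < ε * (1 - x) := by nlinarith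
    nlinarith
  · simp only [mul_im, ofReal_re, I_im, ofReal_im, mul_one, add_zero, zero_mul,
      add_im, one_im, zero_add]
    rw [show τ * (x * (τ * y)) = (τ * τ) * (x * y) by ring, hτ2]
    positivity
  · simp only [add_re, ofReal_re]
    have e1 := (re_le_norm _).trans hl
    have e2 := (re_le_norm h).trans h7
    have e3 : rlog (m * x) < ρ - 2 := by
      rw [log_lt_iff_lt_exp bp]
      linarith
    linarith
  · have hexp : A * rexp (rlog (m * x) + log (1 + (τ*y:ℝ) * I) + h : ℂ).re ≤ |A| * (m * x * rexp 2) := by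
      simp only [add_re, ofReal_re]
      rw [add_assoc, rea, Real.exp_log bp]
      have e1 := (re_le_norm _).trans hl
      have e2 := (re_le_norm h).trans h7
      gcongr
      · exact le_abs_self A
      · linarith
    have him : |τ * IM h| ≤ C * x := by
      rw [abs_mul, hτa, one_mul]
      exact (abs_im_le_norm h).trans h7
    have e4 : τ * (rlog (m * x) + log (1 + (τ*y:ℝ) * I) + h : ℂ).im = b + τ * IM h := by
      simp only [add_im, ofReal_im]
      ring
    rw [e4]
    rw [abs_le] at him
    constructor <;> linarith
theorem sides {X Y : Set ℂ} {Ea Eb : CC} {Va Vb : Set ℂ} (hVa : IsOpen Va) (hVb : IsOpen Vb) (h0a : tC 0 ∈ Va) (h0b : tC 0 ∈ Vb)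
    (hEa : DifferentiableOn ℂ Ea Va) (hEb : DifferentiableOn ℂ Eb Vb) (hz : Ea 0 = Eb 0)
    {v : ℂ} {κ m m' A ρ : ℝ} (hv : ‖v‖ = 1) (hm : 0 < m) (hm' : 0 < m') (hκ : κ ∈ Ioo 0 tp)
    (hda : deriv Ea 0 = m * v) (hdb : deriv Eb 0 = m' * (v * exp (κ * I)))
    (h1 : ∀ s ∈ Sec A ρ 0 κ, Ea 0 + v * exp s ∈ X) (h2 : ∀ s ∈ Sec A ρ κ tp, Ea 0 + v * exp s ∈ Y) {ε : ℝ} (hε : 0 < ε) :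
    (∃ w : ℂ, 0 < RE w ∧ RE w < 1/2 ∧ |IM w| < ε * qq RE w ∧ 0 < IM w ∧ Ea w ∈ X) ∧
    (∃ w : ℂ, 0 < RE w ∧ RE w < 1/2 ∧ |IM w| < ε * qq RE w ∧ IM w < 0 ∧ Ea w ∈ Y) ∧
    (∃ w : ℂ, 0 < RE w ∧ RE w < 1/2 ∧ |IM w| < ε * qq RE w ∧ IM w < 0 ∧ Eb w ∈ X) ∧
    (∃ w : ℂ, 0 < RE w ∧ RE w < 1/2 ∧ |IM w| < ε * qq RE w ∧ 0 < IM w ∧ Eb w ∈ Y) := by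
  have hv0 := norm_ne_zero_iff.1 (by rw [hv]; norm_num)
  have hvb : v * exp (κ * I) ≠ 0 := mul_ne_zero hv0 (exp_ne_zero _)
  have hκ' : 0 < 2 * π - κ := by linarith [hκ.2]
  refine ⟨◇, ◇, ◇, ◇⟩
  · obtain ⟨w, a1, a2, a3, a4, s, b1, b2, b3, b4⟩ := coneSide (A := A) hVa h0a hEa hm hda hv0 hε hκ.1 (Or.inl rfl)
    rw [one_mul] at a4 b3 b4
    exact ⟨w, a1, a2, a3, a4, b1 ▸ h1 s ⟨b2, bl, b4⟩⟩
  · obtain ⟨w, a1, a2, a3, a4, s, b1, b2, b3, b4⟩ := coneSide (A := A) hVa h0a hEa hm hda hv0 hε hκ' (Or.inr rfl)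
    have := h2 (s + (2*π:ℝ) * I) ⟨by simpa using b2, by simp; linarith, by simp; linarith⟩
    refine ⟨w, a1, a2, a3, bl, ◇⟩
    rw [b1]
    push_cast at this
    rwa [exp_add, exp_two_pi_mul_I, mul_one] at this
  · obtain ⟨w, a1, a2, a3, a4, s, b1, b2, b3, b4⟩ := coneSide (A := A) hVb h0b hEb hm' hdb hvb hε hκ.1 (Or.inr rfl)
    have := h1 (s + κ * I) ⟨by simpa using b2, by simp; linarith, by simp; linarith⟩
    refine ⟨w, a1, a2, a3, bl, ◇⟩
    rwa [b1, ← hz, mul_assoc, ← exp_add, add_comm (_ * I)]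
  · obtain ⟨w, a1, a2, a3, a4, s, b1, b2, b3, b4⟩ := coneSide (A := A) hVb h0b hEb hm' hdb hvb hε hκ' (Or.inl rfl)
    have := h2 (s + κ * I) ⟨by simpa using b2, by simp; linarith, by simp; linarith⟩
    refine ⟨w, a1, a2, a3, bl, ◇⟩
    rwa [b1, ← hz, mul_assoc, ← exp_add, add_comm (_ * I)]
theorem coneAvoid {Ea Eb : CC} {Va Vb : Set ℂ} (hVa : IsOpen Va) (hVb : IsOpen Vb)
    (hsa : ∀ x ∈ I01, tC x ∈ Va) (hsb : ∀ x ∈ I01, tC x ∈ Vb)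
    (hEa : DifferentiableOn ℂ Ea Va) (hEb : DifferentiableOn ℂ Eb Vb) (hib : InjOn Eb Vb) (hz : Ea 0 = Eb 0)
    {v : ℂ} {κ m m' : ℝ} (hv : v ≠ 0) (hm : 0 < m) (hm' : 0 < m') (hκ : 0 < |κ|) (hκ2 : |κ| < 2 * π)
    (hda : deriv Ea 0 = m * v) (hdb : deriv Eb 0 = m' * (v * exp (κ * I))) {R : Set ℂ} (hR : IsClosed R) (hzR : Ea 0 ∉ R) :
    ∃ ε > 0, ∃ δ > 0, ∀ w : ℂ, 0 < RE w → RE w < δ → |IM w| < ε * RE w → w ∈ Va ∧ Ea w ∉ R ∧ ∀ x ∈ I01, Eb x ≠ Ea w := by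
  have h0a : tC 0 ∈ Va := by simpa using hsa 0 bs
  obtain ⟨A, hA, r, hr, hb⟩ := endLoc2 hVb hsb hEb hib hm' hdb (mul_ne_zero hv (exp_ne_zero _))
  obtain ⟨δR, hδR, hball⟩ := Metric.isOpen_iff.1 hR.isOpen_compl _ hzR
  have hvp := norm_pos_iff.2 hv
  set η := min |κ| (2*π - |κ|)
  have hη0 : 0 < η := lt_min hκ bl
  set R0 := min (min r (η/(2*A))) (δR/‖v‖)
  obtain ⟨ε, hε, δ, hδ, h⟩ := coneSmall hVa h0a hEa hm hda hv (half_pos hη0) (rlog R0)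
  refine ⟨ε, hε, δ, hδ, fun w h1 h2 h3 ↦ ◇⟩
  obtain ⟨hw, s, hs1, hs2, hs3⟩ := h w h1 h2 h3
  have hes : rexp RE s < R0 := by rwa [lt_log_iff_exp_lt bp] at hs2
  refine ⟨hw, fun hwR ↦ ◇, fun x hx hxw ↦ ◇⟩
  · refine hball ◇ hwR
    rw [hs1, mem_ball, dist_eq_norm, add_sub_cancel_left, norm_mul, norm_exp]
    have := hes.trans_le mlr
    rw [lt_div_iff₀ hvp] at this
    linarith
  · obtain ⟨n, hn⟩ := hb x hx (s - κ * I) (by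
      rw [hxw, hs1, hz, mul_assoc, ← exp_add]; congr 3; ring) (by
      simpa using hes.trans_le ((mll).trans mll))
    have h5 := hes.trans_le ((mll).trans mlr)
    rw [lt_div_iff₀ bp] at h5
    simp only [sub_im, mul_im, ofReal_re, I_im, mul_one, ofReal_im, I_re, mul_zero, sub_re, mul_re, sub_zero] at hn
    have h6 : |κ + n * tp| < η := by
      rw [abs_le] at hn
      rw [abs_lt] at hs3 ⊢
      constructor <;> linarith
    have e1 : η ≤ |κ| := min_le_left _ _
    have e2 : η ≤ 2*π - |κ| := min_le_right _ _
    rcases eq_or_ne n 0 with rfl | hn0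
    · simp at h6
      linarith
    · have : tR 1 ≤ |tR n| := by exact_mod_cast Int.one_le_abs hn0
      have h7 := abs_sub_abs_le_abs_sub (n * tp) (-κ)
      rw [abs_neg, sub_neg_eq_add, abs_mul, abs_of_pos (by positivity : 0 < 2*π), add_comm _ κ] at h7
      nlinarith
theorem cornerData {G : Set ℂ} (hG : IsOpen G) {Ea Eb : CC} {Va Vb : Set ℂ} (hVa : IsOpen Va) (hVb : IsOpen Vb)
    (hsa : ∀ x ∈ I01, tC x ∈ Va) (hsb : ∀ x ∈ I01, tC x ∈ Vb)
    (hEa : DifferentiableOn ℂ Ea Va) (hEb : DifferentiableOn ℂ Eb Vb) (hia : InjOn Ea Va) (hib : InjOn Eb Vb) (hz : Ea 0 = Eb 0)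
    {R : Set ℂ} (hR : IsClosed R) (hzR : Ea 0 ∉ R)
    (hfr : ∀ z ∈ frontier G, (∃ x ∈ I01, Ea x = z) ∨ (∃ x ∈ I01, Eb x = z) ∨ z ∈ R)
    {a : ℝ} (ha : a ∈ Ioo 0 tp) (hang : HasCornerAngle G (Ea 0) a) :
    ∃ (v : ℂ) (κ m m' A ρ : ℝ), ‖v‖ = 1 ∧ κ ∈ Ioo 0 tp ∧ 0 < m ∧ 0 < m' ∧ 0 < A ∧ deriv Ea 0 = m * v ∧
      deriv Eb 0 = m' * (v * exp (κ * I)) ∧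
      (((∀ s ∈ Sec A ρ 0 κ, Ea 0 + v * exp s ∈ G) ∧ (∀ s ∈ Sec A ρ κ tp, Ea 0 + v * exp s ∈ (closure G)ᶜ) ∧ a = κ) ∨
       ((∀ s ∈ Sec A ρ 0 κ, Ea 0 + v * exp s ∈ (closure G)ᶜ) ∧ (∀ s ∈ Sec A ρ κ tp, Ea 0 + v * exp s ∈ G) ∧
      a = 2 * π - κ)) := by
  have hd : ∀ {E : CC} {V : Set ℂ}, IsOpen V → (∀ x ∈ I01, tC x ∈ V) → DifferentiableOn ℂ E V → InjOn E V → deriv E 0 ≠ 0 := by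
    intro E V hV hs hE hi
    exact (inj_inverse hV hE (fun z hz ↦ hi.leftInvOn_invFunOn hz) (by simpa using hs 0 bs)).1
  have hda := hd hVa hsa hEa hia
  have hdb := hd hVb hsb hEb hib
  set m := ‖deriv Ea 0‖ with hmdef
  have hm := norm_pos_iff.2 hda
  set v : ℂ := deriv Ea 0 / m with hvdef
  have hmc : tC m ≠ 0 := by exact_mod_cast hm.ne'
  have hv : ‖v‖ = 1 := by rw [hvdef, norm_div, norm_real, norm_of_nonneg hm.le, ← hmdef, div_self hm.ne']
  have hv0 := norm_ne_zero_iff.1 (by rw [hv]; norm_num)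
  have hda' : deriv Ea 0 = m * v := by
    rw [hvdef]
    field_simp
  set q := deriv Eb 0 / v with hq
  set κ := toIcoMod two_pi_pos 0 (arg q) with hκdef
  have hκ0 : κ ∈ Ico 0 tp := by simpa using toIcoMod_mem_Ico two_pi_pos 0 (arg q)
  have hexpκ : exp (κ * I) = exp (arg q * I) := by
    have : arg q = κ + toIcoDiv two_pi_pos 0 (arg q) • tp := (toIcoMod_add_toIcoDiv_zsmul _ _ _).symm
    rw [exp_eq_exp_iff_exists_int]
    refine ⟨-toIcoDiv two_pi_pos 0 (arg q), ◇⟩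
    have h2 := congrArg (fun x : ℝ ↦ tC x) this
    push_cast at h2 ⊢
    rw [h2]
    ring
  have hdb' : deriv Eb 0 = ‖q‖ * (v * exp (κ * I)) := by
    rw [hexpκ]
    have := norm_mul_exp_arg_mul_I q
    rw [show (‖q‖:ℂ) * (v * exp (arg q * I)) = v * (‖q‖ * exp (arg q * I)) by ring, this, hq]
    field_simp
  have hq' : 0 < ‖q‖ := norm_pos_iff.2 (div_ne_zero hdb hv0)
  obtain ⟨A1, hA1, r1, hr1, hb1⟩ := endLoc2 hVa hsa hEa hia hm hda' hv0
  obtain ⟨A2, hA2, r2, hr2, hb2⟩ := endLoc2 hVb hsb hEb hib hq' hdb' (mul_ne_zero hv0 (exp_ne_zero _))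
  obtain ⟨δR, hδR, hball⟩ := Metric.isOpen_iff.1 hR.isOpen_compl _ hzR
  set A := max A1 A2
  set r0 := min (min r1 r2) δR
  have hA : 0 < A := hA1.trans_le (le_max_left _ _)
  have hca := corner_angle hG hv hA ha hκ0 hang (by
    intro s hs hsf
    have hes : rexp RE s < r0 := by rwa [lt_log_iff_exp_lt (bp : 0 < r0)] at hs
    rcases hfr _ hsf with ⟨x, hx, h⟩ | ⟨x, hx, h⟩ | h
    · obtain ⟨n, hn⟩ := hb1 x hx s h (hes.trans_le ((mll).trans mll))
      exact ⟨n, Or.inl (hn.trans (by gcongr; exact le_max_left _ _))⟩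
    · obtain ⟨n, hn⟩ := hb2 x hx (s - κ * I) (by rw [h, hz, mul_assoc, ← exp_add]; congr 3; ring) (by
        simpa using hes.trans_le ((mll).trans mlr))
      simp only [sub_im, mul_im, I_im, mul_one, ofReal_im, I_re, mul_zero, add_zero, sub_re, mul_re, sub_zero] at hn
      exact ⟨n, Or.inr (hn.trans (by gcongr; exact le_max_right _ _))⟩
    · refine absurd h (hball ◇)
      rw [mem_ball, dist_eq_norm, add_sub_cancel_left, norm_mul, norm_exp, hv, one_mul]
      exact hes.trans_le mlr)
  refine ⟨v, κ, m, ‖q‖, A, rlog r0, hv, ⟨◇, hκ0.2⟩, hm, hq', hA, hda', hdb', hca⟩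
  rcases hca with h | h
  · rw [← h.2.2]
    exact ha.1
  · linarith [ ha.2]
def lens (ε : ℝ) : Set ℂ := {w | 0 < RE w ∧ RE w < 1 ∧ |IM w| < ε * qq RE w}
theorem lens_mono {ε ε' : ℝ} (h : ε ≤ ε') : lens ε ⊆ lens ε' := fun w hw ↦
  ⟨hw.1, hw.2.1, hw.2.2.trans_le (mul_le_mul_of_nonneg_right h (mul_nonneg hw.1.le (by linarith [hw.2.1])))⟩
theorem lens_open (ε : ℝ) : IsOpen (lens ε) :=
  (isOpen_lt continuous_const continuous_re).inter ((isOpen_lt continuous_re continuous_const).inter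
    (isOpen_lt (continuous_im.abs) (continuous_const.mul (continuous_re.mul (continuous_const.sub continuous_re)))))
theorem lens_one_sub {ε : ℝ} {w : ℂ} (h : w ∈ lens ε) : 1 - w ∈ lens ε := by
  obtain ⟨a, b, c⟩ := h
  refine ⟨by simpa using b, by simpa using a, ◇⟩
  simp only [sub_im, one_im, zero_sub, abs_neg, sub_re, one_re, sub_sub_cancel]
  rwa [mul_comm (1 - RE w)]
theorem lens_conj {ε : ℝ} {w : ℂ} (h : w ∈ lens ε) : cj w ∈ lens ε := by
  obtain ⟨a, b, c⟩ := h
  exact ⟨by simpa using a, by simpa using b, by simpa using c⟩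
theorem lens_convex {ε : ℝ} (hε : 0 ≤ ε) : Convex ℝ (lens ε) := by
  intro z hz w hw a b ha hb hab
  obtain ⟨z1, z2, z3⟩ := hz
  obtain ⟨w1, w2, w3⟩ := hw
  obtain rfl : a = 1 - b := bl
  have hre : ((1-b) • z + b • w).re = (1-b) * RE z + b * RE w := bs
  have him : ((1-b) • z + b • w).im = (1-b) * IM z + b * IM w := bs
  have key : ∀ x y u v, x < u → y < v → (1-b) * x + b * y < (1-b) * u + b * v := by
    intro x y u v h1 h2
    rcases hb.eq_or_lt with h | h
    · rw [← h]
      simpa using h1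
    · nlinarith
  refine ⟨◇, ◇, ◇⟩
  · rw [hre]
    simpa using (key _ _ _ _ z1 w1)
  · rw [hre]
    have := key _ _ _ _ z2 w2
    linarith
  · rw [hre, him]
    refine ((abs_add_le _ _).trans_eq ◇).trans_lt ((key _ _ _ _ z3 w3).trans_le ◇)
    · rw [abs_mul, abs_mul, abs_of_nonneg ha, abs_of_nonneg hb]
    · have h1 : 0 ≤ ε * ((1-b) * b * (RE z - RE w)^2) := bp
      nlinarith
theorem halflens_convex {ε : ℝ} (hε : 0 ≤ ε) (τ : ℝ) : Convex ℝ {w | w ∈ lens ε ∧ 0 < τ * IM w} := by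
  have : Convex ℝ {w : ℂ | 0 < τ * IM w} := by
    simpa using (((τ • Complex.imLm).concaveOn convex_univ).convex_gt 0)
  exact (lens_convex hε).inter this
namespace Pre
variable (P : Pre D lam N) (i : Fin N)
local notation "pT" => P.T
local notation "pS" => P.σ
local notation "pU" => P.U
def B (i : Fin N) : CC := fun w ↦ pT (P.σ.symm i) (1 - w)
def VB (i : Fin N) : Set ℂ := (fun w ↦ 1 - w) ⁻¹' pU (P.σ.symm i)
def arc (i : Fin N) : Set ℂ := (fun x : ℝ ↦ pT i x) '' Icc 0 1
def R (i : Fin N) : Set ℂ := ⋃ k ∈ {k : Fin N | k ≠ i ∧ k ≠ P.σ.symm i}, P.arc k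
theorem arc_closed : IsClosed (P.arc i) := by
  refine (isCompact_Icc.image_of_continuousOn ◇).isClosed
  exact (P.diff i).continuousOn.comp continuous_ofReal.continuousOn (P.seg i)
theorem R_closed : IsClosed (P.R i) := by
  exact (Set.toFinite _).isClosed_biUnion fun k _ ↦ P.arc_closed k
theorem B_open : IsOpen (P.VB i) := (P.hU _).preimage bf
theorem B_seg : ∀ x ∈ I01, tC x ∈ P.VB i := fun x hx ↦ by
  simpa [VB] using (P.seg (P.σ.symm i) (1 - x) ⟨by linarith [hx.2], by linarith [hx.1]⟩)
theorem B_diff : DifferentiableOn ℂ (P.B i) (P.VB i) :=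
  (P.diff _).comp bf fun w hw ↦ hw
theorem B_inj : InjOn (P.B i) (P.VB i) := fun w hw w' hw' h ↦ by
  exact sub_right_injective (P.inj _ hw hw' h)
theorem B_zero : pT i 0 = P.B i 0 := by
  have := P.next (P.σ.symm i)
  simp [B, this]
theorem R_not : pT i 0 ∉ P.R i := by
  simp only [R, mem_iUnion, not_exists, not_and, arc, mem_image]
  rintro k ⟨h1, h2⟩ y hy h
  rcases (P.sep i k 0 bs y hy (by simpa using h.symm)) with h | h | h
  · exact h1 h.1.symm
  · simp at h
  · apply h2
    rw [h.2.2]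
    simp
theorem cov : ∀ z ∈ frontier dG, (∃ x ∈ I01, pT i x = z) ∨ (∃ x ∈ I01, P.B i x = z) ∨ z ∈ P.R i := by
  intro z hz
  obtain ⟨k, x, hx, rfl⟩ := (P.cover z).1 hz
  by_cases h1 : k = i
  · subst h1
    exact Or.inl ⟨x, hx, rfl⟩
  by_cases h2 : k = P.σ.symm i
  · subst h2
    refine Or.inr (Or.inl ⟨1 - x, ⟨by linarith [hx.2], by linarith [hx.1]⟩, ◇⟩)
    simp [B]
  · exact Or.inr (Or.inr (mem_biUnion (show k ∈ {k : Fin N | k ≠ i ∧ k ≠ P.σ.symm i} from ⟨h1, h2⟩) ⟨x, hx, rfl⟩))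
theorem corner : ∃ (v : ℂ) (κ m m' A ρ : ℝ), ‖v‖ = 1 ∧ κ ∈ Ioo 0 tp ∧ 0 < m ∧ 0 < m' ∧ 0 < A ∧ deriv (pT i) 0 = m * v ∧
      deriv (P.B i) 0 = m' * (v * exp (κ * I)) ∧
      (((∀ s ∈ Sec A ρ 0 κ, pT i 0 + v * exp s ∈ dG) ∧ (∀ s ∈ Sec A ρ κ tp, pT i 0 + v * exp s ∈ Xt D) ∧ (2 - P.la i) * π = κ) ∨
       ((∀ s ∈ Sec A ρ 0 κ, pT i 0 + v * exp s ∈ Xt D) ∧ (∀ s ∈ Sec A ρ κ tp, pT i 0 + v * exp s ∈ dG) ∧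
      (2 - P.la i) * π = 2 * π - κ)) :=
  cornerData D.isOpen (P.hU i) (P.B_open i) (P.seg i) (P.B_seg i) (P.diff i) (P.B_diff i)
  (P.inj i) (P.B_inj i) (P.B_zero i) (P.R_closed i) (P.R_not i) (P.cov i)
  ⟨mul_pos (by linarith [(P.hla i).2]) pi_pos, by nlinarith [(P.hla i).1, pi_pos]⟩ (P.angle i)
theorem lensAvoid : ∃ ε > 0, ∀ w ∈ lens ε, w ∈ pU i ∧ (IM w ≠ 0 → pT i w ∉ frontier dG) := by
  set Good : ℂ → Prop := fun w ↦ w ∈ pU i ∧ (IM w ≠ 0 → pT i w ∉ frontier dG)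
  have own : ∀ w ∈ pU i, IM w ≠ 0 → ∀ x ∈ I01, pT i x ≠ pT i w := by
    intro w hw hwi x hx h
    rw [← (P.inj i (P.seg i x hx) hw h)] at hwi
    simp at hwi
  suffices h : ∃ ε > 0, ∀ w, RE w ∈ I01 → w ∈ lens ε → Good w by
    obtain ⟨ε, hε, h⟩ := h
    exact ⟨ε, hε, fun w hw ↦ h w ⟨hw.1.le, hw.2.1.le⟩ hw⟩
  have hx1 : ∀ {ε : ℝ} {w : ℂ}, 0 < ε → w ∈ lens ε → |IM w| < ε * RE w := fun {ε w} hε hw ↦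
    hw.2.2.trans_le (by gcongr; nlinarith [hw.1])
  refine isCompact_Icc.induction_on
    ⟨1, one_pos, bs⟩ ◇ ◇ ◇
  · rintro s t hst ⟨ε, hε, h⟩
    exact ⟨ε, hε, fun w hw ↦ h w (hst hw)⟩
  · rintro s t ⟨ε, hε, h⟩ ⟨ε', hε', h'⟩
    refine ⟨min ε ε', bp, fun w hw hwl ↦ ◇⟩
    rcases hw with hw | hw
    · exact h w hw (lens_mono mll hwl)
    · exact h' w hw (lens_mono mlr hwl)
  intro x hx
  rcases eq_or_ne x 0 with rfl | hx0
  · obtain ⟨v, κ, m, m', A, ρ, hv, hκ, hm, hm', -, hda, hdb, -⟩ := P.corner i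
    obtain ⟨ε, hε, δ, hδ, h⟩ := coneAvoid (P.hU i) (P.B_open i) (P.seg i) (P.B_seg i) (P.diff i) (P.B_diff i) (P.B_inj i)
      (P.B_zero i) (norm_ne_zero_iff.1 (by rw [hv]; norm_num)) hm hm' (by rw [abs_of_pos hκ.1]; exact hκ.1)
      (by rw [abs_of_pos hκ.1]; exact hκ.2) hda hdb (P.R_closed i) (P.R_not i)
    refine ⟨Iio δ, mem_nhdsWithin_of_mem_nhds (Iio_mem_nhds hδ), ε, hε, fun w hw hwl ↦ ◇⟩
    obtain ⟨a, b, c⟩ := h w hwl.1 hw (hx1 hε hwl)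
    refine ⟨a, fun hi hf ↦ ◇⟩
    rcases P.cov i _ hf with ⟨y, hy, h⟩ | ⟨y, hy, h⟩ | h
    · exact own w a hi y hy h
    · exact c y hy h
    · exact b h
  rcases eq_or_ne x 1 with rfl | hx1'
  · obtain ⟨v, κ, m, m', A, ρ, hv, hκ, hm, hm', -, hda, hdb, -⟩ := P.corner (pS i)
    have hv0 := norm_ne_zero_iff.1 (by rw [hv]; norm_num)
    obtain ⟨ε, hε, δ, hδ, h⟩ := coneAvoid (P.B_open (pS i)) (P.hU (pS i)) (P.B_seg _) (P.seg _) (P.B_diff _) (P.diff _) (P.inj _)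
      (P.B_zero (pS i)).symm (mul_ne_zero hv0 (exp_ne_zero (κ * I))) hm' hm (by rw [abs_neg, abs_of_pos hκ.1]; exact hκ.1)
      (by rw [abs_neg, abs_of_pos hκ.1]; exact hκ.2) hdb (by rw [hda, mul_assoc, ← exp_add]; simp) (P.R_closed _)
      (by rw [← P.B_zero]; exact P.R_not _)
    refine ⟨Ioi (1 - δ), mem_nhdsWithin_of_mem_nhds (Ioi_mem_nhds bl), ε, hε, fun w hw hwl ↦ ◇⟩
    have hwl' := lens_one_sub hwl
    replace hw : 1 - δ < RE w := hw
    obtain ⟨a, b, c⟩ := h (1 - w) hwl'.1 (by simp; linarith) (hx1 hε hwl')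
    have hBw : P.B (pS i) (1 - w) = pT i w := by simp [B]
    have haU : w ∈ pU i := by simpa [VB] using a
    rw [hBw] at b c
    refine ⟨haU, fun hi hf ↦ ◇⟩
    rcases P.cov (pS i) _ hf with ⟨y, hy, h⟩ | ⟨y, hy, h⟩ | h
    · exact c y hy h
    · refine own w haU hi (1 - y) ⟨by linarith [hy.2], by linarith [hy.1]⟩ ◇
      simp only [B, (bs : P.σ.symm (pS i) = i)] at h
      push_cast
      exact h
    · exact b h
  · have hxn : pT i x ∉ ⋃ k ∈ {k : Fin N | k ≠ i}, P.arc k := by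
      simp only [mem_iUnion, not_exists, not_and, arc, mem_image]
      rintro k hk y hy h
      rcases P.sep i k x hx y hy h.symm with h | h | h
      · exact hk h.1.symm
      · exact hx1' h.1
      · exact hx0 h.1
    have hnh : {w | w ∈ pU i ∧ pT i w ∈ (⋃ k ∈ {k : Fin N | k ≠ i}, P.arc k)ᶜ} ∈ 𝓝 tC x := by
      have hxU := (P.hU i).mem_nhds (P.seg i x hx)
      exact Filter.inter_mem hxU (((P.diff i).differentiableAt hxU).continuousAt.preimage_mem_nhds (((Set.toFinite _).isClosed_biUnion fun k _ ↦ P.arc_closed k).isOpen_compl.mem_nhds hxn))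
    obtain ⟨r, hr, hball⟩ := Metric.mem_nhds_iff.1 hnh
    refine ⟨Ioo (x - r/2) (x + r/2), mem_nhdsWithin_of_mem_nhds (Ioo_mem_nhds bl bl), r, hr, fun w hw hwl ↦ ◇⟩
    have hwb : w ∈ ball tC x r := by
      rw [mem_ball, dist_eq_norm]
      refine (norm_le_abs_re_add_abs_im _).trans_lt ◇
      have h1 : |RE w - x| < r/2 := by
        rw [abs_lt]
        constructor <;> linarith [hw.1, hw.2]
      have h2 : RE w * (1 - RE w) ≤ 1/4 := by nlinarith [sq_nonneg (RE w - 1/2)]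
      have h3 := hwl.2.2
      simp only [sub_re, ofReal_re, sub_im, ofReal_im, sub_zero]
      nlinarith
    obtain ⟨a, b⟩ := hball hwb
    refine ⟨a, fun hi hf ↦ ◇⟩
    obtain ⟨k, y, hy, h⟩ := (P.cover _).1 hf
    by_cases hk : k = i
    · subst hk
      exact own w a hi y hy h
    · exact b (mem_biUnion (show k ∈ {k : Fin N | k ≠ i} from hk) ⟨y, hy, h⟩)
end Pre
theorem fin_bound {N : ℕ} (f : Fin N → ℝ) : ∃ M > 0, ∀ i, f i ≤ M := by
  obtain ⟨M, hM⟩ := (Set.finite_range f).bddAbove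
  exact ⟨max M 1, bp, fun i ↦ (hM ⟨i, rfl⟩).trans (le_max_left _ _)⟩
theorem fin_pos {N : ℕ} (f : Fin N → ℝ) (hf : ∀ i, 0 < f i) : ∃ e > 0, e ≤ 1 ∧ ∀ i, e ≤ f i := by
  obtain ⟨M, hM, h⟩ := fin_bound fun i ↦ (f i)⁻¹
  refine ⟨min M⁻¹ 1, bp, min_le_right _ _, fun i ↦ (mll).trans ◇⟩
  exact inv_le_of_inv_le₀ (hf i) (h i)
theorem lens_half {e : ℝ} (he : 0 < e) : (1/2 + (e/8:ℝ) * I : ℂ) ∈ lens e := by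
  refine ⟨◇, ◇, ◇⟩
  · simp
  · norm_num
  · simp only [add_re, add_im, mul_im, mul_re, ofReal_re, ofReal_im, I_re, I_im]
    rw [show hf2 = ((1/2:ℝ):ℂ) by norm_num, ofReal_re, ofReal_im, abs_of_pos bl]
    linarith
namespace Pre
variable (P : Pre D lam N) (i : Fin N)
local notation "pT" => P.T
local notation "pL" => P.la
def PosC (i : Fin N) : Prop := ∃ (u : ℂ) (m m' A ρ : ℝ), ‖u‖ = 1 ∧ 0 < m ∧ 0 < m' ∧ 0 < A ∧
  deriv (pT i) 0 = m * (u * exp ((pL i * π / 2 : ℝ) * I)) ∧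
  deriv (P.B i) 0 = m' * (u * exp ((-(pL i * π / 2) : ℝ) * I)) ∧
  (∀ s : ℂ, RE s < ρ → |IM s| < pL i * π / 2 - A * rexp RE s → pT i 0 + u * exp s ∈ Xt D) ∧
  (∀ s : ℂ, RE s < ρ → |IM s| < (2 - pL i) * π / 2 - A * rexp RE s → pT i 0 - u * exp s ∈ dG)
theorem orient : ∃ ε > 0, ε ≤ 1 ∧ (∀ i, lens ε ⊆ P.U i) ∧
    ((∀ i, (∀ w ∈ lens ε, 0 < IM w → pT i w ∈ dG) ∧ (∀ w ∈ lens ε, IM w < 0 → pT i w ∈ Xt D) ∧ P.PosC i) ∨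
     (∀ i, (∀ w ∈ lens ε, 0 < IM w → pT i w ∈ Xt D) ∧ (∀ w ∈ lens ε, IM w < 0 → pT i w ∈ dG))) := by
  choose e he hl using P.lensAvoid
  obtain ⟨ε, hε, hε1, hee⟩ := fin_pos e he
  have hU : ∀ i, lens ε ⊆ P.U i := fun i w hw ↦ (hl i w (lens_mono (hee i) hw)).1
  refine ⟨ε, hε, hε1, hU, ◇⟩
  have hside : ∀ i, ∀ τ, (∀ w ∈ {w | w ∈ lens ε ∧ 0 < τ * IM w}, pT i w ∈ dG) ∨
      (∀ w ∈ {w | w ∈ lens ε ∧ 0 < τ * IM w}, pT i w ∈ Xt D) := fun i τ ↦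
    side D.isOpen (halflens_convex hε.le τ).isPreconnected ((P.diff i).continuousOn.mono fun w hw ↦ hU i hw.1) fun w hw ↦
      (hl i w (lens_mono (hee i) hw.1)).2 fun h ↦ by have := hw.2; rw [h] at this; simp at this
  have hex : ∀ z, z ∈ dG → z ∈ Xt D → False := fun z h1 h2 ↦ h2 (subset_closure h1)
  have inG : ∀ i τ w, w ∈ lens ε → 0 < τ * IM w → pT i w ∈ dG → ∀ w ∈ lens ε, 0 < τ * IM w → pT i w ∈ dG := by
    intro i τ w hw h1 h2 w' hw' h1'
    rcases hside i τ with h | h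
    · exact h w' ⟨hw', h1'⟩
    · exact (hex _ h2 (h w ⟨hw, h1⟩)).elim
  have inO : ∀ i τ w, w ∈ lens ε → 0 < τ * IM w → pT i w ∈ Xt D → ∀ w ∈ lens ε, 0 < τ * IM w → pT i w ∈ Xt D := by
    intro i τ w hw h1 h2 w' hw' h1'
    rcases hside i τ with h | h
    · exact (hex _ (h w ⟨hw, h1⟩) h2).elim
    · exact h w' ⟨hw', h1'⟩
  have dich : ∀ i, ((∀ w ∈ lens ε, 0 < IM w → pT i w ∈ dG) ∧ (∀ w ∈ lens ε, IM w < 0 → pT i w ∈ Xt D) ∧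
      (∀ w ∈ lens ε, 0 < IM w → pT (P.σ.symm i) w ∈ dG) ∧ P.PosC i) ∨
      ((∀ w ∈ lens ε, 0 < IM w → pT i w ∈ Xt D) ∧ (∀ w ∈ lens ε, IM w < 0 → pT i w ∈ dG) ∧
      (∀ w ∈ lens ε, 0 < IM w → pT (P.σ.symm i) w ∈ Xt D)) := by
    intro i
    have h0a : 0 ∈ P.U i := by simpa using P.seg i 0 bs
    have h0b : 0 ∈ P.VB i := by simpa using P.B_seg i 0 bs
    obtain ⟨v, κ, m, m', A, ρ, hv, hκ, hm, hm', hA, hda, hdb, ⟨h1, h2, h3⟩ | ⟨h1, h2, h3⟩⟩ := P.corner i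
    · obtain ⟨⟨w1, a1, a2, a3, a4, a5⟩, ⟨w2, b1, b2, b3, b4, b5⟩, ⟨w3, c1, c2, c3, c4, c5⟩, -⟩ :=
        sides (P.hU i) (P.B_open i) h0a h0b (P.diff i) (P.B_diff i) (P.B_zero i) hv hm hm' hκ hda hdb h1 h2 hε
      refine Or.inl ⟨fun w hw hi ↦ inG i 1 w1 ⟨a1, bl, a3⟩ bl a5 w hw bl,
        fun w hw hi ↦ inO i (-1) w2 ⟨b1, bl, b3⟩ bl b5 w hw bl,
        fun w hw hi ↦ inG _ 1 _ (lens_one_sub ⟨c1, bl, c3⟩) (by simp; linarith) c5 w hw bl, ◇⟩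
      have hκI : tC κ = (2 - pL i) * π := by
        rw [← h3]
        push_cast
        ring
      have epi := exp_pi_mul_I
      refine ⟨-v * exp ((κ/2:ℝ) * I), m, m', A, ρ, ◇, hm, hm', hA, ◇, ◇, ◇, ◇⟩
      · rw [norm_mul, norm_neg, hv, norm_exp_ofReal_mul_I, one_mul]
      · rw [hda, mul_assoc _, ← exp_add, show ((κ/2:ℝ) * I + (pL i * π / 2 : ℝ) * I : ℂ) = π * I by
          push_cast; rw [hκI]; ring, epi]; ring
      · rw [hdb, mul_assoc _, ← exp_add, show ((κ/2:ℝ) * I + (-(pL i * π / 2) : ℝ) * I : ℂ) = κ * I - π * I by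
          push_cast; rw [hκI]; ring, exp_sub, epi]; ring
      · intro s hs hsi
        have := h2 (s + ((κ/2 + π : ℝ) * I)) ⟨by simpa using hs, by
          simp; rw [abs_lt] at hsi; nlinarith, by simp; rw [abs_lt] at hsi; nlinarith⟩
        convert! this using 2
        push_cast
        rw [add_mul, exp_add s, exp_add, epi]
        ring
      · intro s hs hsi
        have := h1 (s + ((κ/2 : ℝ) * I)) ⟨by simpa using hs, by
          simp; rw [abs_lt] at hsi; nlinarith, by simp; rw [abs_lt] at hsi; nlinarith⟩
        rw [exp_add] at this
        rwa [show pT i 0 - -v * exp ((κ/2:ℝ) * I) * exp s = pT i 0 + v * (exp s * exp ((κ/2:ℝ) * I)) by ring]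
    · obtain ⟨⟨w1, a1, a2, a3, a4, a5⟩, ⟨w2, b1, b2, b3, b4, b5⟩, ⟨w3, c1, c2, c3, c4, c5⟩, -⟩ :=
        sides (P.hU i) (P.B_open i) h0a h0b (P.diff i) (P.B_diff i) (P.B_zero i) hv hm hm' hκ hda hdb h1 h2 hε
      exact Or.inr ⟨fun w hw hi ↦ inO i 1 w1 ⟨a1, bl, a3⟩ bl a5 w hw bl,
        fun w hw hi ↦ inG i (-1) w2 ⟨b1, bl, b3⟩ bl b5 w hw bl,
        fun w hw hi ↦ inO _ 1 _ (lens_one_sub ⟨c1, bl, c3⟩) (by simp; linarith) c5 w hw bl⟩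
  by_cases hne : ∃ i, ∀ w ∈ lens ε, 0 < IM w → pT i w ∈ dG
  · obtain ⟨i0, hi0⟩ := hne
    have hw0 := lens_half hε
    have hw0' : 0 < (1/2 + (ε/8:ℝ) * I : ℂ).im := by
      simp
      linarith
    have := P.trans (fun i ↦ ∀ w ∈ lens ε, 0 < IM w → pT i w ∈ dG) (by
      intro j hj
      rcases dich _ with h | h
      · exact h.1
      · have h3 := h.2.2 _ hw0 hw0'
        simp only [Equiv.symm_apply_apply] at h3
        exact (hex _ (hj _ hw0 hw0') h3).elim) i0
    left
    intro i
    rcases dich i with h | h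
    · exact ⟨h.1, h.2.1, h.2.2.2⟩
    · exact (hex _ (this i hi0 _ hw0 hw0') (h.1 _ hw0 hw0')).elim
  · right
    intro i
    rcases dich i with h | h
    · exact (hne ⟨i, h.1⟩).elim
    · exact ⟨h.1, h.2.1⟩
def rev : Pre D lam N where
  T i := fun w ↦ pT i (1 - w)
  U i := (fun w ↦ 1 - w) ⁻¹' P.U i
  hU i := (P.hU i).preimage bf
  seg i x hx := by
    have := P.seg i (1 - x) ⟨by linarith [hx.2], by linarith [hx.1]⟩
    simpa using this
  diff i := (P.diff _).comp bf fun w hw ↦ hw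
  inj i := fun w hw w' hw' h ↦ by
    have := P.inj _ hw hw' h
    exact sub_right_injective this
  σ := P.σ.symm
  next i := by
    have := P.next (P.σ.symm i)
    simp at this
    simp [this]
  sep i j x hx y hy h := by
    have := P.sep i j (1 - x) ⟨by linarith [hx.2], by linarith [hx.1]⟩ (1 - y) ⟨by linarith [hy.2], by linarith [hy.1]⟩ (by
      push_cast; exact h)
    rcases this with h | h | h
    · exact Or.inl ⟨h.1, bl⟩
    · exact Or.inr (Or.inr ⟨ bl, bl, by rw [h.2.2]; simp⟩)
    · exact Or.inr (Or.inl ⟨ bl, bl, by rw [h.2.2]; simp⟩)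
  cover z := by
    rw [P.cover z]
    constructor <;> rintro ⟨i, x, hx, h⟩ <;>
      exact ⟨i, 1 - x, ⟨by linarith [hx.2], by linarith [hx.1]⟩, by simpa using h⟩
  integral u hu := by
    rw [P.integral u hu]
    refine sum_congr rfl fun i _ ↦ ◇
    have := integral_comp_sub_left (fun x : ℝ ↦ (‖deriv (pT i) x‖ : ℂ) * u (pT i x)) (a := 0) (b := 1) 1
    simp only [sub_self, sub_zero] at this
    rw [← this]
    congr 1
    ext x
    have : deriv (fun w ↦ pT i (1 - w)) x = - deriv (pT i) (1 - x) := deriv_comp_const_sub (pT i) 1 tC x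
    rw [this, norm_neg]
    push_cast
    rfl
  trans Q hQ i j hi := by
    by_contra hj
    exact P.trans (fun i ↦ ¬ Q i) (fun k hk h ↦ hk (by simpa using hQ _ h)) j i hj hi
  la i := pL (P.σ i)
  hla i := P.hla _
  hlam i := P.hlam _
  angle i := by
    have := P.angle (P.σ i)
    rw [← P.next] at this
    simpa using this
theorem exists_oriented (P : Pre D lam N) : ∃ P' : Pre D lam N, ∃ ε > 0, ε ≤ 1 ∧ (∀ i, lens ε ⊆ P'.U i) ∧
    ((∀ i, (∀ w ∈ lens ε, 0 < IM w → P'.T i w ∈ dG) ∧ (∀ w ∈ lens ε, IM w < 0 → P'.T i w ∈ Xt D) ∧ P'.PosC i)) := by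
  obtain ⟨ε, hε, h1, h2, h | h⟩ := P.orient
  · exact ⟨P, ε, hε, h1, h2, h⟩
  obtain ⟨ε', hε', h1', h2', h' | h'⟩ := P.rev.orient
  · exact ⟨P.rev, ε', hε', h1', h2', h'⟩
  rcases isEmpty_or_nonempty _ with hN | ⟨⟨i⟩⟩
  · exact ⟨P, ε, hε, h1, h2, fun i ↦ hN.elim i⟩
  set e := min ε ε'
  have he : 0 < e := bp
  have hw0 := lens_half he
  have hw0' : 0 < (1/2 + (e/8:ℝ) * I : ℂ).im := by
    simp
    linarith
  have a2 := (h' i).2 _ (lens_mono mlr (lens_one_sub hw0)) (by simp; linarith)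
  simp only [rev, sub_sub_cancel] at a2
  exact (((h i).1 _ (lens_mono mll hw0) hw0') (subset_closure a2)).elim
end Pre
structure Chain (D : JordanDomain) (lam : ℝ) (N : ℕ) extends Pre D lam N where
  ε : ℝ
  hε : 0 < ε
  hε1 : ε ≤ 1
  lU : ∀ i, lens ε ⊆ U i
  up : ∀ i, ∀ w ∈ lens ε, 0 < IM w → T i w ∈ D.G
  lo : ∀ i, ∀ w ∈ lens ε, IM w < 0 → T i w ∈ Xt D
  u : Fin N → ℂ
  hu : ∀ i, ‖u i‖ = 1
  A : ℝ
  hA : 0 < A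
  ρ : ℝ
  exS : ∀ i, ∀ s : ℂ, RE s < ρ → |IM s| < la i * π / 2 - A * rexp RE s → T i 0 + u i * exp s ∈ Xt D
  inS : ∀ i, ∀ s : ℂ, RE s < ρ → |IM s| < (2 - la i) * π / 2 - A * rexp RE s → T i 0 - u i * exp s ∈ D.G
  d0 : ∀ i, ∃ m : ℝ, 0 < m ∧ deriv (T i) 0 = m * (u i * exp ((la i * π / 2 : ℝ) * I))
  d1 : ∀ i, ∃ m : ℝ, 0 < m ∧ deriv (toPre.B i) 0 = m * (u i * exp ((-(la i * π / 2) : ℝ) * I))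
theorem exists_chain (P : Pre D lam N) : Nonempty (Chain D lam N) := by
  obtain ⟨P', ε, hε, hε1, hU, h⟩ := P.exists_oriented
  choose h1 h2 u m m' A ρ hu hm hm' hA hd hd' he hi using h
  obtain ⟨A0, hA0, hA'⟩ := fin_bound A
  obtain ⟨ρ0, -, hρ⟩ := fin_bound fun i ↦ - ρ i
  exact ⟨⟨P', ε, hε, hε1, hU, h1, h2, u, hu, A0, hA0, -ρ0,
    fun i s hs hs2 ↦ he i s (by linarith [hρ i]) (hs2.trans_le (by gcongr; exact hA' i)),
    fun i s hs hs2 ↦ hi i s (by linarith [hρ i]) (hs2.trans_le (by gcongr; exact hA' i)),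
    fun i ↦ ⟨m i, hm i, hd i⟩, fun i ↦ ⟨m' i, hm' i, hd' i⟩⟩⟩
section conf
variable {G : Set ℂ} {φ : CC} {ζ : ℂ}
theorem conf_inv (hG : IsOpen G) (hφ : ConformalOnto G φ ζ) : ∃ ψ : CC, DifferentiableOn ℂ ψ (ball 0 1) ∧
    MapsTo ψ (ball 0 1) G ∧ (∀ z ∈ G, ψ (φ z) = z) ∧ (∀ w ∈ ball tC 0 1, φ (ψ w) = w) ∧ ∀ z ∈ G, deriv φ z ≠ 0 := by
  have hinv : ∀ z ∈ G, invFunOn φ G _ = z := fun z hz ↦ hφ.bijOn.injOn.leftInvOn_invFunOn hz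
  have key := fun z (hz : z ∈ G) ↦ inj_inverse hG (fun z hz ↦ (hφ.differentiable z hz).differentiableWithinAt) hinv hz
  refine ⟨invFunOn φ G, ◇, ◇, hinv, ◇, fun z hz ↦ (key z hz).1⟩
  · intro w hw
    obtain ⟨z, hz, rfl⟩ := hφ.bijOn.surjOn hw
    exact (key z hz).2.1.differentiableAt.differentiableWithinAt
  · exact hφ.bijOn.surjOn.mapsTo_invFunOn
  · exact fun w hw ↦ hφ.bijOn.surjOn.rightInvOn_invFunOn hw
theorem conf_prim (hG : IsOpen G) (hφ : ConformalOnto G φ ζ) {h : CC} (hh : DifferentiableOn ℂ h G) :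
    ∃ H : CC, ∀ z ∈ G, HasDerivAt H (h z) z := by
  obtain ⟨ψ, h1, h2, h3, h4, h5⟩ := conf_inv hG hφ
  obtain ⟨K, hK⟩ := primConvex (convex_ball 0 1) isOpen_ball (f := fun w ↦ h _ * deriv ψ w)
    ((hh.comp h1 h2).mul (h1.deriv isOpen_ball))
  refine ⟨fun z ↦ K (φ z), fun z hz ↦ ◇⟩
  have hb := hφ.bijOn.mapsTo hz
  have e2 := ((h1.differentiableAt (isOpen_ball.mem_nhds hb)).hasDerivAt).comp z (hφ.differentiable z hz).hasDerivAt
  have e3 := (hasDerivAt_id z).congr_of_eventuallyEq (by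
    filter_upwards [hG.mem_nhds hz] with y hy using h3 y hy)
  have e4 := e2.unique e3
  convert! ((hK _ hb).comp z (hφ.differentiable z hz).hasDerivAt) using 1
  rw [mul_assoc, e4, h3 z hz, mul_one]
theorem conf_sqrt (hG : IsOpen G) (hφ : ConformalOnto G φ ζ) : ∃ f : CC, DifferentiableOn ℂ f G ∧ ∀ z ∈ G, f z ^ 2 = deriv φ z := by
  obtain ⟨ψ, h1, h2, h3, h4, h5⟩ := conf_inv hG hφ
  have hd : DifferentiableOn ℂ φ G := fun z hz ↦ (hφ.differentiable z hz).differentiableWithinAt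
  obtain ⟨s, hs, hs2⟩ := sqrtConvex (convex_ball 0 1) isOpen_ball (f := fun w ↦ deriv φ _) ((hd.deriv hG).comp h1 h2)
    (fun w hw ↦ h5 _ (h2 hw))
  refine ⟨fun z ↦ s _, hs.comp hd hφ.bijOn.mapsTo, fun z hz ↦ ◇⟩
  rw [hs2 _ (hφ.bijOn.mapsTo hz), h3 z hz]
theorem conf_cpt (hG : IsOpen G) (hφ : ConformalOnto G φ ζ) {r : ℝ} (hr : r < 1) : ∃ K ⊆ G, IsCompact K ∧ ∀ z ∈ G, z ∉ K → r < ‖φ z‖ := by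
  obtain ⟨ψ, h1, h2, h3, h4, h5⟩ := conf_inv hG hφ
  have hsub : closedBall tC 0 r ⊆ ball 0 1 := closedBall_subset_ball hr
  refine ⟨ψ '' closedBall 0 r, (h2.mono_left hsub).image_subset, (isCompact_closedBall _ _).image_of_continuousOn (h1.continuousOn.mono hsub), ◇⟩
  intro z hz hzK
  by_contra hc
  exact hzK ⟨φ z, by simpa using hc, h3 z hz⟩
theorem conf_near (hG : IsOpen G) (hφ : ConformalOnto G φ ζ) {r : ℝ} (hr : r < 1) {b : ℂ} (hb : b ∉ G) :
    ∀ᶠ z in 𝓝 b, z ∈ G → r < ‖φ z‖ := by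
  obtain ⟨K, hK, hKc, h⟩ := conf_cpt hG hφ hr
  filter_upwards [hKc.isClosed.isOpen_compl.mem_nhds (fun hb' ↦ hb (hK hb'))] with z hz hzG using h z hzG hz
theorem conf_lt (hφ : ConformalOnto G φ ζ) {z : ℂ} (hz : z ∈ G) : ‖φ z‖ < 1 := by simpa using hφ.bijOn.mapsTo hz
end conf
theorem exp_ball {s : ℂ} {d : ℂ} {c : ℝ} (hc : c ≤ 1/2) (hd : ‖d‖ ≤ c * rexp RE s) :
    ∃ s' : ℂ, exp s + d = exp s' ∧ ‖s' - s‖ ≤ 3/2 * c := by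
  have h1 : ‖d / exp s‖ ≤ c := by
    rwa [norm_div, norm_exp, div_le_iff₀ (exp_pos _)]
  refine ⟨s + log (1 + d / exp s), ◇, ◇⟩
  · rw [exp_add, exp_log]
    · field_simp
    · intro h
      have : ‖d / exp s‖ = 1 := by
        rw [show d / exp s = -1 by linear_combination h]
        simp
      linarith
  · rw [add_sub_cancel_left]
    exact (norm_log_one_add_half_le_self (h1.trans hc)).trans (by gcongr)
theorem trig_core {a : ℝ} (ha0 : 0 < a) (ha2 : a < 2) : ∃ c > 0, ∃ d0 > 0, d0 ≤ 1 ∧ ∀ y : ℝ,  |π/2 - abs y| ≤ d0 →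
    rcos (opp a * y) ≤ -c := by
  have hpi := pi_pos
  have hcont : ContinuousAt (fun t ↦ rcos (opp a * t)) (π/2) := bf
  have h0 : rcos (opp a * (π/2)) < 0 := by
    apply Real.cos_neg_of_pi_div_two_lt_of_lt <;> nlinarith
  set c := -rcos (opp a * (π/2)) / 2 with hc
  have hev := hcont.eventually_lt continuousAt_const (show rcos (opp a * (π/2)) < -c by linarith)
  obtain ⟨d, hd, h⟩ := Metric.eventually_nhds_iff_ball.1 hev
  refine ⟨c, bl, min (d/2) 1, bp, min_le_right _ _, fun y hy ↦ ◇⟩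
  have := h |y| (by rw [mem_ball, Real.dist_eq, abs_sub_comm]; linarith [min_le_left (d/2) 1])
  rw [show opp a * |y| = |opp a * y| by rw [abs_mul, abs_of_pos (by linarith : 0 < 1 + a/2)], cos_abs] at this
  exact this.le
theorem re_exp_mul (k : ℝ) (s : ℂ) : (exp (k * s)).re = rexp (k * RE s) * rcos (k * IM s) := by
  rw [exp_re]
  simp
theorem barrier_int {a A : ℝ} (ha0 : 0 < a) (ha2 : a < 2) (hA : 0 < A) : ∃ ρ0 < 0, ∃ c > 0, ∀ s : ℂ, RE s < ρ0 + 1 →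
    |IM s| ≤ a * π / 2 + A * rexp RE s → c * rexp ((1/a + 1/2) * RE s) ≤
      (exp ((1/a:ℝ) * s) - exp ((1/a + 1/2:ℝ) * s)).re := by
  have hpi := pi_pos
  obtain ⟨c1, hc1, d0, hd0, hd1, htr⟩ := trig_core ha0 ha2
  have hsd := sin_pos_of_pos_of_lt_pi hd0 (by linarith [pi_gt_three])
  set q0 := min (min hf2 (rsin d0/2)) (min (c1 * a / (2*A)) (d0 * a / A))
  have hq00 : 0 < q0 := bp
  have b1 : q0 ≤ 1/2 := (mll).trans mll
  have b2 : q0 ≤ rsin d0/2 := (mll).trans mlr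
  have b3 : q0 ≤ c1 * a / (2*A) := (mlr).trans mll
  have b4 : q0 ≤ d0 * a / A := (mlr).trans mlr
  refine ⟨2 * rlog q0 - 1, ◇, min (c1/2) 1, bp, fun s hs him ↦ ◇⟩
  · have := log_neg hq00 bl
    linarith
  set q := rexp (RE s/2) with hq
  have hqp : 0 < q := exp_pos _
  have hqq : q < q0 := by
    rw [hq, ← lt_log_iff_exp_lt hq00]
    linarith
  have hr : rexp RE s = q * q := by
    rw [hq, ← rea]
    ring_nf
  rw [sub_re, re_exp_mul, re_exp_mul, add_mul _, rea, show (1/2 * RE s) = RE s/2 by ring, ← hq]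
  set y := 1/a * IM s with hy
  have hyy : (1/a + 1/2) * IM s = opp a * y := by
    rw [hy]
    field_simp
  rw [hyy]
  set P := rexp (1/a * RE s)
  have hP : 0 < P := exp_pos _
  suffices h : min (c1/2) 1 * q ≤ rcos y - q * rcos (opp a * y) by nlinarith
  have hyabs : |y| ≤ π/2 + A/a * (q*q) := by
    rw [hy, abs_mul, abs_of_pos (by positivity : 0 < 1/a)]
    calc 1/a * |IM s| ≤ 1/a * (a * π/2 + A * rexp RE s) := by gcongr
      _ = _ := by rw [hr]; field_simp
  have hAq : A/a * (q*q) ≤ c1/2 * q := by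
    have : A/a * q ≤ c1/2 := by
      calc A/a * q ≤ A/a * (c1 * a/(2*A)) := by gcongr; linarith
        _ = c1/2 := by field_simp
    nlinarith
  have hAd : A/a * (q*q) ≤ d0 := by
    have : A/a * q ≤ d0 := by
      calc A/a * q ≤ A/a * (d0 * a/A) := by gcongr; linarith
        _ = d0 := by field_simp
    nlinarith
  rw [← cos_abs y, show rcos |y| = rsin (π/2 - |y|) by rw [Real.sin_pi_div_two_sub]]
  have hm1 := min_le_left (c1/2) 1
  have hm2 := min_le_right (c1/2) 1
  by_cases hd : π/2 - |y| ≤ d0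
  · have h1 := htr y (abs_le.2 ⟨ bl, hd⟩)
    have h2 : -(A/a*(q*q)) ≤ rsin (π/2 - |y|) := by
      by_cases h0 : 0 ≤ π/2 - |y|
      · have := Real.sin_nonneg_of_nonneg_of_le_pi h0 (by linarith [abs_nonneg y])
        have : 0 ≤ A/a*(q*q) := bp
        linarith
      · have := sin_lt (x := |y| - π/2) bl
        rw [show π/2 - |y| = -(|y| - π/2) by ring, Real.sin_neg]
        linarith
    nlinarith
  · have h1 : rsin d0 ≤ rsin (π/2 - |y|) := Real.sin_le_sin_of_le_of_le_pi_div_two bl (by linarith [abs_nonneg y]) bl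
    have h2 := cos_le_one (opp a * y)
    nlinarith
set_option maxHeartbeats 800000 in
theorem barrier_ext {a A : ℝ} (ha0 : 0 < a) (ha2 : a < 2) (hA : 0 < A) : ∃ ρ0 < 0, ∃ c > 0, ∀ s : ℂ, RE s < ρ0 + 1 →
    |IM s| < a * π / 2 → 0 < (exp ((1/a:ℝ) * s) + exp ((1/a + 1/2:ℝ) * s)).re →
    2 * A * rexp RE s ≤ a * π/2 - |IM s| ∧ c * rexp (RE s/2) ≤ a * π/2 - |IM s| ∧
    c * (exp ((1/a:ℝ) * s) + exp ((1/a + 1/2:ℝ) * s)).re ≤ rexp (1/a * RE s) * (a * π/2 - |IM s|) := by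
  obtain ⟨c1, hc1, d0, hd0, hd1, htr⟩ := trig_core ha0 ha2
  set k := min c1 d0
  set q0 := min hf2 (a * k / (2*A))
  have hq00 : 0 < q0 := bp
  have b1 : q0 ≤ 1/2 := min_le_left _ _
  have b3 : q0 ≤ a * k / (2*A) := min_le_right _ _
  refine ⟨2 * rlog q0 - 1, ◇, min (a * k) (a * d0/2), bp, fun s hs him hpos ↦ ◇⟩
  · have := log_neg hq00 bl
    linarith
  set q := rexp (RE s/2) with hq
  have hqp : 0 < q := exp_pos _
  have hqq : q < q0 := by
    rw [hq, ← lt_log_iff_exp_lt hq00]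
    linarith
  have hr : rexp RE s = q * q := by
    rw [hq, ← rea]
    ring_nf
  rw [add_re, re_exp_mul, re_exp_mul, add_mul _, rea, show (1/2 * RE s) = RE s/2 by ring, ← hq] at hpos ⊢
  set y := 1/a * IM s with hy
  have hyy : (1/a + 1/2) * IM s = opp a * y := by
    rw [hy]
    field_simp
  rw [hyy] at hpos ⊢
  set P := rexp (1/a * RE s)
  have hP : 0 < P := exp_pos _
  have hpos' : 0 < rcos y + q * rcos (opp a * y) := by
    by_contra hc
    push Not at hc
    nlinarith
  have hyabs : a * |y| = |IM s| := by
    rw [hy, abs_mul, abs_of_pos (by positivity : 0 < 1/a)]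
    field_simp
  have hd : 0 < π/2 - |y| := by
    have : a * |y| < a * (π/2) := by
      rw [hyabs]
      linarith
    linarith [lt_of_mul_lt_mul_left this ha0.le]
  have hgap : a * π/2 - |IM s| = a * (π/2 - |y|) := by
    rw [← hyabs]
    ring
  rw [hgap]
  rw [← cos_abs y, show rcos |y| = rsin (π/2 - |y|) by rw [Real.sin_pi_div_two_sub]] at hpos' ⊢
  set d := π/2 - |y| with hddef
  have hsin := sin_lt hd
  have hkd : k * q ≤ d := by
    by_cases hdd : d ≤ d0
    · have h1 := htr y (abs_le.2 ⟨ bl, hdd⟩)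
      have : k ≤ c1 := min_le_left _ _
      nlinarith
    · have : k ≤ d0 := min_le_right _ _
      nlinarith
  refine ⟨◇, ◇, ◇⟩
  · have h3 : q ≤ a * k/(2*A) := bl
    rw [le_div_iff₀ bp] at h3
    rw [hr]
    nlinarith
  · calc min (a*k) _ * q ≤ a * k * q := by gcongr; exact min_le_left _ _
      _ ≤ a * d := by rw [mul_assoc]; gcongr
  · have hS : rsin d + q * rcos (opp a*y) ≤ 2/d0 * d := by
      by_cases hdd : d ≤ d0
      · have h1 := htr y (abs_le.2 ⟨ bl, hdd⟩)
        have : 1 * d ≤ 2/d0 * d := by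
          gcongr
          rw [le_div_iff₀ hd0]
          linarith
        have : q * rcos (opp a*y) ≤ 0 := mul_nonpos_of_nonneg_of_nonpos hqp.le bl
        linarith
      · have h1 := Real.sin_le_one d
        have h2 := cos_le_one (opp a*y)
        have : 2 ≤ 2/d0 * d := by
          rw [div_mul_eq_mul_div, le_div_iff₀ hd0]
          nlinarith
        have : q * rcos (opp a*y) ≤ q * 1 := by gcongr
        linarith
    calc min (a*k) _ * (P * rsin d + P * q * rcos ((1+a/2)*y))
        = P * (min (a*k) _ * (rsin d + q * rcos ((1+a/2)*y))) := by ring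
      _ ≤ P * (a*d0/2 * (2/d0*d)) := by
          gcongr
          · exact min_le_right _ _
      _ = P * (a * d) := by field_simp
namespace Chain
variable (C : Chain D lam N) (i : Fin N)
local notation "cT" => C.T
local notation "cU" => C.u
local notation "cL" => C.la
local notation "cA" => C.A
theorem corner_fr : cT i 0 ∈ frontier dG := (C.cover _).2 ⟨i, 0, bs, bs⟩
theorem corner_notG : cT i 0 ∉ dG := fun h ↦ by
  have := C.corner_fr i
  rw [D.isOpen.frontier_eq] at this
  exact this.2 h
theorem exS' {s : ℂ} (hs : RE s < C.ρ) (h1 : (2 - cL i) * π / 2 + cA * rexp RE s < |IM s|) (h2 : |IM s| ≤ π) :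
    cT i 0 - cU i * exp s ∉ dG := by
  obtain ⟨s', e1, e2, e3⟩ : ∃ s' : ℂ, exp s' = - exp s ∧ s'.re = RE s ∧ |s'.im| = π - |IM s| := by
    rcases le_total 0 IM s with h | h
    · refine ⟨s - π * I, by rw [exp_sub, exp_pi_mul_I]; ring, bs, ◇⟩
      rw [abs_of_nonneg h] at h2 ⊢
      simp only [sub_im, mul_im, ofReal_re, I_im, ofReal_im]
      rw [abs_of_nonpos] <;> linarith
    · refine ⟨s + π * I, by rw [exp_add, exp_pi_mul_I]; simp, bs, ◇⟩
      rw [abs_of_nonpos h] at h2 ⊢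
      simp only [add_im, mul_im, ofReal_re, I_im, ofReal_im]
      rw [abs_of_nonneg] <;> linarith
  have := C.exS i s' (by rw [e2]; exact hs) (by rw [e2, e3]; linarith)
  rw [e1] at this
  exact fun hG ↦ this (subset_closure (by rwa [mul_neg, ← sub_eq_add_neg]))
variable {φ : CC} {ζ : ℂ}
theorem phi_low (hφ : ConformalOnto dG φ ζ) (i : Fin N) : ∃ M > 0, ∃ δ > 0, ∀ t ∈ dG, ‖t - cT i 0‖ < δ →
    rexp (-(M * ‖t - cT i 0‖ ^ (1/(2 - cL i)))) ≤ ‖φ t‖ := by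
  set a := 2 - cL i with ha
  set z := cT i 0 with hz
  have ha2 : a < 2 := by linarith [(C.hla i).1]
  obtain ⟨ρ0, hρ0, c, hc, hbar⟩ := barrier_int (by linarith [(C.hla i).2]) ha2 C.hA
  have hu0 : cU i ≠ 0 := by
    rw [← norm_ne_zero_iff, C.hu i]
    norm_num
  have hnear : ∀ r < 1, ∃ d > 0, ∀ t ∈ dG, ‖t - z‖ < d → r < ‖φ t‖ := fun r hr ↦ by
    obtain ⟨d, hd, h⟩ := Metric.eventually_nhds_iff_ball.1 (conf_near D.isOpen hφ hr (C.corner_notG i))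
    exact ⟨d, hd, fun t ht h' ↦ h t (by rwa [mem_ball, dist_eq_norm]) ht⟩
  obtain ⟨d, hd, hd2⟩ := hnear hf2 bn
  set ρ1 := min (min ρ0 (C.ρ - 1)) (min (rlog d) (rlog (cL i * π / (4 * cA))))
  have r1 : ρ1 ≤ ρ0 := (mll).trans mll
  have r2 : ρ1 ≤ C.ρ - 1 := (mll).trans mlr
  have r3 : rexp ρ1 ≤ d := by
    rw [← le_log_iff_exp_le hd]
    exact (mlr).trans mll
  have hq : 0 < cL i * π / (4 * cA) := by
    have := (C.hla i).1
    have := C.hA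
    positivity
  have r4 : rexp ρ1 ≤ cL i * π / (4 * cA) := by
    rw [← le_log_iff_exp_le hq]
    exact (mlr).trans mlr
  rw [le_div_iff₀ (by have := C.hA; positivity)] at r4
  have hnorm : ∀ s, ‖z - cU i * exp s - z‖ = rexp RE s := fun s ↦ by
    rw [sub_sub_cancel_left, norm_neg, norm_mul, C.hu i, one_mul, norm_exp]
  have himG : ∀ s, RE s ≤ ρ1 → |IM s| ≤ π → z - cU i * exp s ∈ dG → |IM s| ≤ a * π/2 + cA * rexp RE s := by
    intro s h1 h2 h3
    by_contra hc
    push Not at hc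
    exact C.exS' i bl hc h2 h3
  have hne : ∀ s, RE s ≤ ρ1 → |IM s| ≤ π → z - cU i * exp s ∈ dG → |IM s| < π := by
    intro s h1 h2 h3
    have h4 := himG s h1 h2 h3
    have h5 : cA * rexp RE s ≤ cA * rexp ρ1 := by
      have := C.hA
      gcongr
    have := mul_pos (C.hla i).1 pi_pos
    rw [ha] at h4
    linarith
  set V : CC := fun s ↦ exp ((1/a:ℝ) * s) - exp ((1/a + 1/2:ℝ) * s)
  set v := c * rexp ((1/a + 1/2) * ρ1) with hv
  have hv0 : 0 < v := bp
  set K := 2 * rlog 2 / v with hK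
  have hK0 : 0 < K := div_pos (mul_pos two_pos (log_pos bn)) hv0
  set S : Set ℂ := {s | RE s < ρ1 ∧ |IM s| < π ∧ z - cU i * exp s ∈ dG} with hS
  have hSo : IsOpen S := (isOpen_lt continuous_re continuous_const).inter
    ((isOpen_lt continuous_im.abs continuous_const).inter (D.isOpen.preimage bf))
  have hVpos : ∀ s ∈ S, 0 < (V s).re := fun s hs ↦ lt_of_lt_of_le bp
    (hbar s (by linarith [hs.1]) (himG s hs.1.le hs.2.1.le hs.2.2))
  have hhalf : ∀ s ∈ S, 1/2 < ‖φ (z - cU i * exp s)‖ := fun s hs ↦ hd2 _ hs.2.2 (by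
    rw [hnorm]; exact (Real.exp_lt_exp.2 hs.1).trans_le r3)
  have hψn : ∀ s, ‖(φ (z - cU i * exp s) * exp (K * V s))⁻¹‖ = ‖φ (z - cU i * exp s)‖⁻¹ * rexp (-(K * (V s).re)) := fun s ↦ by
    rw [norm_inv, norm_mul, norm_exp, mul_inv, Real.exp_neg]
    simp
  have hbig : ∀ e > 0, ∃ d > 0, ∀ s ∈ S, ∀ x : ℝ, x < ‖φ (z - cU i * exp s)‖ → 1/(1+e) ≤ x →
      ‖(φ (z - cU i * exp s) * exp (K * V s))⁻¹‖ ≤ 1 + e := fun e he ↦ ⟨1, one_pos, fun s hs x hx hx2 ↦ by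
    rw [hψn]
    have h1 : ‖φ (z - cU i * exp s)‖⁻¹ ≤ 1 + e := by
      apply inv_le_of_inv_le₀ bp
      rw [← one_div]
      linarith
    have h2 : rexp (-(K * (V s).re)) ≤ 1 := Real.exp_le_one_iff.2 (by have := hVpos s hs; simp; positivity)
    calc _ ≤ (1+e) * 1 := by gcongr
      _ = _ := mul_one _⟩
  have hle := maxP hSo (ψ := fun s ↦ (φ (z - cU i * exp s) * exp (K * V s))⁻¹) (by
    intro s hs
    refine (DifferentiableAt.inv (((hφ.differentiable _ hs.2.2).comp s bf).mul bf) ◇).differentiableWithinAt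
    refine mul_ne_zero ◇ (exp_ne_zero _)
    rw [← norm_ne_zero_iff]; linarith [hhalf s hs]) (by
    intro e he b hb
    obtain ⟨-, -, hb1⟩ := hbig e he
    have hbc := frontier_subset_closure hb
    have hbre := closure_minimal (fun s hs ↦ hs.1.le) (isClosed_le continuous_re continuous_const) hbc
    have hbim := closure_minimal (fun s hs ↦ hs.2.1.le) (isClosed_le continuous_im.abs continuous_const) hbc
    by_cases hbG : z - cU i * exp b ∈ dG
    · have hbA := himG b hbre hbim hbG
      have hbre' : RE b = ρ1 := by
        by_contra hne'
        have h1 := lt_of_le_of_ne hbre hne'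
        have hbnot : b ∉ S := fun h ↦ by
          rw [hSo.frontier_eq] at hb
          exact hb.2 h
        exact hbnot ⟨h1, hne b hbre hbim hbG, hbG⟩
      have h1 : v ≤ (V b).re := by
        have := hbar b bl hbA
        rwa [hbre'] at this
      have h2 : ∀ᶠ s in 𝓝 b, v/2 < (V s).re := (continuous_re.comp bf).continuousAt.eventually_const_lt (by simp only [Function.comp]; linarith)
      filter_upwards [nhdsWithin_le_nhds h2, self_mem_nhdsWithin] with s hs hsS
      rw [hψn]
      have e1 : ‖φ (z - cU i * exp s)‖⁻¹ ≤ 2 := inv_le_of_inv_le₀ bn (by linarith [hhalf s hsS])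
      have e2 : rexp (-(K * (V s).re)) ≤ 2⁻¹ := by
        rw [← Real.exp_log (show 0 < 2⁻¹ by norm_num), Real.log_inv, rele]
        have : K * (v/2) = rlog 2 := by
          rw [hK]
          field_simp
        nlinarith
      calc _ ≤ 2 * 2⁻¹ := by gcongr
        _ ≤ 1 + e := by norm_num; exact he.le
    · have h2 : Tendsto (fun s ↦ z - cU i * exp s) (𝓝 b) (𝓝 (z - cU i * exp b)) := by
        apply Continuous.tendsto
        fun_prop
      filter_upwards [nhdsWithin_le_nhds (h2.eventually (conf_near D.isOpen hφ (show 1/(1+e) < 1 by rw [div_lt_one bp]; linarith) hbG)), self_mem_nhdsWithin] with s hs hsS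
      exact hb1 s hsS _ (hs hsS.2.2) le_rfl) (by
    intro e he
    obtain ⟨-, -, hb1⟩ := hbig e he
    obtain ⟨d', hd', h'⟩ := hnear (1/(1+e)) (by rw [div_lt_one bp]; linarith)
    refine ⟨|ρ1| + |rlog d'| + π, fun s hs hR ↦ hb1 s hs _ (h' _ hs.2.2 ◇) le_rfl⟩
    rw [hnorm, ← lt_log_iff_exp_lt hd']
    have e1 := norm_le_abs_re_add_abs_im s
    have e2 := hs.2.1
    rcases abs_cases RE s with h | h
    · linarith [ hs.1]
    · linarith [neg_abs_le (rlog d'), abs_nonneg ρ1])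
  refine ⟨2 * K, bp, rexp ρ1, exp_pos _, fun t ht htd ↦ ◇⟩
  have htz : t - z ≠ 0 := fun h ↦ C.corner_notG i (by rw [sub_eq_zero] at h; rw [← hz, ← h]; exact ht)
  set s := log _ with hs
  have hs1 : z - cU i * exp s = t := by
    rw [hs, exp_log (div_ne_zero (neg_ne_zero.2 htz) hu0)]
    field_simp
    ring
  have hre : rexp RE s = ‖t - z‖ := by rw [← hnorm s, hs1]
  have hsre : RE s < ρ1 := by
    rwa [← Real.exp_lt_exp, hre]
  have him' := hne s hsre.le (abs_le.2 ⟨(neg_pi_lt_log_im _).le, log_im_le_pi _⟩) (by rw [hs1]; exact ht)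
  have h1 := hle s ⟨hsre, him', by rw [hs1]; exact ht⟩
  rw [hψn, hs1] at h1
  have hφ0 : 0 < ‖φ t‖ := by
    have := hhalf s ⟨hsre, him', by rw [hs1]; exact ht⟩
    rw [hs1] at this
    linarith
  refine le_trans (Real.exp_le_exp.2 (neg_le_neg ◇)) (by rwa [inv_mul_le_iff₀ hφ0, mul_one] at h1)
  rw [mul_comm 2 K, mul_assoc]
  gcongr
  have h3 : (V s).re ≤ ‖V s‖ := re_le_norm _
  have h4 : ‖V s‖ ≤ rexp (1/a * RE s) + rexp ((1/a+1/2) * RE s) := by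
    refine (norm_sub_le _ _).trans (le_of_eq ◇)
    rw [norm_exp, norm_exp]
    simp
  have h5 : rexp ((1/a+1/2) * RE s) ≤ rexp (1/a * RE s) := Real.exp_le_exp.2 (by nlinarith)
  rw [← hre, ← exp_mul, mul_comm RE s]
  linarith
theorem cone_ball {η : ℝ} (hη : 0 < η) : ∃ c > 0, ∃ ρ2 < 0, ∀ s : ℂ, RE s < ρ2 → |IM s| ≤ (2 - cL i) * π/2 - η →
    ball (cT i 0 - cU i * exp s) (c * rexp RE s) ⊆ dG := by
  have hA := C.hA
  have hu0 : cU i ≠ 0 := by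
    rw [← norm_ne_zero_iff, C.hu i]
    norm_num
  refine ⟨min hf2 (η/4), bp, min (min (C.ρ - 1) (rlog (η/(2*cA)) - 1)) (-1), bs, fun s hs him t ht ↦ ◇⟩
  have b1 := min_le_left hf2 (η/4)
  have b2 := min_le_right hf2 (η/4)
  have b3 := hs.trans_le ((mll).trans mll)
  have b4 := hs.trans_le ((mll).trans mlr)
  rw [mem_ball, dist_eq_norm] at ht
  obtain ⟨s', h1, h2⟩ := exp_ball (d := -(t - (cT i 0 - cU i * exp s))/cU i) b1 (by
    rw [norm_div, norm_neg, C.hu i, div_one]; exact ht.le)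
  have h3 : t = cT i 0 - cU i * exp s' := by
    rw [← h1]
    field_simp
    ring
  have h4 := (abs_re_le_norm _).trans h2
  have h5 := (abs_im_le_norm _).trans h2
  rw [sub_re, abs_le] at h4
  rw [sub_im] at h5
  have h6 : s'.re < rlog (η/(2*cA)) := bl
  rw [lt_log_iff_exp_lt bp, lt_div_iff₀ bp] at h6
  rw [h3]
  refine C.inS i s' bl ◇
  have := abs_sub_abs_le_abs_sub s'.im IM s
  linarith
theorem cone_f (hφ : ConformalOnto dG φ ζ) {f : CC} (hf : ∀ z ∈ dG, f z ^ 2 = deriv φ z) (i : Fin N) {η : ℝ} (hη : 0 < η) :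
    ∃ K > 0, ∃ ρ2 < 0, ∀ s : ℂ, RE s < ρ2 → |IM s| ≤ (2 - cL i) * π/2 - η →
    ‖f (cT i 0 - cU i * exp s)‖ ≤ K * rexp (-(1/4) * RE s) := by
  obtain ⟨M, hM, δ, hδ, hlow⟩ := C.phi_low hφ i
  obtain ⟨c, hc, ρ2, hρ2, hball⟩ := C.cone_ball i hη
  refine ⟨Real.sqrt (2*M/c), bp, min ρ2 (rlog δ), by simp [hρ2], fun s hs him ↦ ◇⟩
  have h1 := hball s (hs.trans_le mll) him
  have hsδ : rexp RE s < δ := by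
    rw [← lt_log_iff_exp_lt hδ]
    exact hs.trans_le mlr
  set t := cT i 0 - cU i * exp s with ht
  have hr : 0 < c * rexp RE s := bp
  have htG := h1 (mem_ball_self hr)
  have hn : ‖t - cT i 0‖ = rexp RE s := by
    rw [ht, sub_sub_cancel_left, norm_neg, norm_mul, C.hu i, one_mul, norm_exp]
  have h2 := schwarzPick hr (fun z hz ↦ (hφ.differentiable z (h1 hz)).differentiableWithinAt)
    (fun z hz ↦ (conf_lt hφ (h1 hz)).le)
  have h3 := hlow t htG (by rw [hn]; exact hsδ)
  rw [hn, ← exp_mul] at h3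
  set m := M * rexp (RE s * (1/(2 - cL i))) with hm
  have h4 : 1 - ‖φ t‖^2 ≤ 2 * m := by
    have : (rexp (-m))^2 ≤ ‖φ t‖^2 := by gcongr
    rw [← Real.exp_nat_mul] at this
    have := add_one_le_exp (2 * -m)
    push_cast at *
    linarith
  have h5 : ‖f t‖ ^ 2 ≤ 2 * M/c * rexp (-hf2 * RE s) := by
    rw [← norm_pow, hf t htG]
    refine h2.trans ◇
    rw [div_le_iff₀ hr]
    calc _ ≤ 2 * m := h4
      _ ≤ 2 * (M * rexp (RE s * hf2)) := by
        rw [hm]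
        gcongr ?_ * (?_ * rexp ?_)
        have h6 : 1/2 ≤ 1/(2 - cL i) := by
          rw [div_le_div_iff₀ bn (by linarith [(C.hla i).2])]
          linarith [(C.hla i).1]
        nlinarith [hs.trans_le mll]
      _ = 2 * M * rexp (RE s * hf2) := by ring
      _ = 2 * M * (rexp (-hf2 * RE s) * rexp RE s) := by rw [← rea]; ring_nf
      _ = _ := by field_simp
  calc ‖f t‖ ≤ Real.sqrt _ := le_sqrt_of_sq_le h5
    _ = _ := by
      rw [sqrt_mul bp, sqrt_eq_rpow (rexp _), ← exp_mul]
      ring_nf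
end Chain
theorem lens_ball {ε : ℝ} (hε : 0 < ε) (hε1 : ε ≤ 1) {w : ℂ} (hw : w ∈ lens (ε/2)) (hw2 : RE w ≤ 1/2) :
    ball w (ε/16 * RE w) ⊆ lens ε := by
  obtain ⟨w1, w2, w3⟩ := hw
  intro v hv
  rw [mem_ball, dist_eq_norm] at hv
  have h1 := (abs_re_le_norm _).trans_lt hv
  have h2 := (abs_im_le_norm _).trans_lt hv
  have h3 := abs_sub_abs_le_abs_sub IM v IM w
  rw [sub_re, abs_lt] at h1
  rw [sub_im] at h2
  have h4 : ε/16 * RE w ≤ 1/16 * RE w := by gcongr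
  have h5 : RE w * (1 - RE w) - ε/16 * RE w ≤ RE v * (1 - RE v) := by nlinarith
  refine ⟨ bl, bl, ◇⟩
  nlinarith [mul_le_mul_of_nonneg_left (by nlinarith) hε.le]
theorem lens_norm {ε : ℝ} (hε1 : ε ≤ 1) {w : ℂ} (hw : w ∈ lens ε) : ‖w‖ ≤ 2 * RE w := by
  obtain ⟨w1, w2, w3⟩ := hw
  have := norm_le_abs_re_add_abs_im w
  rw [abs_of_pos w1] at this
  have h4 : ε * qq RE w ≤ 1 * (RE w * 1) := by gcongr <;> linarith
  linarith
theorem endBound {G : Set ℂ} {φ E q : CC} {z : ℂ} {M δ p ε τ : ℝ} (hM : 0 < M) (hδ : 0 < δ) (hp : 0 < p)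
    (hlow : ∀ t ∈ G, ‖t - z‖ < δ → rexp (-(M * ‖t - z‖ ^ p)) ≤ ‖φ t‖) (hφ1 : ∀ t ∈ G, ‖φ t‖ ≤ 1)
    (hE : DifferentiableAt ℂ E 0) (hE0 : E 0 = z) (hε : 0 < ε) (hε1 : ε ≤ 1) (hq : DifferentiableOn ℂ q (lens ε))
    (hup : ∀ w ∈ lens ε, 0 < τ * IM w → E w ∈ G ∧ q w = φ (E w)) (hτ : τ ≠ 0)
    (hsym : ∀ w ∈ lens ε, ‖q (starRingEnd ℂ w)‖ = ‖q w‖⁻¹) (hre : ∀ w ∈ lens ε, IM w = 0 → ‖q w‖ = 1) :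
    ∃ K > 0, ∃ r0 > 0, ∀ w ∈ lens (ε/2), RE w < r0 → ‖deriv q w‖ ≤ K * RE w ^ (p - 1) := by
  obtain ⟨L, hL⟩ := hE.isBigO_sub.bound
  obtain ⟨d, hd, hL⟩ := Metric.eventually_nhds_iff_ball.1 hL
  simp only [sub_zero, hE0] at hL
  set L' := |L| + 1 with hL'
  have key : ∀ w ∈ lens ε, ‖w‖ < min d (δ/L') → rexp (-(M * (L' * ‖w‖)^p)) ≤ ‖q w‖ ∧ ‖q w‖ ≤ rexp (M * (L' * ‖w‖)^p) := by
    have up : ∀ w ∈ lens ε, ‖w‖ < min d (δ/L') → 0 < τ * IM w → rexp (-(M * (L' * ‖w‖)^p)) ≤ ‖q w‖ ∧ ‖q w‖ ≤ 1 := by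
      intro w hw hwn him
      obtain ⟨h1, h2⟩ := hup w hw him
      have h3 : ‖E w - z‖ ≤ L' * ‖w‖ := (hL w (by rw [mem_ball_zero_iff]; exact hwn.trans_le mll)).trans (by gcongr; linarith [le_abs_self L])
      have h4 := hwn.trans_le mlr
      rw [lt_div_iff₀ bp] at h4
      rw [h2]
      refine ⟨le_trans (Real.exp_le_exp.2 (neg_le_neg ◇)) (hlow _ h1 bl), hφ1 _ h1⟩
      gcongr
    intro w hw hwn
    have he : 0 ≤ M * (L' * ‖w‖)^p := bp
    rcases lt_trichotomy (τ * IM w) 0 with h | h | h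
    · obtain ⟨h1, h2⟩ := up _ (lens_conj hw) (by rwa [RCLike.norm_conj]) (by simp; linarith)
      have h0 : 0 < ‖q w‖⁻¹ := by
        rw [← hsym w hw]
        exact (exp_pos _).trans_le h1
      rw [hsym w hw, RCLike.norm_conj, Real.exp_neg] at h1
      rw [hsym w hw] at h2
      rw [inv_pos] at h0
      exact ⟨le_trans (Real.exp_le_one_iff.2 bl) (by rwa [inv_le_one₀ h0] at h2), (inv_le_inv₀ (exp_pos _) h0).1 h1⟩
    · rw [hre w hw (by simpa [hτ] using h)]
      exact ⟨Real.exp_le_one_iff.2 bl, one_le_exp he⟩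
    · obtain ⟨h1, h2⟩ := up w hw hwn h
      exact ⟨h1, h2.trans (one_le_exp he)⟩
  set m0 := M * (L' * 3)^p with hm0
  have hm00 : 0 < m0 := bp
  refine ⟨64 * m0 * rexp m0 / ε, bp, min hf2 (min d (δ/L')/3), bp, fun w hw hwr ↦ ◇⟩
  have w2 := hwr.trans_le mll
  have w3 := hwr.trans_le mlr
  have hball := lens_ball hε hε1 hw w2.le
  have hx := hw.1
  have hwn := lens_norm bl hw
  set m := M * (L' * (3 * RE w))^p with hm
  have hR : 0 < ε/16 * RE w := bp
  have hmm : m = m0 * RE w^p := by rw [hm, hm0, mul_assoc, ← mul_assoc L', mul_rpow bp hx.le]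
  have hq3 : ∀ v ∈ ball w (ε/16 * RE w), rexp (-m) ≤ ‖q v‖ ∧ ‖q v‖ ≤ rexp m := by
    intro v hv
    have h1 : ‖v‖ ≤ 3 * RE w := by
      have := norm_sub_norm_le v w
      rw [mem_ball, dist_eq_norm] at hv
      nlinarith
    obtain ⟨h2, h3⟩ := key v (hball hv) bl
    have h4 : M * (L' * ‖v‖)^p ≤ m := by
      rw [hm]
      gcongr
    exact ⟨le_trans (Real.exp_le_exp.2 bl) h2, h3.trans (Real.exp_le_exp.2 h4)⟩
  have h1 := schwarzPick hR ((hq.mono hball).mul_const _) (fun v hv ↦ by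
    rw [norm_mul, norm_real, norm_of_nonneg (exp_pos _).le]
    calc _ ≤ rexp m * rexp (-m) := by gcongr; exact (hq3 v hv).2
      _ = 1 := by rw [← rea]; simp)
  rw [deriv_mul_const ((hq.mono hball).differentiableAt (ball_mem_nhds _ hR)), norm_mul, norm_mul, norm_real, norm_of_nonneg (exp_pos _).le] at h1
  have h2 := (hq3 w (mem_ball_self hR)).1
  have h3 : 1 - (‖q w‖ * rexp (-m))^2 ≤ 4 * m := by
    have : (rexp (-m) * rexp (-m))^2 ≤ (‖q w‖ * rexp (-m))^2 := by gcongr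
    rw [← rea, ← Real.exp_nat_mul] at this
    have := add_one_le_exp (2 * (-m + -m))
    push_cast at *
    linarith
  rw [le_div_iff₀ hR] at h1
  have h4 : ‖deriv q w‖ = ‖deriv q w‖ * rexp (-m) * rexp m := by
    rw [mul_assoc, ← rea]
    simp
  have hmle : m ≤ m0 := by
    rw [hmm]
    exact mul_le_of_le_one_right hm00.le (rpow_le_one hx.le bl hp.le)
  rw [h4]
  calc _ ≤ (4 * m / (ε/16 * RE w)) * rexp m0 := by
        gcongr
        rw [le_div_iff₀ hR]
        linarith
    _ = _ := by
        rw [hmm, Real.rpow_sub_one hx.ne']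
        ring
theorem lens_nhd {O : Set ℂ} (hO : IsOpen O) (h : ∀ x ∈ I01, tC x ∈ O) : ∃ ε > 0, lens ε ⊆ O := by
  obtain ⟨δ, hδ, hs⟩ := (isCompact_Icc.image continuous_ofReal).exists_thickening_subset_open hO
    (show Complex.ofReal '' I01 ⊆ O by rintro _ ⟨x, hx, rfl⟩; exact h x hx)
  refine ⟨δ, hδ, fun w hw ↦ hs (mem_thickening_iff.2 ⟨_, ⟨RE w, ⟨hw.1.le, hw.2.1.le⟩, rfl⟩, ◇⟩)⟩
  rw [dist_eq_norm]
  rw [(by apply cext <;> simp : w - RE w = IM w * I), norm_mul, norm_I, mul_one, norm_real]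
  refine hw.2.2.trans_le ◇
  have : RE w * (1 - RE w) ≤ 1 := by nlinarith [sq_nonneg RE w]
  nlinarith
theorem mem_lens_real {ε x : ℝ} (hε : 0 < ε) (hx : x ∈ O01) : tC x ∈ lens ε := by
  refine ⟨by simpa using hx.1, by simpa using hx.2, ◇⟩
  simpa using mul_pos hε (mul_pos hx.1 (sub_pos.2 hx.2))
theorem endF {F : CC} {ε K r0 β : ℝ} (hε : 0 < ε) (hε1 : ε ≤ 1) (hF : ContinuousOn F (lens ε)) (hr : 0 < r0)
    (h : ∀ w ∈ lens (ε/2), RE w < r0 → ‖F w‖ ≤ K * RE w ^ β) : ∃ M > 0, ∀ w ∈ lens (ε/2), RE w ≤ 1/2 → ‖F w‖ ≤ M * RE w ^ β := by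
  set S : Set ℂ := (Icc r0 hf2) ×ℂ (Icc (-1) 1) ∩ {w | |IM w| ≤ ε/2 * qq RE w}
  have hSc : IsCompact S := (isCompact_Icc.reProdIm isCompact_Icc).inter_right
    (isClosed_le continuous_im.abs bf)
  have hSl : S ⊆ lens ε := by
    rintro w ⟨⟨⟨h1, h2⟩, h3⟩, h4⟩
    have h4' : |IM w| ≤ ε/2 * qq RE w := h4
    have : 0 < RE w * (1 - RE w) := mul_pos bl bl
    exact ⟨ bl, bl, by nlinarith⟩
  obtain ⟨M0, hM0⟩ := hSc.exists_bound_of_continuousOn (hF.mono hSl)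
  refine ⟨max |K| (|M0|/min 1 (r0^β)) + 1, bp, fun w hw hw2 ↦ ◇⟩
  have hx := hw.1
  by_cases hwr : RE w < r0
  · refine (h w hw hwr).trans ◇
    gcongr
    linarith [le_abs_self K, le_max_left |K| (|M0|/min 1 (r0^β))]
  · have h1 : min 1 (r0^β) ≤ RE w^β := by
      rcases le_total 0 β with hb | hb
      · exact (mlr).trans (Real.rpow_le_rpow hr.le bl hb)
      · exact (mll).trans (one_le_rpow_of_pos_of_le_one_of_nonpos hx bl hb)
    have h2 := hM0 w ⟨⟨⟨ bl, hw2⟩, by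
      have := hw.2.2
      exact abs_le.1 (by nlinarith [mul_pos hx (sub_pos.2 hw.2.1)])⟩, hw.2.2.le⟩
    calc ‖F w‖ ≤ |M0| := h2.trans (le_abs_self _)
      _ = |M0|/min 1 _ * min 1 (r0^β) := by field_simp
      _ ≤ _ := by gcongr; linarith [le_max_right |K| (|M0|/min 1 (r0^β))]
theorem Pre.dT_ne (P : Pre D lam N) (i : Fin N) {w : ℂ} (hw : w ∈ P.U i) : deriv (P.T i) w ≠ 0 :=
  (inj_inverse (P.hU i) (P.diff i) (fun _ hz ↦ (P.inj i).leftInvOn_invFunOn hz) hw).1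
theorem Pre.real_notG (P : Pre D lam N) (i : Fin N) {x : ℝ} (hx : x ∈ I01) :
    P.T i x ∈ frontier dG ∧ P.T i x ∉ dG := by
  have := (P.cover _).2 ⟨i, x, hx, rfl⟩
  exact ⟨this, by rw [D.isOpen.frontier_eq] at this; exact this.2⟩
structure Sz (D : JordanDomain) (lam : ℝ) (N : ℕ) (φ f : CC) (am : ℝ) extends Chain D lam N where
  Q : Fin N → CC
  F : Fin N → CC
  Qd : ∀ i, DifferentiableOn ℂ (Q i) (lens ε)
  Fd : ∀ i, DifferentiableOn ℂ (F i) (lens ε)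
  Qup : ∀ i, ∀ w ∈ lens ε, 0 < IM w → Q i w = φ (T i w)
  Fup : ∀ i, ∀ w ∈ lens ε, 0 < IM w → F i w = f (T i w)
  Qlo : ∀ i, ∀ w ∈ lens ε, (1 + am)/2 ≤ ‖Q i w‖
  Qhi : ∀ i, ∀ w ∈ lens ε, ‖Q i w‖ ≤ 2/(1 + am)
  FQ : ∀ i, ∀ x ∈ O01, cj (F i x) * ‖deriv (T i) x‖ = F i x * deriv (T i) x / (I * Q i x)
  Qone : ∀ i, ∀ x ∈ O01, ‖Q i x‖ = 1
  FM : ℝ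
  hFM : 0 < FM
  Fb0 : ∀ i, ∀ w ∈ lens ε, RE w ≤ 1/2 → ‖F i w‖ ≤ FM * RE w ^ ((1/(2 - la i) - 1)/2)
  Fb1 : ∀ i, ∀ w ∈ lens ε, 1/2 ≤ RE w → ‖F i w‖ ≤ FM * (1 - RE w) ^ ((1/(2 - la (σ i)) - 1)/2)
theorem exists_sz (C : Chain D lam N) {φ f : CC} {ζ : ℂ} (hφ : ConformalOnto dG φ ζ)
    (hfd : DifferentiableOn ℂ f dG) (hf : ∀ z ∈ dG, f z ^ 2 = deriv φ z) {am : ℝ} (ham0 : 0 ≤ am) (ham : am < 1) :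
    Nonempty (Sz D lam N φ f am) := by
  obtain ⟨K, hKG, hKc, hK⟩ := conf_cpt D.isOpen hφ (show (1 + am)/2 < 1 by linarith)
  have hTc : ∀ i, ContinuousOn _ _ := fun i ↦ ((C.diff i).deriv (C.hU i)).continuousOn
  have hsh : ∀ i, ∃ e > 0, ∃ c > 0, lens e ⊆ {w | w ∈ C.U i ∧ C.T i w ∉ K ∧ c < ‖deriv (C.T i) w‖} := by
    intro i
    obtain ⟨x0, hx0, hmin⟩ := isCompact_Icc.exists_isMinOn (nonempty_Icc.2 (zero_le_one' ℝ))
      (((hTc i).norm).comp continuous_ofReal.continuousOn (C.seg i))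
    have hc := norm_pos_iff.2 (C.dT_ne i (C.seg i _ hx0))
    have hO : IsOpen {w | w ∈ C.U i ∧ C.T i w ∉ K ∧ ‖deriv (C.T i) x0‖/2 < ‖deriv (C.T i) w‖} := by
      have h2 := (hTc i).norm.isOpen_inter_preimage (C.hU i) (isOpen_Ioi (a := ‖deriv (C.T i) x0‖/2))
      convert! ((C.diff i).continuousOn.isOpen_inter_preimage (C.hU i) hKc.isClosed.isOpen_compl).inter h2 using 1
      ext w
      constructor
      · exact fun h ↦ ⟨⟨h.1, h.2.1⟩, h.1, h.2.2⟩
      · exact fun h ↦ ⟨h.1.1, h.1.2, h.2.2⟩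
    obtain ⟨e, he, hs⟩ := lens_nhd hO (fun x hx ↦ ⟨C.seg i x hx, fun h ↦ (C.real_notG i hx).2 (hKG h), by
      have : ‖deriv (C.T i) x0‖ ≤ ‖deriv (C.T i) x‖ := hmin hx
      linarith⟩)
    exact ⟨e, he, _, half_pos hc, hs⟩
  choose e he c hc hs using hsh
  obtain ⟨e0, he0, he01, hee⟩ := fin_pos e he
  obtain ⟨c0, hc0, hc01, hcc⟩ := fin_pos c hc
  set ε := min C.ε e0
  have hε0 := lt_min C.hε he0
  have hε1 : ε ≤ 1 := (mll).trans C.hε1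
  have hlC : lens ε ⊆ lens C.ε := lens_mono mll
  have hle : ∀ i, ∀ w ∈ lens ε, w ∈ C.U i ∧ C.T i w ∉ K ∧ c0 ≤ ‖deriv (C.T i) w‖ := fun i w hw ↦ by
    obtain ⟨a1, a2, a3⟩ := hs i (lens_mono ((mlr).trans (hee i)) hw)
    exact ⟨a1, a2, (hcc i).trans a3.le⟩
  have hrf := fun i ↦ reflect (lens_open ε) (fun w hw ↦ lens_conj hw) (q := fun w ↦ φ _) (by
      intro w hw him
      exact (hφ.differentiable _ (C.up i w (hlC hw) him)).comp w ((C.diff i).differentiableAt ((C.hU i).mem_nhds (hle i w hw).1))) (by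
      intro w hw him
      have h1 := C.up i w (hlC hw) him
      exact ⟨by linarith [hK _ h1 (hle i w hw).2.1], conf_lt hφ h1⟩) (by
      intro b hb hbi
      have hbx : (RE b) = b := by apply cext <;> simp [hbi]
      have hTb : C.T i b ∉ dG := by
        rw [← hbx]
        exact (C.real_notG i ⟨hb.1.le, hb.2.1.le⟩).2
      have hG : ∀ᶠ w in 𝓝[{w : ℂ | 0 < IM w}] b, C.T i w ∈ dG := by
        filter_upwards [nhdsWithin_le_nhds ((lens_open ε).mem_nhds hb), self_mem_nhdsWithin] with w hw him using C.up i w (hlC hw) him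
      refine tendsto_order.2 ⟨fun r hr ↦ ◇, fun r hr ↦ ◇⟩
      · filter_upwards [hG, nhdsWithin_le_nhds ((((C.diff i).continuousOn.continuousAt ((C.hU i).mem_nhds (hle i b hb).1))).eventually (conf_near D.isOpen hφ hr hTb))] with w h1 h2 using h2 h1
      · filter_upwards [hG] with w h1 using (conf_lt hφ h1).trans hr)
  choose Q Qd Qup Qne Qsym Qre using hrf
  have hQreal : ∀ i, ∀ w ∈ lens ε, IM w = 0 → ‖Q i w‖ = 1 := fun i w hw him ↦ by
    have h1 := Qsym i w hw
    rw [conj_eq_iff_im.2 him] at h1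
    have h2 : ‖Q i w‖ = ‖Q i w‖⁻¹ := by conv_lhs => rw [h1]
                                        rw [norm_inv, RCLike.norm_conj]
    have h3 := norm_pos_iff.2 (Qne i w hw)
    field_simp at h2
    nlinarith
  have hQsn : ∀ i, ∀ w ∈ lens ε, ‖Q i _‖ = ‖Q i w‖⁻¹ := fun i w hw ↦ by
    rw [Qsym i w hw, norm_inv, RCLike.norm_conj]
  have hQup : ∀ i, ∀ w ∈ lens ε, 0 < IM w → (1+am)/2 ≤ ‖Q i w‖ ∧ ‖Q i w‖ ≤ 1 := fun i w hw him ↦ by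
    have h1 := C.up i w (hlC hw) him
    rw [Qup i w hw him]
    exact ⟨(hK _ h1 (hle i w hw).2.1).le, (conf_lt hφ h1).le⟩
  have h2am : 1 ≤ 2/(1+am) := by
    rw [le_div_iff₀ bl]
    linarith
  have hQb : ∀ i, ∀ w ∈ lens ε, (1+am)/2 ≤ ‖Q i w‖ ∧ ‖Q i w‖ ≤ 2/(1+am) := fun i w hw ↦ by
    rcases lt_trichotomy IM w 0 with h | h | h
    · obtain ⟨h1, h2⟩ := hQup i _ (lens_conj hw) (by simpa using h)
      rw [hQsn i w hw] at h1 h2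
      rw [inv_le_one₀ (norm_pos_iff.2 (Qne i w hw))] at h2
      refine ⟨ bl, ◇⟩
      have := inv_anti₀ bl h1
      rwa [inv_inv, inv_div] at this
    · rw [hQreal i w hw h]
      exact ⟨ bl, h2am⟩
    · exact ⟨(hQup i w hw h).1, (hQup i w hw h).2.trans h2am⟩
  have hTd : ∀ i, ∀ w ∈ lens ε, HasDerivAt _ _ w := fun i w hw ↦
    ((C.diff i).differentiableAt ((C.hU i).mem_nhds (hle i w hw).1)).hasDerivAt
  have hQda : ∀ i, ∀ w ∈ lens ε, DifferentiableAt ℂ _ w := fun i w hw ↦ (Qd i).differentiableAt ((lens_open ε).mem_nhds hw)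
  have hQ'up : ∀ i, ∀ w ∈ lens ε, 0 < IM w → deriv (Q i) w = deriv φ _ * deriv (C.T i) w := fun i w hw him ↦ by
    refine ((((hφ.differentiable _ (C.up i w (hlC hw) him)).hasDerivAt).comp w (hTd i w hw)).congr_of_eventuallyEq ◇).deriv
    filter_upwards [(lens_open ε).mem_nhds hw, (isOpen_lt continuous_const continuous_im).mem_nhds (show w ∈ {w : ℂ | 0 < IM w} from him)] with v h2 h3
    exact Qup i v h2 h3
  obtain ⟨-, -, -, -, -, hφ'⟩ := conf_inv D.isOpen hφ
  have hQ'ne : ∀ i, ∀ w ∈ lens ε, deriv (Q i) w ≠ 0 := fun i w hw ↦ by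
    rcases lt_trichotomy IM w 0 with h | h | h
    · have hw' := lens_conj hw
      have h1 : deriv (Q i) (starRingEnd ℂ w) ≠ 0 := by
        rw [hQ'up i _ hw' (by simpa using h)]
        exact mul_ne_zero (hφ' _ (C.up i _ (hlC hw') (by simpa using h))) (C.dT_ne i (hle i _ hw').1)
      have h2 := ((hQda i _ hw).hasDerivAt.conj_conj).inv (by
        simpa using Qne i w hw)
      have h3 := (h2.congr_of_eventuallyEq (by
        filter_upwards [(lens_open ε).mem_nhds hw'] with v hv
        simpa using (Qsym i _ (lens_conj hv)))).deriv
      rw [h3] at h1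
      intro h0
      simp [h0] at h1
    · have hbx : (RE w) = w := by apply cext <;> simp [h]
      obtain ⟨t, ht, h2⟩ := Qre i RE w (by rw [hbx]; exact hw)
      rw [hbx] at h2
      intro h0
      rw [h0, zero_div] at h2
      have := ht.ne'
      simp at h2
      contradiction
    · rw [hQ'up i w hw h]
      exact mul_ne_zero (hφ' _ (C.up i _ (hlC hw) h)) (C.dT_ne i (hle i _ hw).1)
  have hT0 : ∀ i, ∀ w ∈ lens ε, deriv (C.T i) w ≠ 0 := fun i w hw ↦ C.dT_ne i (hle i w hw).1
  have hsq : ∀ i, ∃ F : CC, DifferentiableOn ℂ F (lens ε) ∧ (∀ w ∈ lens ε, F w ^ 2 = deriv (Q i) w / deriv (C.T i) w) ∧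
      ∀ w ∈ lens ε, 0 < IM w → F w = f (C.T i w) := by
    intro i
    obtain ⟨F, hF, hF2⟩ := sqrtConvex (lens_convex hε0.le) (lens_open ε) (((Qd i).deriv (lens_open ε)).div ((fun i ↦ ((C.diff i).deriv (C.hU i)).mono fun w hw ↦ (hle i w hw).1) i) (hT0 i))
      (fun w hw ↦ div_ne_zero (hQ'ne i w hw) (hT0 i w hw))
    have hpc := (halflens_convex hε0.le 1).isPreconnected
    have hsub : ∀ w ∈ {w | w ∈ lens ε ∧ 0 < 1 * IM w}, w ∈ lens ε ∧ C.T i w ∈ dG ∧ 0 < IM w := fun w hw ↦ by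
      have h2 := hw.2
      rw [one_mul] at h2
      exact ⟨hw.1, C.up i w (hlC hw.1) h2, h2⟩
    have hfT : ∀ w ∈ {w | w ∈ lens ε ∧ 0 < 1 * IM w}, f _^2 = F w ^ 2 := fun w hw ↦ by
      obtain ⟨h1, h2, h3⟩ := hsub w hw
      rw [hf _ h2, hF2 w h1, Pi.div_apply, hQ'up i w h1 h3, mul_div_cancel_right₀ _ (hT0 i w h1)]
    rcases hpc.eq_or_eq_neg_of_sq_eq (g := fun w ↦ f _) (hF.continuousOn.mono fun w hw ↦ hw.1)
      (hfd.continuousOn.comp ((C.diff i).continuousOn.mono fun w hw ↦ (hle i w (hsub w hw).1).1) fun w hw ↦ (hsub w hw).2.1)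
      (fun w hw ↦ (hfT w hw).symm) (fun {w} hw h0 ↦ by
        have := hf _ (hsub w hw).2.1
        rw [h0] at this; exact hφ' _ (hsub w hw).2.1 (by rw [← this]; simp)) with h | h
    · exact ⟨F, hF, hF2, fun w hw him ↦ h ⟨hw, by simpa using him⟩⟩
    · exact ⟨fun w ↦ - F w, hF.neg, fun w hw ↦ by rw [neg_sq]; exact hF2 w hw, fun w hw him ↦ by
        simp only [(h (show w ∈ {w | w ∈ lens ε ∧ 0 < 1 * IM w} from ⟨hw, by simpa using him⟩)), Pi.neg_apply, neg_neg]⟩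
  choose F Fd F2 Fup using hsq
  have sqb : ∀ (i : Fin N) w (K' x p : ℝ), w ∈ lens ε → 0 < x → 0 < K' → ‖deriv (Q i) w‖ ≤ K' * x^(p - 1) →
      ‖F i w‖ ≤ Real.sqrt (K'/c0) * x ^ ((p - 1)/2) := by
    intro i w K' x p hw hx hK' h
    have h1 : ‖F i w‖^2 ≤ K'/c0 * x^(p-1) := by
      rw [← norm_pow, F2 i w hw, norm_div, div_mul_eq_mul_div]
      have := (hle i w hw).2.2
      gcongr
    refine (le_sqrt_of_sq_le h1).trans (le_of_eq ◇)
    rw [sqrt_mul bp, sqrt_eq_rpow (x^(p-1)), ← rpow_mul hx.le]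
    ring_nf
  have hla := fun i ↦ (C.hla i).2
  have end0 : ∀ i, ∃ M > 0, ∀ w ∈ lens (ε/2), RE w ≤ 1/2 → ‖F i w‖ ≤ M * RE w ^ ((1/(2 - C.la i) - 1)/2) := by
    intro i
    obtain ⟨M, hM, δ, hδ, hlow⟩ := C.phi_low hφ i
    obtain ⟨K', hK', r0, hr0, hb⟩ := endBound hM hδ (by have := hla i; simp; linarith) hlow (fun t ht ↦ (conf_lt hφ ht).le) ((fun i ↦ (C.diff i).differentiableAt ((C.hU i).mem_nhds (by simpa using C.seg i 0 bs))) i) rfl hε0 hε1 (Qd i)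
      (fun w hw h ↦ by rw [one_mul] at h; exact ⟨C.up i w (hlC hw) h, Qup i w hw h⟩) one_ne_zero (hQsn i) (hQreal i)
    exact endF hε0 hε1 (Fd i).continuousOn hr0 fun w hw hwr ↦ sqb i w K' RE w _ (lens_mono bl hw) hw.1 hK' (hb w hw hwr)
  have end1 : ∀ i, ∃ M > 0, ∀ w ∈ lens (ε/2), RE w ≤ 1/2 → ‖F i (1 - w)‖ ≤ M * RE w ^ ((1/(2 - C.la (C.σ i)) - 1)/2) := by
    intro i
    obtain ⟨M, hM, δ, hδ, hlow⟩ := C.phi_low hφ _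
    have hsubd : ∀ w : ℂ, HasDerivAt (fun w : ℂ ↦ 1 - w) (-1) w := fun w ↦ by simpa using (hasDerivAt_id w).const_sub 1
    obtain ⟨K', hK', r0, hr0, hb⟩ := endBound (E := fun w ↦ C.T i (1 - w)) (q := fun w ↦ Q i (1 - w)) hM hδ (by have := hla (C.σ i); simp; linarith) hlow (fun t ht ↦ (conf_lt hφ ht).le)
      (((C.diff i).differentiableAt ((C.hU i).mem_nhds (by simpa using C.seg i 1 bs))).comp 0 (hsubd 0).differentiableAt) (by rw [sub_zero, C.next]) hε0 hε1 ((Qd i).comp bf fun w hw ↦ lens_one_sub hw)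
      (τ := -1) (fun w hw h ↦ by
        have h' : 0 < (1 - w).im := by simpa using h
        exact ⟨C.up i _ (hlC (lens_one_sub hw)) h', Qup i _ (lens_one_sub hw) h'⟩) bn (fun w hw ↦ by
          rw [← hQsn i _ (lens_one_sub hw)]; simp) (fun w hw h ↦ hQreal i _ (lens_one_sub hw) (by simpa using h))
    refine endF hε0 hε1 ((Fd i).continuousOn.comp bf fun w hw ↦ lens_one_sub hw) hr0 fun w hw hwr ↦
      sqb i _ K' RE w _ (lens_one_sub (lens_mono bl hw)) hw.1 hK' ◇
    have h1 := hb w hw hwr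
    have h2 : deriv (fun w ↦ Q i _) w = _ := ((hQda i _ (lens_one_sub (lens_mono bl hw))).hasDerivAt.comp w (hsubd w)).deriv
    rw [h2] at h1
    simpa using h1
  choose M0 hM0 hb0 using end0
  choose M1 hM1 hb1 using end1
  obtain ⟨m0, hm0, hm0'⟩ := fin_bound M0
  obtain ⟨m1, hm1, hm1'⟩ := fin_bound M1
  have hl2 : lens (ε/2) ⊆ lens ε := lens_mono bl
  refine ⟨⟨⟨C.toPre, ε/2, bp, bl, fun i ↦ (hl2.trans hlC).trans (C.lU i), fun i w hw ↦ C.up i w (hlC (hl2 hw)),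
    fun i w hw ↦ C.lo i w (hlC (hl2 hw)), C.u, C.hu, C.A, C.hA, C.ρ, C.exS, C.inS, C.d0, C.d1⟩, Q, F, fun i ↦ (Qd i).mono hl2, fun i ↦ (Fd i).mono hl2,
    fun i w hw ↦ Qup i w (hl2 hw), fun i w hw ↦ Fup i w (hl2 hw), fun i w hw ↦ (hQb i w (hl2 hw)).1, fun i w hw ↦ (hQb i w (hl2 hw)).2, ◇, ◇, m0 + m1, bp, ◇, ◇⟩⟩
  · intro i x hx
    have hxl := mem_lens_real hε0 hx
    obtain ⟨t, ht, h2⟩ := Qre i x hxl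
    have hQx := Qne i x hxl
    have hTx := hT0 i x hxl
    have h4 : F i x * F i x * deriv (C.T i) x = I * t * Q i x := by
      rw [← sq, (F2 i x hxl), div_mul_cancel₀ _ hTx, ← h2, div_mul_cancel₀ _ hQx]
    have h5 : F i x ≠ 0 := fun h ↦ by
      rw [h] at h4
      simp [hQx, ht.ne'] at h4
    have h6 : ‖F i x‖ * ‖F i x‖ * ‖deriv (C.T i) x‖ = t := by
      rw [← norm_mul, ← norm_mul, h4, norm_mul, norm_mul, hQreal i x hxl bs, norm_I, norm_real, norm_of_nonneg ht.le]
      ring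
    have h8 : F i x * (cj (F i x) * ‖deriv (C.T i) x‖) = t := by
      rw [← mul_assoc, (by rw [mul_conj, normSq_eq_norm_sq, sq] : F i x * cj (F i x) = (‖F i x‖ * ‖F i x‖ : ℝ)), ← ofReal_mul, h6]
    refine mul_left_cancel₀ h5 ◇
    rw [h8, ← mul_div_assoc, ← mul_assoc, h4]
    have := I_ne_zero
    field_simp
  · exact fun i x hx ↦ hQreal i x (mem_lens_real hε0 hx) bs
  · intro i w hw h
    have := hw.1
    refine (hb0 i w hw h).trans ◇
    gcongr
    linarith [hm0' i]
  · intro i w hw h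
    have hw2 := hw.2.1
    have := hb1 i _ (lens_one_sub hw) (by simp; linarith)
    rw [sub_sub_cancel, sub_re, one_re] at this
    refine this.trans ◇
    gcongr
    linarith [hm1' i]
theorem wt_int {q : ℝ} (hq : q < 1) : IntervalIntegrable (fun x : ℝ ↦ qq x ^ (-q)) volume 0 1 := by
  have h := (Complex.betaIntegral_convergent (u := (1 - q : ℝ)) (v := (1 - q : ℝ)) (by simp; linarith) (by simp; linarith)).norm
  rw [intervalIntegrable_iff_integrableOn_Ioo_of_le zero_le_one] at h ⊢
  refine h.congr_fun (fun x hx ↦ ◇) measurableSet_Ioo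
  have h1 := sub_pos.2 hx.2
  have e : ((1 - q : ℝ) : ℂ) - 1 = ((-q : ℝ) : ℂ) := by
    push_cast
    ring
  simp only [e]
  rw [norm_mul, norm_cpow_eq_rpow_re_of_pos hx.1, show (1 - x) = ((1 - x : ℝ) : ℂ) by simp, norm_cpow_eq_rpow_re_of_pos h1, ofReal_re, mul_rpow hx.1.le h1.le]
theorem wt_pos {x : ℝ} (hx : x ∈ O01) : 0 < x * (1 - x) := mul_pos hx.1 (sub_pos.2 hx.2)
theorem wt_le {x : ℝ} : x * (1 - x) ≤ 1/4 := by nlinarith [sq_nonneg (x - 1/2)]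
theorem wt_one {x q : ℝ} (hx : x ∈ O01) (hq : 0 ≤ q) : 1 ≤ qq x ^ (-q) :=
  one_le_rpow_of_pos_of_le_one_of_nonpos (wt_pos hx) (by linarith [wt_le (x := x)]) bl
theorem end_bd {g : ℝ → ℂ} {M r0 q : ℝ} (hq : 0 ≤ q) (hr : 0 < r0) (hg : ContinuousOn g (Ioo 0 1))
    (hb : ∀ x ∈ O01, x * (1 - x) < r0 → ‖g x‖ ≤ M * qq x ^ (-q)) :
    ∃ M' > 0, ∀ x ∈ O01, ‖g x‖ ≤ M' * qq x ^ (-q) := by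
  obtain ⟨M1, hM1⟩ := (isCompact_Icc.inter_right (isClosed_le continuous_const (show Continuous fun x : ℝ ↦ x * (1 - x) by fun_prop))).exists_bound_of_continuousOn (hg.mono (by
    rintro x ⟨⟨h1, h2⟩, h3⟩
    refine ⟨lt_of_le_of_ne h1 ◇, lt_of_le_of_ne h2 ◇⟩ <;> rintro rfl <;> norm_num at h3 <;> linarith))
  refine ⟨|M| + |M1| + 1, bp, fun x hx ↦ ◇⟩
  have h1 := wt_one hx hq
  by_cases h : x * (1 - x) < r0
  · refine (hb x hx h).trans ◇
    gcongr
    linarith [le_abs_self M, abs_nonneg M1]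
  · refine (hM1 x ⟨Ioo_subset_Icc_self hx, not_lt.1 h⟩).trans ◇
    calc M1 ≤ (|M| + |M1| + 1) * 1 := by linarith [le_abs_self M1, abs_nonneg M]
      _ ≤ _ := by gcongr
theorem int_of_bd {g : ℝ → ℂ} {M q : ℝ} (hq : q < 1) (hg : ContinuousOn g (Ioo 0 1))
    (hb : ∀ x ∈ O01, ‖g x‖ ≤ M * qq x ^ (-q)) : IntervalIntegrable g volume 0 1 := by
  have h := (wt_int hq).const_mul M
  rw [intervalIntegrable_iff_integrableOn_Ioo_of_le zero_le_one] at h ⊢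
  exact h.mono' (hg.aestronglyMeasurable measurableSet_Ioo) ((ae_restrict_iff' measurableSet_Ioo).2 (ae_of_all _ hb))
def wp (s x : ℝ) : ℂ := x - (s * qq x : ℝ) * I
def wp' (s x : ℝ) : ℂ := 1 - (s * (1 - 2 * x) : ℝ) * I
theorem wp_re (s x : ℝ) : (wp s x).re = x := by simp [wp]
theorem wp_im (s x : ℝ) : (wp s x).im = -(s * qq x) := by simp [wp]
theorem wp_zero (x : ℝ) : wp 0 x = x := by simp [wp]
theorem wp'_zero (x : ℝ) : wp' 0 x = 1 := by simp [wp']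
theorem wp_one_sub (s x : ℝ) : wp s (1 - x) = 1 - wp (-s) x := by
  simp [wp]
  ring
theorem wp_mem {ε s x : ℝ} (hs : |s| < ε) (hx : x ∈ O01) : wp s x ∈ lens ε := by
  refine ⟨by rw [wp_re]; exact hx.1, by rw [wp_re]; exact hx.2, ◇⟩
  rw [wp_re, wp_im, abs_neg, abs_mul, abs_of_pos (wt_pos hx)]
  exact mul_lt_mul_of_pos_right hs (wt_pos hx)
theorem wp_deriv (s x : ℝ) : HasDerivAt (wp s) (wp' s x) x := by
  have h1 : HasDerivAt (fun x ↦ s * qq x) (s * (1 - 2 * x)) x := by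
    convert! (((hasDerivAt_id x).mul ((hasDerivAt_id x).const_sub 1)).const_mul s) using 1
    simp only [id]
    ring
  exact (hasDerivAt_id x).ofReal_comp.sub (h1.ofReal_comp.mul_const I)
theorem wp_cont (s : ℝ) : Continuous (wp s) := by
  unfold wp
  fun_prop
theorem wp'_cont (s : ℝ) : Continuous (wp' s) := by
  unfold wp'
  fun_prop
theorem wp'_le {s x : ℝ} (hs : |s| ≤ 1) (hx : x ∈ I01) : ‖wp' s x‖ ≤ 2 := by
  refine (norm_sub_le _ _).trans ◇
  have : |1 - 2 * x| ≤ 1 := abs_le.2 ⟨by linarith [hx.2], by linarith [hx.1]⟩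
  simp only [norm_one, norm_mul, norm_I, norm_real, norm_eq_abs]
  nlinarith [abs_nonneg s]
theorem path_cd {S : Set ℂ} (hS : IsOpen S) {g : CC} (hg : DifferentiableOn ℂ g S) {s : ℝ} (hws : ∀ x ∈ O01, wp s x ∈ S) :
    ContinuousOn (fun x ↦ g (wp s x) * wp' s x) (Ioo 0 1) :=
  (hg.continuousOn.comp (wp_cont s).continuousOn hws).mul (wp'_cont s).continuousOn
theorem endLim {ε M r0 : ℝ} (hε : 0 < ε) (hε1 : ε ≤ 1) {S : Set ℂ} (hS : IsOpen S) (hsym : ∀ w ∈ S, ((RE w : ℝ) : ℂ) ∈ S) (hSc : Convex ℝ S) (h0S : ∀ x ∈ O01, tC x ∈ S)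
    {H g : CC} (hH : ∀ w ∈ S, HasDerivAt H (g w) w) (hr : 0 < r0) (hg : DifferentiableOn ℂ g S)
    (hb : ∀ w ∈ S, w ∈ lens ε → RE w * (1 - RE w) < r0 → ‖g w‖ ≤ M * qq RE w ^ mh) :
    ∃ l0 : ℂ, ∀ s : ℝ, |s| < ε → (∀ x ∈ O01, wp s x ∈ S) → Tendsto (fun x ↦ H (wp s x)) (𝓝[>] 0) (𝓝 l0) := by
  have hint : IntervalIntegrable (fun x ↦ g x) volume 0 1 := by
    obtain ⟨M', hM', hb'⟩ := end_bd (q := 1/2) bn hr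
      (hg.continuousOn.comp continuous_ofReal.continuousOn h0S)
      (fun x hx h ↦ by simpa using hb x (h0S x hx) (mem_lens_real hε hx) (by simpa using h))
    exact int_of_bd bn (hg.continuousOn.comp continuous_ofReal.continuousOn h0S) hb'
  refine ⟨H hf2 - ∫ x in 0..hf2, g x, fun s hs hws ↦ ◇⟩
  have hint2 : IntervalIntegrable (fun x ↦ g x) volume 0 hf2 := hint.mono_set (by
    rw [uIcc_of_le bn, uIcc_of_le bn]; exact Icc_subset_Icc_right bn)
  have hreal : Tendsto (fun x : ℝ ↦ H x) (𝓝[>] 0) (𝓝 (H (1/2:ℝ) - ∫ x in 0..hf2, g x)) := by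
    have h1 : Tendsto (fun x ↦ H (1/2:ℝ) - ∫ t in x..hf2, g t) (𝓝[>] 0) (𝓝 (H (1/2:ℝ) - ∫ x in 0..hf2, g x)) := by
      refine Tendsto.const_sub _ ◇
      have := intervalIntegral.continuousOn_primitive_interval_left
        ((intervalIntegrable_iff' bs).1 hint2)
      rw [uIcc_of_le bn] at this
      refine (this 0 bn).mono_left ◇
      rw [nhdsWithin_le_iff]
      filter_upwards [Ioo_mem_nhdsGT (show 0 < 1/2 by norm_num)] with x hx using Ioo_subset_Icc_self hx
    refine h1.congr' ◇
    filter_upwards [Ioo_mem_nhdsGT (show 0 < 1/2 by norm_num)] with x hx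
    rw [integral_eq_sub_of_hasDerivAt (f := fun x ↦ H x) (fun t ht ↦ ◇)
      (hint2.mono_set (by rw [uIcc_of_le hx.2.le, uIcc_of_le bn]; exact Icc_subset_Icc_left hx.1.le)), sub_sub_cancel]
    rw [uIcc_of_le hx.2.le] at ht
    exact (hH _ (h0S t ⟨by linarith [hx.1, ht.1], by linarith [ht.2]⟩)).comp_ofReal
  have hdiff : Tendsto (fun x ↦ H (wp s x) - H x) (𝓝[>] 0) (𝓝 0) := by
    have h2 : Tendsto (fun x ↦ |M| * qq x ^ (1/2:ℝ)) (𝓝[>] 0) (𝓝 0) := by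
      have : ContinuousAt (fun x ↦ |M| * qq x ^ (1/2:ℝ)) 0 := by
        refine ContinuousAt.mul continuousAt_const (ContinuousAt.rpow_const bf bn)
      have h3 := this.tendsto
      simp at h3
      exact (h3.congr fun x ↦ by norm_num).mono_left nhdsWithin_le_nhds
    refine squeeze_zero_norm' ◇ h2
    filter_upwards [Ioo_mem_nhdsGT (show 0 < min 1 r0 by positivity)] with x hx
    have hx1 : x ∈ Ioo 0 1 := ⟨hx.1, hx.2.trans_le mll⟩
    have hseg :=
      (hSc.inter (lens_convex hε.le)).segment_subset ⟨h0S x hx1, mem_lens_real hε hx1⟩ ⟨hws x hx1, wp_mem hs hx1⟩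
    have hre : ∀ v ∈ segment ℝ tC x (wp s x), RE v = x := by
      rintro v ⟨a, b, -, -, hab, rfl⟩
      simp [wp_re]
      rw [← add_mul, hab, one_mul]
    have := Convex.norm_image_sub_le_of_norm_hasDerivWithin_le (f' := g)
      (fun v hv ↦ (hH v (hseg hv).1).hasDerivWithinAt) (fun v hv ↦ by
        have := hb v (hseg hv).1 (hseg hv).2 (by rw [hre v hv]; exact (by nlinarith [hx.2.trans_le mlr, hx.1]))
        rwa [hre v hv] at this) (convex_segment _ _) (left_mem_segment _ _ _) (right_mem_segment _ _ _)
    refine this.trans ◇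
    have e1 : ‖wp s x - x‖ ≤ x * (1 - x) := by
      rw [wp, sub_sub_cancel_left, norm_neg, norm_mul, norm_I, mul_one, norm_real, norm_eq_abs, abs_mul, abs_of_pos (wt_pos hx1)]
      exact mul_le_of_le_one_left (wt_pos hx1).le bl
    have e2 : qq x ^ mh * qq x = qq x ^ (1/2:ℝ) := by
      rw [← Real.rpow_add_one (wt_pos hx1).ne']
      norm_num
    have hp := rpow_nonneg (wt_pos hx1).le mh
    calc _ ≤ |M| * qq x ^ mh * qq x := by gcongr; exact le_abs_self M
      _ = _ := by rw [mul_assoc, e2]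
  simpa using hdiff.add hreal
theorem lensInt {ε M r0 : ℝ} (hε : 0 < ε) (hε1 : ε ≤ 1) {S : Set ℂ} (hS : IsOpen S) (hSc : Convex ℝ S) (h0S : ∀ x ∈ O01, tC x ∈ S)
    (hsym : ∀ w ∈ S, ((RE w : ℝ) : ℂ) ∈ S) {H g : CC} (hH : ∀ w ∈ S, HasDerivAt H (g w) w) (hr : 0 < r0) (hg : DifferentiableOn ℂ g S)
    (hb : ∀ w ∈ S, w ∈ lens ε → RE w * (1 - RE w) < r0 → ‖g w‖ ≤ M * qq RE w ^ mh) :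
    ∃ l0 l1 : ℂ, ∀ s : ℝ, |s| < ε → (∀ x ∈ O01, wp s x ∈ S) → Tendsto (fun x ↦ H (wp s x)) (𝓝[>] 0) (𝓝 l0) ∧
      Tendsto (fun x ↦ H (wp s x)) (𝓝[<] 1) (𝓝 l1) ∧ IntervalIntegrable (fun x ↦ g (wp s x) * wp' s x) volume 0 1 ∧
      ∫ x in 0..1, g (wp s x) * wp' s x = l1 - l0 := by
  obtain ⟨l0, hl0⟩ := endLim hε hε1 hS hsym hSc h0S hH hr hg hb
  obtain ⟨l1, hl1⟩ := endLim (S := (fun w ↦ 1 - w) ⁻¹' S) hε hε1 (hS.preimage bf)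
    (fun w hw ↦ by have := hsym _ hw; simpa using this) (by
      intro a ha b hb x y hx hy hxy
      have := hSc ha hb hx hy hxy
      have e : x • (1 - a) + y • (1 - b) = 1 - (x • a + y • b) := by
        have : tC x + y = 1 := by exact_mod_cast hxy
        simp only [real_smul]
        linear_combination this
      rw [e] at this; exact this) (fun x hx ↦ by
        have := h0S (1 - x) ⟨by linarith [hx.2], by linarith [hx.1]⟩
        simpa using this) (fun w hw ↦ (hH _ hw).comp w ((fun w ↦ by simpa using (hasDerivAt_id w).const_sub 1) w)) hr
    ((hg.comp (f := fun w ↦ 1 - w) bf fun w hw ↦ hw).mul_const _) (fun w hw hl hwr ↦ by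
      simpa [mul_comm] using (hb _ hw (lens_one_sub hl) (by simpa [mul_comm] using hwr)))
  refine ⟨l0, l1, fun s hs hws ↦ ◇⟩
  have h1 : Tendsto (fun x ↦ H (wp s x)) (𝓝[<] 1) (𝓝 l1) := by
    have h2 := hl1 _ (by rwa [abs_neg]) (fun x hx ↦ by
      have := hws (1 - x) ⟨by linarith [hx.2], by linarith [hx.1]⟩
      rwa [wp_one_sub] at this)
    have h3 : Tendsto (fun x : ℝ ↦ 1 - x) (𝓝[<] 1) (𝓝[>] 0) := by
      refine tendsto_nhdsWithin_iff.2 ⟨◇, ◇⟩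
      · have : Tendsto (fun x : ℝ ↦ 1 - x) _ (𝓝 (1 - 1)) := (continuous_const.sub continuous_id).tendsto 1
        rw [sub_self] at this
        exact this.mono_left nhdsWithin_le_nhds
      · filter_upwards [self_mem_nhdsWithin] with x hx
        have : x < 1 := hx
        exact sub_pos.2 this
    refine (h2.comp h3).congr fun x ↦ ◇
    simp only [Function.comp]
    rw [← wp_one_sub, sub_sub_cancel]
  have hint : IntervalIntegrable (fun x ↦ g (wp s x) * wp' s x) volume 0 1 := by
    have hc := path_cd hS hg hws
    obtain ⟨M', -, hM'⟩ := end_bd (q := 1/2) (M := M * 2) bn hr hc (fun x hx hxr ↦ by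
      have e1 := hb _ (hws x hx) (wp_mem hs hx) (by rw [wp_re]; exact hxr)
      rw [wp_re] at e1
      rw [norm_mul]
      have e2 := wp'_le bl (Ioo_subset_Icc_self hx)
      calc _ ≤ M * qq x ^ mh * 2 := by gcongr; exact (norm_nonneg (g (wp s x))).trans e1
        _ = _ := by ring)
    exact int_of_bd bn hc hM'
  exact ⟨hl0 s hs hws, h1, hint, intervalIntegral.integral_eq_sub_of_hasDerivAt_of_tendsto zero_lt_one
    (fun x hx ↦ (hH _ (hws x hx)).comp x (wp_deriv s x)) hint (hl0 s hs hws) h1⟩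
theorem cornerPt {E : CC} {V : Set ℂ} (hV : IsOpen V) (h0 : tC 0 ∈ V) (hE : DifferentiableOn ℂ E V)
    {u : ℂ} {m θ κ : ℝ} (hu : ‖u‖ = 1) (hm : 0 < m) (hd : deriv E 0 = m * (u * exp (tR θ * I))) (hκ : 0 < κ) (hκ1 : κ ≤ 1/4) :
    ∃ δ > 0, ∃ K > 0, ∀ x y : ℝ, 0 < x → x < δ → κ/2 ≤ |y| → |y| ≤ κ → ∃ s : ℂ, E (x * (1 + y * I)) = E 0 + u * exp s ∧
      |IM s - (θ + y)| ≤ |y|/2 ∧ |RE s - rlog x| ≤ K := by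
  obtain ⟨C, hC, δ, hδ, -, h⟩ := coneLoc hV h0 hE hm hd (mul_ne_zero (by rw [← norm_ne_zero_iff, hu]; norm_num) (exp_ne_zero _))
  refine ⟨min δ (κ/(8*C)), bp, |rlog m| + 1, bp, fun x y hx hxd hy hy2 ↦ ◇⟩
  obtain ⟨e, he, hw⟩ := h x y hx bl (hxd.trans_le mll)
  have hx2 := hxd.trans_le mlr
  rw [lt_div_iff₀ bp] at hx2
  have hi := (abs_im_le_norm e).trans he
  have hr := (abs_re_le_norm e).trans he
  have hy1 : ‖(y * I : ℂ)‖ ≤ |y| := bs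
  have hl2 : ‖log (1 + y * I) - y * I‖ ≤ |y|/4 := by
    refine (Complex.norm_log_one_add_sub_self_le bl).trans ◇
    have h2 : (1 - |y|)⁻¹ ≤ 2 := by
      rw [inv_le_comm₀ bl bn]
      linarith
    rw [(bs : ‖(y * I : ℂ)‖ = |y|)]
    nlinarith
  have hl3 := (abs_im_le_norm _).trans hl2
  have hl4 := (abs_re_le_norm _).trans hl2
  refine ⟨rlog (m * x) + log (1 + y * I) + e + θ * I, ◇, ◇, ◇⟩
  · rw [hw, exp_add _ (θ * I)]
    ring
  · simp at hl3 ⊢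
    rw [abs_le] at *
    constructor <;> linarith
  · simp only [sub_re, mul_re, ofReal_re, I_re, ofReal_im, add_re] at hl4 ⊢
    rw [Real.log_mul hm.ne' hx.ne']
    have := le_abs_self (rlog m)
    have := neg_abs_le (rlog m)
    rw [abs_le] at hl4 hr ⊢
    constructor <;> linarith
namespace Chain
variable (C : Chain D lam N) (i : Fin N)
local notation "cT" => C.T
local notation "cE" => C.ε
local notation "cU" => C.u
local notation "cL" => C.la
theorem ex_kap : ∃ κ > 0, κ < cE / 2 ∧ κ ≤ 1/4 ∧ ∀ i, κ ≤ cL i ∧ κ ≤ 2 - cL i := by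
  obtain ⟨e, he, -, h⟩ := fin_pos (fun i ↦ min (cL i) (2 - cL i)) fun i ↦ lt_min (C.hla i).1 (by linarith [(C.hla i).2])
  have := C.hε
  refine ⟨min e (min (1/4) (cE/4)), bp, ◇, ◇, fun i ↦ ⟨◇, ◇⟩⟩
  · linarith [min_le_right e (min (1/4) (cE/4)), min_le_right (1/4) (cE/4)]
  · linarith [min_le_right e (min (1/4) (cE/4)), min_le_left (1/4) (cE/4)]
  · exact (mll).trans ((h i).trans mll)
  · exact (mll).trans ((h i).trans mlr)
noncomputable def κ : ℝ := C.ex_kap.choose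
theorem hκ : 0 < C.κ := C.ex_kap.choose_spec.1
theorem hκε : C.κ < cE / 2 := C.ex_kap.choose_spec.2.1
theorem hκ1 : C.κ ≤ 1/4 := C.ex_kap.choose_spec.2.2.1
theorem hκl : C.κ ≤ cL i ∧ C.κ ≤ 2 - cL i := C.ex_kap.choose_spec.2.2.2 i
theorem T0_mem : tC 0 ∈ C.U i := by simpa using C.seg i 0 bs
theorem rawPt : ∃ δ > 0, ∃ K > 0, ∀ τ x : ℝ, |τ| = 1 → 0 < x → x < δ → x ≤ 1/2 ∧
    (∃ s : ℂ, cT i (wp (τ * C.κ) x) = cT i 0 + cU i * exp s ∧ |IM s - (cL i * π / 2 - τ * C.κ * (1 - x))| ≤ C.κ * (1 - x) / 2 ∧ |RE s - rlog x| ≤ K) ∧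
    (∃ s : ℂ, cT (C.σ.symm i) (wp (τ * C.κ) (1 - x)) = cT i 0 + cU i * exp s ∧ |IM s - (-(cL i * π / 2) + τ * C.κ * (1 - x))| ≤ C.κ * (1 - x) / 2 ∧ |RE s - rlog x| ≤ K) := by
  have hκ := C.hκ
  obtain ⟨m, hm, hd⟩ := C.d0 i
  obtain ⟨m', hm', hd'⟩ := C.d1 i
  obtain ⟨δ, hδ, K, hK, h⟩ := cornerPt (C.hU i) (C.T0_mem i) (C.diff i) (C.hu i) hm hd hκ C.hκ1
  obtain ⟨δ', hδ', K', hK', h'⟩ := cornerPt (C.B_open i) (by simpa using C.B_seg i 0 bs) (C.B_diff i) (C.hu i) hm' hd' hκ C.hκ1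
  refine ⟨min (min δ δ') hf2, bp, max K K', bp, fun τ x hτ hx hxd ↦ ◇⟩
  have a1 := hxd.trans_le ((mll).trans mll)
  have a2 := hxd.trans_le ((mll).trans mlr)
  have a3 := hxd.trans_le mlr
  have hy : |τ * C.κ * (1 - x)| = C.κ * (1 - x) := by rw [abs_mul, abs_mul, hτ, abs_of_pos hκ, abs_of_pos bl, one_mul]
  obtain ⟨s, b1, b2, b3⟩ := h x _ hx a1 (by rw [abs_neg, hy]; nlinarith) (by rw [abs_neg, hy]; nlinarith)
  obtain ⟨s', c1, c2, c3⟩ := h' x _ hx a2 (by rw [hy]; nlinarith) (by rw [hy]; nlinarith)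
  refine ⟨a3.le, ⟨s, ◇, ◇, b3.trans (le_max_left _ _)⟩, ⟨s', ◇, ◇, c3.trans (le_max_right _ _)⟩⟩
  · rw [← b1]
    congr 1
    simp [wp]
    ring
  · rwa [abs_neg, hy] at b2
  · rw [wp_one_sub, C.B_zero i, ← c1]
    congr 1
    simp [wp]
    ring
  · rwa [hy] at c2
theorem exPt : ∃ δ > 0, ∃ K > 0, ∀ x : ℝ, 0 < x → x < δ →
    (∃ s : ℂ, cT i (wp C.κ x) = cT i 0 + cU i * exp s ∧ |IM s| ≤ cL i * π / 2 - C.κ/4 ∧ |RE s - rlog x| ≤ K) ∧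
    (∃ s : ℂ, cT (C.σ.symm i) (wp C.κ (1 - x)) = cT i 0 + cU i * exp s ∧ |IM s| ≤ cL i * π / 2 - C.κ/4 ∧ |RE s - rlog x| ≤ K) := by
  obtain ⟨δ, hδ, K, hK, h⟩ := C.rawPt i
  have hκ := C.hκ
  have hp := pi_gt_three
  have h4 := (C.hκl i).1
  refine ⟨δ, hδ, K, hK, fun x hx hxd ↦ ◇⟩
  obtain ⟨h1, ⟨s, a1, a2, a3⟩, ⟨s', b1, b2, b3⟩⟩ := h 1 x bs hx hxd
  rw [one_mul] at a1 a2 b1 b2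
  rw [abs_le] at a2 b2
  refine ⟨⟨s, a1, abs_le.2 ⟨◇, ◇⟩, a3⟩, ⟨s', b1, abs_le.2 ⟨◇, ◇⟩, b3⟩⟩ <;> nlinarith
theorem inPt : ∃ δ > 0, ∃ K > 0, ∀ x : ℝ, 0 < x → x < δ →
    (∃ s : ℂ, cT i (wp (-C.κ) x) = cT i 0 - cU i * exp s ∧ |IM s| ≤ (2 - cL i) * π / 2 - C.κ/4 ∧ |RE s - rlog x| ≤ K) ∧
    (∃ s : ℂ, cT (C.σ.symm i) (wp (-C.κ) (1 - x)) = cT i 0 - cU i * exp s ∧ |IM s| ≤ (2 - cL i) * π / 2 - C.κ/4 ∧ |RE s - rlog x| ≤ K) := by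
  obtain ⟨δ, hδ, K, hK, h⟩ := C.rawPt i
  have hκ := C.hκ
  have hp := pi_gt_three
  have h4 := (C.hκl i).2
  refine ⟨δ, hδ, K, hK, fun x hx hxd ↦ ◇⟩
  obtain ⟨h1, ⟨s, a1, a2, a3⟩, ⟨s', b1, b2, b3⟩⟩ := h (-1) x bs hx hxd
  rw [neg_one_mul] at a1 a2 b1 b2
  rw [abs_le] at a2 b2
  refine ⟨⟨s - π * I, ◇, ◇, by simpa using a3⟩, ⟨s' + π * I, ◇, ◇, by simpa using b3⟩⟩
  · rw [a1, exp_sub, exp_pi_mul_I]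
    ring
  · simp only [sub_im, mul_im, ofReal_re, I_im, ofReal_im]
    rw [abs_le]
    constructor <;> nlinarith
  · rw [b1, exp_add, exp_pi_mul_I]
    ring
  · simp only [add_im, mul_im, ofReal_re, I_im, ofReal_im]
    rw [abs_le]
    constructor <;> nlinarith
end Chain
def Kc (e : ℝ) : Set ℂ := {w | 0 ≤ RE w ∧ RE w ≤ 1 ∧ |IM w| ≤ e * qq RE w}
theorem Kc_cpt {e : ℝ} (h0 : 0 ≤ e) (h1 : e ≤ 1) : IsCompact (Kc e) := by
  refine Metric.isCompact_of_isClosed_isBounded ◇ ((isBounded_closedBall (x := 0) (r := 2)).subset fun w hw ↦ ◇)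
  · refine (isClosed_le continuous_const continuous_re).inter ((isClosed_le continuous_re continuous_const).inter
      (isClosed_le (f := fun w ↦ |IM w|) bf bf))
  · obtain ⟨a, b, c⟩ := hw
    have := norm_le_abs_re_add_abs_im w
    rw [abs_of_nonneg a] at this
    have : e * qq RE w ≤ 1 * (1/4) := by
      gcongr
      exact wt_le
    rw [mem_closedBall, dist_zero_right]
    linarith
theorem lens_Kc {e : ℝ} : lens e ⊆ Kc e := fun _ hw ↦ ⟨hw.1.le, hw.2.1.le, hw.2.2.le⟩
theorem wp_Kc {e s x : ℝ} (hs : |s| ≤ e) (hx : x ∈ I01) : wp s x ∈ Kc e := by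
  have h : 0 ≤ x * (1 - x) := mul_nonneg hx.1 (by linarith [hx.2])
  refine ⟨by rw [wp_re]; exact hx.1, by rw [wp_re]; exact hx.2, ◇⟩
  rw [wp_re, wp_im, abs_neg, abs_mul, abs_of_nonneg h]
  exact mul_le_mul_of_nonneg_right hs h
namespace Chain
variable (C : Chain D lam N) (i : Fin N)
local notation "cT" => C.T
local notation "cK" => C.κ
local notation "cE" => C.ε
local notation "cU" => C.u
local notation "cL" => C.la
theorem Kc_U {w : ℂ} (hw : w ∈ Kc (cE/2)) : w ∈ C.U i := by
  obtain ⟨a, b, c⟩ := hw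
  rcases a.eq_or_lt with h | h
  · have : w = tC 0 := cext h.symm (by rw [← h] at c; simpa using c)
    rw [this]
    exact C.seg i 0 bs
  rcases b.eq_or_lt with h' | h'
  · have : w = tC 1 := cext h' (by rw [h'] at c; simpa using c)
    rw [this]
    exact C.seg i 1 bs
  exact C.lU i ⟨h, h', by nlinarith [mul_pos C.hε (mul_pos h (sub_pos.2 h'))]⟩
theorem cptK : IsCompact (Kc (cE/2)) := Kc_cpt (by linarith [C.hε]) (by linarith [C.hε1])
theorem Tc : ContinuousOn (cT i) (Kc (cE/2)) := (C.diff i).continuousOn.mono fun _ ↦ C.Kc_U i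
theorem dTc : ContinuousOn (deriv (cT i)) (Kc (cE/2)) := ((C.diff i).deriv (C.hU i)).continuousOn.mono fun _ ↦ C.Kc_U i
theorem dT_bd : ∃ M > 0, ∀ i, ∀ w ∈ Kc (cE/2), ‖deriv (cT i) w‖ ≤ M := by
  choose M hM using fun i ↦ C.cptK.exists_bound_of_continuousOn (C.dTc i)
  obtain ⟨M', h, h'⟩ := fin_bound M
  exact ⟨M', h, fun i w hw ↦ (hM i w hw).trans (h' i)⟩
theorem e2 : 0 < cE/2 := by linarith [C.hε]
theorem e21 : cE/2 ≤ 1 := by linarith [C.hε1]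
theorem lens2 {w : ℂ} (hw : w ∈ lens (cE/2)) : w ∈ lens cE := lens_mono (by linarith [C.hε]) hw
theorem hda {w : ℂ} (hw : w ∈ lens cE) : HasDerivAt (cT i) (deriv (cT i) w) w :=
  ((C.diff i).differentiableAt ((C.hU i).mem_nhds (C.lU i hw))).hasDerivAt
theorem κm : |cK| < cE/2 := by
  rw [abs_of_pos C.hκ]
  exact C.hκε
structure Good (h : CC) (hi : Fin N → CC) : Prop where
  d : DifferentiableOn ℂ h D.G
  di : ∀ i, DifferentiableOn ℂ (hi i) (lens cE)
  up : ∀ i, ∀ w ∈ lens cE, 0 < IM w → hi i w = h (cT i w)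
  b : ∃ M > 0, ∃ r0 > 0, ∀ i, ∀ w ∈ lens (cE/2), RE w * (1 - RE w) < r0 → ‖hi i w‖ ≤ M * qq RE w ^ mh
  cone : ∀ i, ∃ M > 0, ∃ ρ2 < 0, ∀ s : ℂ, RE s < ρ2 → |IM s| ≤ (2 - cL i) * π / 2 - cK/4 →
    ‖h (cT i 0 - cU i * exp s)‖ ≤ M * rexp (-hf2 * RE s)
theorem cauchy0 {h : CC} {hi : Fin N → CC} (hg : C.Good h hi) {φ : CC} {ζ : ℂ} (hφ : ConformalOnto dG φ ζ) {s : ℝ} (hs : |s| < cE/2) :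
    (∀ i, IntervalIntegrable (fun x ↦ hi i (wp s x) * deriv (cT i) (wp s x) * wp' s x) volume 0 1) ∧
    ∑ i, ∫ x in 0..1, hi i (wp s x) * deriv (cT i) (wp s x) * wp' s x = 0 := by
  obtain ⟨H, hH⟩ := conf_prim D.isOpen hφ hg.d
  obtain ⟨M, hM, r0, hr0, hb⟩ := hg.b
  obtain ⟨M1, hM1, hdT⟩ := C.dT_bd
  have hgd : ∀ i, DifferentiableOn ℂ (fun w ↦ hi i w * deriv (cT i) w) _ := fun i ↦
    ((hg.di i).mono fun _ ↦ C.lens2).mul (((C.diff i).deriv (C.hU i)).mono fun w hw ↦ C.lU i (C.lens2 hw))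
  have hP : ∀ i, ∃ H1 : CC, (∀ w ∈ lens (cE/2), HasDerivAt H1 (hi i w * deriv (cT i) w) w) ∧ ∀ w ∈ lens (cE/2), 0 < IM w → H1 w = H (cT i w) := by
    intro i
    obtain ⟨H1, h1⟩ := primConvex (lens_convex C.e2.le) (lens_open _) (hgd i)
    have hop : IsOpen {w | w ∈ lens (cE/2) ∧ 0 < 1 * IM w} := (lens_open _).inter (isOpen_lt (f := fun _ : ℂ ↦ tR 0) continuous_const bf)
    have hd : ∀ w ∈ {w | w ∈ lens (cE/2) ∧ 0 < 1 * IM w}, HasDerivAt (fun w ↦ H1 w - H (cT i w)) 0 w := by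
      rintro w ⟨hw, hw2⟩
      rw [one_mul] at hw2
      have := (h1 w hw).sub ((hH _ (C.up i w (C.lens2 hw) hw2)).comp w (C.hda i (C.lens2 hw)))
      rw [hg.up i w (C.lens2 hw) hw2, sub_self] at this
      exact this
    obtain ⟨c, hc⟩ := hop.exists_is_const_of_deriv_eq_zero (halflens_convex C.e2.le 1).isPreconnected (fun w hw ↦ (hd w hw).differentiableAt.differentiableWithinAt) (fun w hw ↦ (hd w hw).deriv)
    refine ⟨fun w ↦ H1 w - c, fun w hw ↦ (h1 w hw).sub_const c, fun w hw hw2 ↦ ◇⟩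
    rw [← (hc w ⟨hw, bl⟩)]
    ring
  choose H1 hH1 hHu using hP
  have hL := fun i ↦ lensInt C.e2 C.e21 (lens_open _) (lens_convex C.e2.le) (fun x hx ↦ mem_lens_real C.e2 hx)
    (fun w hw ↦ mem_lens_real C.e2 ⟨hw.1, hw.2.1⟩) (hH1 i) hr0 (hgd i) (M := M * M1) (fun w hw _ hwr ↦ by
      have : 0 ≤ qq RE w ^ mh := rpow_nonneg (wt_pos ⟨hw.1, hw.2.1⟩).le _
      calc _ ≤ M * qq RE w ^ mh * M1 := by
            rw [norm_mul]
            gcongr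
            exacts [hb i w hw hwr, hdT i w (lens_Kc hw)]
        _ = _ := by ring)
  choose l0 l1 hl using hL
  have hcor : ∀ i, l1 (C.σ.symm i) = l0 i := by
    intro i
    obtain ⟨M2, hM2, ρ2, hρ2, hcone⟩ := hg.cone i
    obtain ⟨c, hc, ρ3, hρ3, hball⟩ := C.cone_ball i (show 0 < cK/4 by linarith [C.hκ])
    obtain ⟨δ, hδ, K, hK, hpt⟩ := C.inPt i
    have hκ' : |(-cK)| < cE/2 := by
      rw [abs_neg]
      exact C.κm
    have t1 := (hl (C.σ.symm i) (-cK) hκ' fun x hx ↦ wp_mem hκ' hx).2.1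
    have h3 : Tendsto (fun x : ℝ ↦ 1 - x) (𝓝[>] 0) (𝓝[<] 1) := by
      refine tendsto_nhdsWithin_iff.2 ⟨◇, ◇⟩
      · have : Tendsto (fun x : ℝ ↦ 1 - x) (𝓝 0) (𝓝 (1 - 0)) := (continuous_const.sub continuous_id).tendsto 0
        rw [sub_zero] at this
        exact this.mono_left nhdsWithin_le_nhds
      · filter_upwards [self_mem_nhdsWithin] with x hx
        exact sub_lt_self 1 (mem_Ioi.1 hx)
    have t2 := (t1.comp h3).sub ((hl i (-cK) hκ' fun x hx ↦ wp_mem hκ' hx).1)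
    refine sub_eq_zero.1 (tendsto_nhds_unique t2 (squeeze_zero_norm' (a := fun x ↦ M2 * rexp (1/2 * (rlog x + K)) * (2 * K + 8)) ◇ ◇))
    · have hx0 : ∀ᶠ x : ℝ in 𝓝[>] 0, rlog x < min ρ2 ρ3 - K := by
        exact tendsto_log_nhdsGT_zero.eventually (eventually_lt_atBot _)
      filter_upwards [hx0, Ioo_mem_nhdsGT (show 0 < min δ 1 by positivity)] with x hlx hx
      obtain ⟨⟨s1, a1, a2, a3⟩, ⟨s2, b1, b2, b3⟩⟩ := hpt x hx.1 (hx.2.trans_le mll)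
      have hx1 : x ∈ Ioo 0 1 := ⟨hx.1, hx.2.trans_le mlr⟩
      have hx2 : 1 - x ∈ Ioo 0 1 := ⟨by linarith [hx1.2], by linarith [hx1.1]⟩
      have him : ∀ y ∈ Ioo 0 1, 0 < (wp (-cK) y).im := fun y hy ↦ by
        rw [wp_im]
        nlinarith [wt_pos hy, C.hκ]
      have e2 := hHu (C.σ.symm i) _ (wp_mem hκ' hx2) (him _ hx2)
      simp only [Function.comp]
      rw [(hHu i _ (wp_mem hκ' hx1) (him x hx1)), e2, a1, b1]
      set P : Set ℂ := {s | RE s ≤ rlog x + K} ∩ {s | |IM s| ≤ (2 - cL i) * π / 2 - cK/4}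
      have hPc : Convex ℝ P := (convex_halfSpace_re_le _).inter (by
        convert! ((convex_halfSpace_im_le ((2 - cL i) * π / 2 - cK/4)).inter (convex_halfSpace_im_ge (-((2 - cL i) * π / 2 - cK/4)))) using 1; ext w; simp only [mem_inter_iff, mem_ofPred_eq, abs_le]; tauto)
      have hP1 : ∀ s ∈ P, HasDerivAt (fun s ↦ H (cT i 0 - cU i * exp s)) (h (cT i 0 - cU i * exp s) * (-(cU i * exp s))) s := by
        rintro s ⟨p1, p2⟩
        have p1 : RE s ≤ _ := p1
        have := (hH _ (hball s (by linarith [min_le_right ρ2 ρ3]) p2 (mem_ball_self bp))).comp s (((hasDerivAt_exp s).const_mul _).const_sub _)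
        exact this
      have := Convex.norm_image_sub_le_of_norm_hasDerivWithin_le (C := M2 * rexp (1/2 * (rlog x + K)))
        (fun v hv ↦ (hP1 v hv).hasDerivWithinAt) (fun v hv ↦ by
          have p1 : RE v ≤ _ := hv.1
          rw [norm_mul, norm_neg, norm_mul, C.hu i, one_mul, norm_exp]
          calc _ ≤ M2 * rexp (-hf2 * RE v) * rexp RE v := by gcongr; exact hcone v (by linarith [min_le_left ρ2 ρ3]) hv.2
            _ = M2 * rexp (1/2 * RE v) := by rw [mul_assoc, ← rea]; ring_nf
            _ ≤ _ := by gcongr) hPc ⟨by show RE s1 ≤ _; linarith [(abs_le.1 a3).2], a2⟩ ⟨by show RE s2 ≤ _; linarith [(abs_le.1 b3).2], b2⟩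
      refine this.trans ◇
      gcongr
      refine (norm_le_abs_re_add_abs_im _).trans ◇
      have q1 : |(s2 - s1).re| ≤ 2 * K := by
        rw [sub_re]
        rw [abs_le] at *
        constructor <;> linarith
      have q2 : |(s2 - s1).im| ≤ 8 := by
        have := pi_lt_four
        have := pi_pos
        have := (C.hla i).1
        have := C.hκ
        have : (2 - cL i) * π / 2 ≤ 4 := by nlinarith
        rw [sub_im]
        rw [abs_le] at *
        constructor <;> linarith
      linarith
    · have h4 : Tendsto (fun x ↦ rexp (1/2 * (rlog x + K))) _ _ :=
        Real.tendsto_exp_atBot.comp (Tendsto.const_mul_atBot bn (tendsto_atBot_add_const_right _ _ tendsto_log_nhdsGT_zero))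
      simpa using (h4.const_mul M2).mul_const _
  refine ⟨fun i ↦ (hl i s hs fun x hx ↦ wp_mem hs hx).2.2.1, ◇⟩
  rw [sum_congr rfl fun i _ ↦ (hl i s hs fun x hx ↦ wp_mem hs hx).2.2.2, sum_sub_distrib, sub_eq_zero, ← Equiv.sum_comp C.σ.symm]
  exact sum_congr rfl fun i _ ↦ hcor i
end Chain
theorem cauchyT {g τ : ℝ → ℂ} (hg : IntervalIntegrable g volume 0 1) (hτ : ContinuousOn τ (Icc 0 1)) {z : ℂ} (hz : z ∉ τ '' Icc 0 1) :
    HasDerivAt (fun t ↦ ∫ x in 0..1, g x / (τ x - t)) (∫ x in 0..1, g x / (τ x - z) ^ 2) z := by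
  obtain ⟨r, hr, hrb⟩ := Metric.isOpen_iff.1 (isCompact_Icc.image_of_continuousOn hτ).isClosed.isOpen_compl z hz
  have hd : ∀ x ∈ I01, ∀ t ∈ ball z (r/2), r/2 ≤ ‖τ x - t‖ := by
    intro x hx t ht
    by_contra hc
    refine hrb (show τ x ∈ ball z r from ◇) ⟨x, hx, rfl⟩
    rw [mem_ball, dist_eq_norm] at ht ⊢
    have := norm_add_le (τ x - t) (t - z)
    rw [sub_add_sub_cancel] at this
    linarith
  have hne : ∀ x ∈ I01, ∀ t ∈ ball z _, τ x - t ≠ 0 := fun x hx t ht ↦ norm_pos_iff.1 ((half_pos hr).trans_le (hd x hx t ht))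
  have hm : ∀ t ∈ ball z _, ∀ k, IntervalIntegrable (fun x ↦ g x / (τ x - t) ^ k) volume 0 1 := fun t ht k ↦ by
    refine hg.mul_continuousOn ◇
    rw [uIcc_of_le zero_le_one]
    exact ((hτ.sub continuousOn_const).pow k).inv₀ fun x hx ↦ pow_ne_zero k (hne x hx t ht)
  have hm1 : ∀ t ∈ ball z _, IntervalIntegrable (fun x ↦ g x / (τ x - t)) volume 0 1 := fun t ht ↦ by simpa using hm t ht 1
  have hz' : z ∈ ball z (r/2) := mem_ball_self bl
  have hIcc : ∀ x, x ∈ uIoc 0 1 → x ∈ I01 := fun x hx ↦ by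
    rw [uIoc_of_le zero_le_one] at hx
    exact ⟨hx.1.le, hx.2⟩
  refine (intervalIntegral.hasDerivAt_integral_of_dominated_loc_of_deriv_le (F' := fun t x ↦ g x / (τ x - t) ^ 2)
    (bound := fun x ↦ ‖g x‖ / (r/2) ^ 2) (ball_mem_nhds z (show 0 < r/2 by linarith)) ◇ (hm1 z hz') ◇ ◇ (hg.norm.div_const _) ◇).2
  · filter_upwards [ball_mem_nhds z (show 0 < r/2 by linarith)] with t ht using (hm1 t ht).def'.aestronglyMeasurable
  · exact (hm z hz' 2).def'.aestronglyMeasurable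
  · refine ae_of_all _ fun x hx t ht ↦ ◇
    rw [norm_div, norm_pow]
    gcongr
    exact hd x (hIcc x hx) t ht
  · refine ae_of_all _ fun x hx t ht ↦ ◇
    have := (((hasDerivAt_id t).const_sub _).inv (hne x (hIcc x hx) t ht)).const_mul (g x)
    simpa [div_eq_mul_inv] using this
namespace Chain
variable (C : Chain D lam N) (i : Fin N)
local notation "cT" => C.T
local notation "cK" => C.κ
local notation "cE" => C.ε
local notation "cU" => C.u
local notation "cL" => C.la
local notation "cS" => C.σ
theorem ex_ball {s : ℂ} (hs : RE s < C.ρ - 1) (h : 4 * C.A * rexp RE s ≤ cL i * π / 2 - |IM s|) :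
    ball (cT i 0 + cU i * exp s) ((cL i * π / 2 - |IM s|)/8 * rexp RE s) ⊆ Xt D := by
  set g := cL i * π / 2 - |IM s| with hg
  have hA := C.hA
  have hu0 : cU i ≠ 0 := by
    rw [← norm_ne_zero_iff, C.hu i]
    norm_num
  have hg0 := lt_of_lt_of_le bp h
  have hg4 : g ≤ 4 := by
    have := pi_lt_four
    have := pi_pos
    have := (C.hla i).2
    have := (C.hla i).1
    have := abs_nonneg IM s
    nlinarith
  intro t ht
  rw [mem_ball, dist_eq_norm] at ht
  obtain ⟨s', h1, h2⟩ := exp_ball (d := (t - (cT i 0 + cU i * exp s)) / cU i) (c := g/8) bl (by rw [norm_div, C.hu, div_one]; exact ht.le)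
  have e1 : t = cT i 0 + cU i * exp s' := by
    rw [← h1]
    field_simp
    ring
  have r1 := (abs_le.1 ((abs_re_le_norm _).trans h2)).2
  have r2 := (abs_im_le_norm _).trans h2
  rw [sub_re] at r1
  rw [sub_im] at r2
  rw [e1]
  refine C.exS i s' bl ◇
  have r3 := abs_sub_abs_le_abs_sub s'.im IM s
  have : rexp s'.re ≤ 3 * rexp RE s := by
    calc _ ≤ rexp (1 + RE s) := Real.exp_le_exp.2 bl
      _ = rexp 1 * rexp RE s := rea _ _
      _ ≤ _ := by gcongr; linarith [Real.exp_one_lt_d9]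
  have := mul_le_mul_of_nonneg_left this hA.le
  linarith
theorem low_notG {w : ℂ} (hw : w ∈ lens cE) (h : IM w ≤ 0) : cT i w ∉ dG := by
  rcases h.lt_or_eq with h | h
  · exact fun h' ↦ C.lo i w hw h (subset_closure h')
  · rw [show w = RE w from cext rfl (by simpa using h)]
    exact (C.real_notG i ⟨hw.1.le, hw.2.1.le⟩).2
theorem Om_conn (C : Chain D lam N) : IsPreconnected Xt D := by
  have hκ := C.hκ
  rw [isPreconnected_iff_subset_of_disjoint]
  have main : ∀ u v, IsOpen u → IsOpen v → Xt D ⊆ u ∪ v → Xt D ∩ (u ∩ v) = ∅ →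
      (∀ i, ∀ w ∈ lens C.ε, IM w < 0 → C.T i w ∈ u) → Xt D ⊆ u := by
    intro u v hu hv huv hd hL
    by_contra hc
    obtain ⟨t0, ht0, ht0u⟩ := not_subset.1 hc
    have hdis : ∀ t ∈ Xt D, t ∈ u → t ∈ v → False := fun t h1 h2 h3 ↦ by
      have : t ∈ Xt D ∩ (u ∩ v) := ⟨h1, h2, h3⟩
      rwa [hd] at this
    have hcon := (Set.Countable.isPathConnected_compl_of_one_lt_rank (by rw [Complex.rank_real_complex]; norm_num)
      (finite_range fun i ↦ C.T i 0).countable).isConnected.isPreconnected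
    have hsub := hcon.subset_of_closure_inter_subset (isClosed_closure.isOpen_compl.inter hv)
      ⟨t0, fun ⟨i, hi⟩ ↦ ht0 (by rw [← hi]; exact frontier_subset_closure (C.corner_fr i)), ht0, (huv ht0).resolve_left ht0u⟩ (by
      rintro t ⟨ht, htZ⟩
      by_cases htO : t ∈ Xt D
      · rcases huv htO with h | h
        · obtain ⟨t', h1, h2⟩ := mem_closure_iff.1 ht _ (isClosed_closure.isOpen_compl.inter hu) ⟨htO, h⟩
          exact (hdis t' h1.1 h1.2 h2.2).elim
        · exact ⟨htO, h⟩
      · exfalso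
        have htG : t ∉ dG := fun h ↦ by
          obtain ⟨t', h1, h2⟩ := mem_closure_iff.1 ht _ D.isOpen h
          exact h2.1 (subset_closure h1)
        have hfr : t ∈ frontier dG := by
          rw [D.isOpen.frontier_eq]
          exact ⟨not_not.1 htO, htG⟩
        obtain ⟨i, x, hx, rfl⟩ := (C.cover t).1 hfr
        have hx' : x ∈ Ioo 0 1 := by
          refine ⟨lt_of_le_of_ne hx.1 ◇, lt_of_le_of_ne hx.2 ◇⟩
          · rintro rfl
            exact htZ ⟨i, bs⟩
          · rintro rfl
            exact htZ ⟨C.σ i, by simp [C.next i]⟩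
        have hn := ((inj_inverse (C.hU i) (C.diff i) (fun w hw ↦ (C.inj i).leftInvOn_invFunOn hw) (C.seg i x hx)).2.2) (image_mem_map ((lens_open _).mem_nhds (mem_lens_real C.hε hx')))
        obtain ⟨_, ⟨w, hw, rfl⟩, h2⟩ := mem_closure_iff_nhds.1 ht _ hn
        rcases lt_trichotomy IM w 0 with h | h | h
        · exact hdis _ h2.1 (hL i w hw h) h2.2
        · rw [show w = RE w from cext rfl (by simpa using h)] at h2
          exact h2.1 (frontier_subset_closure (C.real_notG i ⟨hw.1.le, hw.2.1.le⟩).1)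
        · exact h2.1 (subset_closure (C.up i w hw h)))
    obtain ⟨z, hz⟩ := D.nonempty
    exact (hsub (show z ∈ (range fun i ↦ C.T i 0)ᶜ from fun ⟨i, hi⟩ ↦ C.corner_notG i (by simpa [hi] using hz))).1 (subset_closure hz)
  intro u v hu hv huv hd
  have hpre : ∀ S, IsPreconnected S → S ⊆ Xt D → ∀ a ∈ S, a ∈ u → S ⊆ u := by
    intro S hS hSO a ha hau
    refine (isPreconnected_iff_subset_of_disjoint.1 hS u v hu hv (hSO.trans huv) (subset_empty_iff.1 (hd ▸ inter_subset_inter_left _ hSO))).elim id fun h ↦ ◇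
    have : a ∈ Xt D ∩ (u ∩ v) := ⟨hSO ha, hau, h ha⟩
    rw [hd] at this
    exact this.elim
  have hlow : ∀ i, ∀ w ∈ lens C.ε, IM w < 0 → C.T i w ∈ u → ∀ w ∈ lens C.ε, IM w < 0 → C.T i w ∈ u := by
    intro i w hw hwi hwu w' hw' hwi'
    refine hpre _ ((halflens_convex C.hε.le (-1)).isPreconnected.image _ ((C.diff i).continuousOn.mono fun w hw ↦ C.lU i hw.1)) ◇ _
      ⟨w, ⟨hw, bl⟩, rfl⟩ hwu ⟨w', ⟨hw', bl⟩, rfl⟩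
    rintro _ ⟨w, ⟨h1, h2⟩, rfl⟩
    exact C.lo i w h1 bl
  by_cases hex : ∃ i, ∀ w ∈ lens C.ε, IM w < 0 → C.T i w ∈ u
  · obtain ⟨i0, hi0⟩ := hex
    left
    refine main u v hu hv huv hd fun i ↦ C.trans (fun i ↦ ∀ w ∈ lens C.ε, IM w < 0 → C.T i w ∈ u) (fun j hj ↦ ◇) i0 i hi0
    obtain ⟨δ, hδ, K, hK, hpt⟩ := C.exPt _
    have hA := C.hA
    set r := min (C.ρ - 1) (rlog (C.κ/(16*C.A)))
    have hrA : ∀ s, RE s < r → 4 * C.A * rexp RE s ≤ C.κ/4 := fun s hs ↦ by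
      have := Real.exp_le_exp.2 (hs.trans_le mlr).le
      rw [Real.exp_log bp, le_div_iff₀ bp] at this
      linarith
    set x := min (δ/2) (min hf2 (rexp (r - K - 1)))
    have hx0 : 0 < x := bp
    have hx1 : x ≤ 1/2 := (mlr).trans mll
    have hlx : rlog x ≤ r - K - 1 := by
      rw [Real.log_le_iff_le_exp hx0]
      exact (mlr).trans mlr
    obtain ⟨⟨s1, a1, a2, a3⟩, ⟨s2, b1, b2, b3⟩⟩ := hpt x hx0 (by linarith [min_le_left (δ/2) (min hf2 (rexp (r - K - 1)))])
    have hκε : |C.κ| < C.ε := C.κm.trans (by linarith [C.hε])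
    have him : ∀ y ∈ Ioo 0 1, (wp C.κ y).im < 0 := fun y hy ↦ by
      rw [wp_im]
      nlinarith [wt_pos hy]
    have m1 : x ∈ Ioo 0 1 := ⟨hx0, bl⟩
    have m2 : 1 - x ∈ Ioo 0 1 := ⟨ bl, bl⟩
    rw [Equiv.symm_apply_apply] at b1
    have hPc : Convex ℝ ({s : ℂ | RE s < r} ∩ {s | |IM s| ≤ C.la _ * π / 2 - C.κ/4}) := (convex_halfSpace_re_lt _).inter (by
      convert! ((convex_halfSpace_im_le (C.la (C.σ j) * π / 2 - C.κ/4)).inter (convex_halfSpace_im_ge (-(C.la (C.σ j) * π / 2 - C.κ/4)))) using 1; ext w; simp only [mem_inter_iff, mem_ofPred_eq, abs_le]; tauto)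
    have q := hpre ((fun s ↦ C.T (C.σ j) 0 + C.u (C.σ j) * exp s) '' _) (hPc.isPreconnected.image _ bf) (by
      rintro _ ⟨s, ⟨q1, q2⟩, rfl⟩
      have q2 : |IM s| ≤ _ := q2
      have q1 := q1
      refine C.ex_ball _ (q1.trans_le mll) (by linarith [hrA s q1]) (mem_ball_self ◇)
      have : 0 < C.la (C.σ j) * π / 2 - |IM s| := bl
      positivity) _ ⟨s2, ⟨by show RE s2 < r; linarith [(abs_le.1 b3).2], b2⟩, rfl⟩ (by
        show C.T _ 0 + C.u _ * exp s2 ∈ u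
        rw [← b1]; exact hj _ (wp_mem hκε m2) (him _ m2))
      ⟨s1, ⟨by show RE s1 < r; linarith [(abs_le.1 a3).2], a2⟩, rfl⟩
    exact hlow _ _ (wp_mem hκε m1) (him _ m1) (by rw [a1]; exact q)
  · right
    refine main v u hv hu (by rwa [union_comm]) (by rwa [inter_comm v]) fun i w hw hwi ↦ ◇
    by_contra hc
    exact hex ⟨i, hlow i w hw hwi ((huv (C.lo i w hw hwi)).resolve_right hc)⟩
end Chain
namespace Chain
variable (C : Chain D lam N) (i : Fin N)
local notation "cT" => C.T
local notation "cK" => C.κ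
local notation "cE" => C.ε
local notation "ce2" => C.e2
theorem Kc_low {w : ℂ} (hw : w ∈ Kc (cE/2)) (h : IM w ≤ 0) : cT i w ∉ dG := by
  obtain ⟨a, b, c⟩ := hw
  have key : ∀ x ∈ I01, w = x → cT i w ∉ dG := fun x hx h ↦ by
    rw [h]
    exact (C.real_notG i hx).2
  rcases a.eq_or_lt with h | h
  · exact key 0 bs (cext h.symm (by rw [← h] at c; simpa using c))
  rcases b.eq_or_lt with h' | h'
  · exact key 1 bs (cext h' (by rw [h'] at c; simpa using c))
  exact C.low_notG i ⟨h, h', by nlinarith [mul_pos C.hε (mul_pos h (sub_pos.2 h'))]⟩ ‹_›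
theorem apart {z : ℂ} (hz : z ∈ dG) : ∃ c > 0, ∀ i, ∀ w ∈ Kc (cE/2), IM w < c → c ≤ ‖cT i w - z‖ := by
  have : ∀ i, ∃ c > 0, ∀ w ∈ Kc (cE/2), IM w < c → c ≤ ‖cT i w - z‖ := by
    intro i
    obtain ⟨w0, hw0, hm⟩ := C.cptK.exists_isMinOn ⟨0, by simp [Kc]⟩
      (ContinuousOn.sup continuous_im.continuousOn ((C.Tc i).sub continuousOn_const).norm)
    refine ⟨max IM w0 ‖cT i w0 - z‖, ◇, fun w hw hl ↦ (le_max_iff.1 (hm hw)).resolve_left (not_le.2 hl)⟩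
    rcases le_or_gt IM w0 0 with h | h
    · exact lt_max_of_lt_right (norm_pos_iff.2 (sub_ne_zero.2 fun e ↦ C.Kc_low i hw0 h (e ▸ hz)))
    · exact lt_max_of_lt_left h
  choose c hc h using this
  obtain ⟨e, he, -, hle⟩ := fin_pos c hc
  exact ⟨e, he, fun i w hw hl ↦ (hle i).trans (h i w hw (hl.trans_le (hle i)))⟩
theorem shift {z : ℂ} (hz : z ∈ dG) (i : Fin N) {g : CC} (hg : DifferentiableOn ℂ g (lens cE)) {M r0 : ℝ} (hM : 0 ≤ M) (hr : 0 < r0)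
    (hb : ∀ w ∈ lens (cE/2), RE w * (1 - RE w) < r0 → ‖g w‖ ≤ M * qq RE w ^ mh) :
    ∃ L : ℂ, ∀ s, 0 ≤ s → s < cE/2 → IntervalIntegrable (fun x ↦ g (wp s x) * deriv (cT i) (wp s x) * wp' s x / (cT i (wp s x) - z)) volume 0 1 ∧
      ∫ x in 0..1, g (wp s x) * deriv (cT i) (wp s x) * wp' s x / (cT i (wp s x) - z) = L := by
  obtain ⟨c, hc, hap⟩ := C.apart hz
  obtain ⟨M1, hM1, hdT⟩ := C.dT_bd
  set S := lens (cE/2) ∩ {w | IM w < c}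
  have hSo : IsOpen S := (lens_open _).inter (isOpen_lt continuous_im continuous_const)
  have hSc := (lens_convex C.e2.le).inter (convex_halfSpace_im_lt c)
  have hd : DifferentiableOn ℂ (fun w ↦ g w * deriv (cT i) w / (cT i w - z)) S := fun w hw ↦
    (((hg.mono fun w hw ↦ C.lens2 hw.1) w hw).mul ((((C.diff i).deriv (C.hU i)).mono fun w hw ↦ C.lU i (C.lens2 hw.1)) w hw)).div
      ((C.hda i (C.lens2 hw.1)).differentiableAt.differentiableWithinAt.sub_const z) (norm_pos_iff.1 (hc.trans_le (hap i w (lens_Kc hw.1) hw.2)))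
  obtain ⟨H, hH⟩ := primConvex hSc hSo hd
  obtain ⟨l0, l1, hl⟩ := lensInt (M := M * M1 / c) ce2 C.e21 hSo hSc (fun x hx ↦ ⟨mem_lens_real ce2 hx, by simpa using hc⟩)
    (fun w hw ↦ ⟨mem_lens_real ce2 ⟨hw.1.1, hw.1.2.1⟩, by simpa using hc⟩) hH hr hd (fun w hw hw' hwr ↦ by
      have : 0 ≤ qq RE w ^ mh := rpow_nonneg (wt_pos ⟨hw'.1, hw'.2.1⟩).le _
      calc _ ≤ M * qq RE w ^ mh * M1 / c := by
            rw [norm_div, norm_mul]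
            gcongr
            exacts [hb w hw' hwr, hdT i w (lens_Kc hw'), hap i w (lens_Kc hw') hw.2]
        _ = _ := by ring)
  refine ⟨l1 - l0, fun s h0 h1 ↦ ◇⟩
  have hs : |s| < cE/2 := by rwa [abs_of_nonneg h0]
  have e : (fun x ↦ g (wp s x) * deriv (cT i) (wp s x) * wp' s x / (cT i (wp s x) - z)) = fun x ↦ g (wp s x) * deriv (cT i) (wp s x) / (cT i (wp s x) - z) * wp' s x := by
    ext x
    ring
  rw [e]
  exact ((hl s hs fun x hx ↦ ⟨wp_mem hs hx, by show (wp s x).im < c; rw [wp_im]; nlinarith [wt_pos hx]⟩).2.2)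
noncomputable def E (i : Fin N) (s : ℝ) (z : ℂ) : ℂ := ∫ x in 0..1, deriv (cT i) (wp s x) * wp' s x / (cT i (wp s x) - z)
theorem pathc {s : ℝ} (hs : |s| ≤ cE/2) (i : Fin N) : ContinuousOn (fun x ↦ cT i (wp s x)) (Icc 0 1) :=
  (C.Tc i).comp (wp_cont s).continuousOn fun _ hx ↦ wp_Kc hs hx
theorem pathd {s : ℝ} (hs : |s| ≤ cE/2) (i : Fin N) : ContinuousOn (fun x ↦ deriv (cT i) (wp s x) * wp' s x) (Icc 0 1) :=
  ((C.dTc i).comp (wp_cont s).continuousOn fun _ hx ↦ wp_Kc hs hx).mul (wp'_cont s).continuousOn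
theorem E_deriv {s : ℝ} (hs : |s| ≤ cE/2) (i : Fin N) {z : ℂ} (hz : ∀ x ∈ I01, cT i (wp s x) ≠ z) :
    HasDerivAt (C.E i s) (1/(cT i 0 - z) - 1/(cT i 1 - z)) z := by
  have hg : IntervalIntegrable (fun x ↦ deriv (cT i) _ * wp' s x) volume 0 1 :=
    intervalIntegrable (by rw [uIcc_of_le zero_le_one]; exact C.pathd hs i)
  convert! (cauchyT hg (C.pathc hs i) (by rintro ⟨x, hx, h⟩; exact hz x hx h)) using 1
  have hne : ∀ x ∈ I01, cT i _ - z ≠ 0 := fun x hx ↦ sub_ne_zero.2 (hz x hx)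
  rw [integral_eq_sub_of_hasDerivAt (f := fun x ↦ -(cT i (wp s x) - z)⁻¹)]
  · simp [wp]
    ring
  · intro x hx
    rw [uIcc_of_le zero_le_one] at hx
    have := (((((C.diff i).differentiableAt ((C.hU i).mem_nhds (C.Kc_U i (wp_Kc hs hx)))).hasDerivAt.comp x (wp_deriv s x)).sub_const z).inv (hne x hx)).neg
    convert! this using 1
    simp [neg_div]
  · refine intervalIntegrable ◇
    rw [uIcc_of_le zero_le_one]
    exact (C.pathd hs i).div (((C.pathc hs i).sub continuousOn_const).pow 2) fun x hx ↦ pow_ne_zero 2 (hne x hx)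
noncomputable def W (s : Fin N → ℝ) (z : ℂ) : ℂ := ∑ i, C.E i (s i) z
theorem W_deriv {s : Fin N → ℝ} (hs : ∀ i, |s i| ≤ cE/2) {z : ℂ} (hz : ∀ i, ∀ x ∈ I01, cT i (wp (s i) x) ≠ z) : HasDerivAt (C.W s) 0 z := by
  convert! (HasDerivAt.fun_sum (u := Finset.univ) fun i _ ↦ C.E_deriv (hs i) i (hz i)) using 1
  rw [sum_sub_distrib, eq_comm, sub_eq_zero, ← Equiv.sum_comp C.σ]
  exact sum_congr rfl fun i _ ↦ by rw [C.next i]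
theorem W_Om {z : ℂ} (hz : z ∈ Xt D) : C.W 0 z = 0 := by
  obtain ⟨M1, hM1, hdT⟩ := C.dT_bd
  have hd : ∀ z ∈ Xt D, HasDerivAt (C.W 0) 0 z := fun z hz ↦ C.W_deriv (fun i ↦ by simpa using C.e2.le) fun i x hx h ↦ hz (by
    rw [← h, Pi.zero_apply, wp_zero]; exact frontier_subset_closure (C.real_notG i hx).1)
  obtain ⟨c, hc⟩ := isClosed_closure.isOpen_compl.exists_is_const_of_deriv_eq_zero C.Om_conn (fun w hw ↦ (hd w hw).differentiableAt.differentiableWithinAt) (fun w hw ↦ (hd w hw).deriv)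
  obtain ⟨R, hR⟩ := D.bounded.closure.exists_norm_le
  have hR0 := (norm_nonneg _).trans (hR _ (subset_closure D.nonempty.choose_spec))
  rw [hc z hz]
  by_contra hc0
  set t := (N * M1 + 1)/‖c‖ with ht
  have ht0 : 0 < t := bp
  have hzt : ((R + t : ℝ) : ℂ) ∈ Xt D := fun h ↦ by
    have := hR _ h
    rw [norm_real, norm_of_nonneg bl] at this
    linarith
  have hE : ∀ i, ‖C.E i 0 (R + t : ℝ)‖ ≤ M1 / t := fun i ↦ by
    have := intervalIntegral.norm_integral_le_of_norm_le_const (C := M1/t) (f := fun x ↦ deriv (cT i) (wp 0 x) * wp' 0 x / (cT i (wp 0 x) - (R + t : ℝ))) (fun x hx ↦ by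
      rw [uIoc_of_le zero_le_one] at hx
      have hx' : x ∈ I01 := ⟨hx.1.le, hx.2⟩
      rw [wp'_zero, mul_one, norm_div]
      gcongr
      · exact hdT i _ (wp_Kc (by simpa using C.e2.le) hx')
      · have h1 := hR _ (frontier_subset_closure (C.real_notG i hx').1)
        have h2 := norm_sub_norm_le ((R + t : ℝ) : ℂ) (cT i x)
        rw [norm_real, norm_of_nonneg bl] at h2
        rw [wp_zero, norm_sub_rev]; linarith)
    simpa [E] using this
  have h1 : ‖c‖ ≤ N * (M1/t) := by
    rw [← hc _ hzt]
    refine (norm_sum_le_of_le _ fun i _ ↦ hE i).trans ◇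
    simp
  rw [← mul_div_assoc, le_div_iff₀ ht0, ht, mul_div_cancel₀ _ (norm_pos_iff.2 hc0).ne'] at h1
  linarith
theorem jump : C.E i cK (cT i (wp (cK/2) hf2)) - C.E i 0 (cT i (wp (cK/2) hf2)) = 2 * π * I := by
  have hκ := C.hκ
  have hκ2 := C.hκε
  set w0 := wp _ hf2 with hw0
  have hw0U := C.lU i (C.lens2 (wp_mem (by rw [abs_of_pos bl]; linarith) bn : w0 ∈ lens (cE/2)))
  have w0r : RE w0 = 1/2 := wp_re _ _
  have w0i : IM w0 = -(cK/8) := by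
    rw [hw0, wp_im]
    ring
  set R := dslope (cT i) w0
  have hRd : DifferentiableOn ℂ R _ := (differentiableOn_dslope ((C.hU i).mem_nhds hw0U)).2 (C.diff i)
  have hRe : ∀ w, (w - w0) * R w = cT i w - cT i w0 := fun w ↦ by simpa using sub_smul_dslope (cT i) w0 w
  have hR0 : ∀ w ∈ C.U i, R w ≠ 0 := by
    intro w hw h
    have := hRe w
    rw [h, mul_zero] at this
    rw [(C.inj i hw hw0U (sub_eq_zero.1 this.symm)), show R w0 = deriv (cT i) w0 from dslope_same _ _] at h
    exact C.dT_ne i hw0U h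
  have hd : DifferentiableOn ℂ (fun w ↦ deriv R w / R w) _ := (hRd.deriv (C.hU i)).div hRd hR0
  obtain ⟨M, hM⟩ := C.cptK.exists_bound_of_continuousOn (hd.continuousOn.mono fun _ ↦ C.Kc_U i)
  have hd2 := hd.mono fun w hw ↦ C.lU i (C.lens2 hw)
  obtain ⟨H, hH⟩ := primConvex (lens_convex C.e2.le) (lens_open _) hd2
  obtain ⟨l0, l1, hl⟩ := lensInt (M := M) ce2 C.e21 (lens_open _) (lens_convex C.e2.le) (fun x hx ↦ mem_lens_real ce2 hx)
    (fun w hw ↦ mem_lens_real ce2 ⟨hw.1, hw.2.1⟩) hH one_pos hd2 (fun w hw _ _ ↦ by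
      have h1 := wt_one ⟨hw.1, hw.2.1⟩ (show 0 ≤ 1/2 by norm_num)
      have h2 := hM w (lens_Kc hw)
      nlinarith [(norm_nonneg _).trans h2])
  have key : ∀ s, |s| < cE/2 → ∀ a, a * a = -1 → (∀ x ∈ I01, a * (wp s x - w0) ∈ slitPlane) →
      C.E i s (cT i w0) = l1 - l0 + (log (a * (1 - w0)) - log (a * (0 - w0))) := by
    intro s hs a ha hsl
    have hne : ∀ x ∈ I01, wp s x - w0 ≠ 0 := fun x hx ↦ right_ne_zero_of_mul (slitPlane_ne_zero (hsl x hx))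
    obtain ⟨-, -, h1, h2⟩ := hl s hs fun x hx ↦ wp_mem hs hx
    have hci : IntervalIntegrable (fun x ↦ wp' s x / (wp s x - w0)) volume 0 1 := intervalIntegrable (by
      rw [uIcc_of_le zero_le_one]
      exact (wp'_cont s).continuousOn.div ((wp_cont s).continuousOn.sub continuousOn_const) hne)
    have h3 : ∫ x in 0..1, wp' s x / (wp s x - w0) = log (a * (1 - w0)) - log (a * (0 - w0)) := by
      rw [integral_eq_sub_of_hasDerivAt (f := fun x ↦ log (a * (wp s x - w0))) _ hci]
      · simp [wp]
      · intro x hx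
        rw [uIcc_of_le zero_le_one] at hx
        have := (((wp_deriv s x).sub_const w0).const_mul a).clog_real (hsl x hx)
        rwa [mul_div_mul_left _ _ (fun h ↦ by simp [h] at ha)] at this
    rw [← h2, ← h3, ← intervalIntegral.integral_add h1 hci]
    refine integral_congr fun x hx ↦ ◇
    rw [uIcc_of_le zero_le_one] at hx
    have hU := C.Kc_U i (wp_Kc hs.le hx)
    have e1 : HasDerivAt (cT i) (1 * R (wp s x) + (wp s x - w0) * deriv R (wp s x)) (wp s x) := by
      have := (((hasDerivAt_id _).sub_const w0).mul (hRd.differentiableAt ((C.hU i).mem_nhds hU)).hasDerivAt).add_const (cT i w0)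
      refine this.congr_of_eventuallyEq (Eventually.of_forall fun w ↦ ◇)
      simp [hRe]
    have := hR0 _ hU
    have := hne x hx
    simp only [e1.deriv, ← hRe]
    field_simp
    ring
  rw [key cK C.κm I I_mul_I, key 0 (by simpa using ce2) (-I) bs]
  · have hneg : ∀ v, 0 < IM v → log (-v) = log v - π * I := fun v hv ↦ by
      rw [log, log, norm_neg, arg_neg_eq_arg_sub_pi_of_im_pos hv]
      push_cast
      ring
    have h1 := hneg (I * (1 - w0)) (by simp [w0r]; norm_num)
    have h2 := hneg (-I * (0 - w0)) (by simp [w0r])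
    rw [neg_mul, neg_neg] at h2
    rw [← neg_mul] at h1
    rw [h1, h2]
    ring
  · intro x _
    left
    simp [wp_im]
    linarith
  · intro x _
    by_cases hx : x = 1/2
    · left
      simp [wp_im, hx]
      linarith
    · right
      simp [wp_re]
      intro h
      exact hx bl
theorem W_G {z : ℂ} (hz : z ∈ dG) : C.W 0 z = 2 * π * I := by
  have hκ := C.hκ
  have hκ2 := C.hκε
  obtain ⟨i0, -⟩ : ∃ i, True := by
    obtain ⟨i, -⟩ := (C.cover (D.γ 0)).1 (D.γ_boundary ▸ ⟨0, ⟨le_rfl, D.l_pos⟩, rfl⟩)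
    exact ⟨i, trivial⟩
  set s : Fin N → ℝ := Function.update 0 i0 cK with hsd
  have s0 : s i0 = cK := by simp [hsd]
  have s1 : ∀ i, i ≠ i0 → s i = 0 := fun i h ↦ by simp [hsd, h]
  have hs : ∀ i, 0 ≤ s i ∧ s i < cE/2 := fun i ↦ by
    by_cases h : i = i0
    · rw [h, s0]
      exact ⟨hκ.le, hκ2⟩
    · rw [s1 i h]
      exact ⟨le_rfl, ce2⟩
  have hs' : ∀ i, |s i| ≤ cE/2 := fun i ↦ by
    rw [abs_of_nonneg (hs i).1]
    exact (hs i).2.le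
  have hoff : ∀ t, 0 ≤ t → t ≤ cE/2 → ∀ i, ∀ x ∈ I01, cT i _ ∉ dG := fun t h0 h1 i x hx ↦
    C.Kc_low i (wp_Kc (by rwa [abs_of_nonneg h0]) hx) (by rw [wp_im]; nlinarith [mul_nonneg hx.1 (sub_nonneg.2 hx.2)])
  have hG : ∀ z ∈ dG, C.W s z = C.W 0 z := fun z hz ↦ sum_congr rfl fun i _ ↦ by
    obtain ⟨L, hL⟩ := C.shift hz i (differentiableOn_const _) zero_le_one (zero_lt_one' ℝ) (fun w hw _ ↦ by
      rw [norm_one, one_mul]; exact wt_one ⟨hw.1, hw.2.1⟩ bn)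
    have h1 := (hL _ (hs i).1 (hs i).2).2
    have h2 := (hL 0 le_rfl ce2).2
    simp only [one_mul] at h1 h2
    exact h1.trans h2.symm
  set c : ℝ → ℂ := fun y ↦ 1/2 + y * I with hcd
  have hl : ∀ y ∈ Icc (-(cK/8)) _, c y ∈ lens cE := fun y hy ↦ by
    refine ⟨by simp [hcd], by simp [hcd]; norm_num, ◇⟩
    have := abs_le.2 hy
    simp [hcd]
    linarith
  have him : ∀ y, (c y).im = y := fun y ↦ by simp [hcd]
  have hre : ∀ y, (c y).re = 1/2 := fun y ↦ by simp [hcd]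
  have hcon : ∀ y ∈ Icc (-(cK/8)) (cK/8), HasDerivWithinAt (fun y ↦ C.W s (cT i0 (c y))) 0 (Icc (-(cK/8)) (cK/8)) y := by
    intro y hy
    have h1 := C.W_deriv hs' (by
      intro i x hx he
      rcases le_or_gt y 0 with h | h
      · by_cases hi : i = i0
        · rw [hi, s0] at he
          have := C.inj i0 (C.Kc_U i0 (wp_Kc C.κm.le hx)) (C.lU i0 (hl y hy)) he
          have e1 := congrArg re this
          have e2 := congrArg im this
          rw [wp_re, hre] at e1
          rw [wp_im, him, e1] at e2
          linarith [hy.1]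
        · rw [s1 i hi, wp_zero] at he
          rcases h.lt_or_eq with h | h
          · exact C.lo i0 _ (hl y hy) (by rwa [him]) (he ▸ frontier_subset_closure (C.real_notG i hx).1)
          · rw [show c y = ((1/2:ℝ):ℂ) by simp [hcd, h]] at he
            rcases C.sep i i0 x hx hf2 bn he with h | h | h
            · exact hi h.1
            · norm_num at h
            · norm_num at h
      · exact hoff _ (hs i).1 (hs i).2.le i x hx (he ▸ C.up i0 _ (hl y hy) (by rwa [him])))
    have := (h1.comp y ((C.hda i0 (hl y hy)).comp y (by simpa [hcd] using ((hasDerivAt_id y).ofReal_comp.mul_const I).const_add hf2))).hasDerivWithinAt (s := Icc (-(cK/8)) (cK/8))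
    rwa [zero_mul] at this
  have hm : -(cK/8) ∈ Icc (-(cK/8)) (cK/8) := ⟨le_rfl, bl⟩
  have hp : cK/8 ∈ Icc (-(cK/8)) _ := ⟨ bl, le_rfl⟩
  have hseg := Convex.norm_image_sub_le_of_norm_hasDerivWithin_le (C := 0) hcon (fun x _ ↦ by simp) (convex_Icc _ _) hm hp
  rw [zero_mul, norm_le_zero_iff, sub_eq_zero] at hseg
  have hd : ∀ z ∈ dG, HasDerivAt (C.W 0) 0 z := fun z hz ↦ C.W_deriv (fun i ↦ by simpa using C.e2.le) fun i x hx h ↦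
    hoff 0 le_rfl C.e2.le i x hx (by rw [Pi.zero_apply] at h; exact h ▸ hz)
  obtain ⟨k, hk⟩ := D.isOpen.exists_is_const_of_deriv_eq_zero D.connected.isPreconnected (fun w hw ↦ (hd w hw).differentiableAt.differentiableWithinAt) (fun w hw ↦ (hd w hw).deriv)
  have hc1 := C.up i0 _ (hl _ hp) (by rw [him]; linarith)
  rw [hk z hz, ← hk _ hc1, ← hG _ hc1, hseg]
  have e1 : c (-(cK/8)) = wp (cK/2) hf2 := cext (by rw [hre, wp_re]) (by rw [him, wp_im]; ring)
  rw [← sub_zero (C.W s _), ← (C.W_Om (C.lo i0 _ (hl _ hm) (by rw [him]; linarith))), W, W, ← sum_sub_distrib, Finset.sum_eq_single i0 (fun i _ h ↦ by rw [s1 i h]; simp) bs, s0, e1]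
  exact C.jump i0
end Chain
namespace Chain
variable (C : Chain D lam N) (i : Fin N)
local notation "cT" => C.T
theorem cone_near {P : ℂ → Prop} (h : ∀ᶠ t in 𝓝 (cT i 0), P t) : ∃ ρ2 < 0, ∀ s : ℂ, RE s < ρ2 → P (cT i 0 - C.u i * exp s) := by
  obtain ⟨r, hr, hb⟩ := Metric.eventually_nhds_iff_ball.1 h
  refine ⟨min (rlog r) (-1), bs, fun s hs ↦ hb _ ◇⟩
  rw [mem_ball, dist_eq_norm, sub_sub_cancel_left, norm_neg, norm_mul, C.hu, one_mul, norm_exp]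
  exact (lt_log_iff_exp_lt hr).1 (hs.trans_le mll)
open Classical in
theorem good_dslope {h : CC} {hi : Fin N → CC} (hg : C.Good h hi) {z : ℂ} (hz : z ∈ dG) :
    C.Good (dslope h z) (fun i w ↦ if 0 < IM w then dslope h z (cT i w) else (hi i w - h z) / (cT i w - z)) := by
  have hd := (differentiableOn_dslope (D.isOpen.mem_nhds hz)).2 hg.d
  obtain ⟨c, hc, hap⟩ := C.apart hz
  have hq : ∀ i, ∀ w ∈ lens C.ε, cT i w ≠ z → (if 0 < IM w then dslope h z (cT i w) else (hi i w - h z) / (cT i w - z)) = (hi i w - h z) / (cT i w - z) := by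
    intro i w hw hne
    split_ifs with h0
    · rw [dslope_of_ne _ hne, slope_def_field, hg.up i w hw h0]
    · rfl
  have hnm : ∀ a b, ∀ A X k, 0 < k → 0 ≤ A → 1 ≤ X → ‖a‖ ≤ A * X → k ≤ ‖b‖ → ‖(a - h z)/b‖ ≤ (A + ‖h z‖)/k * X := by
    intro a b A X k hk hA hX ha hb
    rw [norm_div, div_mul_eq_mul_div]
    gcongr
    nlinarith [norm_sub_le a (h z), norm_nonneg (h z)]
  refine ⟨hd, fun i w hw ↦ ◇, fun i w hw h0 ↦ if_pos h0, ◇, fun i ↦ ◇⟩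
  · rcases lt_or_ge 0 IM w with h0 | h0
    · refine (((hd.differentiableAt (D.isOpen.mem_nhds (C.up i w hw h0))).comp w (C.hda i hw).differentiableAt).congr_of_eventuallyEq ◇).differentiableWithinAt
      filter_upwards [(isOpen_lt continuous_const continuous_im).mem_nhds h0] with v hv using if_pos hv
    · have hne : cT i w ≠ z := fun e ↦ C.low_notG i hw h0 (e ▸ hz)
      refine (((((hg.di i).differentiableAt ((lens_open _).mem_nhds hw)).sub_const (h z)).div ((C.hda i hw).differentiableAt.sub_const z) (sub_ne_zero.2 hne)).congr_of_eventuallyEq ◇).differentiableWithinAt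
      filter_upwards [(lens_open _).mem_nhds hw, (C.hda i hw).continuousAt.eventually_ne hne] with v hv hv2 using hq i v hv hv2
  · obtain ⟨M, hM, r0, hr0, hb⟩ := hg.b
    refine ⟨(M + ‖h z‖)/c, bp, min r0 c, bp, fun i w hw hr ↦ ◇⟩
    have hp := wt_pos ⟨hw.1, hw.2.1⟩
    have h1 := hap i w (lens_Kc hw) (by nlinarith [le_abs_self IM w, hw.2.2, C.e21, min_le_right r0 c])
    rw [hq i w (C.lens2 hw) (sub_ne_zero.1 (norm_pos_iff.1 (hc.trans_le h1)))]
    exact hnm _ _ _ _ _ hc hM.le (wt_one ⟨hw.1, hw.2.1⟩ bn) (hb i w hw (hr.trans_le mll)) h1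
  · obtain ⟨M, hM, ρ2, hρ2, hb⟩ := hg.cone i
    have hp : 0 < ‖cT i 0 - z‖ := norm_pos_iff.2 (sub_ne_zero.2 fun e ↦ C.corner_notG i (e ▸ hz))
    obtain ⟨ρ3, hρ3, h3⟩ := C.cone_near i (P := fun t ↦ ‖cT i 0 - z‖/2 < ‖t - z‖) ((continuous_id.sub continuous_const).norm.continuousAt.eventually_const_lt (half_lt_self hp))
    refine ⟨(M + ‖h z‖)/(‖cT i 0 - z‖/2), bp, min ρ2 ρ3, by simp [hρ2], fun s hs hs2 ↦ ◇⟩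
    have h4 := h3 s (hs.trans_le mlr)
    rw [dslope_of_ne _ (sub_ne_zero.1 (norm_pos_iff.1 ((half_pos hp).trans h4))), slope_def_field]
    exact hnm _ _ _ _ _ (half_pos hp) hM.le (one_le_exp (by linarith [min_le_right ρ2 ρ3])) (hb s (hs.trans_le mll) hs2) h4.le
theorem cauchyI {h : CC} {hi : Fin N → CC} (hg : C.Good h hi) {φ : CC} {ζ : ℂ} (hφ : ConformalOnto dG φ ζ) {z : ℂ} (hz : z ∈ dG) {s : ℝ} (hs0 : 0 ≤ s) (hs : s < C.ε/2) :
    (∀ i, IntervalIntegrable (fun x ↦ hi i (wp s x) * deriv (cT i) (wp s x) * wp' s x / (cT i (wp s x) - z)) volume 0 1) ∧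
    ∑ i, ∫ x in 0..1, hi i (wp s x) * deriv (cT i) (wp s x) * wp' s x / (cT i (wp s x) - z) = 2 * π * I * h z := by
  obtain ⟨M, hM, r0, hr0, hb⟩ := hg.b
  choose L hL using fun i ↦ C.shift hz i (hg.di i) hM.le hr0 (hb i)
  choose L1 hL1 using fun i ↦ C.shift hz i (differentiableOn_const _) zero_le_one (zero_lt_one' ℝ) (fun w hw _ ↦ by
      rw [norm_one, one_mul]; exact wt_one ⟨hw.1, hw.2.1⟩ bn)
  refine ⟨fun i ↦ (hL i s hs0 hs).1, ◇⟩
  have hW := C.W_G hz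
  rw [W] at hW
  simp only [Pi.zero_apply] at hW
  rw [sum_congr rfl fun i _ ↦ show C.E i 0 z = L1 i by have := (hL1 i 0 le_rfl C.e2).2; simp only [one_mul] at this; exact this] at hW
  rw [sum_congr rfl fun i _ ↦ (hL i s hs0 hs).2, ← hW, Finset.sum_mul, ← sub_eq_zero, ← sum_sub_distrib, ← ((C.cauchy0 (C.good_dslope hg hz) hφ (s := 0) (by simpa using C.e2)).2)]
  refine sum_congr rfl fun i _ ↦ ◇
  obtain ⟨a1, a2⟩ := hL i 0 le_rfl C.e2
  obtain ⟨b1, b2⟩ := hL1 i 0 le_rfl C.e2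
  rw [← a2, ← b2, ← intervalIntegral.integral_mul_const, ← intervalIntegral.integral_sub a1 (b1.mul_const _)]
  refine integral_congr fun x _ ↦ ◇
  simp [wp_im]
  ring
end Chain
namespace Sz
variable {φ f : CC} {am : ℝ} (S : Sz D lam N φ f am)
local notation "sT" => S.T
local notation "sFM" => S.FM
theorem Fq (i : Fin N) {w : ℂ} (hw : w ∈ lens S.ε) : ‖S.F i w‖ ≤ sFM * qq RE w ^ (-(1/4:ℝ)) := by
  have hFM := S.hFM
  have key : ∀ y, 0 < y → y ≤ 1 → RE w * (1 - RE w) ≤ y → ∀ j, y ^ ((1/(2 - S.la j) - 1)/2) ≤ qq RE w ^ (-(1/4:ℝ)) := by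
    intro y hy hy1 hyr j
    have := (S.hla j).1
    have h2 := (S.hla j).2
    have : 1/2 ≤ 1/(2 - S.la j) := one_div_le_one_div_of_le bl bl
    exact (Real.rpow_le_rpow_of_exponent_ge hy hy1 bl).trans (rpow_le_rpow_of_nonpos (wt_pos ⟨hw.1, hw.2.1⟩) hyr bn)
  rcases le_total RE w hf2 with h | h
  · refine (S.Fb0 i w hw h).trans ◇
    gcongr
    exact key _ hw.1 hw.2.1.le (by nlinarith [hw.1]) _
  · refine (S.Fb1 i w hw h).trans ◇
    gcongr
    exact key _ (by linarith [hw.2.1]) bl (by nlinarith [hw.2.1]) _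
theorem Fq1 (i : Fin N) {w : ℂ} (hw : w ∈ lens S.ε) : 1 + ‖S.F i w‖ ≤ (1 + sFM) * qq RE w ^ (-(1/4:ℝ)) := by
  have := S.Fq i hw
  have := wt_one ⟨hw.1, hw.2.1⟩ (show 0 ≤ 1/4 by norm_num)
  linarith
theorem wt_sq {ρ : ℝ} (h : 0 < ρ) : (ρ ^ (-(1/4:ℝ))) ^ 2 = ρ ^ mh := by
  rw [← Real.rpow_natCast, ← rpow_mul h.le]
  norm_num
theorem good {ζ0 : ℂ} (ham : am < 1) (hφ : ConformalOnto dG φ ζ0) (hf : ∀ z ∈ dG, f z ^ 2 = deriv φ z) {h : CC} {hi : Fin N → CC} (d : DifferentiableOn ℂ h dG)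
    (di : ∀ i, DifferentiableOn ℂ (hi i) (lens S.ε)) (up : ∀ i, ∀ w ∈ lens S.ε, 0 < IM w → hi i w = h (sT i w)) {M : ℝ} (hM : 0 < M)
    (hb : ∀ z ∈ dG, (1 + am)/2 < ‖φ z‖ → ‖h z‖ ≤ M * (1 + ‖f z‖) ^ 2) (hbi : ∀ i, ∀ w ∈ lens (S.ε/2), ‖hi i w‖ ≤ M * (1 + ‖S.F i w‖) ^ 2) :
    S.toChain.Good h hi := by
  have hFM := S.hFM
  refine ⟨d, di, up, ⟨M * (1 + sFM) ^ 2, bp, 1, one_pos, fun i w hw _ ↦ ◇⟩, fun i ↦ ◇⟩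
  · refine (hbi i w hw).trans ◇
    rw [← wt_sq (wt_pos ⟨hw.1, hw.2.1⟩), mul_assoc, ← mul_pow]
    gcongr
    exact S.Fq1 i (S.lens2 hw)
  · have hη : 0 < S.κ/4 := by linarith [S.hκ]
    obtain ⟨K, hK, ρ2, hρ2, hc⟩ := S.cone_f hφ hf i hη
    obtain ⟨c, hc0, ρ3, hρ3, hball⟩ := S.cone_ball i hη
    obtain ⟨ρ4, hρ4, h4⟩ := S.cone_near i (conf_near D.isOpen hφ (show (1 + am)/2 < 1 by linarith) (S.corner_notG i))
    refine ⟨M * (1 + K) ^ 2, bp, min ρ2 (min ρ3 ρ4), by simp [hρ2], fun s hs hs2 ↦ ◇⟩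
    rw [lt_min_iff, lt_min_iff] at hs
    have hG := hball s hs.2.1 hs2 (mem_ball_self bp)
    refine (hb _ hG (h4 s hs.2.2 hG)).trans ◇
    have e : rexp (-hf2 * RE s) = rexp (-(1/4) * RE s) ^ 2 := by
      rw [← Real.exp_nat_mul]
      congr 1
      ring
    rw [e, mul_assoc, ← mul_pow]
    have := one_le_exp (show 0 ≤ -(1/4) * RE s by linarith)
    gcongr
    linarith [hc s hs.1 hs2]
structure Tame (p : CC) (pi : Fin N → CC) : Prop where
  d : DifferentiableOn ℂ p D.G
  di : ∀ i, DifferentiableOn ℂ (pi i) (lens S.ε)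
  up : ∀ i, ∀ w ∈ lens S.ε, 0 < IM w → pi i w = p (sT i w)
  b : ∃ M > 0, (∀ z ∈ D.G, (1 + am)/2 < ‖φ z‖ → ‖p z‖ ≤ M * (1 + ‖f z‖)) ∧ ∀ i, ∀ w ∈ lens (S.ε/2), ‖pi i w‖ ≤ M * (1 + ‖S.F i w‖)
theorem T_bd : ∃ R > 0, (∀ z ∈ dG, ‖z‖ ≤ R) ∧ ∀ i, ∀ w ∈ lens (S.ε/2), ‖sT i w‖ ≤ R := by
  choose M hM using fun i ↦ S.cptK.exists_bound_of_continuousOn (S.Tc i)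
  obtain ⟨R, hR⟩ := D.bounded.exists_norm_le
  obtain ⟨M', h, h'⟩ := fin_bound M
  exact ⟨max M' R, bp, fun z hz ↦ (hR z hz).trans (le_max_right _ _), fun i w hw ↦ ((hM i w (lens_Kc hw)).trans (h' i)).trans (le_max_left _ _)⟩
theorem tame_poly (P : Polynomial ℂ) : S.Tame (fun z ↦ P.eval z) (fun i w ↦ P.eval (sT i w)) := by
  obtain ⟨R, hR, h1, h2⟩ := S.T_bd
  obtain ⟨M, hM⟩ := (isCompact_closedBall 0 R).exists_bound_of_continuousOn P.continuous.continuousOn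
  have key : ∀ z y : ℂ, ‖z‖ ≤ R → ‖P.eval z‖ ≤ (|M| + 1) * (1 + ‖y‖) := fun z y hz ↦ by
    have := hM z (by simpa using hz)
    nlinarith [le_abs_self M, abs_nonneg M, norm_nonneg y]
  exact ⟨P.differentiable.differentiableOn, fun i ↦ P.differentiable.comp_differentiableOn ((S.diff i).mono (S.lU i)), fun _ _ _ _ ↦ rfl, |M| + 1, bp,
    fun z hz _ ↦ key _ _ (h1 z hz), fun i w hw ↦ key _ _ (h2 i w hw)⟩
theorem tame_sub {p q : CC} {pi qi : Fin N → CC} (hp : S.Tame p pi) (hq : S.Tame q qi) : S.Tame (fun z ↦ p z - q z) (fun i w ↦ pi i w - qi i w) := by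
  obtain ⟨M, hM, a, b⟩ := hp.b
  obtain ⟨M', hM', a', b'⟩ := hq.b
  refine ⟨hp.d.sub hq.d, fun i ↦ (hp.di i).sub (hq.di i), fun i w hw h ↦ by rw [hp.up i w hw h, hq.up i w hw h], M + M', bp, fun z hz h ↦ ◇, fun i w hw ↦ ◇⟩
  · linarith [norm_sub_le (p z) (q z), a z hz h, a' z hz h]
  · linarith [norm_sub_le (pi i w) (qi i w), b i w hw, b' i w hw]
noncomputable def k (_ : Sz D lam N φ f am) (ζ z : ℂ) : ℂ := (dl / tp) * (f z * cj (f ζ) / (1 - cj (φ ζ) * φ z))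
noncomputable def ki (ζ : ℂ) (i : Fin N) (w : ℂ) : ℂ := (dl / tp) * (S.F i w * cj (f ζ) / (1 - cj (φ ζ) * S.Q i w))
theorem k_den (h0 : 0 ≤ am) (h1 : am < 1) {a q : ℂ} (ha : ‖a‖ ≤ am) (hq : ‖q‖ ≤ 2/(1 + am)) : (1 - am)/(1 + am) ≤ ‖1 - cj a * q‖ := by
  have h2 := norm_sub_norm_le 1 (cj a * q)
  rw [norm_one, norm_mul, RCLike.norm_conj] at h2
  have : ‖a‖ * ‖q‖ ≤ am * (2/(1 + am)) := by gcongr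
  have : (1 - am)/(1 + am) = 1 - am * (2/(1 + am)) := by
    field_simp
    ring
  linarith
theorem ki_bd (h0 : 0 ≤ am) (h1 : am < 1) {B : ℝ} (hB : 0 ≤ B) {ζ : ℂ} (hζ : ‖φ ζ‖ ≤ am) (hfζ : ‖f ζ‖ ≤ B) {y q : ℂ} (hq : ‖q‖ ≤ 2/(1 + am)) :
    ‖(dl / tp) * (y * cj (f ζ) / (1 - cj (φ ζ) * q))‖ ≤ dl / tp * (B / ((1 - am)/(1 + am))) * ‖y‖ := by
  have hl := D.l_pos
  have e : ‖(dl:ℂ) / tp‖ = dl / tp := by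
    rw [norm_div, norm_mul, norm_real, norm_real, norm_of_nonneg hl.le, norm_of_nonneg pi_pos.le]
    norm_num
  rw [norm_mul, e, norm_div, norm_mul, RCLike.norm_conj, mul_assoc]
  gcongr
  calc _ ≤ ‖y‖ * B / ((1 - am)/(1 + am)) := by gcongr; exact k_den h0 h1 hζ hq
    _ = _ := by ring
theorem tame_k {ζ0 : ℂ} (h0 : 0 ≤ am) (h1 : am < 1) (hφ : ConformalOnto dG φ ζ0) (hfd : DifferentiableOn ℂ f dG) {ζ : ℂ} (hζ : ‖φ ζ‖ ≤ am) :
    S.Tame (S.k ζ) (S.ki ζ) := by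
  have hl := D.l_pos
  have hq : ∀ z ∈ dG, ‖φ z‖ ≤ 2/(1 + am) := fun z hz ↦ (conf_lt hφ hz).le.trans (by rw [le_div_iff₀ bl]; linarith)
  have hne : ∀ q, ‖q‖ ≤ 2/(1 + am) → 1 - cj (φ ζ) * q ≠ 0 := fun q h ↦ norm_pos_iff.1 ((div_pos bl bl).trans_le (k_den h0 h1 hζ h))
  set X := dl / tp * (‖f ζ‖ / ((1 - am)/(1 + am)))
  have hX : 0 ≤ X := bp
  refine ⟨fun z hz ↦ ◇, fun i w hw ↦ ◇, fun i w hw h ↦ ◇, X + 1, bp, fun z hz _ ↦ ◇, fun i w hw ↦ ◇⟩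
  · exact ((((hfd z hz).mul_const _)).div (((hφ.differentiable z hz).differentiableWithinAt.const_mul _).const_sub _) (hne _ (hq z hz))).const_mul _
  · exact ((((S.Fd i w hw).mul_const _)).div (((S.Qd i w hw).const_mul _).const_sub _) (hne _ (S.Qhi i w hw))).const_mul _
  · rw [k, ki, S.Qup i w hw h, S.Fup i w hw h]
  · refine (ki_bd h0 h1 (norm_nonneg _) hζ le_rfl (hq z hz)).trans ◇
    show X * _ ≤ _
    nlinarith [norm_nonneg (f z)]
  · refine (ki_bd h0 h1 (norm_nonneg _) hζ le_rfl (S.Qhi i w (S.lens2 hw))).trans ◇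
    show X * _ ≤ _
    nlinarith [norm_nonneg (S.F i w)]
noncomputable def ig (u v : Fin N → CC) (i : Fin N) (x : ℝ) : ℂ := u i x * cj (v i x) * ‖deriv (sT i) x‖
noncomputable def ip (u v : Fin N → CC) : ℂ := ∑ i, ∫ x in 0..1, S.ig u v i x
theorem real_cont {p : CC} {pi : Fin N → CC} (hp : S.Tame p pi) (i : Fin N) : ContinuousOn (fun x : ℝ ↦ pi i x) (Ioo 0 1) :=
  (hp.di i).continuousOn.comp continuous_ofReal.continuousOn fun x hx ↦ mem_lens_real S.hε hx
theorem dT_real (i : Fin N) : ContinuousOn (fun x : ℝ ↦ deriv (sT i) x) (Icc 0 1) := by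
  simpa [wp_zero, wp'_zero] using (S.pathd (s := 0) (by simpa using S.e2.le) i)
theorem ig_int {p q : CC} {pi qi : Fin N → CC} (hp : S.Tame p pi) (hq : S.Tame q qi) (i : Fin N) : IntervalIntegrable (S.ig pi qi i) volume 0 1 := by
  obtain ⟨M, hM, -, b⟩ := hp.b
  obtain ⟨M', hM', -, b'⟩ := hq.b
  obtain ⟨M1, hM1, hdT⟩ := S.dT_bd
  have hFM := S.hFM
  refine int_of_bd (M := M * (1 + sFM) * (M' * (1 + sFM)) * M1) (q := 1/2) bn ◇ fun x hx ↦ ◇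
  · exact ((S.real_cont hp i).mul (continuous_conj.comp_continuousOn (S.real_cont hq i))).mul
      (continuous_ofReal.comp_continuousOn ((S.dT_real i).mono Ioo_subset_Icc_self).norm)
  · have hx' := mem_lens_real S.e2 hx
    have h1 := S.Fq1 i (S.lens2 hx')
    have h2 := hdT i x (lens_Kc hx')
    rw [ofReal_re] at h1
    rw [ig, norm_mul, norm_mul, RCLike.norm_conj, norm_real, norm_norm, ← wt_sq (wt_pos hx)]
    have hX := rpow_nonneg (wt_pos hx).le (-(1/4))
    generalize qq x ^ (-(1/4:ℝ)) = X at *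
    calc _ ≤ (M * ((1 + sFM) * X)) * (M' * ((1 + sFM) * X)) * M1 := by
          gcongr
          · exact (b i x hx').trans (mul_le_mul_of_nonneg_left h1 hM.le)
          · exact (b' i x hx').trans (mul_le_mul_of_nonneg_left h1 hM'.le)
      _ = _ := by ring
theorem ip_sub_left {p q v : CC} {pi qi vi : Fin N → CC} (hp : S.Tame p pi) (hq : S.Tame q qi) (hv : S.Tame v vi) :
    S.ip (fun i w ↦ pi i w - qi i w) vi = S.ip pi vi - S.ip qi vi := by
  rw [ip, ip, ip, ← sum_sub_distrib]
  refine sum_congr rfl fun i _ ↦ ◇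
  rw [← intervalIntegral.integral_sub (S.ig_int hp hv i) (S.ig_int hq hv i)]
  simp only [ig, sub_mul]
theorem ip_conj (u v : Fin N → CC) : S.ip v u = cj (S.ip u v) := by
  rw [ip, ip, map_sum]
  refine sum_congr rfl fun i _ ↦ ◇
  rw [integral_of_le zero_le_one, integral_of_le zero_le_one, ← integral_conj]
  simp only [ig, map_mul, conj_conj, conj_ofReal, mul_comm _]
theorem ip_sub_right {p q v : CC} {pi qi vi : Fin N → CC} (hp : S.Tame p pi) (hq : S.Tame q qi) (hv : S.Tame v vi) :
    S.ip vi (fun i w ↦ pi i w - qi i w) = S.ip vi pi - S.ip vi qi := by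
  rw [S.ip_conj, S.ip_sub_left hp hq hv, map_sub, ← S.ip_conj, ← S.ip_conj]
theorem repro {ζ0 : ℂ} (h0 : 0 ≤ am) (h1 : am < 1) (hφ : ConformalOnto dG φ ζ0) (hfd : DifferentiableOn ℂ f dG) (hf : ∀ z ∈ dG, f z ^ 2 = deriv φ z) {ζ : ℂ} (hζG : ζ ∈ dG)
    (hζ : ‖φ ζ‖ ≤ am) {p : CC} {pi : Fin N → CC} (hp : S.Tame p pi) : S.ip pi (S.ki ζ) = dl * p ζ := by
  obtain ⟨M, hM, b, b'⟩ := hp.b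
  obtain ⟨R, hR, hR1, hR2⟩ := S.T_bd
  have hdφ : ∀ z ∈ dG, DifferentiableWithinAt ℂ φ dG z := fun z hz ↦ (hφ.differentiable z hz).differentiableWithinAt
  have hf0 : f ζ ≠ 0 := fun h ↦ by
    have := (inj_inverse D.isOpen hdφ (fun z hz ↦ hφ.bijOn.injOn.leftInvOn_invFunOn hz) hζG).1
    rw [← hf ζ hζG, h] at this
    simp at this
  set Ds := dslope φ ζ
  have hDs := (differentiableOn_dslope (D.isOpen.mem_nhds hζG)).2 hdφ
  have hDe : ∀ z, (z - ζ) * Ds z = φ z - φ ζ := fun z ↦ by simpa using sub_smul_dslope φ ζ z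
  have hDζ : Ds ζ = f ζ ^ 2 := by
    rw [hf ζ hζG]
    exact dslope_same _ _
  have hD0 : ∀ z ∈ dG, Ds z ≠ 0 := fun z hz h ↦ by
    have := hDe z
    rw [h, mul_zero] at this
    have e := hφ.bijOn.injOn hz hζG (sub_eq_zero.1 this.symm)
    rw [e, hDζ] at h
    exact pow_ne_zero 2 hf0 h
  have hk : ∀ q, (1 + am)/2 ≤ ‖q‖ → (1 - am)/2 ≤ ‖q - φ ζ‖ := fun q hq ↦ by linarith [norm_sub_norm_le q (φ ζ)]
  have hk0 : ∀ q, (1 + am)/2 ≤ ‖q‖ → q - φ ζ ≠ 0 := fun q hq ↦ norm_pos_iff.1 (lt_of_lt_of_le bl (hk q hq))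
  have hbd : ∀ t y q e, ‖t‖ ≤ R → (1 + am)/2 ≤ ‖q‖ → ‖y‖ ≤ M * (1 + ‖e‖) → ‖y * e * ((t - ζ) / (q - φ ζ))‖ ≤ M * ((R + R) / ((1 - am)/2)) * (1 + ‖e‖) ^ 2 := by
    intro t y q e ht hq hy
    have := hk q hq
    have : 0 < (1 - am)/2 := bl
    have h3 := (norm_sub_le _ _).trans (add_le_add ht (hR1 ζ hζG))
    rw [norm_mul, norm_mul, norm_div]
    calc _ ≤ M * (1 + ‖e‖) * (1 + ‖e‖) * ((R + R) / ((1 - am)/2)) := by gcongr; linarith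
      _ = _ := by ring
  have hG := S.good (h := fun z ↦ p z * f z * (1 / Ds z)) (hi := fun i w ↦ pi i w * S.F i w * ((sT i w - ζ) / (S.Q i w - φ ζ)))
    h1 hφ hf ((hp.d.mul hfd).mul ((differentiableOn_const 1).div hDs hD0))
    (fun i w hw ↦ ((hp.di i w hw).mul (S.Fd i w hw)).mul (((S.hda i hw).differentiableAt.differentiableWithinAt.sub_const _).div ((S.Qd i w hw).sub_const _) (hk0 _ (S.Qlo i w hw))))
    (fun i w hw h ↦ by
      have h4 := hk0 _ (S.Qlo i w hw)
      rw [S.Qup i w hw h] at h4 ⊢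
      rw [hp.up i w hw h, S.Fup i w hw h]
      have := hD0 _ (S.up i w hw h)
      congr 1; rw [div_eq_div_iff h4 this, hDe, one_mul])
    (by have : 0 < (1 - am)/2 := bl
        positivity)
    (fun z hz h ↦ by
      have h5 := hbd z _ _ _ (hR1 z hz) h.le (b z hz h)
      rwa [show (z - ζ) / (φ z - φ ζ) = 1 / Ds z by rw [div_eq_div_iff (hk0 _ h.le) (hD0 z hz), hDe, one_mul]] at h5)
    (fun i w hw ↦ hbd _ _ _ _ (hR2 i w hw) (S.Qlo i w (S.lens2 hw)) (b' i w hw))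
  have hc := (S.cauchyI hG hφ hζG le_rfl S.e2).2
  have e : S.ip pi (S.ki ζ) = (dl / tp) * f ζ / I * (2 * π * I * (p ζ * f ζ * (1 / Ds ζ))) := by
    rw [← hc, ip, mul_sum]
    refine sum_congr rfl fun i _ ↦ ◇
    rw [← intervalIntegral.integral_const_mul, integral_of_le zero_le_one, integral_of_le zero_le_one, integral_Ioc_eq_integral_Ioo, integral_Ioc_eq_integral_Ioo]
    refine setIntegral_congr_fun measurableSet_Ioo fun x hx ↦ ◇
    have hFQ := S.FQ i x hx
    have hq1 := S.Qone i x hx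
    have hqq : cj (S.Q i x) = (S.Q i x)⁻¹ := by
      rw [inv_def, normSq_eq_norm_sq, hq1]
      simp
    have hQ0 := norm_pos_iff.1 (by rw [hq1]; exact one_pos)
    have hT0 : sT i x - ζ ≠ 0 := sub_ne_zero.2 fun e ↦ (S.real_notG i (Ioo_subset_Icc_self hx)).2 (e ▸ hζG)
    simp only [ig, ki, wp_zero, wp'_zero, map_mul, map_div₀, map_sub, map_one, conj_conj, conj_ofReal, hqq, map_ofNat, (by field_simp : 1 - φ ζ * (S.Q i x)⁻¹ = (S.Q i x - φ ζ) / S.Q i x)]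
    calc _ = pi i x * ((dl / tp) * f ζ * S.Q i x / (S.Q i x - φ ζ)) * (cj (S.F i x) * ‖deriv (sT i) x‖) := by field_simp
      _ = _ := by rw [hFQ]; field_simp
  rw [e, hDζ]
  field_simp
end Sz
theorem hadam {h : CC} {t1 : ℂ} {r R M : ℝ} {q n : ℕ} (hr : 0 < r) (hR : r < R) (hd : ∀ z ∈ closedBall t1 R, DifferentiableAt ℂ h z)
    (hA : ∀ z ∈ closedBall t1 r, ‖h z‖ ^ q ≤ M * (r/R) ^ n) (hB : ∀ z ∈ closedBall t1 R, ‖h z‖ ^ q ≤ M) {z : ℂ} (hz : z ∈ closedBall t1 R) :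
    ‖h z‖ ^ q ≤ M * (max ‖z - t1‖ r / R) ^ n := by
  have hR0 := hr.trans hR
  rcases le_or_gt ‖z - t1‖ r with h1 | h1
  · rw [max_eq_right h1]
    exact hA z (by rwa [mem_closedBall, dist_eq_norm])
  rw [max_eq_left h1.le]
  rw [mem_closedBall, dist_eq_norm] at hz
  set U := ball t1 R ∩ (closedBall t1 r)ᶜ
  have hcl : closure U ⊆ {z | r ≤ ‖z - t1‖ ∧ ‖z - t1‖ ≤ R} := by
    refine closure_minimal (fun w hw ↦ ◇) ((isClosed_le (f := fun _ ↦ r) bf bf).inter (isClosed_le (g := fun _ ↦ R) bf bf))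
    have h2 := hw.1
    have h3 := hw.2
    simp only [mem_ball, mem_compl_iff, mem_closedBall, dist_eq_norm, not_le] at h2 h3
    exact ⟨h3.le, h2.le⟩
  have hψ : DiffContOnCl ℂ (fun z ↦ h z ^ q / (z - t1) ^ n) U := by
    refine DifferentiableOn.diffContOnCl fun w hw ↦ ◇
    obtain ⟨h2, h3⟩ := hcl hw
    exact (((hd w (by rwa [mem_closedBall, dist_eq_norm])).pow q).div ((differentiableAt_id.sub_const t1).pow n) (pow_ne_zero _ (norm_pos_iff.1 (hr.trans_le h2)))).differentiableWithinAt
  have hfr : ∀ w ∈ frontier U, ‖h w ^ q / (w - t1) ^ n‖ ≤ M / R ^ n := by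
    intro w hw
    have h4 : ‖w - t1‖ = R ∨ ‖w - t1‖ = r := by
      rcases frontier_inter_subset _ _ hw with h | h
      · have := h.1
        rw [frontier_ball _ hR0.ne', mem_sphere, dist_eq_norm] at this
        exact Or.inl this
      · have := h.2
        rw [frontier_compl, frontier_closedBall _ hr.ne', mem_sphere, dist_eq_norm] at this
        exact Or.inr this
    rw [norm_div, norm_pow, norm_pow]
    rcases h4 with h4 | h4
    · rw [h4]
      gcongr
      exact hB w (by rw [mem_closedBall, dist_eq_norm, h4])
    · rw [h4, div_le_iff₀ bp]
      refine (hA w (by rw [mem_closedBall, dist_eq_norm, h4])).trans (le_of_eq ◇)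
      rw [div_pow]
      ring
  have hfin : ‖h z ^ q / (z - t1) ^ n‖ ≤ M / R ^ n := by
    rcases hz.lt_or_eq with h5 | h5
    · refine Complex.norm_le_of_forall_mem_frontier_norm_le (Metric.isBounded_ball.subset inter_subset_left) hψ hfr (subset_closure ⟨◇, ◇⟩)
      · rwa [mem_ball, dist_eq_norm]
      · rw [mem_compl_iff, mem_closedBall, dist_eq_norm]
        exact not_le.2 h1
    · rw [norm_div, norm_pow, norm_pow, h5]
      gcongr
      exact hB z (by rw [mem_closedBall, dist_eq_norm, h5])
  rw [norm_div, norm_pow, norm_pow, div_le_iff₀ (pow_pos (hr.trans h1) n)] at hfin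
  rw [div_pow]; calc _ ≤ _ := hfin
    _ = _ := by ring
namespace Chain
variable (C : Chain D lam N) (i : Fin N)
local notation "cT" => C.T
theorem bilip : ∃ c > 0, ∀ i, ∀ x ∈ I01, ∀ y ∈ I01, c * |x - y| ≤ ‖cT i x - cT i y‖ := by
  suffices h : ∀ i, ∃ c > 0, ∀ x ∈ I01, ∀ y ∈ I01, c * |x - y| ≤ ‖cT i x - cT i y‖ by
    choose c hc h using h
    obtain ⟨e, he, -, hec⟩ := fin_pos c hc
    exact ⟨e, he, fun i x hx y hy ↦ (mul_le_mul_of_nonneg_right (hec i) (abs_nonneg _)).trans (h i x hx y hy)⟩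
  intro i
  suffices h : ∃ c > 0, ∀ p : ℝ × ℝ, p ∈ I01 ×ˢ I01 → c * |p.1 - p.2| ≤ ‖cT i p.1 - cT i p.2‖ by
    obtain ⟨c, hc, h⟩ := h
    exact ⟨c, hc, fun x hx y hy ↦ h (x, y) ⟨hx, hy⟩⟩
  refine (isCompact_Icc.prod isCompact_Icc).induction_on ⟨1, one_pos, bs⟩ ◇ ◇ ◇
  · rintro s t hst ⟨c, hc, h⟩
    exact ⟨c, hc, fun p hp ↦ h p (hst hp)⟩
  · rintro s t ⟨c, hc, h⟩ ⟨c', hc', h'⟩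
    refine ⟨min c c', bp, fun p hp ↦ ◇⟩
    rcases hp with hp | hp
    · exact (mul_le_mul_of_nonneg_right mll (abs_nonneg _)).trans (h p hp)
    · exact (mul_le_mul_of_nonneg_right mlr (abs_nonneg _)).trans (h' p hp)
  · rintro ⟨x, y⟩ ⟨hx, hy⟩
    have hda : ∀ x ∈ I01, AnalyticAt ℂ (cT i) x := fun x hx ↦ (C.diff i).analyticAt ((C.hU i).mem_nhds (C.seg i x hx))
    have hp : ∀ {P : ℝ × ℝ → Prop}, (∀ᶠ p in 𝓝 _, P p) → {p | P p} ∈ 𝓝[I01 ×ˢ I01] (x, y) := fun h ↦ mem_nhdsWithin_of_mem_nhds h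
    by_cases hxy : x = y
    · subst hxy
      have hd := C.dT_ne i (C.seg i x hx)
      have hs := ((hda x hx).hasStrictDerivAt).isLittleO.def (half_pos (norm_pos_iff.2 hd))
      have hct : Tendsto (fun p : ℝ × ℝ ↦ ((p.1:ℂ), (p.2:ℂ))) (𝓝 (x, x)) _ := (Continuous.tendsto bf _)
      refine ⟨_, hp (hct.eventually hs), ‖deriv (cT i) x‖/2, half_pos (norm_pos_iff.2 hd), fun p h ↦ ◇⟩
      replace h : ‖cT i p.1 - cT i p.2 - deriv (cT i) x * (p.1 - p.2)‖ ≤ ‖deriv (cT i) x‖/2 * ‖(p.1:ℂ) - p.2‖ := by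
        simpa [mul_comm] using h
      have h2 := norm_sub_norm_le (deriv (cT i) x * (p.1 - p.2)) (cT i p.1 - cT i p.2)
      rw [norm_sub_rev _ (cT i p.1 - cT i p.2), norm_mul] at h2
      have e : ‖(p.1:ℂ) - p.2‖ = |p.1 - p.2| := by
        rw [← ofReal_sub, norm_real]
        rfl
      rw [e] at h h2
      linarith
    · have hne := norm_pos_iff.2 (sub_ne_zero.2 fun h ↦ hxy (ofReal_injective (C.inj i (C.seg i x hx) (C.seg i y hy) h)))
      have hc : ContinuousAt (fun p : ℝ × ℝ ↦ ‖cT i p.1 - cT i p.2‖) (x, y) := by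
        have h2 : ContinuousAt (fun p : ℝ × ℝ ↦ cT i p.2) (x, y) := (hda y hy).continuousAt.comp (f := fun p : ℝ × ℝ ↦ (p.2:ℂ)) bf
        exact (((hda x hx).continuousAt.comp (f := fun p : ℝ × ℝ ↦ (p.1:ℂ)) bf).sub h2).norm
      refine ⟨_, inter_mem (hp (hc.eventually_const_lt (half_lt_self hne))) self_mem_nhdsWithin, ‖cT i x - cT i y‖/2, half_pos hne, fun p ⟨h, h3⟩ ↦ ◇⟩
      have h4 : |p.1 - p.2| ≤ 1 := by
        rw [abs_le]
        constructor <;> linarith [h3.1.1, h3.1.2, h3.2.1, h3.2.2]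
      have h5 : ‖cT i x - cT i y‖/2 < ‖cT i p.1 - cT i p.2‖ := h
      nlinarith
structure Adm (n : ℕ) (m : ℝ) (g : Fin N → ℝ → ℂ) : Prop where
  hm : 0 < m
  c : ∀ i, IntervalIntegrable (g i) volume 0 1
  s : ∀ i, IntervalIntegrable (fun x ↦ ‖g i x‖ ^ 2) volume 0 1
  b : ∀ i, ∫ x in 0..1, ‖g i x‖ ^ 2 ≤ m ^ 2
  o : ∀ k ≤ n, ∑ i, ∫ x in 0..1, g i x * cT i x ^ k = 0
noncomputable def H (g : Fin N → ℝ → ℂ) (t : ℂ) : ℂ := ∑ i, ∫ x in 0..1, g i x / (cT i x - t)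
theorem rc : ContinuousOn (fun x : ℝ ↦ cT i x) (Icc 0 1) := by
  simpa [wp_zero] using (C.pathc (s := 0) (by simpa using C.e2.le) i)
theorem sqb {c d : ℝ} (hc : 0 < c) (hd : 0 < d) (hbl : ∀ x ∈ I01, ∀ y ∈ I01, c * |x - y| ≤ ‖cT i x - cT i y‖) {t : ℂ}
    (ht : ∀ x ∈ I01, d ≤ ‖cT i x - t‖) : IntervalIntegrable (fun x ↦ (‖cT i x - t‖ ^ 2)⁻¹) volume 0 1 ∧ ∫ x in 0..1, (‖cT i x - t‖ ^ 2)⁻¹ ≤ 4 * π / c / d := by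
  have hct : ContinuousOn (fun x : ℝ ↦ ‖cT i x - t‖) _ := ((C.rc i).sub continuousOn_const).norm
  have hI : IntervalIntegrable (fun x ↦ (‖cT i x - t‖ ^ 2)⁻¹) volume 0 1 :=
    ContinuousOn.intervalIntegrable_of_Icc zero_le_one ((hct.pow 2).inv₀ fun x hx ↦ (pow_pos (hd.trans_le (ht x hx)) 2).ne')
  refine ⟨hI, ◇⟩
  obtain ⟨x0, hx0, hmin⟩ := isCompact_Icc.exists_isMinOn (nonempty_Icc.2 zero_le_one) hct
  set e := c / (2 * d) with he
  have hpt : ∀ x ∈ I01, (‖cT i x - t‖ ^ 2)⁻¹ ≤ 2 / d ^ 2 * (1 + (e * x - e * x0) ^ 2)⁻¹ := by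
    intro x hx
    have h1 := ht x hx
    have h2 : ‖cT i x0 - t‖ ≤ ‖cT i x - t‖ := hmin hx
    have h3 := hbl x hx x0 hx0
    have h4 : ‖cT i x - cT i x0‖ ≤ ‖cT i x - t‖ + ‖cT i x0 - t‖ := by
      rw [norm_sub_rev (cT i x0)]
      exact norm_sub_le_norm_sub_add_norm_sub _ _ _
    have h5 : (c * |x - x0|) ^ 2 ≤ (2 * ‖cT i x - t‖) ^ 2 := pow_le_pow_left₀ bp bl 2
    have h6 : d ^ 2 ≤ ‖cT i x - t‖ ^ 2 := by gcongr
    rw [mul_pow, sq_abs] at h5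
    have h10 := hd.trans_le h1
    have h7 : 1 + (e * x - e * x0) ^ 2 = (4 * d ^ 2 + c ^ 2 * (x - x0) ^ 2) / (4 * d ^ 2) := by
      rw [he]
      field_simp
      ring
    rw [h7, inv_div, div_mul_div_comm, inv_eq_one_div, div_le_div_iff₀ bp bp]
    nlinarith
  have hc2 : Continuous (fun x ↦ 2 / d ^ 2 * (1 + (e * x - e * x0) ^ 2)⁻¹) := by
    refine continuous_const.mul (Continuous.inv₀ bf fun x ↦ by positivity)
  refine (integral_mono_on zero_le_one hI (hc2.intervalIntegrable _ _) hpt).trans ◇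
  rw [intervalIntegral.integral_const_mul, intervalIntegral.integral_comp_mul_sub (fun y ↦ (1 + y ^ 2)⁻¹) (bp : 0 < e).ne', integral_inv_one_add_sq, smul_eq_mul]
  calc _ ≤ 2 / d ^ 2 * (e⁻¹ * π) := by gcongr; exact (fun a b ↦ by linarith [Real.arctan_lt_pi_div_two a, Real.neg_pi_div_two_lt_arctan b] : ∀ a b, Real.arctan a - Real.arctan b ≤ π) _ _
    _ = _ := by rw [he]; field_simp; ring
theorem hbd : ∃ K > 0, ∀ n m g, C.Adm n m g → ∀ i t d, 0 < d → (∀ x ∈ I01, d ≤ ‖cT i x - t‖) →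
    IntervalIntegrable (fun x ↦ g i x / (cT i x - t)) volume 0 1 ∧ ∫ x in 0..1, ‖g i x / (cT i x - t)‖ ≤ K * m * d ^ mh := by
  obtain ⟨c, hc, hbl⟩ := C.bilip
  refine ⟨(1 + 4 * π / c)/2, bp, fun n m g hg i t d hd ht ↦ ◇⟩
  have hm := hg.hm
  obtain ⟨h1, h2⟩ := C.sqb i hc hd (hbl i) ht
  have hI : IntervalIntegrable (fun x ↦ g i x / (cT i x - t)) volume 0 1 := by
    refine (hg.c i).mul_continuousOn ◇
    rw [uIcc_of_le zero_le_one]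
    exact ((C.rc i).sub continuousOn_const).inv₀ fun x hx ↦ norm_pos_iff.1 (hd.trans_le (ht x hx))
  refine ⟨hI, ◇⟩
  set X := d ^ mh with hX
  have hX0 : 0 < X := bp
  have hXX : X * X = d⁻¹ := by
    rw [hX, ← rpow_add hd]
    norm_num [Real.rpow_neg_one]
  have hpt : ∀ x ∈ I01, ‖g i x / (cT i x - t)‖ ≤ (X / m) / 2 * ‖g i x‖ ^ 2 + (m / X)/2 * (‖cT i x - t‖ ^ 2)⁻¹ := by
    intro x hx
    rw [norm_div, div_eq_mul_inv, ← inv_pow]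
    generalize ‖g i x‖ = a; generalize ‖cT i x - t‖⁻¹ = b
    have : 0 ≤ (X * a - m * b) ^ 2 / (X * m) := bp
    have e : (X * a - m * b) ^ 2 / (X * m) = X / m * a ^ 2 + m / X * b ^ 2 - 2 * (a * b) := by
      field_simp
      ring
    linarith
  refine (integral_mono_on zero_le_one hI.norm (((hg.s i).const_mul _).add (h1.const_mul _)) hpt).trans ◇
  rw [intervalIntegral.integral_add ((hg.s i).const_mul _) (h1.const_mul _), intervalIntegral.integral_const_mul, intervalIntegral.integral_const_mul]
  calc _ ≤ X / m / 2 * m ^ 2 + m / X / 2 * (4 * π / c / d) := by gcongr; exact hg.b i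
    _ = X / m / 2 * m ^ 2 + m / X / 2 * (4 * π / c * (X * X)) := by rw [hXX]; field_simp
    _ = _ := by field_simp
theorem H_bd : ∃ K > 0, ∀ n m g, C.Adm n m g → ∀ t d, 0 < d → (∀ i, ∀ x ∈ I01, d ≤ ‖cT i x - t‖) → ‖C.H g t‖ ≤ K * m * d ^ mh := by
  obtain ⟨K, hK, h⟩ := C.hbd
  refine ⟨(N + 1) * K, bp, fun n m g hg t d hd ht ↦ ◇⟩
  have hm := hg.hm
  refine (norm_sum_le_of_le Finset.univ fun i _ ↦ (intervalIntegral.norm_integral_le_integral_norm zero_le_one).trans (h n m g hg i t d hd (ht i)).2).trans ◇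
  have : 0 ≤ K * m * d ^ mh := bp
  simp only [sum_const, card_univ, Fintype.card_fin, nsmul_eq_mul]
  nlinarith
theorem T_Om {x : ℝ} (hx : x ∈ I01) : cT i x ∉ Xt D := fun h ↦ h (frontier_subset_closure (C.real_notG i hx).1)
theorem H_d {n : ℕ} {m : ℝ} {g : Fin N → ℝ → ℂ} (hg : C.Adm n m g) {t : ℂ} (ht : t ∈ Xt D) : DifferentiableAt ℂ (C.H g) t := by
  unfold H
  refine DifferentiableAt.fun_sum fun i _ ↦ (cauchyT (hg.c i) (C.rc i) ◇).differentiableAt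
  rintro ⟨x, hx, rfl⟩
  exact C.T_Om i hx ht
def Ex (t : ℂ) : Prop := ∃ K > 0, ∃ c > 0, ∃ r > 0, ∀ n m g, C.Adm n m g → ∀ z ∈ ball t r, ‖C.H g z‖ ≤ K * rexp (-(c * n)) * m
theorem Ex_far : ∃ t ∈ Xt D, C.Ex t := by
  obtain ⟨R, hR0⟩ := D.bounded.exists_norm_le
  have hR : ∀ z ∈ closure dG, ‖z‖ ≤ R := fun z hz ↦ closure_minimal hR0 (isClosed_le (g := fun _ ↦ R) bf bf) hz
  set L := |R| + 1 with hL
  have hL1 : 1 ≤ L := by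
    rw [hL]
    linarith [abs_nonneg R]
  have hRL : R ≤ L := by
    rw [hL]
    linarith [le_abs_self R]
  have hTL : ∀ i, ∀ x ∈ I01, ‖cT i x‖ ≤ L := fun i x hx ↦ (hR _ (frontier_subset_closure (C.real_notG i hx).1)).trans hRL
  refine ⟨(3 * L : ℝ), fun h ↦ ◇, N + 1, bp, rlog 2, log_pos one_lt_two, 1, one_pos, fun n m g hg z hz ↦ ◇⟩
  · have := hR _ h
    rw [norm_real, norm_of_nonneg bl] at this
    linarith
  have hm := hg.hm
  have hz2 : 2 * L ≤ ‖z‖ := by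
    rw [mem_ball, dist_eq_norm, norm_sub_rev] at hz
    have := norm_sub_norm_le ((3 * L : ℝ) : ℂ) z
    rw [norm_real, norm_of_nonneg bl] at this
    linarith
  have hz0 := norm_pos_iff.1 bl
  have hne : ∀ i, ∀ x ∈ I01, 1 ≤ ‖cT i x - z‖ := fun i x hx ↦ by
    have := norm_sub_norm_le z (cT i x)
    rw [norm_sub_rev] at this
    linarith [hTL i x hx]
  have hne0 : ∀ i, ∀ x ∈ I01, cT i x - z ≠ 0 := fun i x hx ↦ norm_pos_iff.1 (one_pos.trans_le (hne i x hx))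
  have hi1 : ∀ i (F : ℝ → ℂ), ContinuousOn F _ → IntervalIntegrable (fun x ↦ g i x * F x) volume 0 1 := fun i F hF ↦
    (hg.c i).mul_continuousOn (by rwa [uIcc_of_le zero_le_one])
  have hcc : ∀ i, ContinuousOn (fun x : ℝ ↦ (cT i x / z) ^ (n+1) / (cT i x - z)) _ := fun i ↦ (((C.rc i).div_const _).pow _).div ((C.rc i).sub continuousOn_const) (hne0 i)
  have key : C.H g z = ∑ i, ∫ x in 0..1, g i x * ((cT i x / z) ^ (n+1) / (cT i x - z)) := by
    have h1 : ∀ i, ∫ x in 0..1, g i x / (cT i x - z) = (∫ x in 0..1, g i x * ((cT i x / z) ^ (n+1) / (cT i x - z))) - ∑ k ∈ FR n, (∫ x in 0..1, g i x * cT i x ^ k) / z ^ (k+1) := by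
      intro i
      have h2 : ∀ k ∈ FR n, IntervalIntegrable (fun x ↦ g i x * cT i x ^ k / z ^ (k+1)) volume 0 1 := fun k _ ↦ (hi1 i _ ((C.rc i).pow k)).div_const _
      simp only [← intervalIntegral.integral_div]
      have h3 : IntervalIntegrable (fun x ↦ ∑ k ∈ FR n, g i x * cT i x ^ k / z ^ (k+1)) volume 0 1 := by
        convert! IntervalIntegrable.sum _ h2 using 2
        simp
      rw [← intervalIntegral.integral_finset_sum h2, ← intervalIntegral.integral_sub (hi1 i _ (hcc i)) h3]
      refine integral_congr fun x hx ↦ ◇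
      rw [uIcc_of_le zero_le_one] at hx
      have h3 := hne0 i x hx
      have h5 : ∑ k ∈ FR n, g i x * cT i x ^ k / z ^ (k+1) = g i x / z * ∑ k ∈ FR n, (cT i x / z) ^ k := by
        rw [mul_sum]
        refine sum_congr rfl fun k _ ↦ ◇
        rw [div_pow, pow_succ]
        field_simp
      simp only [h5]
      have h6 : ∑ k ∈ FR n, (cT i x / z) ^ k = ((cT i x / z) ^ (n+1) - 1) * z / (cT i x - z) := by
        rw [← (geom_sum_mul (cT i x / z) (n+1))]
        field_simp
      rw [h6]
      field_simp
      ring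
    rw [H, sum_congr rfl fun i _ ↦ h1 i, sum_sub_distrib, sum_comm, sub_eq_self]
    refine Finset.sum_eq_zero fun k hk ↦ ◇
    rw [← Finset.sum_div, hg.o k (by simpa using hk), zero_div]
  rw [key]
  have e2 : rexp (-(rlog 2 * n)) = (1/2) ^ n := by
    rw [mul_comm, ← mul_neg, Real.exp_nat_mul, Real.exp_neg, Real.exp_log two_pos]
    norm_num
  have hb : ∀ i, ‖∫ x in 0..1, g i x * ((cT i x / z) ^ (n+1) / (cT i x - z))‖ ≤ (1/2) ^ n * m := by
    intro i
    refine (intervalIntegral.norm_integral_le_integral_norm zero_le_one).trans ◇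
    have hpt : ∀ x ∈ I01, ‖g i x * ((cT i x / z) ^ (n+1) / (cT i x - z))‖ ≤ (1/2) ^ n * (1/(2*m) * ‖g i x‖ ^ 2 + m/2) := by
      intro x hx
      have h2 : ‖cT i x‖ / ‖z‖ ≤ 1/2 := by
        rw [div_le_div_iff₀ bl two_pos]
        linarith [hTL i x hx]
      have h3 : ‖g i x‖ ≤ 1/(2*m) * ‖g i x‖ ^ 2 + m/2 := by
        have : 0 ≤ (‖g i x‖ - m) ^ 2 / (2 * m) := bp
        have e : (‖g i x‖ - m) ^ 2 / (2 * m) = 1/(2*m) * ‖g i x‖ ^ 2 + m/2 - ‖g i x‖ := by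
          field_simp
          ring
        linarith
      rw [norm_mul, norm_div, norm_pow, norm_div, mul_comm]
      have h4 : (‖cT i x‖ / ‖z‖) ^ (n+1) / ‖cT i x - z‖ ≤ (1/2:ℝ) ^ n := by
        refine (div_le_self bp (hne i x hx)).trans ((pow_le_pow_left₀ bp h2 _).trans (pow_le_pow_of_le_one bn bn bs))
      gcongr
    refine (integral_mono_on zero_le_one (hi1 i _ (hcc i)).norm (((((hg.s i).const_mul (1/(2*m))).add (intervalIntegrable_const (c := m/2))).const_mul ((1/2:ℝ) ^ n))) hpt).trans ◇
    rw [intervalIntegral.integral_const_mul, intervalIntegral.integral_add ((hg.s i).const_mul _) intervalIntegrable_const, intervalIntegral.integral_const_mul]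
    gcongr
    calc _ ≤ 1/(2*m) * m ^ 2 + m/2 := by gcongr; exact hg.b i; simp
      _ = m := by field_simp; ring
  refine (norm_sum_le_of_le _ fun i _ ↦ hb i).trans ◇
  rw [e2]
  have : 0 ≤ (1/2) ^ n * m := bp
  simp only [sum_const, card_univ, Fintype.card_fin, nsmul_eq_mul]
  nlinarith
theorem Ex_all {t : ℂ} (ht : t ∈ Xt D) : C.Ex t := by
  suffices h : Xt D ⊆ {t | C.Ex t} from h ht
  refine C.Om_conn.subset_of_closure_inter_subset ◇ ◇ ◇
  · refine isOpen_iff_mem_nhds.2 fun t ⟨K, hK, c, hc, r, hr, h⟩ ↦ mem_of_superset (ball_mem_nhds t (half_pos hr)) fun t' ht' ↦ ◇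
    exact ⟨K, hK, c, hc, r/2, half_pos hr, fun n m g hg z hz ↦ h n m g hg z (by
      rw [mem_ball] at *; linarith [dist_triangle z t' t])⟩
  · obtain ⟨t, ht, h⟩ := C.Ex_far
    exact ⟨t, ht, h⟩
  · rintro t ⟨htc, htO⟩
    obtain ⟨r4, hr4, hball⟩ := Metric.isOpen_iff.1 isClosed_closure.isOpen_compl t htO
    obtain ⟨r, hr⟩ : ∃ r, r = r4/4 := ⟨_, rfl⟩
    have hr0 : 0 < r := bl
    obtain ⟨t1, ⟨K, hK, c, hc, r1, hr1, h1⟩, hd1⟩ := Metric.mem_closure_iff.1 htc r hr0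
    obtain ⟨K2, hK2, hH⟩ := C.H_bd
    set s := min (r1/2) (r/2)
    have hs1 : s ≤ r1/2 := min_le_left _ _
    have hs2 : s ≤ r/2 := min_le_right _ _
    obtain ⟨q, hq⟩ := exists_nat_gt (max 0 (rlog (2 * r / s) / c))
    have hq0 : tR 0 < q := (le_max_left _ _).trans_lt hq
    have hq1 : rexp (-(c * q)) ≤ s / (2 * r) := by
      rw [← le_log_iff_exp_le bp, ← inv_div, Real.log_inv, neg_le_neg_iff]
      have := (le_max_right _ _).trans hq.le
      rw [div_le_iff₀ hc] at this
      linarith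
    set B := max K (K2 * r ^ mh)
    have hB0 : 0 < B := bp
    refine ⟨B, hB0, rlog (4/3) / q, div_pos (log_pos bn) hq0, r/2, bp, fun n m g hg z hz ↦ ◇⟩
    have hm := hg.hm
    have hzt : dist z t1 < 3/2 * r := by
      rw [mem_ball] at hz
      linarith [dist_triangle z t t1]
    have hin : ∀ w ∈ closedBall t1 (2 * r), ball w r ⊆ Xt D := fun w hw y hy ↦ hball (by
      rw [mem_ball, mem_closedBall] at *; rw [dist_comm t t1] at hd1; linarith [dist_triangle y w t, dist_triangle w t1 t])
    have hb := hadam (h := C.H g) (t1 := t1) (r := s) (R := 2 * r) (M := (B * m) ^ q) (q := q) (n := n) bp bl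
      (fun w hw ↦ C.H_d hg (hin w hw (mem_ball_self hr0))) (fun w hw ↦ ◇) (fun w hw ↦ ◇) (by rw [mem_closedBall]; linarith)
    · have h3 : max ‖z - t1‖ s / (2 * r) ≤ 3/4 := by
        rw [div_le_iff₀ bp]
        refine max_le ◇ ◇ <;> [rw [← dist_eq_norm]; skip] <;> linarith
      have h4 : (B * m) ^ q * (max ‖z - t1‖ s / (2 * r)) ^ n ≤ (B * rexp (-(rlog (4/3) / q * n)) * m) ^ q := by
        rw [mul_right_comm, mul_pow _ (rexp _)]
        gcongr
        rw [← Real.exp_nat_mul, show tR q * -(rlog (4/3) / q * n) = n * (-rlog (4/3)) by field_simp, Real.exp_nat_mul, Real.exp_neg, Real.exp_log bn]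
        refine pow_le_pow_left₀ bp (h3.trans bn) _
      exact le_of_pow_le_pow_left₀ (by exact_mod_cast hq0.ne') bp (hb.trans h4)
    · have h3 := h1 n m g hg w (by rw [mem_ball]; rw [mem_closedBall] at hw; linarith)
      calc _ ≤ (K * rexp (-(c * n)) * m) ^ q := by gcongr
        _ = (K * m) ^ q * (rexp (-(c * q))) ^ n := by rw [mul_right_comm, mul_pow _ _, ← Real.exp_nat_mul, ← Real.exp_nat_mul]; congr 2; ring
        _ ≤ _ := by gcongr; exact le_max_left _ _
    · refine pow_le_pow_left₀ (norm_nonneg _) ((hH n m g hg w r hr0 fun i x hx ↦ ◇).trans ◇) q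
      · by_contra h
        push Not at h
        exact C.T_Om i hx (hin w hw (by rwa [mem_ball, dist_eq_norm]))
      · rw [mul_right_comm]
        gcongr
        exact le_max_right _ _
theorem Ex_cpt {Z : Set ℂ} (hZ : IsCompact Z) (hs : Z ⊆ Xt D) : ∃ K > 0, ∃ c > 0, ∀ n m g, C.Adm n m g → ∀ z ∈ Z, ‖C.H g z‖ ≤ K * rexp (-(c * n)) * m := by
  refine hZ.induction_on ⟨1, one_pos, 1, one_pos, bs⟩ ◇ ◇ ◇
  · rintro s t hst ⟨K, hK, c, hc, h⟩
    exact ⟨K, hK, c, hc, fun n m g hg z hz ↦ h n m g hg z (hst hz)⟩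
  · rintro s t ⟨K, hK, c, hc, h⟩ ⟨K', hK', c', hc', h'⟩
    refine ⟨max K K', bp, min c c', bp, fun n m g hg z hz ↦ ◇⟩
    have hm := hg.hm
    rcases hz with hz | hz
    · refine (h n m g hg z hz).trans ◇
      gcongr
      exacts [le_max_left _ _, min_le_left _ _]
    · refine (h' n m g hg z hz).trans ◇
      gcongr
      exacts [le_max_right _ _, min_le_right _ _]
  · intro t ht
    obtain ⟨K, hK, c, hc, r, hr, h⟩ := C.Ex_all (hs ht)
    exact ⟨_, mem_nhdsWithin_of_mem_nhds (ball_mem_nhds t hr), K, hK, c, hc, h⟩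
end Chain
namespace Chain
variable (C : Chain D lam N) (i : Fin N)
local notation "cA" => C.A
theorem ball_dist {x : ℝ} (hx : x ∈ I01) {t : ℂ} {r : ℝ} (h : ball t r ⊆ Xt D) : r ≤ ‖C.T i x - t‖ := by
  by_contra h2
  push Not at h2
  exact C.T_Om i hx (h (by rwa [mem_ball, dist_eq_norm]))
noncomputable def V (a : ℝ) (s : ℂ) : ℂ := exp ((1/a:ℝ) * s) + exp ((1/a + 1/2:ℝ) * s)
theorem V_le {a : ℝ} {s : ℂ} (hs : RE s ≤ 0) : (V a s).re ≤ 2 * rexp (1/a * RE s) := by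
  have h2 := norm_add_le (exp ((1/a:ℝ) * s)) (exp ((1/a + 1/2:ℝ) * s))
  rw [norm_exp, norm_exp, re_ofReal_mul, re_ofReal_mul] at h2
  have h3 : rexp ((1/a + 1/2) * RE s) ≤ rexp (1/a * RE s) := Real.exp_le_exp.2 (by nlinarith)
  have := (re_le_norm (V a s)).trans h2
  linarith
theorem V_ge {a η : ℝ} (ha : 0 < a) (hη : 0 < η) (hη2 : η ≤ a * π / 2) : ∃ c > 0, ∃ ρ < 0, ∀ s : ℂ, RE s < ρ → |IM s| ≤ a * π / 2 - η → c * rexp (1/a * RE s) ≤ (V a s).re := by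
  have hpi := pi_pos
  have hs0 : 0 < rsin (η/a) := sin_pos_of_pos_of_lt_pi bp (by rw [div_lt_iff₀ ha]; nlinarith)
  refine ⟨rsin (η/a)/2, half_pos hs0, min (2 * rlog (rsin (η/a)/2)) (-1), bs, fun s hs hi ↦ ◇⟩
  have h1 : rexp (RE s/2) ≤ rsin (η/a)/2 := by
    rw [← le_log_iff_exp_le (half_pos hs0)]
    linarith [min_le_left (2 * rlog (rsin (η/a)/2)) (-1)]
  have e1 : (V a s).re = rexp (1/a * RE s) * (rcos (1/a * IM s) + rexp (RE s/2) * rcos ((1/a + 1/2) * IM s)) := by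
    rw [V, add_re, exp_re, exp_re, re_ofReal_mul, re_ofReal_mul, im_ofReal_mul, im_ofReal_mul, mul_add, ← mul_assoc, ← rea]
    congr 3
    ring_nf
  have h2 : rsin (η/a) ≤ rcos (1/a * IM s) := by
    rw [← Real.cos_pi_div_two_sub, ← cos_abs (1/a * IM s), abs_mul, abs_of_pos bp]
    refine Real.cos_le_cos_of_nonneg_of_le_pi bp (by have : 0 < η/a := bp; linarith) ◇
    calc _ ≤ 1/a * (a * π / 2 - η) := by gcongr
      _ = _ := by field_simp
  have h3 := Real.neg_one_le_cos ((1/a + 1/2) * IM s)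
  rw [e1, mul_comm]
  gcongr
  nlinarith [exp_pos (RE s/2)]
theorem corner {η : ℝ} (hη : 0 < η) (hη2 : η ≤ C.la i * π / 2) : ∃ K > 0, ∃ c > 0, ∃ ρ3 < 0, ∀ n m g, C.Adm n m g → ∀ s : ℂ, RE s < ρ3 → |IM s| ≤ C.la i * π / 2 - η →
    ‖C.H g (C.T i 0 + C.u i * exp s)‖ ≤ K * m * (rexp (-hf2 * RE s) * rexp (-(c * n * rexp (1/C.la i * RE s)))) := by
  have ha := (C.hla i).1
  set a := C.la i with hadef
  have hA := C.hA
  obtain ⟨ρ0, hρ0, c, hc, hbar⟩ := barrier_ext (A := 2 * cA) (C.hla i).1 (C.hla i).2 bp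
  rw [← hadef] at hbar
  obtain ⟨c3, hc3, ρ2, hρ2, hV⟩ := V_ge ha hη hη2
  obtain ⟨K1, hK1, hH⟩ := C.H_bd
  set ρ1 := min ρ0 (C.ρ - 2)
  have r0 : ρ1 ≤ ρ0 := min_le_left _ _
  have r1 : ρ1 ≤ C.ρ - 2 := min_le_right _ _
  set τ : CC := fun s ↦ C.T i 0 + C.u i * exp s with hτ
  have hτd : Differentiable ℂ τ := by
    rw [hτ]
    fun_prop
  have hball : ∀ s, RE s ≤ ρ1 → 4 * cA * rexp RE s ≤ a * π / 2 - |IM s| → ball (τ s) _ ⊆ Xt D :=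
    fun s hs h ↦ C.ex_ball i bl h
  have hmem : ∀ s, RE s ≤ ρ1 → 4 * cA * rexp RE s ≤ a * π / 2 - |IM s| → τ s ∈ Xt D := fun s hs h ↦ hball s hs h (mem_ball_self (by
    have : 0 < 4 * cA * rexp RE s := bp
    have : 0 < a * π / 2 - |IM s| := bl
    positivity))
  set Z0 : Set ℂ := {s | RE s = ρ1 ∧ 4 * cA * rexp ρ1 ≤ a * π / 2 - |IM s|}
  have hZ0 : IsCompact Z0 := by
    refine Metric.isCompact_of_isClosed_isBounded ((isClosed_eq continuous_re continuous_const).inter (isClosed_le (f := fun _ ↦ 4 * cA * rexp ρ1) bf bf)) ◇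
    refine isBounded_iff_forall_norm_le.2 ⟨|ρ1| + a * π / 2, fun s ⟨h1, h2⟩ ↦ (norm_le_abs_re_add_abs_im s).trans ◇⟩
    rw [h1]
    have : 0 < 4 * cA * rexp ρ1 := bp
    linarith
  obtain ⟨K2, hK2, c2, hc2, hE⟩ := C.Ex_cpt (hZ0.image hτd.continuous) (by
    rintro _ ⟨s, ⟨h1, h2⟩, rfl⟩; exact hmem s h1.le (by rwa [h1]))
  obtain ⟨b, hb⟩ : ∃ b, b = (1 - 1/a)/2 := ⟨_, rfl⟩
  set c' := c2/2
  set Y := (c/8) ^ mh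
  set K3 := K1 * Y + K2 * rexp (ρ1 * b)
  refine ⟨K3 * (c3/2) ^ mh, bp, c' * (c3/2), bp, min ρ2 ρ1, by simp [hρ2], fun n m g hg s0 hs0 hi0 ↦ ◇⟩
  have hm := hg.hm
  rw [lt_min_iff] at hs0
  have hV0 := hV s0 hs0.1 hi0
  obtain ⟨δ, hδ⟩ : ∃ δ, δ = (V a s0).re / 2 := ⟨_, rfl⟩
  have hδ1 : c3/2 * rexp (1/a * RE s0) ≤ δ := by
    rw [hδ]
    linarith
  have hδ0 := lt_of_lt_of_le bp hδ1
  have hexp1 : ∀ s, RE s ≤ 0 → rexp (1/a * RE s) ≤ 1 := fun s hs ↦ Real.exp_le_one_iff.2 (mul_nonpos_of_nonneg_of_nonpos bp hs)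
  have hδ2 : δ ≤ 1 := by
    rw [hδ]
    linarith [V_le (a := a) (s := s0) bl, hexp1 s0 bl]
  have hδY : 1 ≤ δ ^ mh := one_le_rpow_of_pos_of_le_one_of_nonpos hδ0 hδ2 bn
  have hVd : Differentiable ℂ (V a) := by
    unfold V
    fun_prop
  have hVc := continuous_re.comp hVd.continuous
  set U : Set ℂ := {s | RE s < ρ1 ∧ |IM s| < a * π / 2 ∧ δ < (V a s).re}
  have hUo : IsOpen U := (isOpen_lt (g := fun _ ↦ ρ1) bf bf).inter ((isOpen_lt (g := fun _ ↦ a * π / 2) bf bf).inter (isOpen_lt continuous_const hVc))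
  have hcl : ∀ s ∈ closure U, RE s ≤ ρ1 ∧ |IM s| < a * π / 2 ∧ δ ≤ (V a s).re := by
    intro s hs
    have h2 := closure_minimal (fun s hs ↦ show _ ∧ _ ∧ _ from ⟨hs.1.le, hs.2.2.le, (hbar s (by linarith [hs.1]) hs.2.1 (hδ0.trans hs.2.2)).2.2⟩)
      ((isClosed_le (g := fun _ ↦ ρ1) bf bf).inter ((isClosed_le continuous_const hVc).inter
        (isClosed_le (continuous_const.mul hVc) bf))) hs
    refine ⟨h2.1, ◇, h2.2.1⟩
    linarith [pos_of_mul_pos_right (lt_of_lt_of_le (mul_pos hc (hδ0.trans_le h2.2.1)) h2.2.2) (exp_pos _).le]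
  have hgap : ∀ s ∈ closure U, 4 * cA * rexp RE s ≤ a * π / 2 - |IM s| := fun s hs ↦ by
    obtain ⟨h1, h2, h3⟩ := hcl s hs
    have := (hbar s bl h2 (hδ0.trans_le h3)).1
    linarith
  have hUb : Bornology.IsBounded U := by
    refine isBounded_iff_forall_norm_le.2 ⟨max (-(a * rlog (δ/2))) 0 + a * π / 2, fun s ⟨h1, h2, h3⟩ ↦ (norm_le_abs_re_add_abs_im s).trans (add_le_add ◇ h2.le)⟩
    rw [abs_of_neg bl]
    refine le_max_of_le_left (neg_le_neg ◇)
    have h4 := V_le (a := a) (s := s) bl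
    have h5 : rlog (δ/2) < 1/a * RE s := by
      rw [log_lt_iff_lt_exp bp]
      linarith
    rw [one_div_mul_eq_div, lt_div_iff₀ ha] at h5
    linarith
  set ψ : CC := fun s ↦ C.H g _ * (exp (tR b * s) * exp ((n * c' : ℝ) * V a s))
  have hψn : ∀ s, ‖ψ s‖ = ‖C.H g (τ s)‖ * (rexp (b * RE s) * rexp (n * c' * (V a s).re)) := fun s ↦ by
    rw [norm_mul, norm_mul, norm_exp, norm_exp, re_ofReal_mul, re_ofReal_mul]
  have hψ : DiffContOnCl ℂ ψ U := by
    refine DifferentiableOn.diffContOnCl fun s hs ↦ DifferentiableAt.differentiableWithinAt ◇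
    refine ((C.H_d hg (hmem s (hcl s hs).1 (hgap s hs))).comp s (hτd s)).mul ◇
    have := hVd s
    fun_prop
  set M := K3 * m * (δ ^ mh * rexp (n * c' * δ))
  have hfr : ∀ s ∈ frontier U, ‖ψ s‖ ≤ M := by
    intro s hs
    have hsc := frontier_subset_closure hs
    obtain ⟨h1, h2, h3⟩ := hcl s hsc
    have hg4 := hgap s hsc
    rw [hψn]
    have hex : 1 ≤ rexp (n * c' * δ) := one_le_exp bp
    by_cases h4 : RE s = ρ1
    · have h5 := hE n m g hg _ ⟨s, ⟨h4, by rwa [h4] at hg4⟩, rfl⟩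
      have h6 : (V a s).re ≤ 2 := by linarith [V_le (a := a) (s := s) bl, hexp1 s bl]
      calc _ ≤ K2 * rexp (-(c2 * n)) * m * (rexp (b * ρ1) * rexp (n * c' * 2)) := by rw [h4]; gcongr
        _ = K2 * rexp (ρ1 * b) * m * (rexp (-(c2 * n)) * rexp (n * c' * 2)) := by ring_nf
        _ = K2 * rexp (ρ1 * b) * m * 1 := by rw [← rea, show -(c2 * n) + n * c' * 2 = 0 by simp only [c']; ring, Real.exp_zero]
        _ ≤ _ := by
          have : 0 < K1 * Y := bp
          simp only [M]
          gcongr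
          · linarith
          · nlinarith
    · have h5 : (V a s).re = δ := by
        refine le_antisymm (le_of_not_gt fun h ↦ ◇) h3
        rw [hUo.frontier_eq] at hs
        exact hs.2 ⟨lt_of_le_of_ne h1 h4, h2, h⟩
      have h6' : c * δ ≤ rexp (1/a * RE s) * (a * π/2 - |IM s|) := by
        rw [← h5]
        exact ((hbar s bl h2 (hδ0.trans_le h3)).2.2)
      have hd : c/8 * δ * rexp (2 * b * RE s) ≤ (a * π / 2 - |IM s|)/8 * rexp RE s := by
        have e : rexp RE s = rexp (1/a * RE s) * rexp (2 * b * RE s) := by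
          rw [← rea, hb]
          congr 1
          ring
        have := mul_le_mul_of_nonneg_right h6' (exp_pos (2 * b * RE s)).le
        rw [e]
        linarith
      have h7 := hH n m g hg _ _ bp fun j x hx ↦ hd.trans (C.ball_dist j hx (hball s h1 hg4))
      rw [mul_rpow bp bp, mul_rpow bp bp, ← exp_mul, show 2 * b * RE s * -hf2 = -(b * RE s) by ring, Real.exp_neg] at h7
      calc _ ≤ K1 * m * (Y * δ ^ mh * (rexp (b * RE s))⁻¹) * (rexp (b * RE s) * rexp (n * c' * δ)) := by rw [h5]; gcongr
        _ = K1 * Y * m * (δ ^ mh * rexp (n * c' * δ)) := by field_simp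
        _ ≤ _ := by
          simp only [M]
          gcongr
          have : 0 < K2 * rexp (ρ1 * b) := bp
          linarith
  have hfin := Complex.norm_le_of_forall_mem_frontier_norm_le hUb hψ hfr (subset_closure ⟨hs0.2, bl, bl⟩)
  rw [hψn, show (V a s0).re = δ + δ by linarith, mul_add, rea] at hfin
  have hδp : δ ^ mh ≤ (c3/2) ^ mh * rexp (1/a * RE s0 * (-hf2)) := by
    rw [exp_mul, ← mul_rpow bp bp]
    exact rpow_le_rpow_of_nonpos bp hδ1 bn
  have e1 : ‖C.H g (τ s0)‖ ≤ K3 * m * (δ ^ mh * rexp (-(n * c' * δ)) * rexp (-(b * RE s0))) := by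
    rw [Real.exp_neg, Real.exp_neg]
    simp only [M] at hfin
    have p1 := exp_pos (n * c' * δ)
    have p2 := exp_pos (b * RE s0)
    generalize rexp (n * c' * δ) = X at *; generalize rexp (b * RE s0) = X2 at *
    rw [(by field_simp : ‖C.H g (τ s0)‖ = ‖C.H g (τ s0)‖ * (X2 * (X * X)) / (X2 * (X * X))), div_le_iff₀ bp]
    refine hfin.trans (le_of_eq ◇)
    field_simp
  refine e1.trans ◇
  calc _ ≤ K3 * m * ((c3/2) ^ mh * rexp (1/a * RE s0 * (-hf2)) * rexp (-(n * c' * (c3/2 * rexp (1/a * RE s0)))) * rexp (-(b * RE s0))) := by gcongr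
    _ = K3 * (c3/2) ^ mh * m * (rexp (1/a * RE s0 * (-hf2) + -(b * RE s0)) * rexp (-(n * c' * (c3/2 * rexp (1/a * RE s0))))) := by rw [rea]; ring
    _ = _ := by rw [hb]; congr 3 <;> ring_nf
end Chain
namespace Chain
variable (C : Chain D lam N) (i : Fin N)
local notation "cT" => C.T
local notation "cK" => C.κ
local notation "cL" => C.la
local notation "cA" => C.A
noncomputable def ee (n : ℕ) (c a x : ℝ) : ℝ := x ^ mh * rexp (-(c * n * x ^ ivv a))
def Pt (a K c x : ℝ) (P : ℂ) : Prop := ball P (c * x) ⊆ Xt D ∧ ∀ n m g, C.Adm n m g → ‖C.H g P‖ ≤ K * m * ee n c a x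
theorem Pt_mono {a K c K' c' x : ℝ} {P : ℂ} (hx : 0 ≤ x) (hK : K ≤ K') (hK' : 0 ≤ K') (hc : c' ≤ c) (h : C.Pt a K c x P) : C.Pt a K' c' x P := by
  refine ⟨(ball_subset_ball (by gcongr)).trans h.1, fun n m g hg ↦ (h.2 n m g hg).trans ◇⟩
  have := hg.hm
  unfold ee
  gcongr
theorem lo_wp {x : ℝ} (hx : x ∈ O01) : cT i (wp cK x) ∈ Xt D :=
  C.lo i _ (C.lens2 (wp_mem C.κm hx)) (by rw [wp_im]; linarith [mul_pos C.hκ (wt_pos hx)])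
theorem ends : ∃ K > 0, ∃ c > 0, ∀ x, 0 < x → x ≤ 1/2 → C.Pt (cL i) K c x (cT i (wp cK x)) ∧ C.Pt (cL i) K c x (cT (C.σ.symm i) (wp cK (1 - x))) := by
  have hpi := pi_gt_three
  have ha := (C.hla i).1
  have hκ := C.hκ
  have hA := C.hA
  obtain ⟨δ, hδ, K0, hK0, hpt⟩ := C.exPt i
  obtain ⟨K1, hK1, c1, hc1, ρ3, hρ3, hcor⟩ := C.corner i (η := cK/4) bp (by nlinarith [(C.hκl i).1])
  set a := cL i with hadef
  set ρs := min ρ3 (min (C.ρ - 1) (rlog (cK/(16 * cA))))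
  have q1 : ρs ≤ ρ3 := min_le_left _ _
  have q2 : ρs ≤ C.ρ - 1 := (mlr).trans mll
  have q3 : ρs ≤ rlog (cK/(16 * cA)) := (mlr).trans mlr
  set d := min δ (rexp (ρs - K0))
  have hd : 0 < d := bp
  have near : ∀ x s, ∀ y, 0 < y → y < d → x = cT i 0 + C.u i * exp s → |IM s| ≤ a * π / 2 - cK/4 → |RE s - rlog y| ≤ K0 →
      C.Pt a (K1 * rexp (K0/2)) (min (cK/32 * rexp (-K0)) (c1 * rexp (1/a * (-K0)))) y x := by
    rintro _ s y hy hyd rfl h1 h2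
    rw [abs_le] at h2
    have h3 := (log_lt_iff_lt_exp hy).2 (hyd.trans_le mlr)
    have h4 : 4 * cA * rexp RE s ≤ cK/4 := by
      have : rexp RE s ≤ cK/(16 * cA) := (le_log_iff_exp_le bp).1 bl
      calc _ ≤ 4 * cA * (cK/(16 * cA)) := by gcongr
        _ = _ := by field_simp; ring
    have h5 : rexp (-K0) * y ≤ rexp RE s := by
      rw [← Real.exp_log hy, ← rea]
      exact Real.exp_le_exp.2 bl
    refine ⟨(ball_subset_ball ◇).trans (C.ex_ball i bl (by rw [← hadef]; linarith)), fun n m g hg ↦ (hcor n m g hg s bl h1).trans ◇⟩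
    · calc _ ≤ cK/32 * rexp (-K0) * y := by gcongr; exact min_le_left _ _
        _ = (cK/4)/8 * (rexp (-K0) * y) := by ring
        _ ≤ _ := by
          exact mul_le_mul bl h5 bp bl
    · have hm := hg.hm
      rw [mul_right_comm K1 (rexp (K0/2)), mul_assoc (K1 * m), ee, ← mul_assoc (rexp (K0/2))]
      refine mul_le_mul_of_nonneg_left (mul_le_mul ◇ (Real.exp_le_exp.2 (neg_le_neg ◇)) bp bp) bp
      · rw [rpow_def_of_pos hy, ← rea]
        exact Real.exp_le_exp.2 bl
      · calc _ ≤ c1 * rexp (1/a * (-K0)) * n * y ^ ivv a := by gcongr; exact min_le_right _ _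
          _ = c1 * n * rexp (1/a * (rlog y - K0)) := by rw [rpow_def_of_pos hy, mul_sub, sub_eq_add_neg, rea]; ring_nf
          _ ≤ _ := by gcongr; linarith
  set Z := (fun x ↦ cT i _) '' Icc d hf2 ∪ (fun x ↦ cT (C.σ.symm i) _) '' Icc hf2 (1 - d)
  have hZ : IsCompact Z := (isCompact_Icc.image_of_continuousOn ((C.pathc C.κm.le _).mono (Icc_subset_Icc hd.le bn))).union
    (isCompact_Icc.image_of_continuousOn ((C.pathc C.κm.le _).mono (Icc_subset_Icc bn bl)))
  have hZO : Z ⊆ Xt D := by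
    rintro _ (⟨x, hx, rfl⟩ | ⟨x, hx, rfl⟩)
    · exact C.lo_wp _ ⟨hd.trans_le hx.1, by linarith [hx.2]⟩
    · exact C.lo_wp _ ⟨by linarith [hx.1], by linarith [hx.2]⟩
  obtain ⟨K2, hK2, c2, hc2, hE⟩ := C.Ex_cpt hZ hZO
  obtain ⟨e, he, hth⟩ := hZ.exists_thickening_subset_open isClosed_closure.isOpen_compl hZO
  have mid : ∀ P ∈ Z, ∀ x, 0 < x → x ≤ 1/2 → C.Pt a K2 (min c2 e) x P := by
    intro P hP x hx hx2
    refine ⟨fun y hy ↦ hth ◇, fun n m g hg ↦ (hE n m g hg P hP).trans ◇⟩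
    · rw [mem_thickening_iff]
      rw [mem_ball] at hy
      have : min c2 e * x ≤ e * 1 := by
        gcongr
        exacts [min_le_right _ _, by linarith]
      exact ⟨P, hP, bl⟩
    · have hm := hg.hm
      rw [mul_right_comm]
      gcongr
      have h1 : 1 ≤ x ^ mh := one_le_rpow_of_pos_of_le_one_of_nonpos hx bl bn
      have h2 : rexp (-(c2 * n)) ≤ rexp (-(min c2 e * n * x ^ ivv a)) := by
        refine Real.exp_le_exp.2 (neg_le_neg ◇)
        calc _ ≤ c2 * n * 1 := by gcongr; exacts [min_le_left _ _, rpow_le_one hx.le bl bp]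
          _ = _ := mul_one _
      rw [ee]
      nlinarith [exp_pos (-(c2 * n))]
  set c3 := min (cK/32 * rexp (-K0)) _
  refine ⟨max (K1 * rexp (K0/2)) K2, bp, min c3 (min c2 e), bp, fun x hx hx2 ↦ ◇⟩
  have f1 : ∀ P, C.Pt a (K1 * rexp (K0/2)) c3 x P → _ := fun P h ↦ C.Pt_mono hx.le (le_max_left _ K2) bp (min_le_left _ (min c2 e)) h
  have f2 : ∀ P, C.Pt a K2 (min c2 e) x P → _ := fun P h ↦ C.Pt_mono hx.le (le_max_right (K1 * rexp (K0/2)) K2) bp (min_le_right c3 _) h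
  rcases lt_or_ge x d with h | h
  · obtain ⟨⟨s, a1, a2, a3⟩, ⟨s', b1, b2, b3⟩⟩ := hpt x hx (h.trans_le mll)
    exact ⟨f1 _ (near _ s x hx h a1 a2 a3), f1 _ (near _ s' x hx h b1 b2 b3)⟩
  · exact ⟨f2 _ (mid _ (Or.inl ⟨x, ⟨h, hx2⟩, rfl⟩) x hx hx2), f2 _ (mid _ (Or.inr ⟨1 - x, ⟨ bl, bl⟩, rfl⟩) x hx hx2)⟩
theorem gam : ∃ K > 0, ∃ c > 0, ∀ i, ∀ x ∈ O01, (x ≤ 1/2 → C.Pt (cL i) K c x (cT i (wp cK x))) ∧ (1/2 ≤ x → C.Pt (cL (C.σ i)) K c (1 - x) (cT i (wp cK x))) := by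
  choose K hK c hc h using C.ends
  obtain ⟨K', hK', hKK⟩ := fin_bound K
  obtain ⟨c', hc', -, hcc⟩ := fin_pos c hc
  refine ⟨K', hK', c', hc', fun i x hx ↦ ⟨fun h2 ↦ C.Pt_mono hx.1.le (hKK i) hK'.le (hcc i) (h i x hx.1 h2).1, fun h2 ↦ ◇⟩⟩
  have := (h (C.σ i) (1 - x) (by linarith [hx.2]) bl).2
  rw [Equiv.symm_apply_apply, sub_sub_cancel] at this
  exact C.Pt_mono (by linarith [hx.2]) (hKK _) hK'.le (hcc _) this
end Chain
theorem decay {a lam c : ℝ} (ha : a ∈ Ioo tR 0 2) (hl : lam ≤ a) (hc : 0 < c) : ∃ K > 0, ∀ n : ℕ, 0 < n →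
    IntegrableOn (fun x : ℝ ↦ x ^ ((1/(2 - a) - 1)/2) * Chain.ee n c a x) (Ioi 0) ∧
    ∫ x in Ioi tR 0, x ^ ((1/(2 - a) - 1)/2) * Chain.ee n c a x ≤ K * tR n ^ (-(lam/(2 - lam))/2) := by
  obtain ⟨h0, h2⟩ := ha
  set e := a/(2 * (2 - a)) with he
  have he0 : 0 < e := bp
  refine ⟨c ^ (-e) * a * Real.Gamma e, bp, fun n hn ↦ ◇⟩
  have hn0 : tR 0 < n := by exact_mod_cast hn
  have h5 : -1 < 1/(2 * (2 - a)) - 1 := by have : 0 < 1/(2 * (2 - a)) := bp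
                                           linarith
  have h4 := integral_rpow_mul_exp_neg_mul_rpow (p := 1/a) (b := c * n) bp h5 bp
  have e1 : (1/(2 * (2 - a)) - 1 + 1)/ivv a = e := by
    rw [he]
    field_simp
    ring
  rw [neg_div, e1, one_div_one_div] at h4
  have hcg : ∀ x ∈ Ioi 0, x ^ (1/(2 * (2 - a)) - 1) * rexp (-(c * n) * x ^ ivv a) = x ^ ((1/(2 - a) - 1)/2) * Chain.ee n c a x := fun x hx ↦ by
    rw [Chain.ee, ← mul_assoc, ← rpow_add hx, ← neg_mul]
    congr 2 <;> field_simp <;> ring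
  have h6 : IntegrableOn (fun x : ℝ ↦ x ^ (1/(2 * (2 - a)) - 1) * rexp (-(c * n) * x ^ ivv a)) (Ioi 0) := by
    by_contra h
    rw [integral_undef h] at h4
    have : 0 < (c * n) ^ (-e) * a * Real.Gamma e := bp
    linarith
  refine ⟨h6.congr_fun hcg measurableSet_Ioi, ◇⟩
  rw [← setIntegral_congr_fun measurableSet_Ioi hcg, h4, mul_rpow hc.le hn0.le]
  have h7 : tR n ^ (-e) ≤ n ^ (-(lam/(2 - lam))/2) := by
    refine Real.rpow_le_rpow_of_exponent_le (by exact_mod_cast hn) ◇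
    have : lam/(2 - lam) ≤ a/(2 - a) := by
      rw [div_le_div_iff₀ bl bl]
      nlinarith
    have : e = a/(2 - a)/2 := by
      rw [he]
      field_simp
    linarith
  calc _ = c ^ (-e) * a * Real.Gamma e * n ^ (-e) := by ring
    _ ≤ _ := by gcongr
theorem iI (f : ℝ → ℂ) : (∫ x in 0..1, f x) = ∫ x in O01, f x := by
  rw [integral_of_le zero_le_one, integral_Ioc_eq_integral_Ioo]
namespace Chain
variable (C : Chain D lam N) (i : Fin N)
local notation "cT" => C.T
local notation "cK" => C.κ
theorem off (i j : Fin N) {x : ℝ} (hx : x ∈ O01) : cT j x ∉ (fun y ↦ cT i (wp cK y)) '' Icc 0 1 := by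
  rintro ⟨y, hy, h⟩
  rcases eq_endpoints_or_mem_Ioo_of_mem_Icc hy with rfl | rfl | hy
  · rcases (C.sep i j 0 bs x (Ioo_subset_Icc_self hx) (by simpa [wp] using h)) with ⟨-, h1⟩ | ⟨-, h1, -⟩ | ⟨-, h1, -⟩ <;> linarith [hx.1, hx.2]
  · rcases (C.sep i j 1 bs x (Ioo_subset_Icc_self hx) (by simpa [wp] using h)) with ⟨-, h1⟩ | ⟨-, h1, -⟩ | ⟨-, h1, -⟩ <;> linarith [hx.1, hx.2]
  · exact C.T_Om j (Ioo_subset_Icc_self hx) (h ▸ C.lo_wp i hy)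
theorem bdry {h : CC} {hi : Fin N → CC} (hg : C.Good h hi) {φ : CC} {ζ : ℂ} (hφ : ConformalOnto dG φ ζ)
    (hI : ∀ i, IntervalIntegrable (fun x ↦ hi i (wp cK x) * deriv (cT i) (wp cK x) * wp' cK x) volume 0 1) (j : Fin N) {x : ℝ} (hx : x ∈ O01) :
    ∑ i, ∫ y in 0..1, hi i (wp cK y) * deriv (cT i) (wp cK y) * wp' cK y / (cT i (wp cK y) - cT j x) = 2 * π * I * hi j x := by
  have hxl := mem_lens_real C.hε hx
  have hk := (le_abs_self _).trans_lt C.κm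
  have c1 : ContinuousAt (fun t ↦ ∑ i, ∫ y in 0..1, hi i _ * deriv (cT i) _ * wp' cK y / (cT i _ - t)) _ :=
    tendsto_finset_sum _ fun i _ ↦ (cauchyT (hI i) (C.pathc C.κm.le i) (C.off i j hx)).continuousAt
  have t0 : Tendsto (fun y : ℝ ↦ x + y * I) (𝓝[>] 0) (𝓝 x) :=
    ((by fun_prop : Continuous fun y : ℝ ↦ x + y * I).tendsto' 0 _ bs).mono_left nhdsWithin_le_nhds
  have c3 := (((hg.di j).differentiableAt ((lens_open _).mem_nhds hxl)).continuousAt.tendsto.comp t0).const_mul (2 * π * I)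
  refine tendsto_nhds_unique ((c1.tendsto.comp ((C.hda j hxl).continuousAt.tendsto.comp t0)).congr' ◇) c3
  filter_upwards [t0 ((lens_open _).mem_nhds hxl), self_mem_nhdsWithin] with y hy hy0
  have h1 : 0 < (x + y * I).im := by simpa using hy0
  simp only [Function.comp]
  rw [(C.cauchyI hg hφ (C.up j _ hy h1) C.hκ.le hk).2, hg.up j _ hy h1]
theorem gamd : ∃ c > 0, ∀ i j, ∀ y ∈ O01, ∀ x ∈ I01, c * qq y ≤ ‖cT j x - cT i (wp cK y)‖ := by
  obtain ⟨K, hK, c, hc, h⟩ := C.gam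
  refine ⟨c, hc, fun i j y hy x hx ↦ ◇⟩
  have h1 := hy.1
  have h2 := hy.2
  rcases le_total y hf2 with h3 | h3
  · exact le_trans (by gcongr; nlinarith) (C.ball_dist j hx ((h i y hy).1 h3).1)
  · exact le_trans (by gcongr; nlinarith) (C.ball_dist j hx ((h i y hy).2 h3).1)
theorem fub {n : ℕ} {m M : ℝ} {g Φ : Fin N → ℝ → ℂ} (hg : C.Adm n m g) (hM : 0 < M) (hΦ : ∀ i, ContinuousOn (Φ i) (Ioo 0 1))
    (hb : ∀ i, ∀ y ∈ O01, ‖Φ i y‖ ≤ M * qq y ^ (-(1/4:ℝ))) :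
    ∑ j, ∫ x in 0..1, g j x * ∑ i, ∫ y in 0..1, Φ i y / (cT i (wp cK y) - cT j x) = -∑ i, ∫ y in 0..1, Φ i y * C.H g (cT i (wp cK y)) := by
  obtain ⟨c, hc, hd⟩ := C.gamd
  obtain ⟨K, hK, hH⟩ := C.hbd
  have hdp : ∀ y ∈ Ioo 0 1, 0 < c * qq y := fun y hy ↦ mul_pos hc (wt_pos hy)
  have hp : ∀ i j, Integrable (uncurry fun x y ↦ g j x * (Φ i y / (cT i (wp cK y) - cT j x))) ((volume.restrict (Ioo 0 1)).prod (volume.restrict (Ioo 0 1))) := by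
    intro i j
    have hms : AEStronglyMeasurable (uncurry fun x y ↦ g j x * (Φ i y / (cT i (wp cK y) - cT j x))) ((volume.restrict (Ioo 0 1)).prod (volume.restrict (Ioo 0 1))) := by
      refine ((((intervalIntegrable_iff_integrableOn_Ioo_of_le zero_le_one).1 (hg.c j)).aestronglyMeasurable).comp_fst).mul ◇
      rw [Measure.prod_restrict]
      refine ContinuousOn.aestronglyMeasurable (ContinuousOn.div ((hΦ i).comp continuousOn_snd fun p hp ↦ hp.2) (ContinuousOn.sub
        ((C.pathc C.κm.le i).comp continuousOn_snd fun p hp ↦ Ioo_subset_Icc_self hp.2) ((C.rc j).comp continuousOn_fst fun p hp ↦ Ioo_subset_Icc_self hp.1)) ◇) (measurableSet_Ioo.prod measurableSet_Ioo)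
      rintro ⟨x, y⟩ ⟨hx, hy⟩ h0
      exact C.off i j hx ⟨y, Ioo_subset_Icc_self hy, sub_eq_zero.1 h0⟩
    have hsl : ∀ y ∈ Ioo 0 1, (fun x ↦ g j x * (Φ i y / (cT i _ - cT j x))) = fun x ↦ -Φ i y * (g j x / (cT j x - cT i (wp cK y))) := fun y hy ↦ by
      ext x
      rw [← neg_sub _, div_neg]
      ring
    rw [integrable_prod_iff' hms]
    refine ⟨(ae_restrict_iff' measurableSet_Ioo).2 (ae_of_all _ fun y hy ↦ ◇), ◇⟩
    · simp only [uncurry_apply_pair]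
      rw [hsl y hy]
      exact ((intervalIntegrable_iff_integrableOn_Ioo_of_le zero_le_one).1 (hH n m g hg j _ _ (hdp y hy) (hd i j y hy)).1).const_mul _
    · have h2 := ((wt_int (q := 3/4) bn).const_mul (M * (K * m * c ^ mh)))
      rw [intervalIntegrable_iff_integrableOn_Ioo_of_le zero_le_one] at h2
      refine h2.mono' hms.norm.prod_swap.integral_prod_right' ((ae_restrict_iff' measurableSet_Ioo).2 (ae_of_all _ fun y hy ↦ ◇))
      have h3 := (hH n m g hg j _ _ (hdp y hy) (hd i j y hy)).2
      rw [integral_of_le zero_le_one, integral_Ioc_eq_integral_Ioo] at h3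
      have h4 := wt_pos hy
      rw [norm_of_nonneg (integral_nonneg fun _ ↦ norm_nonneg _)]
      simp only [uncurry_apply_pair]
      simp only [congrFun (hsl y hy), norm_mul, norm_neg]
      rw [integral_const_mul, show (-(3/4:ℝ)) = -(1/4) + -hf2 by norm_num, rpow_add h4]
      refine (mul_le_mul (hb i y hy) h3 (integral_nonneg fun _ ↦ norm_nonneg _) bp).trans_eq ◇
      rw [mul_rpow hc.le h4.le]
      ring
  simp only [iI]
  have e1 : ∀ j, ∫ x in Ioo 0 1, g j x * ∑ i, ∫ y in Ioo 0 1, Φ i y / (cT i (wp cK y) - cT j x) = ∑ i, ∫ y in Ioo 0 1, ∫ x in Ioo 0 1, g j x * (Φ i y / (cT i (wp cK y) - cT j x)) := by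
    intro j
    simp only [mul_sum, ← integral_const_mul]
    refine (integral_finset_sum _ fun i _ ↦ (hp i j).integral_prod_left).trans ◇
    exact sum_congr rfl fun i _ ↦ integral_integral_swap (hp i j)
  rw [sum_congr rfl fun j _ ↦ e1 j, sum_comm, ← sum_neg_distrib]
  refine sum_congr rfl fun i _ ↦ ◇
  refine (integral_finset_sum _ fun j _ ↦ (hp i j).integral_prod_right).symm.trans ◇
  rw [← integral_neg]
  refine integral_congr_ae (ae_of_all _ fun y ↦ ◇)
  simp only [H, mul_sum, ← sum_neg_distrib, iI, ← integral_const_mul, ← integral_neg]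
  refine sum_congr rfl fun j _ ↦ integral_congr_ae (ae_of_all _ fun x ↦ ◇)
  simp only [uncurry_apply_pair]
  rw [← neg_sub _, div_neg]
  ring
end Chain
namespace Sz
variable {φ f : CC} {am : ℝ} (S : Sz D lam N φ f am)
local notation "sla" => S.la
theorem qd {c : ℝ} (hc : 0 < c) : ∃ K > 0, ∀ i, ∀ n : ℕ, 0 < n →
    IntervalIntegrable (fun x : ℝ ↦ x ^ ((1/(2 - sla i) - 1)/2) * Chain.ee n c (sla i) x) volume 0 1 ∧
    ∫ x in 0..1, x ^ ((1/(2 - sla i) - 1)/2) * Chain.ee n c (sla i) x ≤ K * tR n ^ (-(lam/(2 - lam))/2) := by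
  choose K hK h using fun i ↦ decay (S.hla i) (S.hlam i) hc
  obtain ⟨K', hK', hb⟩ := fin_bound K
  refine ⟨K', hK', fun i n hn ↦ ◇⟩
  obtain ⟨h1, h2⟩ := h i n hn
  refine ⟨(intervalIntegrable_iff_integrableOn_Ioc_of_le zero_le_one).2 (h1.mono_set Ioc_subset_Ioi_self), ◇⟩
  rw [integral_of_le zero_le_one]
  refine (setIntegral_mono_set h1 ((ae_restrict_iff' measurableSet_Ioi).2 (ae_of_all _ fun x hx ↦ ◇)) Ioc_subset_Ioi_self.eventuallyLE).trans (h2.trans (by gcongr; exact hb i))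
  have : 0 < x := hx
  simp only [Chain.ee]
  positivity
theorem dual {ζ0 : ℂ} (h0 : 0 ≤ am) (h1 : am < 1) (hφ : ConformalOnto dG φ ζ0) (hfd : DifferentiableOn ℂ f dG) (hf : ∀ z ∈ dG, f z ^ 2 = deriv φ z) {B : ℝ} (hB : 0 < B) :
    ∃ R > 0, ∀ n : ℕ, 0 < n → ∀ m g, S.Adm n m g → ∀ ζ, ‖φ ζ‖ ≤ am → ‖f ζ‖ ≤ B →
      ‖∑ j, ∫ x in 0..1, g j x * S.ki ζ j x‖ ≤ R * m * tR n ^ (-(lam/(2 - lam))/2) := by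
  obtain ⟨M1, hM1, hdT⟩ := S.dT_bd
  obtain ⟨K, hK, c, hc, hgam⟩ := S.gam
  obtain ⟨K2, hK2, hq⟩ := S.qd hc
  have hl := D.l_pos
  have hpi := pi_gt_three
  have hFM := S.hFM
  set X := dl / tp * (B / ((1 - am)/(1 + am)))
  set Y := X * S.FM * M1 * 2
  refine ⟨(N + 1) * (2 * Y * K * K2), bp, fun n hn m g hg ζ hζ hfζ ↦ ◇⟩
  have hm := hg.hm
  have htk := S.tame_k h0 h1 hφ hfd hζ
  obtain ⟨M, hM, b, b'⟩ := htk.b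
  have sq : ∀ y : ℂ, M * (1 + ‖y‖) ≤ M * (1 + ‖y‖) ^ 2 := fun y ↦ mul_le_mul_of_nonneg_left (by nlinarith [norm_nonneg y]) hM.le
  have hG := S.good h1 hφ hf htk.d htk.di htk.up hM (fun z hz h ↦ (b z hz h).trans (sq _)) (fun i w hw ↦ (b' i w hw).trans (sq _))
  set Φ : Fin N → ℝ → ℂ := fun i y ↦ S.ki ζ i (wp S.κ y) * deriv (S.T i) (wp S.κ y) * wp' S.κ y with hΦ
  have hw : ∀ y ∈ Ioo 0 1, wp S.κ y ∈ lens (S.ε/2) := fun y hy ↦ wp_mem S.κm hy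
  have hΦF : ∀ i, ∀ y ∈ Ioo 0 1, ∀ Z, ‖S.F i (wp S.κ y)‖ ≤ S.FM * Z → ‖Φ i y‖ ≤ Y * Z := by
    intro i y hy Z hZ
    have k1 : ‖S.ki ζ i (wp S.κ y)‖ ≤ X * ‖S.F i (wp S.κ y)‖ := ki_bd h0 h1 hB.le hζ hfζ (S.Qhi i _ (S.lens2 (hw y hy)))
    have k2 := hdT i _ (lens_Kc (hw y hy))
    have k3 := wp'_le (by rw [abs_of_pos S.hκ]; linarith [S.hκ1]) (Ioo_subset_Icc_self hy)
    rw [hΦ, norm_mul, norm_mul]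
    have := (norm_nonneg _).trans hZ
    calc _ ≤ X * (S.FM * Z) * M1 * 2 := by gcongr; exact k1.trans (by gcongr)
      _ = _ := by ring
  have hΦb : ∀ i, ∀ y ∈ Ioo 0 1, ‖Φ i y‖ ≤ Y * qq y ^ (-(1/4:ℝ)) := fun i y hy ↦ hΦF i y hy _ (by
    have := S.Fq i (S.lens2 (hw y hy)); rwa [wp_re] at this)
  have hΦc : ∀ i, ContinuousOn (Φ i) (Ioo 0 1) := fun i ↦ by
    have k1 := (htk.di i).continuousOn.comp (wp_cont S.κ).continuousOn fun y hy ↦ S.lens2 (hw y hy)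
    have k2 := (S.pathd S.κm.le i).mono Ioo_subset_Icc_self
    exact (k1.mul k2).congr fun y _ ↦ mul_assoc _ _ _
  have hfub := S.fub hg bp hΦc hΦb
  rw [sum_congr rfl fun j _ ↦ show _ = 2 * π * I * ∫ x in 0..1, g j x * S.ki ζ j x by
    rw [← intervalIntegral.integral_const_mul, iI, iI]
    refine setIntegral_congr_fun measurableSet_Ioo fun x hx ↦ ◇
    rw [S.bdry hG hφ (fun i ↦ int_of_bd bn (hΦc i) (hΦb i)) j hx]; ring, ← mul_sum] at hfub
  have hn0 := congrArg norm hfub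
  rw [norm_neg, norm_mul, norm_mul, norm_mul, norm_I, norm_real, norm_of_nonneg bl, RCLike.norm_ofNat] at hn0
  have hb1 : ∀ i, ‖∫ y in 0..1, Φ i y * S.H g (S.T i (wp S.κ y))‖ ≤ 2 * Y * K * K2 * m * n ^ (-(lam/(2 - lam))/2) := by
    intro i
    obtain ⟨a1, a2⟩ := hq i n hn
    obtain ⟨a3, a4⟩ := hq (S.σ i) n hn
    have a5 := (a3.comp_sub_left 1).symm
    simp only [sub_self, sub_zero] at a5
    have hnn : ∀ a x, 0 ≤ x → 0 ≤ x ^ ((1/(2 - a) - 1)/2) * Chain.ee n c a x := fun a x hx ↦ by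
      simp only [Chain.ee]
      positivity
    refine (intervalIntegral.norm_integral_le_of_norm_le zero_le_one ◇ ((a1.add a5).const_mul (Y * (K * m)))).trans ◇
    · filter_upwards [Measure.ae_ne volume 1] with y hy1 hy
      have hy : y ∈ Ioo 0 1 := ⟨hy.1, lt_of_le_of_ne hy.2 hy1⟩
      have u1 := hnn (sla i) y hy.1.le
      have w := hw y hy
      rw [norm_mul]
      rcases le_total y hf2 with h | h
      · have v1 := hΦF i y hy _ (by have := S.Fb0 i _ (S.lens2 w) (by rwa [wp_re]); rwa [wp_re] at this)
        have v2 := ((hgam i y hy).1 h).2 n m g hg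
        calc _ ≤ Y * (K * m) * (y ^ ((1/(2 - sla i) - 1)/2) * Chain.ee n c (sla i) y) :=
              (mul_le_mul v1 v2 (norm_nonneg _) ((norm_nonneg _).trans v1)).trans_eq (by ring)
          _ ≤ _ := mul_le_mul_of_nonneg_left (le_add_of_nonneg_right (hnn (sla (S.σ i)) (1 - y) (by linarith [hy.2]))) bp
      · have v1 := hΦF i y hy _ (by have := S.Fb1 i _ (S.lens2 w) (by rwa [wp_re]); rwa [wp_re] at this)
        have v2 := ((hgam i y hy).2 h).2 n m g hg
        calc _ ≤ Y * (K * m) * ((1 - y) ^ ((1/(2 - sla _) - 1)/2) * Chain.ee n c _ _) :=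
              (mul_le_mul v1 v2 (norm_nonneg _) ((norm_nonneg _).trans v1)).trans_eq (by ring)
          _ ≤ _ := mul_le_mul_of_nonneg_left (le_add_of_nonneg_left u1) bp
    · rw [intervalIntegral.integral_const_mul, intervalIntegral.integral_add a1 a5, integral_comp_sub_left (fun x ↦ x ^ ((1/(2 - sla _) - 1)/2) * Chain.ee n c _ x), sub_self, sub_zero]
      calc _ ≤ Y * (K * m) * (K2 * n ^ (-(lam/(2 - lam))/2) + K2 * n ^ (-(lam/(2 - lam))/2)) := by gcongr
        _ = _ := by ring
  have hs := (norm_sum_le Finset.univ _).trans (Finset.sum_le_card_nsmul Finset.univ _ _ fun i _ ↦ hb1 i)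
  rw [← hn0, card_univ, Fintype.card_fin, nsmul_eq_mul] at hs
  have hpos : 0 ≤ 2 * Y * K * K2 * m * n ^ (-(lam/(2 - lam))/2) := bp
  have := norm_nonneg (∑ j, ∫ x in 0..1, g j x * S.ki ζ j x)
  nlinarith
end Sz
namespace Sz
variable {φ f : CC} {am : ℝ} (S : Sz D lam N φ f am)
local notation "sT" => S.T
local notation "sip" => S.ip
noncomputable def pe (P : Polynomial ℂ) : Fin N → CC := fun i w ↦ P.eval (sT i w)
theorem tpe (P : Polynomial ℂ) : S.Tame (fun z ↦ P.eval z) (S.pe P) := S.tame_poly P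
noncomputable def pl {v : CC} {vi : Fin N → CC} (hv : S.Tame v vi) : Polynomial ℂ →ₗ[ℂ] ℂ where
  toFun P := sip (S.pe P) vi
  map_add' P Q := by
    rw [ip, ip, ip, ← Finset.sum_add_distrib]
    refine sum_congr rfl fun i _ ↦ ◇
    rw [← intervalIntegral.integral_add (S.ig_int (S.tpe P) hv i) (S.ig_int (S.tpe Q) hv i)]
    simp only [ig, pe, Polynomial.eval_add, add_mul]
  map_smul' c P := by
    simp only [ip, ig, pe, Polynomial.eval_smul, smul_eq_mul, mul_assoc, RingHom.id_apply, intervalIntegral.integral_const_mul, mul_sum]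
theorem ip_poly (P Q : Polynomial ℂ) : sip (S.pe P) (S.pe Q) = ∫ s in 0..D.l, P.eval (D.γ s) * cj (Q.eval (D.γ s)) := by
  rw [S.integral (fun z ↦ P.eval z * cj (Q.eval z)) (P.continuous.mul (continuous_conj.comp Q.continuous)), ip]
  simp only [ig, pe, mul_comm]
noncomputable def Sp (p : ℕ → Polynomial ℂ) (n : ℕ) (ζ : ℂ) : Polynomial ℂ := ∑ k ∈ FR n, cj ((p k).eval ζ) • p k
theorem Sp_eval (p : ℕ → Polynomial ℂ) (n : ℕ) (ζ z : ℂ) : (Sp p n ζ).eval z = partialSum p ζ n z := by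
  simp [Sp, partialSum, Polynomial.eval_finset_sum]
theorem approx {ζ0 : ℂ} (h0 : 0 ≤ am) (h1 : am < 1) (hφ : ConformalOnto dG φ ζ0) (hfd : DifferentiableOn ℂ f dG) (hf : ∀ z ∈ dG, f z ^ 2 = deriv φ z) {B : ℝ} (hB : 0 < B)
    {p : ℕ → Polynomial ℂ} (hp : D.IsONPolys p) : ∃ R > 0, ∀ n : ℕ, 0 < n → ∀ ζ ∈ dG, ∀ z ∈ dG, ‖φ ζ‖ ≤ am → ‖φ z‖ ≤ am → ‖f ζ‖ ≤ B → ‖f z‖ ≤ B →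
      ‖S.k ζ z - partialSum p ζ n z‖ ≤ R * tR n ^ (-(lam/(2 - lam))) := by
  obtain ⟨R, hR, hdual⟩ := S.dual h0 h1 hφ hfd hf hB
  obtain ⟨M1, hM1, hdT⟩ := S.dT_bd
  have hl := D.l_pos
  obtain ⟨hdeg, hlc, hon⟩ := hp
  refine ⟨R * (R * M1) / dl, bp, fun n hn ζ hζG z hzG hζ hz hfζ hfz ↦ ◇⟩
  have hn0 : tR 0 < n := by exact_mod_cast hn
  have htk := S.tame_k h0 h1 hφ hfd hζ
  have hts := S.tame_poly (Sp p n ζ)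
  set gi : Fin N → CC := fun i w ↦ S.ki ζ i w - (Sp p n ζ).eval _ with hgi
  have htg : S.Tame (fun z ↦ S.k ζ z - (Sp p n ζ).eval z) gi := S.tame_sub htk hts
  have hδ : ∀ j k, sip _ _ = if j = k then (dl:ℂ) else 0 := fun j k ↦ by
    have h3 := ofReal_ne_zero.2 hl.ne'
    rw [S.ip_poly, ← mul_right_inj' (one_div_ne_zero h3), (hon j k)]
    split_ifs <;> simp [h3]
  have hpj : ∀ j ≤ n, S.pl htg (p j) = 0 := by
    intro j hj
    have e1 : sip (S.pe (Sp p n ζ)) (S.pe (p j)) = cj ((p j).eval ζ) * dl := by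
      show S.pl (S.tpe _) _ = _
      rw [Sp, map_sum, Finset.sum_eq_single_of_mem j (Finset.mem_range.2 (by omega))]
      · rw [map_smul]
        show _ • sip _ _ = _
        rw [hδ, if_pos rfl, smul_eq_mul]
      · intro k _ hk
        rw [map_smul]
        show _ • sip _ _ = _
        rw [hδ, if_neg hk, smul_zero]
    refine (S.ip_sub_right htk hts (S.tpe _)).trans ◇
    have e2 := S.repro h0 h1 hφ hfd hf hζG hζ (S.tpe (p j))
    show sip _ _ - sip _ (S.pe _) = 0
    rw [e2, S.ip_conj, e1, map_mul, conj_conj, conj_ofReal, mul_comm, sub_self]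
  have hdeg' : ∀ j, (p j).degree = j := fun j ↦ by
    rw [Polynomial.degree_eq_natDegree, hdeg]
    intro h
    obtain ⟨c, hc, h'⟩ := hlc j
    rw [h, Polynomial.leadingCoeff_zero] at h'
    exact hc.ne' (by exact_mod_cast h'.symm)
  have horth : ∀ P : Polynomial ℂ, P.degree ≤ n → S.pl htg P = 0 := by
    intro P hP
    have h2 := Polynomial.Sequence.span_degreeLE ⟨p, hdeg'⟩ (m := n) fun i _ ↦ by
      obtain ⟨c, hc, h'⟩ := hlc i
      exact isUnit_iff_ne_zero.2 (by rw [show (Polynomial.Sequence.mk p hdeg') i = p i from rfl, h']; exact ofReal_ne_zero.2 hc.ne')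
    have h3 : Submodule.span ℂ (p '' Iic n) ≤ LinearMap.ker _ := Submodule.span_le.2 (by rintro _ ⟨j, hj, rfl⟩; exact hpj j hj)
    exact h3 (h2.symm ▸ Polynomial.mem_degreeLE.2 hP)
  have hre : ∀ j x, S.ig gi gi j x = ((‖gi j x‖ ^ 2 * ‖deriv (sT j) x‖ : ℝ) : ℂ) := fun j x ↦ by
    rw [ig, mul_conj, normSq_eq_norm_sq]
    push_cast
    rfl
  set E := ∑ j, ∫ x in 0..1, ‖gi j x‖ ^ 2 * ‖deriv (sT j) x‖ with hE
  have hEip : sip gi gi = E := by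
    rw [ip, hE, ofReal_sum]
    refine sum_congr rfl fun j _ ↦ ◇
    rw [← intervalIntegral.integral_ofReal]
    exact integral_congr fun x _ ↦ hre j x
  have hEn : ∀ j, 0 ≤ ∫ x in 0..1, ‖gi j x‖ ^ 2 * ‖deriv (sT j) x‖ := fun j ↦ intervalIntegral.integral_nonneg zero_le_one fun x _ ↦ bp
  have hE0 : 0 ≤ E := Finset.sum_nonneg fun j _ ↦ hEn j
  set g : Fin N → ℝ → ℂ := fun j x ↦ cj (gi j x) * ‖deriv (sT j) x‖ with hg
  have hgint : ∀ j, IntervalIntegrable (fun x ↦ ‖gi j x‖ ^ 2 * ‖deriv (sT j) x‖) volume 0 1 := fun j ↦ by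
    have := (S.ig_int htg htg j).norm
    simp only [hre, norm_real, norm_mul, norm_pow, norm_norm] at this
    exact this
  have hg2 : ∀ j x, ‖g j x‖ ^ 2 = ‖gi j x‖ ^ 2 * ‖deriv (sT j) x‖ * ‖deriv (sT j) x‖ := fun j x ↦ by
    rw [hg, norm_mul, RCLike.norm_conj, norm_real, norm_norm]
    ring
  have hs2 : ∀ j, IntervalIntegrable (fun x ↦ ‖g j x‖ ^ 2) volume 0 1 := fun j ↦ by
    simp only [hg2]
    exact (hgint j).mul_continuousOn (by rw [uIcc_of_le zero_le_one]; exact (S.dT_real j).norm)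
  have hAdm : ∀ m > 0, M1 * E ≤ m ^ 2 → S.Adm n m g := by
    intro m hm hmE
    refine ⟨hm, fun j ↦ ◇, hs2, fun j ↦ ◇, fun k hk ↦ ◇⟩
    · have e : S.ig (fun i w ↦ Polynomial.eval (sT i w) 1) gi j = g j := by
        ext
        simp [ig, hg]
      exact e ▸ (S.ig_int (S.tame_poly 1) htg j)
    · calc _ ≤ ∫ x in 0..1, M1 * (‖gi j x‖ ^ 2 * ‖deriv (sT j) x‖) := by
            refine integral_mono_on zero_le_one (hs2 j) ((hgint j).const_mul _) fun x hx ↦ ◇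
            rw [hg2, mul_comm M1]
            gcongr
            have := wp_Kc (s := 0) (by simpa using S.e2.le) hx
            rw [wp_zero] at this
            exact hdT j x this
        _ ≤ M1 * E := by
            rw [intervalIntegral.integral_const_mul]
            gcongr
            exact single_le_sum (fun j _ ↦ hEn j) (Finset.mem_univ j)
        _ ≤ _ := hmE
    · have := horth _ ((Polynomial.degree_X_pow_le k).trans (by exact_mod_cast hk))
      rw [← this]
      show _ = sip _ _
      rw [ip]
      simp only [ig, pe, eval_pow, Polynomial.eval_X]
      refine sum_congr rfl fun i _ ↦ integral_congr fun x _ ↦ ◇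
      ring
  set e := tR n ^ (-(lam/(2 - lam))/2)
  have hd : ∀ m > 0, M1 * E ≤ m ^ 2 → ∀ ζ', ‖φ ζ'‖ ≤ am → ‖f ζ'‖ ≤ B → ‖sip (S.ki ζ') gi‖ ≤ R * m * e := by
    intro m hm hmE ζ' a b
    convert! (hdual n hn m g (hAdm m hm hmE) ζ' a b) using 2
    rw [ip]
    refine sum_congr rfl fun i _ ↦ integral_congr fun x _ ↦ ◇
    simp only [ig]
    ring
  have hEk : sip (S.ki ζ) gi = E := by
    rw [← hEip]
    conv_rhs => rw [hgi]
    rw [S.ip_sub_left htk hts htg]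
    have h2 : sip (S.pe (Sp p n ζ)) gi = 0 := horth _ (by
      refine (Polynomial.degree_sum_le _ _).trans (Finset.sup_le fun k hk ↦ (Polynomial.degree_smul_le _ _).trans ◇)
      rw [hdeg']; exact_mod_cast Nat.lt_succ_iff.1 (Finset.mem_range.1 hk))
    show _ = _ - sip (S.pe _) gi
    rw [h2, sub_zero]
  have hmE : M1 * E ≤ (R * M1 * e) ^ 2 := by
    by_contra hlt
    push Not at hlt
    have hpos := lt_of_le_of_lt bp hlt
    have h2 := hd _ (Real.sqrt_pos.2 hpos) (Real.sq_sqrt hpos.le).ge ζ hζ hfζ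
    rw [hEk, norm_real, norm_of_nonneg hE0] at h2
    have h4 := Real.mul_self_sqrt hpos.le
    nlinarith [mul_le_mul_of_nonneg_left h2 hM1.le]
  have h5 := hd _ bp hmE z hz hfz
  rw [S.ip_conj, S.repro h0 h1 hφ hfd hf hzG hz htg, RCLike.norm_conj, norm_mul, norm_real, norm_of_nonneg hl.le, Sp_eval] at h5
  have h6 : n ^ (-(lam/(2 - lam))) = e * e := by
    rw [← rpow_add hn0]
    ring_nf
  rw [h6, div_mul_eq_mul_div, le_div_iff₀ hl]
  linarith
end Sz
theorem mob_den {a u : ℂ} (ha : ‖a‖ < 1) (hu : ‖u‖ < 1) : 1 - cj a * u ≠ 0 := fun h ↦ by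
  have h2 : ‖cj a * u‖ = 1 := by rw [← sub_eq_zero.1 h, norm_one]
  rw [norm_mul, RCLike.norm_conj] at h2
  nlinarith [norm_nonneg a]
theorem mob_lt {a u : ℂ} (ha : ‖a‖ < 1) (hu : ‖u‖ < 1) : ‖(u - a)/(1 - cj a * u)‖ < 1 := by
  rw [norm_div, div_lt_one (norm_pos_iff.2 (mob_den ha hu)), ← sq_lt_sq₀ (norm_nonneg _) (norm_nonneg _), ← normSq_eq_norm_sq, ← normSq_eq_norm_sq]
  have h1 : normSq a < 1 := by
    rw [normSq_eq_norm_sq]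
    nlinarith [norm_nonneg a]
  have h2 : normSq u < 1 := by
    rw [normSq_eq_norm_sq]
    nlinarith [norm_nonneg u]
  simp only [normSq_apply, sub_re, sub_im, mul_re, mul_im, conj_re, conj_im, one_re, one_im] at *
  nlinarith
theorem mob_diff {a : ℂ} (ha : ‖a‖ < 1) : DifferentiableOn ℂ (fun u ↦ (u - a)/(1 - cj a * u)) (ball 0 1) := fun u hu ↦
  ((differentiableAt_id.sub_const a).div ((differentiableAt_id.const_mul _).const_sub 1) (mob_den ha (by simpa using hu))).differentiableWithinAt
theorem mob_inv {a u : ℂ} (ha : ‖a‖ < 1) (hu : ‖u‖ < 1) : ((u - a)/(1 - cj a * u) - -a)/(1 - cj (-a) * ((u - a)/(1 - cj a * u))) = u := by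
  have h1 := mob_den ha hu
  rw [div_eq_iff (mob_den (a := -a) (by simpa using ha) (mob_lt ha hu)), map_neg]
  generalize cj a = b at *
  exact mul_right_cancel₀ h1 (by linear_combination (1 - u * b) * div_mul_cancel₀ (u - a) h1)
theorem conf_uniq {G : Set ℂ} (hG : IsOpen G) {φ0 φ : CC} {ζ0 ζ : ℂ} (h0 : ConformalOnto G φ0 ζ0) (h : ConformalOnto G φ ζ) (hζ : ζ ∈ G) :
    ∃ c : ℂ, ‖c‖ = 1 ∧ ∀ z ∈ G, φ z = (φ0 z - φ0 ζ)/(1 - cj (φ0 ζ) * φ0 z) * c := by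
  obtain ⟨ψ0, a1, a2, a3, a4, a5⟩ := conf_inv hG h0
  obtain ⟨ψ, b1, b2, b3, b4, b5⟩ := conf_inv hG h
  have ha := conf_lt h0 hζ
  have ha' : ‖-φ0 ζ‖ < 1 := by simpa using ha
  have m1 : ∀ b, ‖b‖ < 1 → MapsTo (fun u ↦ (u - b)/(1 - cj b * u)) (ball 0 1) (ball 0 1) := fun b hb u hu ↦ by
    simpa using mob_lt hb (by simpa using hu)
  have d0 : DifferentiableOn ℂ φ0 G := fun z hz ↦ (h0.differentiable z hz).differentiableWithinAt
  have d1 : DifferentiableOn ℂ φ G := fun z hz ↦ (h.differentiable z hz).differentiableWithinAt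
  set M : CC := fun u ↦ (u - -φ0 ζ)/(1 - cj (-φ0 ζ) * u)
  set χ : CC := fun u ↦ (u - φ0 ζ)/(1 - cj (φ0 ζ) * u) with hχ
  have e1 : ∀ u, ‖u‖ < 1 → M _ = u := fun u hu ↦ mob_inv ha hu
  have e2 : ∀ u, ‖u‖ < 1 → χ (M u) = u := fun u hu ↦ by
    have := mob_inv ha' hu
    rwa [neg_neg] at this
  have gd : DifferentiableOn ℂ (fun u ↦ φ (ψ0 (M u))) _ := d1.comp (a1.comp (mob_diff ha') (m1 _ ha')) (a2.comp (m1 _ ha'))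
  have gm : MapsTo (fun u ↦ φ (ψ0 (M u))) _ _ := h.bijOn.mapsTo.comp (a2.comp (m1 _ ha'))
  have kd : DifferentiableOn ℂ (fun u ↦ χ (φ0 (ψ u))) _ := (mob_diff ha).comp (d0.comp b1 b2) (h0.bijOn.mapsTo.comp b2)
  have km := (m1 _ ha).comp (h0.bijOn.mapsTo.comp b2)
  have hχ0 : χ (φ0 ζ) = 0 := by simp [hχ]
  have g0 : φ (ψ0 (M 0)) = 0 := by rw [← hχ0, e1 _ ha, a3 _ hζ, h.map_center, hχ0]
  have hx : (1/2:ℂ) ∈ ball 0 1 := by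
    simp
    norm_num
  have hx' : ‖(1/2:ℂ)‖ < 1 := by simpa using hx
  have i1 := norm_le_norm_of_mapsTo_ball gd (gm.mono_right ball_subset_closedBall) g0 hx'
  have i2 := norm_le_norm_of_mapsTo_ball kd (km.mono_right ball_subset_closedBall) (by rw [show ψ 0 = ζ by rw [← h.map_center, b3 _ hζ], hχ0]) (z := φ (ψ0 (M hf2))) (by simpa using gm hx)
  have hM2 : M hf2 ∈ ball 0 1 := m1 _ ha' hx
  simp only [b3 _ (a2 hM2), a4 _ hM2, e2 _ hx'] at i2
  obtain ⟨c, hc, hE⟩ := affine_of_mapsTo_ball_of_exists_norm_dslope_eq_div' gd (by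
    intro u hu; have := ball_subset_closedBall (gm hu); simpa only [g0] using this) ⟨1/2, hx, by
    rw [dslope_of_ne _ bn, slope_def_module, norm_smul, g0, sub_zero, sub_zero, norm_inv, le_antisymm i1 i2, div_one]
    exact inv_mul_cancel₀ bn⟩
  refine ⟨c, by simpa using hc, fun z hz ↦ ◇⟩
  have hz' := conf_lt h0 hz
  have := hE (m1 _ ha (by simpa using hz' : φ0 z ∈ ball 0 1))
  simp only [g0, smul_eq_mul, sub_zero, zero_add] at this
  rw [← this, e1 _ hz', a3 _ hz]
theorem conf_deriv {G : Set ℂ} (hG : IsOpen G) {φ0 φ f : CC} {ζ0 ζ : ℂ} (h0 : ConformalOnto G φ0 ζ0) (h : ConformalOnto G φ ζ) (hζ : ζ ∈ G)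
    (hf : ∀ z ∈ G, f z ^ 2 = deriv φ0 z) {z : ℂ} (hz : z ∈ G) :
    f ζ * deriv φ z = cj (f ζ) * (f z ^ 2 * (1 - cj (φ0 ζ) * φ0 ζ) / (1 - cj (φ0 ζ) * φ0 z) ^ 2) := by
  obtain ⟨c, hc, hφ⟩ := conf_uniq hG h0 h hζ
  have ha := conf_lt h0 hζ
  have key : ∀ z ∈ G, deriv φ z = f z ^ 2 * (1 - cj (φ0 ζ) * φ0 ζ) / (1 - cj (φ0 ζ) * φ0 z) ^ 2 * c := fun z hz ↦ by
    have hd := (h0.differentiable z hz).hasDerivAt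
    have hn := mob_den ha (conf_lt h0 hz)
    have := (((hd.sub_const _).div ((hd.const_mul _).const_sub 1) hn).mul_const c).congr_of_eventuallyEq (by
      filter_upwards [hG.mem_nhds hz] with w hw using hφ w hw)
    rw [this.deriv, hf z hz]
    ring
  have hn := mob_den ha ha
  obtain ⟨_, _, _, _, _, h5⟩ := conf_inv hG h0
  obtain ⟨r, hr, hrr⟩ := h.deriv_center_pos
  have hs : 1 - cj (φ0 ζ) * φ0 ζ = ((1 - ‖φ0 ζ‖ ^ 2 : ℝ) : ℂ) := by
    rw [mul_comm, mul_conj, normSq_eq_norm_sq]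
    push_cast
    rfl
  have e1 : f ζ ^ 2 * c = ((r * (1 - ‖φ0 ζ‖ ^ 2) : ℝ) : ℂ) := by
    rw [ofReal_mul, ← hs, ← hrr, key ζ hζ]
    field_simp
  have e2 : f ζ ^ 2 * c = f ζ * cj (f ζ) := by
    have := congrArg norm e1
    rw [norm_mul, norm_pow, hc, norm_real, norm_of_nonneg (mul_nonneg hr.le (by nlinarith [norm_nonneg (φ0 ζ)])), mul_one] at this
    rw [e1, ← this, mul_conj, normSq_eq_norm_sq]
  have e3 : f ζ * c = cj (f ζ) := mul_left_cancel₀ (fun h ↦ h5 ζ hζ (by rw [← hf ζ hζ, h]; simp) : f ζ ≠ 0) (by rw [← e2]; ring)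
  rw [key z hz, ← e3]
  ring
theorem J_deriv (D : JordanDomain) (p : ℕ → Polynomial ℂ) (ζ : ℂ) (n : ℕ) (z : ℂ) :
    deriv (Jfun D p ζ n) z = ((2 * π / D.l : ℝ) : ℂ) / partialSum p ζ n ζ * partialSum p ζ n z ^ 2 := by
  have h1 : partialSum p ζ n ζ = ∑ k ∈ FR n, ((‖(p k).eval ζ‖ : ℂ)) ^ 2 := by
    refine sum_congr rfl fun k _ ↦ ◇
    rw [mul_comm, mul_conj, normSq_eq_norm_sq]
    push_cast
    rfl
  set P : Polynomial ℂ := (∑ k ∈ FR n, Polynomial.C (cj ((p k).eval ζ)) * p k) ^ 2 with hP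
  have h2 : partialSum p ζ n z ^ 2 = P.eval z := by
    rw [hP, eval_pow, Polynomial.eval_finsetSum]
    simp [partialSum]
  rw [h1, h2, Polynomial.eval_eq_sum_range]
  refine HasDerivAt.deriv (HasDerivAt.const_mul _ (HasDerivAt.fun_sum fun i _ ↦ HasDerivAt.const_mul _ ◇))
  convert! (((hasDerivAt_pow (i+1) z).sub_const (ζ ^ (i+1))).div_const (i+1)) using 1
  push_cast
  field_simp
theorem final_est {K K0 s s0 : ℂ} {k0 σ Km e R : ℝ} (hk0 : 0 < k0) (hσ : 0 < σ) (h1 : k0 ≤ ‖K0‖) (h2 : σ ≤ ‖s0‖) (h3 : ‖K‖ ≤ Km)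
    (hR : 0 < R) (he0 : 0 ≤ e) (he : e ≤ 1) (h4 : ‖K - s‖ ≤ R * e) (h5 : ‖K0 - s0‖ ≤ R * e) :
    ‖K ^ 2 / K0 - s ^ 2 / s0‖ ≤ (R * (2 * Km + R) / k0 + (Km + R) ^ 2 * R / (k0 * σ)) * e := by
  have hK0 := norm_pos_iff.1 (hk0.trans_le h1)
  have hs0 := norm_pos_iff.1 (hσ.trans_le h2)
  have e1 : K ^ 2 / K0 - s ^ 2 / s0 = (K - s) * (K + s) / K0 - s ^ 2 * (K0 - s0) / (K0 * s0) := by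
    field_simp
    ring
  have hRe := mul_le_of_le_one_right hR.le he
  have hs : ‖s‖ ≤ Km + R := by
    have := norm_sub_norm_le s K
    rw [norm_sub_rev] at this
    linarith
  have hKm := (norm_nonneg K).trans h3
  rw [e1, add_mul]
  refine (norm_sub_le _ _).trans (add_le_add ◇ ◇)
  · rw [norm_div, norm_mul]
    calc _ ≤ R * e * (2 * Km + R) / k0 := by
          gcongr
          exact (norm_add_le _ _).trans bl
      _ = _ := by ring
  · rw [norm_div, norm_mul, norm_mul, norm_pow]
    calc _ ≤ (Km + R) ^ 2 * (R * e) / (k0 * σ) := by gcongr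
      _ = _ := by ring
theorem conformalMap_deriv_interior_rate
    (D : JordanDomain) (B : PiecewiseAnalyticBoundary D)
    (lam : ℝ) (hlam0 : 0 < lam) (hlam2 : lam < 2)
    (hmin : ∀ i, lam ≤ B.extAngle i) (hattained : ∃ i, B.extAngle i = lam)
    (p : ℕ → Polynomial ℂ) (hp : D.IsONPolys p)
    (F : Set ℂ) (hF : IsCompact F) (hFG : F ⊆ D.G) :
    ∃ C : ℝ, 0 < C ∧ ∀ ζ ∈ F, ∀ φ : ℂ → ℂ,
      ConformalOnto D.G φ ζ →
      ∀ n : ℕ, 0 < n → ∀ z ∈ F,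
        ‖deriv φ z - deriv (Jfun D p ζ n) z‖ ≤
          C * (n : ℝ) ^ (-(lam / (2 - lam))) := by
  by_cases hex : ∃ ζ0 ∈ F, ∃ φ0, ConformalOnto D.G φ0 ζ0
  swap
  · exact ⟨1, one_pos, fun ζ hζ φ hφ ↦ (hex ⟨ζ, hζ, φ, hφ⟩).elim⟩
  obtain ⟨ζ0, hζ0, φ0, hφ0⟩ := hex
  obtain ⟨f, hfd, hf⟩ := conf_sqrt D.isOpen hφ0
  obtain ⟨_, _, _, _, _, hd0⟩ := conf_inv D.isOpen hφ0
  have hne : F.Nonempty := ⟨ζ0, hζ0⟩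
  have hfc := (hfd.continuousOn.mono hFG).norm
  obtain ⟨za, hza, hzam⟩ := hF.exists_isMaxOn hne (fun z hz ↦ (hφ0.differentiable z (hFG hz)).continuousAt.norm.continuousWithinAt)
  obtain ⟨zb, hzb, hzbm⟩ := hF.exists_isMaxOn hne hfc
  obtain ⟨zc, hzc, hzcm⟩ := hF.exists_isMinOn hne hfc
  have h1 := conf_lt hφ0 (hFG hza)
  have h0 := norm_nonneg (φ0 za)
  have hfp : ∀ z ∈ F, 0 < ‖f z‖ := fun z hz ↦ norm_pos_iff.2 fun h ↦ hd0 z (hFG hz) (by rw [← hf z (hFG hz), h]; simp)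
  have hB := hfp _ hzb
  have hb := hfp _ hzc
  obtain ⟨N, ⟨P⟩⟩ := exists_pre D B hmin
  obtain ⟨C⟩ := exists_chain P
  obtain ⟨S⟩ := exists_sz C hφ0 hfd hf h0 h1
  obtain ⟨R, hR, hap⟩ := S.approx h0 h1 hφ0 hfd hf hB hp
  have hl := D.l_pos
  obtain ⟨hdeg, hlc, -⟩ := hp
  obtain ⟨c0, hc0, hl0⟩ := hlc 0
  have hp0 : p 0 = Polynomial.C tC c0 := by
    rw [Polynomial.eq_C_of_natDegree_eq_zero (hdeg 0)]
    rw [Polynomial.leadingCoeff, hdeg 0] at hl0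
    rw [hl0]
  set am := ‖φ0 za‖
  set b := ‖f zc‖
  set Bm := ‖f zb‖
  set Km := D.l / tp * (Bm / ((1 - am)/(1 + am))) * Bm with hKm
  set k0 := D.l / tp * (b ^ 2 / 1) with hk0
  refine ⟨2 * π / D.l * (R * (2 * Km + R) / k0 + (Km + R) ^ 2 * R / (k0 * c0 ^ 2)), bp, ◇⟩
  intro ζ hζ φ hφ n hn z hz
  have ha := conf_lt hφ0 (hFG hζ)
  have hzl := conf_lt hφ0 (hFG hz)
  have hfζ := norm_pos_iff.1 (hfp ζ hζ)
  have hlC := ofReal_ne_zero.2 hl.ne'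
  have e1 : deriv φ z = ((2 * π / D.l : ℝ) : ℂ) * (S.k ζ z ^ 2 / S.k ζ ζ) := by
    refine mul_left_cancel₀ hfζ ((conf_deriv D.isOpen hφ0 hφ (hFG hζ) hf (hFG hz)).trans ◇)
    rw [Sz.k, Sz.k]
    push_cast
    field_simp
  have e2 : deriv (Jfun D p ζ n) z = ((2 * π / D.l : ℝ) : ℂ) * (partialSum p ζ n z ^ 2 / partialSum p ζ n ζ) := by
    rw [J_deriv]
    ring
  have hs : 1 - cj (φ0 ζ) * φ0 ζ = ((1 - ‖φ0 ζ‖ ^ 2 : ℝ) : ℂ) := by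
    rw [mul_comm, mul_conj, normSq_eq_norm_sq]
    push_cast
    rfl
  have hK0 : k0 ≤ ‖S.k ζ ζ‖ := by
    have e : ‖(D.l:ℂ) / tp‖ = D.l / tp := by
      rw [norm_div, norm_mul, norm_real, norm_real, norm_of_nonneg hl.le, norm_of_nonneg pi_pos.le]
      norm_num
    have hpos : 0 < 1 - ‖φ0 ζ‖ ^ 2 := by nlinarith [norm_nonneg (φ0 ζ)]
    rw [Sz.k, norm_mul, e, norm_div, norm_mul, RCLike.norm_conj, ← sq, hs, norm_real, norm_of_nonneg hpos.le, hk0]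
    have : b ≤ ‖f ζ‖ := hzcm hζ
    gcongr
    nlinarith
  have hKz : ‖S.k ζ z‖ ≤ Km := by
    rw [Sz.k]
    refine (Sz.ki_bd h0 h1 hB.le (hzam hζ) (hzbm hζ) (hzl.le.trans ◇)).trans ◇
    · rw [le_div_iff₀ bp]
      linarith
    · rw [hKm]
      gcongr
      exact hzbm hz
  have hs0 : c0 ^ 2 ≤ ‖partialSum p ζ n ζ‖ := by
    have h1 : partialSum p ζ n ζ = ((∑ k ∈ Finset.range (n + 1), ‖(p k).eval ζ‖ ^ 2 : ℝ) : ℂ) := by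
      rw [partialSum, ofReal_sum]
      refine sum_congr rfl fun k _ ↦ ◇
      rw [mul_comm, mul_conj, normSq_eq_norm_sq]
    rw [h1, norm_real, norm_of_nonneg bp]
    refine le_trans ◇ (single_le_sum (fun k _ ↦ by positivity) (Finset.mem_range.2 (Nat.succ_pos n)))
    simp [hp0]
  have := final_est bp bp hK0 hs0 hKz hR bp
    (Real.rpow_le_one_of_one_le_of_nonpos (by exact_mod_cast hn) (neg_nonpos.2 (div_nonneg hlam0.le bl)))
    (hap n hn ζ (hFG hζ) z (hFG hz) (hzam hζ) (hzam hz) (hzbm hζ) (hzbm hz))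
    (hap n hn ζ (hFG hζ) ζ (hFG hζ) (hzam hζ) (hzam hζ) (hzbm hζ) (hzbm hζ))
  rw [e1, e2, ← mul_sub, norm_mul, norm_real, norm_of_nonneg bp, mul_assoc]
  gcongr
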